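/- Let B be a solution of B_t + J B_x + μ Λ^α B = 0, B_x = ℋJ, with 0 < α < 2 and nonnegative initial data B₀ ≥ 0. Then B(·, t) ≥ 0 for all t ≥ 0, and the L¹ norm is conserved: ‖B(t)‖_{L¹} = ‖B₀‖_{L¹} for all t ≥ 0. Combined with the maximum principle ‖B(t)‖_{L^∞} ≤ ‖B₀‖_{L^∞}, the L² norm of B(t) is bounded uniformly in time. -/

import Mathlib

/-!
Preservation of nonnegativity, conservation of the `L¹` norm, and uniform-in-time
boundedness of the `L²` norm for the nonlocal transport model
`B_t + J B_x + μ Λ^α B = 0`, `B_x = ℋ J`, `0 < α < 2`, with nonnegative initial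
data (the Remark following Lemma 6.1 of the paper), formulated on `ℝ`.
-/

open Filter Topology MeasureTheory

noncomputable section

/-- `H` is the Hilbert transform of `f` on `ℝ`:
`H x = (1/π) P.V. ∫ f y / (x - y) dy`. -/
def IsHilbertPV (f H : ℝ → ℝ) : Prop :=
  ∀ x : ℝ,
    Tendsto (fun ε : ℝ => (1 / Real.pi) * ∫ y in {y : ℝ | ε < |x - y|}, f y / (x - y))
      (𝓝[>] 0) (𝓝 (H x))

/-- `g = Λ^α f` (for `0 < α < 2`), via the principal-value singular integral
`g x = (1/π) P.V. ∫ (f x - f y)/|x - y|^{1+α} dy`. -/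
def IsFracLapPV (α : ℝ) (f g : ℝ → ℝ) : Prop :=
  ∀ x : ℝ,
    Tendsto
      (fun ε : ℝ => (1 / Real.pi) * ∫ y in {y : ℝ | ε < |x - y|}, (f x - f y) / |x - y| ^ (1 + α))
      (𝓝[>] 0) (𝓝 (g x))

section

open scoped Real
open Complex (I normSq_eq_norm_sq normSq_apply im_le_norm continuous_ofReal norm_real norm_I continuous_im norm_ofNat abs_im_le_norm ofReal_re ofReal_im mul_re I_re I_im mul_im abs_re_le_norm im I_ne_zero ofRealCLM I_sq im_ofReal_mul inv_im reCLM imCLM re_ofReal_mul)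
open Real (norm_eq_abs pi_pos pi_ne_zero rpow_natCast norm_of_nonneg pi_gt_three log log_mul log_neg_eq_log rpow_neg dist_eq rpow_pos_of_pos mul_rpow)
open Metric (ball ball_mem_nhds mem_ball closedBall)
open Set (Ioi uIcc uIcc_of_le uIoc_of_le Ioc indicator_of_mem indicator_of_notMem Ioo Icc Iio mem_Ioi)
open intervalIntegral (integral_of_le integral_add_adjacent_intervals integral_congr)
variable {M y v ε Y r α X C R σ x s p m C1 C2 η μ n R' Q ρ t t1 e : ℝ} {b b0 f f' g J k L : ℝ → ℝ} {z c ζ : ℂ}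

def gC (b : ℝ → ℝ) (z : ℂ) : ℂ := -(I / π) * ∫ s : ℝ, (b s : ℂ) / (z - s) ^ 2

structure Bd (M : ℝ) (b : ℝ → ℝ) : Prop where
  c : Continuous b
  le : ∀ x, |b x| ≤ M

lemma Bd.nonneg (h : Bd M b) : 0 ≤ M := (abs_nonneg _).trans (h.le 0)

lemma normSq_sub (z : ℂ) (s : ℝ) : ‖z - s‖ ^ 2 = (s - z.re) ^ 2 + z.im ^ 2 := by
  rw [← normSq_eq_norm_sq, normSq_apply]; simp; ring

lemma integrable_lor (x : ℝ) (hy : 0 < y) :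
    Integrable (fun s : ℝ => ((s - x) ^ 2 + y ^ 2)⁻¹) := by
  have h := (integrable_inv_one_add_sq.comp_div hy.ne').comp_sub_right x
  refine (h.const_mul (y⁻¹ ^ 2)).congr (ae_of_all _ fun s => ?_)
  have h1 : 0 < y ^ 2 + (s - x) ^ 2 := by positivity
  simp only []
  rw [div_pow, inv_pow]
  field_simp
  ring

lemma integral_lor (x : ℝ) (hy : 0 < y) :
    ∫ s : ℝ, ((s - x) ^ 2 + y ^ 2)⁻¹ = π / y := by
  have e : ∀ s : ℝ, ((s - x) ^ 2 + y ^ 2)⁻¹ = y⁻¹ ^ 2 * (1 + ((s - x) / y) ^ 2)⁻¹ := by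
    intro s
    have h1 : 0 < y ^ 2 + (s - x) ^ 2 := by positivity
    rw [div_pow, inv_pow]
    field_simp
    ring
  simp_rw [e]
  rw [integral_const_mul, integral_sub_right_eq_self (fun s : ℝ => (1 + (s / y) ^ 2)⁻¹) x,
    Measure.integral_comp_div (fun s : ℝ => (1 + s ^ 2)⁻¹) y, integral_univ_inv_one_add_sq,
    abs_of_pos hy, smul_eq_mul]
  field_simp

lemma norm_sub_pos (hz : 0 < z.im) (s : ℝ) : 0 < ‖z - s‖ := by
  have := normSq_sub z s
  have h2 : 0 < ‖z - s‖ ^ 2 := by rw [this]; positivity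
  exact lt_of_le_of_ne (norm_nonneg _) fun h => by rw [← h] at h2; norm_num at h2

lemma sub_ne (hz : 0 < z.im) (s : ℝ) : z - s ≠ 0 := norm_pos_iff.mp (norm_sub_pos hz s)

lemma im_le_norm_sub (z : ℂ) (s : ℝ) : z.im ≤ ‖z - s‖ := by
  have := im_le_norm (z - s)
  simpa using this

lemma gC_integrable (h : Bd M b) (hz : 0 < z.im) :
    Integrable (fun s : ℝ => (b s : ℂ) / (z - s) ^ 2) := by
  refine ((integrable_lor z.re hz).const_mul M).mono' ?_ (ae_of_all _ fun s => ?_)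
  · refine Continuous.aestronglyMeasurable ?_
    refine Continuous.div (continuous_ofReal.comp h.c) (by fun_prop) ?_
    intro s; exact pow_ne_zero _ (sub_ne hz s)
  · rw [norm_div, norm_pow, normSq_sub, norm_real, div_eq_mul_inv]
    exact mul_le_mul_of_nonneg_right (h.le s) (by positivity)

lemma gC_bound (h : Bd M b) (hz : 0 < z.im) :
    ‖gC b z‖ ≤ M / z.im := by
  have h1 : ‖∫ s : ℝ, (b s : ℂ) / (z - s) ^ 2‖ ≤ M * (π / z.im) := by
    rw [← integral_lor z.re hz, ← integral_const_mul]
    refine norm_integral_le_of_norm_le ((integrable_lor z.re hz).const_mul M) (ae_of_all _ fun s => ?_)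
    rw [norm_div, norm_pow, normSq_sub, norm_real, div_eq_mul_inv]
    exact mul_le_mul_of_nonneg_right (h.le s) (by positivity)
  rw [gC, norm_mul, norm_neg, norm_div, norm_I, norm_real, norm_eq_abs,
    abs_of_pos pi_pos]
  calc 1 / π * _ ≤ 1 / π * (M * (π / z.im)) := by gcongr
    _ = M / z.im := by field_simp [pi_ne_zero]

lemma gC_diff (h : Bd M b) (hz : 0 < z.im) :
    DifferentiableAt ℂ (gC b) z := by
  unfold gC
  refine DifferentiableAt.const_mul ?_ _
  have hM := h.nonneg
  have key := hasDerivAt_integral_of_dominated_loc_of_deriv_le (μ := (volume : Measure ℝ)) (𝕜 := ℂ)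
    (F := fun (w : ℂ) (s : ℝ) => (b s : ℂ) / (w - s) ^ 2)
    (F' := fun (w : ℂ) (s : ℝ) => (b s : ℂ) * (-2 / (w - s) ^ 3)) (x₀ := z)
    (s := ball z (z.im / 2)) (bound := fun s => M * (16 / z.im * ((s - z.re) ^ 2 + z.im ^ 2)⁻¹))
    (ball_mem_nhds z (by positivity)) ?_ (gC_integrable h hz) ?_ ?_ ?_ ?_
  · exact key.2.differentiableAt
  · have : ∀ᶠ w in 𝓝 z, 0 < w.im := continuous_im.continuousAt.eventually_const_lt hz
    filter_upwards [this] with w hw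
    exact (gC_integrable h hw).aestronglyMeasurable
  · refine Continuous.aestronglyMeasurable ?_
    refine (continuous_ofReal.comp h.c).mul (Continuous.div (by fun_prop) (by fun_prop) ?_)
    intro s; exact pow_ne_zero _ (sub_ne hz s)
  · refine ae_of_all _ fun s w hw => ?_
    rw [mem_ball, dist_eq_norm] at hw
    have h1 : ‖z - s‖ / 2 ≤ ‖w - s‖ := by
      have h2 := im_le_norm_sub z s
      have h3 : ‖z - s‖ ≤ ‖w - s‖ + ‖w - z‖ := by
        have := norm_sub_le (w - s) (w - z); simpa using this
      linarith
    rw [norm_mul, norm_div, norm_real, norm_pow, norm_neg, norm_ofNat]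
    have hp := norm_sub_pos hz s
    have h4 : z.im * ((s - z.re) ^ 2 + z.im ^ 2) / 8 ≤ ‖w - s‖ ^ 3 := by
      rw [← normSq_sub z s]
      calc z.im * ‖z - s‖ ^ 2 / 8 ≤ ‖z - s‖ * ‖z - s‖ ^ 2 / 8 := by
            gcongr; exact im_le_norm_sub z s
        _ = (‖z - s‖ / 2) ^ 3 := by ring
        _ ≤ _ := by gcongr
    have h5 : 0 < z.im * ((s - z.re) ^ 2 + z.im ^ 2) / 8 := by positivity
    refine mul_le_mul (h.le s) ?_ (by positivity) hM
    calc 2 / ‖w - s‖ ^ 3 ≤ 2 / (z.im * ((s - z.re) ^ 2 + z.im ^ 2) / 8) := by gcongr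
      _ = _ := by field_simp; norm_num
  · exact ((integrable_lor z.re hz).const_mul _).const_mul _
  · refine ae_of_all _ fun s w hw => ?_
    rw [mem_ball, dist_eq_norm] at hw
    have hw' : 0 < w.im := by
      have := (abs_im_le_norm (w - z))
      rw [Complex.sub_im] at this
      have := (abs_le.mp this).1
      linarith
    have hne := sub_ne hw' s
    have h1 : HasDerivAt (fun w : ℂ => (w - s) ^ 2) (2 * (w - s)) w := by
      simpa using ((hasDerivAt_id' w).sub_const (s : ℂ)).fun_pow 2
    have h2 := (h1.fun_inv (pow_ne_zero 2 hne)).const_mul (b s : ℂ)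
    simp only [div_eq_mul_inv]
    have e : (b s : ℂ) * (-(2 * (w - s)) / ((w - s) ^ 2) ^ 2) = b s * (-2 * ((w - s) ^ 3)⁻¹) := by
      field_simp
    rw [e] at h2
    exact h2

lemma gC_tendsto {ι : Type*} {l : Filter ι} [l.IsCountablyGenerated] {b : ι → ℝ → ℝ}
    (h : ∀ᶠ i in l, Bd M (b i)) (hb : ∀ x, Tendsto (fun i => b i x) l (𝓝 (b0 x)))
    (hz : 0 < z.im) : Tendsto (fun i => gC (b i) z) l (𝓝 (gC b0 z)) := by
  unfold gC
  refine Tendsto.const_mul _ ?_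
  refine tendsto_integral_filter_of_dominated_convergence
    (fun s => M * ((s - z.re) ^ 2 + z.im ^ 2)⁻¹) ?_ ?_ ((integrable_lor z.re hz).const_mul M) ?_
  · filter_upwards [h] with i hi
    exact (gC_integrable hi hz).aestronglyMeasurable
  · filter_upwards [h] with i hi
    refine ae_of_all _ fun s => ?_
    rw [norm_div, norm_pow, normSq_sub, norm_real, div_eq_mul_inv]
    exact mul_le_mul_of_nonneg_right (hi.le s) (by positivity)
  · refine ae_of_all _ fun s => ?_
    exact ((continuous_ofReal.tendsto _).comp (hb s)).div_const _

def GC (b : ℝ → ℝ) (z : ℂ) : ℂ := gC b z ^ 2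

lemma GC_bound (h : Bd M b) (hz : 0 < z.im) :
    ‖GC b z‖ ≤ M ^ 2 / z.im ^ 2 := by
  rw [GC, norm_pow, ← div_pow]
  exact pow_le_pow_left₀ (norm_nonneg _) (gC_bound h hz) 2

lemma GC_diff (h : Bd M b) (hz : 0 < z.im) :
    DifferentiableAt ℂ (GC b) z := (gC_diff h hz).pow 2

lemma GC_deriv_bound (h : Bd M b) (hv : 0 < v) (hz : v ≤ z.im) :
    ‖deriv (GC b) z‖ ≤ (M ^ 2 / (v / 2) ^ 2) / (v / 2) := by
  have him : ∀ w ∈ closedBall z (v / 2), v / 2 ≤ w.im := by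
    intro w hw
    rw [Metric.mem_closedBall, dist_eq_norm] at hw
    have := (abs_im_le_norm (w - z))
    rw [Complex.sub_im] at this
    have := (abs_le.mp this).1
    linarith
  refine Complex.norm_deriv_le_of_forall_mem_sphere_norm_le (by positivity) ?_ ?_
  · refine DifferentiableOn.diffContOnCl ?_
    rw [closure_ball _ (by positivity)]
    intro w hw
    exact (GC_diff h (by linarith [him w hw])).differentiableWithinAt
  · intro w hw
    have h1 := him w (Metric.sphere_subset_closedBall hw)
    refine (GC_bound h (by linarith)).trans ?_
    gcongr

lemma GC_tendsto {ι : Type*} {l : Filter ι} [l.IsCountablyGenerated] {b : ι → ℝ → ℝ}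
    (h : ∀ᶠ i in l, Bd M (b i)) (hb : ∀ x, Tendsto (fun i => b i x) l (𝓝 (b0 x)))
    (hz : 0 < z.im) : Tendsto (fun i => GC (b i) z) l (𝓝 (GC b0 z)) :=
  (gC_tendsto h hb hz).pow 2

lemma GC_line_cont (h : Bd M b) (hv : 0 < v) :
    Continuous (fun s : ℝ => GC b (s + v * I)) := by
  refine continuous_iff_continuousAt.mpr fun s => ?_
  refine ContinuousAt.comp (g := GC b) (GC_diff h (by simpa using hv)).continuousAt (by fun_prop)

structure TF where
  f0 : ℝ → ℝ
  f1 : ℝ → ℝ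
  f2 : ℝ → ℝ
  f3 : ℝ → ℝ
  h0 : ∀ x, HasDerivAt f0 (f1 x) x
  h1 : ∀ x, HasDerivAt f1 (f2 x) x
  h2 : ∀ x, HasDerivAt f2 (f3 x) x
  c3 : Continuous f3
  i0 : Integrable f0
  i1 : Integrable f1
  i2 : Integrable f2
  i3 : Integrable f3

lemma TF.c0 (ψ : TF) : Continuous ψ.f0 := continuous_iff_continuousAt.mpr fun x => (ψ.h0 x).continuousAt

lemma TF.c1 (ψ : TF) : Continuous ψ.f1 := continuous_iff_continuousAt.mpr fun x => (ψ.h1 x).continuousAt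

lemma TF.c2 (ψ : TF) : Continuous ψ.f2 := continuous_iff_continuousAt.mpr fun x => (ψ.h2 x).continuousAt

def n1 (f : ℝ → ℝ) : ℝ := ∫ s, |f s|

lemma n1_nonneg (f : ℝ → ℝ) : 0 ≤ n1 f := integral_nonneg fun _ => abs_nonneg _

def TF.N (ψ : TF) : ℝ := n1 ψ.f0 + n1 ψ.f1 + n1 ψ.f2 + n1 ψ.f3

def Th (b f : ℝ → ℝ) (v : ℝ) : ℂ := ∫ s : ℝ, (f s : ℂ) * GC b (s + v * I)

lemma line_im (s v : ℝ) : ((s : ℂ) + v * I).im = v := by simp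

lemma line_re (s v : ℝ) : ((s : ℂ) + v * I).re = s := by simp

lemma Th_integrable (h : Bd M b) (hf : Integrable f) (hv : 0 < v) :
    Integrable (fun s : ℝ => (f s : ℂ) * GC b (s + v * I)) := by
  refine hf.ofReal.mul_bdd (c := M ^ 2 / v ^ 2) (GC_line_cont h hv).aestronglyMeasurable
    (ae_of_all _ fun s => ?_)
  have := GC_bound h (z := s + v * I) (by rwa [line_im])
  rwa [line_im] at this

lemma Th_bound' (hf : Integrable f) {A : ℝ} (hA : ∀ s, f s ≠ 0 → ‖GC b (s + v * I)‖ ≤ A) : ‖Th b f v‖ ≤ A * n1 f := by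
  rw [Th, n1, ← integral_const_mul]
  refine norm_integral_le_of_norm_le (hf.abs.const_mul A) (ae_of_all _ fun s => ?_)
  rw [norm_mul, norm_real, norm_eq_abs, mul_comm]
  by_cases h0 : f s = 0
  · simp [h0]
  · exact mul_le_mul_of_nonneg_right (hA s h0) (abs_nonneg _)

lemma Th_bound (h : Bd M b) (hf : Integrable f) (hv : 0 < v) :
    ‖Th b f v‖ ≤ M ^ 2 / v ^ 2 * n1 f := by
  refine Th_bound' hf fun s _ => ?_
  have := GC_bound h (z := s + v * I) (by rwa [line_im])
  rwa [line_im] at this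

lemma Th_tendsto {ι : Type*} {l : Filter ι} [l.IsCountablyGenerated] {b : ι → ℝ → ℝ}
    (h : ∀ᶠ i in l, Bd M (b i)) (hb : ∀ x, Tendsto (fun i => b i x) l (𝓝 (b0 x)))
    (hf : Integrable f) (hv : 0 < v) : Tendsto (fun i => Th (b i) f v) l (𝓝 (Th b0 f v)) := by
  refine tendsto_integral_filter_of_dominated_convergence (fun s => M ^ 2 / v ^ 2 * |f s|) ?_ ?_
    (hf.abs.const_mul _) ?_
  · filter_upwards [h] with i hi using (Th_integrable hi hf hv).aestronglyMeasurable
  · filter_upwards [h] with i hi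
    refine ae_of_all _ fun s => ?_
    have := GC_bound hi (z := s + v * I) (by rwa [line_im])
    rw [line_im] at this
    rw [norm_mul, norm_real, norm_eq_abs, mul_comm]
    exact mul_le_mul_of_nonneg_right this (abs_nonneg _)
  · exact ae_of_all _ fun s => (GC_tendsto h hb (by rwa [line_im])).const_mul _

lemma Th_deriv (h : Bd M b) (hd : ∀ x, HasDerivAt f (f' x) x)
    (hf : Integrable f) (hf' : Integrable f') (hv : 0 < v) :
    HasDerivAt (Th b f) (-I * Th b f' v) v := by
  have hG : ∀ s w : ℝ, 0 < w → HasDerivAt (GC b) (deriv (GC b) (s + w * I)) (s + w * I) :=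
    fun s w hw => (GC_diff h (by rwa [line_im])).hasDerivAt
  have hcG' : Continuous (fun s : ℝ => deriv (GC b) (s + v * I)) := by
    refine continuous_iff_continuousAt.mpr fun s => ?_
    have hopen : IsOpen {z : ℂ | 0 < z.im} := isOpen_lt continuous_const continuous_im
    have hdo : DifferentiableOn ℂ (GC b) {z : ℂ | 0 < z.im} := fun z hz => (GC_diff h hz).differentiableWithinAt
    have := (hdo.deriv hopen).continuousOn.continuousAt (hopen.mem_nhds (show 0 < ((s : ℂ) + v * I).im by rwa [line_im]))
    exact ContinuousAt.comp (g := deriv (GC b)) this (by fun_prop)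
  set D := (M ^ 2 / (v / 2 / 2) ^ 2) / (v / 2 / 2) with hD
  have hD0 : 0 ≤ D := by positivity
  have key := hasDerivAt_integral_of_dominated_loc_of_deriv_le (μ := (volume : Measure ℝ)) (𝕜 := ℝ)
    (F := fun (w : ℝ) (s : ℝ) => (f s : ℂ) * GC b (s + w * I))
    (F' := fun (w : ℝ) (s : ℝ) => (f s : ℂ) * (deriv (GC b) (s + w * I) * I)) (x₀ := v)
    (s := Ioi (v / 2)) (bound := fun s => |f s| * D)
    (Ioi_mem_nhds (by linarith)) ?_ (Th_integrable h hf hv) ?_ ?_ ?_ ?_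
  · have h1 := key.2
    have hbd : ∀ s : ℝ, ‖deriv (GC b) (s + v * I)‖ ≤ D := fun s =>
      GC_deriv_bound h (by positivity) (by rw [line_im]; linarith)
    have ibp := integral_mul_deriv_eq_deriv_mul_of_integrable (u := fun s : ℝ => (f s : ℂ))
      (v := fun s : ℝ => GC b (s + v * I)) (u' := fun s => (f' s : ℂ))
      (v' := fun s : ℝ => deriv (GC b) (s + v * I))
      (fun s _ => (hd s).ofReal_comp) (fun s _ => ?_) ?_ ?_ ?_
    · have e : ∫ s : ℝ, (f s : ℂ) * (deriv (GC b) (s + v * I) * I) =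
        -I * Th b f' v := by
        have : ∀ s : ℝ, (f s : ℂ) * (deriv (GC b) (s + v * I) * I) =
          ((f s : ℂ) * deriv (GC b) (s + v * I)) * I := fun s => by ring
        simp_rw [this]
        rw [integral_mul_const, ibp, Th]; ring
      rw [← e]; exact h1
    · have h3 : HasDerivAt (fun s : ℝ => (s : ℂ) + v * I) 1 s := by
        simpa using (hasDerivAt_id s).ofReal_comp.add_const ((v : ℂ) * I)
      have h4 := HasDerivAt.comp s (hG s v hv) h3
      rw [mul_one] at h4
      exact h4
    · exact hf.ofReal.mul_bdd (c := D) hcG'.aestronglyMeasurable (ae_of_all _ hbd)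
    · exact Th_integrable h hf' hv
    · exact Th_integrable h hf hv
  · filter_upwards [Ioi_mem_nhds hv] with w hw using (Th_integrable h hf hw).aestronglyMeasurable
  · exact hf.ofReal.aestronglyMeasurable.mul (hcG'.mul continuous_const).aestronglyMeasurable
  · refine ae_of_all _ fun s w hw => ?_
    rw [norm_mul, norm_real, norm_mul, norm_I, mul_one, norm_eq_abs]
    refine mul_le_mul_of_nonneg_left ?_ (abs_nonneg _)
    exact GC_deriv_bound h (by positivity) (by rw [line_im]; exact (le_of_lt hw))
  · exact hf.abs.mul_const D
  · refine ae_of_all _ fun s w hw => ?_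
    refine HasDerivAt.const_mul _ ?_
    have h2 := hG s w (lt_trans (by positivity) hw)
    have h3 : HasDerivAt (fun w : ℝ => (s : ℂ) + w * I) I w := by
      simpa using ((hasDerivAt_id w).ofReal_comp.mul_const I).const_add (s : ℂ)
    exact HasDerivAt.comp w h2 h3

def Qf (b : ℝ → ℝ) (ψ : TF) (ε Y : ℝ) : ℂ :=
  Th b ψ.f0 (ε + Y) + I * Y * Th b ψ.f1 (ε + Y) - (Y : ℂ) ^ 2 / 2 * Th b ψ.f2 (ε + Y)
    - I / 2 * ∫ τ in 0..Y, (τ : ℂ) ^ 2 * Th b ψ.f3 (ε + τ)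

lemma Th_contOn (h : Bd M b) (hf : Integrable f) :
    ContinuousOn (Th b f) (Ioi 0) := by
  intro v hv
  refine ContinuousAt.continuousWithinAt ?_
  have hv : 0 < v := hv
  refine tendsto_integral_filter_of_dominated_convergence (fun s => M ^ 2 / (v / 2) ^ 2 * |f s|) ?_ ?_
    (hf.abs.const_mul _) ?_
  · filter_upwards [Ioi_mem_nhds hv] with i hi using (Th_integrable h hf hi).aestronglyMeasurable
  · filter_upwards [Ioi_mem_nhds (show v / 2 < v by linarith)] with i hi
    have hi : v / 2 < i := hi
    refine ae_of_all _ fun s => ?_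
    have := GC_bound h (z := s + i * I) (by rw [line_im]; linarith)
    rw [line_im] at this
    rw [norm_mul, norm_real, norm_eq_abs, mul_comm]
    refine mul_le_mul_of_nonneg_right (this.trans ?_) (abs_nonneg _)
    gcongr
  · refine ae_of_all _ fun s => Tendsto.const_mul _ ?_
    have h1 : ContinuousAt (GC b) (s + v * I) := (GC_diff h (by rwa [line_im])).continuousAt
    exact ContinuousAt.comp (f := fun v : ℝ => (s : ℂ) + v * I) h1 (by fun_prop)

lemma shift (h : Bd M b) (ψ : TF) (hε : 0 < ε) (hY : 0 ≤ Y) :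
    Th b ψ.f0 ε = Qf b ψ ε Y := by
  have hd : ∀ τ ∈ uIcc 0 Y, HasDerivAt (fun τ : ℝ => Th b ψ.f0 (ε + τ) + I * τ * Th b ψ.f1 (ε + τ)
      - (τ : ℂ) ^ 2 / 2 * Th b ψ.f2 (ε + τ)) (I / 2 * ((τ : ℂ) ^ 2 * Th b ψ.f3 (ε + τ))) τ := by
    intro τ hτ
    rw [uIcc_of_le hY] at hτ
    have hp : 0 < ε + τ := by linarith [hτ.1]
    have a0 := (Th_deriv h ψ.h0 ψ.i0 ψ.i1 hp).comp_const_add ε τ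
    have a1 := (Th_deriv h ψ.h1 ψ.i1 ψ.i2 hp).comp_const_add ε τ
    have a2 := (Th_deriv h ψ.h2 ψ.i2 ψ.i3 hp).comp_const_add ε τ
    have t1 : HasDerivAt (fun τ : ℝ => I * (τ : ℂ)) I τ := by
      simpa using (hasDerivAt_id τ).ofReal_comp.const_mul I
    have t2 : HasDerivAt (fun τ : ℝ => (τ : ℂ) ^ 2 / 2) (τ : ℂ) τ := by
      have := ((hasDerivAt_id' τ).ofReal_comp.fun_pow 2).div_const 2
      simpa using this
    refine ((a0.fun_add (t1.fun_mul a1)).fun_sub (t2.fun_mul a2)).congr_deriv ?_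
    linear_combination (-(τ : ℂ) * Th b ψ.f2 (ε + τ)) * Complex.I_mul_I
  have ci : ContinuousOn (fun τ : ℝ => I / 2 * ((τ : ℂ) ^ 2 * Th b ψ.f3 (ε + τ))) (uIcc 0 Y) := by
    rw [uIcc_of_le hY]
    refine continuousOn_const.mul (ContinuousOn.mul (by fun_prop) ?_)
    exact (Th_contOn h ψ.i3).comp (by fun_prop) fun τ hτ => by
      have := hτ.1
      show 0 < ε + τ
      linarith
  have := intervalIntegral.integral_eq_sub_of_hasDerivAt hd ci.intervalIntegrable
  rw [intervalIntegral.integral_const_mul] at this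
  rw [Qf, this]
  simp

lemma Qf_tendsto (h : Bd M b) (ψ : TF) (hY : 0 < Y) :
    Tendsto (fun ε => Th b ψ.f0 ε) (𝓝[>] 0) (𝓝 (Qf b ψ 0 Y)) := by
  have e : (fun ε => Qf b ψ ε Y) =ᶠ[𝓝[>] 0] (fun ε => Th b ψ.f0 ε) := by
    filter_upwards [self_mem_nhdsWithin] with ε hε using (shift h ψ hε hY.le).symm
  refine Tendsto.congr' e ?_
  have hc : ∀ {f : ℝ → ℝ}, Integrable f → ∀ τ : ℝ, 0 < τ →
      Tendsto (fun ε : ℝ => Th b f (ε + τ)) (𝓝[>] 0) (𝓝 (Th b f (0 + τ))) := by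
    intro f hf τ hτ
    have h1 : ContinuousAt (Th b f) (0 + τ) :=
      (Th_contOn h hf).continuousAt (Ioi_mem_nhds (by simpa using hτ))
    exact (ContinuousAt.comp (f := fun ε : ℝ => ε + τ) h1 (by fun_prop)).tendsto.mono_left nhdsWithin_le_nhds
  unfold Qf
  refine (((hc ψ.i0 Y hY).add ((hc ψ.i1 Y hY).const_mul _)).sub ((hc ψ.i2 Y hY).const_mul _)).sub
    (Tendsto.const_mul _ ?_)
  refine intervalIntegral.tendsto_integral_filter_of_dominated_convergence (fun _ => M ^ 2 * n1 ψ.f3) ?_ ?_ ?_ ?_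
  · filter_upwards [self_mem_nhdsWithin] with ε hε
    have hε : 0 < ε := hε
    refine ContinuousOn.aestronglyMeasurable ?_ measurableSet_uIoc
    refine ContinuousOn.mul (by fun_prop) ?_
    refine (Th_contOn h ψ.i3).comp (by fun_prop) fun τ hτ => ?_
    rw [uIoc_of_le hY.le] at hτ
    have := hτ.1
    show 0 < ε + τ
    linarith
  · filter_upwards [self_mem_nhdsWithin] with ε hε
    have hε : 0 < ε := hε
    refine ae_of_all _ fun τ hτ => ?_
    rw [uIoc_of_le hY.le] at hτ
    have h0 := hτ.1
    rw [norm_mul, norm_pow, norm_real, norm_eq_abs, sq_abs]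
    have h1 := Th_bound h ψ.i3 (v := ε + τ) (by linarith)
    calc τ ^ 2 * ‖Th b ψ.f3 (ε + τ)‖ ≤ (ε + τ) ^ 2 * (M ^ 2 / (ε + τ) ^ 2 * n1 ψ.f3) := by
          gcongr; linarith
      _ = _ := by field_simp
  · simp
  · refine ae_of_all _ fun τ hτ => ?_
    rw [uIoc_of_le hY.le] at hτ
    exact (hc ψ.i3 τ hτ.1).const_mul _

lemma Qf_indep (h : Bd M b) (ψ : TF) {Y' : ℝ} (hY : 0 < Y) (hY' : 0 < Y') :
    Qf b ψ 0 Y = Qf b ψ 0 Y' := tendsto_nhds_unique (Qf_tendsto h ψ hY) (Qf_tendsto h ψ hY')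

lemma Qf_boundK (h : Bd M b) (ψ : TF) {v0 A : ℝ} (hY : 0 < Y) (hv0 : 0 ≤ v0)
    (hvY : v0 ≤ Y) (hA0 : 0 ≤ A)
    (hA : ∀ s v, v0 < v → v ≤ Y → (ψ.f0 s ≠ 0 ∨ ψ.f1 s ≠ 0 ∨ ψ.f2 s ≠ 0 ∨ ψ.f3 s ≠ 0) →
      ‖GC b (s + v * I)‖ ≤ A) (hAY : M ^ 2 / Y ^ 2 ≤ A ∨ v0 < Y) :
    ‖Qf b ψ 0 Y‖ ≤ A * (n1 ψ.f0 + Y * n1 ψ.f1 + Y ^ 2 * n1 ψ.f2 + Y ^ 3 * n1 ψ.f3)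
      + M ^ 2 * v0 * n1 ψ.f3 := by
  have hb : ∀ f : ℝ → ℝ, Integrable f → (∀ s, f s ≠ 0 → (ψ.f0 s ≠ 0 ∨ ψ.f1 s ≠ 0 ∨ ψ.f2 s ≠ 0 ∨ ψ.f3 s ≠ 0)) →
      ‖Th b f (0 + Y)‖ ≤ A * n1 f := by
    intro f hf hs
    rw [zero_add]
    rcases hAY with hAY | hAY
    · exact (Th_bound h hf hY).trans (mul_le_mul_of_nonneg_right hAY (n1_nonneg _))
    · exact Th_bound' hf fun s h0 => hA s Y hAY le_rfl (hs s h0)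
  have b0 := hb ψ.f0 ψ.i0 (by tauto)
  have b1 := hb ψ.f1 ψ.i1 (by tauto)
  have b2 := hb ψ.f2 ψ.i2 (by tauto)
  have n0 := n1_nonneg ψ.f3
  have b3 : ‖∫ τ in 0..Y, (τ : ℂ) ^ 2 * Th b ψ.f3 (0 + τ)‖ ≤
      A * Y ^ 3 * n1 ψ.f3 + M ^ 2 * v0 * n1 ψ.f3 := by
    have hle : ∀ τ ∈ Ioc 0 Y, ‖(τ : ℂ) ^ 2 * Th b ψ.f3 (0 + τ)‖ ≤
        (A * Y ^ 2 * n1 ψ.f3) + (Ioc 0 v0).indicator (fun _ => M ^ 2 * n1 ψ.f3) τ := by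
      intro τ hτ
      rw [norm_mul, norm_pow, norm_real, norm_eq_abs, sq_abs, zero_add]
      have h0 := hτ.1
      by_cases hc : τ ≤ v0
      · have hm : τ ∈ Ioc 0 v0 := ⟨h0, hc⟩
        rw [indicator_of_mem hm]
        have h1 := Th_bound h ψ.i3 h0
        have : τ ^ 2 * ‖Th b ψ.f3 τ‖ ≤ τ ^ 2 * (M ^ 2 / τ ^ 2 * n1 ψ.f3) := by gcongr
        have e : τ ^ 2 * (M ^ 2 / τ ^ 2 * n1 ψ.f3) = M ^ 2 * n1 ψ.f3 := by field_simp
        have : 0 ≤ A * Y ^ 2 * n1 ψ.f3 := by positivity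
        linarith
      · rw [indicator_of_notMem (fun h => hc h.2), add_zero]
        push Not at hc
        have h1 : ‖Th b ψ.f3 τ‖ ≤ A * n1 ψ.f3 := Th_bound' ψ.i3 fun s hs => hA s τ hc hτ.2 (by tauto)
        calc τ ^ 2 * ‖Th b ψ.f3 τ‖ ≤ Y ^ 2 * (A * n1 ψ.f3) := by gcongr; exact hτ.2
          _ = _ := by ring
    have hii : IntervalIntegrable (fun τ => (Ioc 0 v0).indicator (fun _ => M ^ 2 * n1 ψ.f3) τ) volume 0 Y := by
      rw [intervalIntegrable_iff]
      exact ((integrable_indicator_iff measurableSet_Ioc).mpr (integrableOn_const (by simp))).integrableOn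
    refine (intervalIntegral.norm_integral_le_of_norm_le hY.le (ae_of_all _ hle)
      (intervalIntegrable_const.add hii)).trans ?_
    rw [intervalIntegral.integral_add intervalIntegrable_const hii]
    have e2 : ∫ τ in 0..Y, (Ioc 0 v0).indicator (fun _ => M ^ 2 * n1 ψ.f3) τ = M ^ 2 * v0 * n1 ψ.f3 := by
      rw [integral_of_le hY.le, setIntegral_indicator measurableSet_Ioc,
        Set.Ioc_inter_Ioc]
      simp [hvY, hv0]
      ring
    rw [e2]
    simp
    apply le_of_eq; ring
  unfold Qf
  refine (norm_sub_le _ _).trans ?_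
  have t1 := norm_sub_le (Th b ψ.f0 (0 + Y) + I * Y * Th b ψ.f1 (0 + Y)) ((Y : ℂ) ^ 2 / 2 * Th b ψ.f2 (0 + Y))
  have t2 := norm_add_le (Th b ψ.f0 (0 + Y)) (I * Y * Th b ψ.f1 (0 + Y))
  have e1 : ‖I * Y * Th b ψ.f1 (0 + Y)‖ = Y * ‖Th b ψ.f1 (0 + Y)‖ := by
    rw [norm_mul, norm_mul, norm_I, norm_real, norm_eq_abs, abs_of_pos hY, one_mul]
  have e2 : ‖(Y : ℂ) ^ 2 / 2 * Th b ψ.f2 (0 + Y)‖ = Y ^ 2 / 2 * ‖Th b ψ.f2 (0 + Y)‖ := by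
    rw [norm_mul, norm_div, norm_pow, norm_real, norm_eq_abs, abs_of_pos hY, norm_ofNat]
  have e3 : ‖I / 2 * ∫ τ in 0..Y, (τ : ℂ) ^ 2 * Th b ψ.f3 (0 + τ)‖ =
      1 / 2 * ‖∫ τ in 0..Y, (τ : ℂ) ^ 2 * Th b ψ.f3 (0 + τ)‖ := by
    rw [norm_mul, norm_div, norm_I, norm_ofNat]
  have g1 : Y * ‖Th b ψ.f1 (0 + Y)‖ ≤ Y * (A * n1 ψ.f1) := by gcongr
  have g2 : Y ^ 2 / 2 * ‖Th b ψ.f2 (0 + Y)‖ ≤ Y ^ 2 * (A * n1 ψ.f2) := by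
    gcongr; nlinarith [sq_nonneg Y]
  have := norm_nonneg (∫ τ in 0..Y, (τ : ℂ) ^ 2 * Th b ψ.f3 (0 + τ))
  nlinarith

lemma Qf_bound (h : Bd M b) (ψ : TF) (hY : 0 < Y) :
    ‖Qf b ψ 0 1‖ ≤ 2 * M ^ 2 * (n1 ψ.f0 / Y ^ 2 + n1 ψ.f1 / Y + n1 ψ.f2 + Y * n1 ψ.f3) := by
  rw [Qf_indep h ψ one_pos hY]
  refine (Qf_boundK h ψ (A := M ^ 2 / Y ^ 2) hY hY.le le_rfl (by positivity)
    (fun s v h1 h2 => absurd h1 (not_lt.mpr h2)) (Or.inl le_rfl)).trans ?_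
  have n0 := n1_nonneg ψ.f0
  have n01 := n1_nonneg ψ.f1
  have n2 := n1_nonneg ψ.f2
  have n3 := n1_nonneg ψ.f3
  have e : M ^ 2 / Y ^ 2 * (n1 ψ.f0 + Y * n1 ψ.f1 + Y ^ 2 * n1 ψ.f2 + Y ^ 3 * n1 ψ.f3) + M ^ 2 * Y * n1 ψ.f3
    = M ^ 2 * (n1 ψ.f0 / Y ^ 2 + n1 ψ.f1 / Y + n1 ψ.f2 + 2 * (Y * n1 ψ.f3)) := by field_simp; ring
  rw [e]
  have : 0 ≤ n1 ψ.f0 / Y ^ 2 := by positivity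
  have : 0 ≤ n1 ψ.f1 / Y := by positivity
  have : 0 ≤ Y * n1 ψ.f3 := by positivity
  nlinarith [sq_nonneg M, mul_nonneg (sq_nonneg M) (by positivity : 0 ≤ n1 ψ.f0 / Y ^ 2 + n1 ψ.f1 / Y + n1 ψ.f2)]

lemma Qf_cont {ι : Type*} {l : Filter ι} [l.IsCountablyGenerated] {b : ι → ℝ → ℝ}
    (h : ∀ᶠ i in l, Bd M (b i)) (hb : ∀ x, Tendsto (fun i => b i x) l (𝓝 (b0 x)))
    (ψ : TF) : Tendsto (fun i => Qf (b i) ψ 0 1) l (𝓝 (Qf b0 ψ 0 1)) := by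
  unfold Qf
  have hc : ∀ {f : ℝ → ℝ}, Integrable f → ∀ τ : ℝ, 0 < τ →
      Tendsto (fun i => Th (b i) f (0 + τ)) l (𝓝 (Th b0 f (0 + τ))) := fun hf τ hτ =>
    Th_tendsto h hb hf (by simpa using hτ)
  refine (((hc ψ.i0 1 one_pos).add ((hc ψ.i1 1 one_pos).const_mul _)).sub ((hc ψ.i2 1 one_pos).const_mul _)).sub
    (Tendsto.const_mul _ ?_)
  refine intervalIntegral.tendsto_integral_filter_of_dominated_convergence (fun _ => M ^ 2 * n1 ψ.f3) ?_ ?_ ?_ ?_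
  · filter_upwards [h] with i hi
    refine ContinuousOn.aestronglyMeasurable ?_ measurableSet_uIoc
    refine ContinuousOn.mul (by fun_prop) ?_
    refine (Th_contOn hi ψ.i3).comp (by fun_prop) fun τ hτ => ?_
    rw [uIoc_of_le zero_le_one] at hτ
    have := hτ.1
    show 0 < 0 + τ
    linarith
  · filter_upwards [h] with i hi
    refine ae_of_all _ fun τ hτ => ?_
    rw [uIoc_of_le zero_le_one] at hτ
    have h0 := hτ.1
    rw [norm_mul, norm_pow, norm_real, norm_eq_abs, sq_abs, zero_add]
    have h1 := Th_bound hi ψ.i3 (v := τ) (by linarith)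
    calc τ ^ 2 * ‖Th (b i) ψ.f3 τ‖ ≤ τ ^ 2 * (M ^ 2 / τ ^ 2 * n1 ψ.f3) := by gcongr
      _ = _ := by field_simp
  · simp
  · refine ae_of_all _ fun τ hτ => ?_
    rw [uIoc_of_le zero_le_one] at hτ
    exact (hc ψ.i3 τ hτ.1).const_mul _

def D2 (f : ℝ → ℝ) (r s : ℝ) : ℝ := 2 * f s - f (s + r) - f (s - r)

lemma D2_cont (hf : Continuous f) : Continuous (fun p : ℝ × ℝ => D2 f p.1 p.2) := by
  unfold D2; fun_prop

lemma D2_int (hf : Integrable f) (r : ℝ) : Integrable (D2 f r) := by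
  unfold D2
  exact ((hf.const_mul 2).sub (hf.comp_add_right r)).sub (hf.comp_sub_right r)

lemma n1_shift (f : ℝ → ℝ) (r : ℝ) : n1 (fun s => f (s + r)) = n1 f :=
  integral_add_right_eq_self (fun s => |f s|) r

lemma n1_sub_le (hf : Integrable f) (hg : Integrable g) :
    n1 (fun s => f s - g s) ≤ n1 f + n1 g := by
  unfold n1
  rw [← integral_add hf.abs hg.abs]
  exact integral_mono (hf.sub hg).abs (hf.abs.add hg.abs) fun s => abs_sub _ _

lemma n1_diff (hd : ∀ x, HasDerivAt f (f' x) x) (hc : Continuous f')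
    (hf : Integrable f) (hi : Integrable f') {h : ℝ} (hh : 0 ≤ h) :
    n1 (fun s => f (s + h) - f s) ≤ h * n1 f' := by
  have hle : ∀ s, |f (s + h) - f s| ≤ ∫ a in 0..h, |f' (s + a)| := by
    intro s
    have e : ∫ a in 0..h, f' (s + a) = f (s + h) - f s := by
      rw [intervalIntegral.integral_comp_add_left (fun a => f' a) s]
      have := intervalIntegral.integral_eq_sub_of_hasDerivAt (a := s + 0) (b := s + h)
        (fun x _ => hd x) (hc.intervalIntegrable _ _)
      simpa using this
    rw [← e]
    exact intervalIntegral.abs_integral_le_integral_abs hh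
  have hprod : Integrable (fun p : ℝ × ℝ => |f' (p.1 + p.2)|) (volume.prod (volume.restrict (Ioc 0 h))) := by
    rw [integrable_prod_iff' (by
      refine Continuous.aestronglyMeasurable (by fun_prop))]
    constructor
    · exact ae_of_all _ fun a => (hi.comp_add_right a).abs
    · have : ∀ a, ∫ s, ‖|f' (s + a)|‖ = n1 f' := fun a => by
        simp only [norm_eq_abs, abs_abs]; exact n1_shift f' a
      simp only [this]
      exact integrableOn_const (by simp)
  unfold n1
  calc ∫ s, |f (s + h) - f s| ≤ ∫ s, ∫ a in Ioc 0 h, |f' (s + a)| := by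
        refine integral_mono ((hf.comp_add_right h).sub hf).abs hprod.integral_prod_left fun s => ?_
        have := hle s
        rwa [integral_of_le hh] at this
    _ = ∫ a in Ioc 0 h, ∫ s, |f' (s + a)| := integral_integral_swap hprod
    _ = ∫ a in Ioc 0 h, n1 f' := by
        refine integral_congr_ae (ae_of_all _ fun a => n1_shift f' a)
    _ = h * n1 f' := by simp [hh]

lemma n1_D2_le4 (hf : Integrable f) (r : ℝ) : n1 (D2 f r) ≤ 4 * n1 f := by
  unfold D2
  have a := n1_sub_le (f := fun s => 2 * f s - f (s + r)) ((hf.const_mul 2).sub (hf.comp_add_right r)) (hf.comp_sub_right r)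
  have b := n1_sub_le (hf.const_mul 2) (hf.comp_add_right r)
  have c : n1 (fun s => 2 * f s) = 2 * n1 f := by
    unfold n1; rw [← integral_const_mul]; simp [abs_mul]
  have d := n1_shift f r
  have e := n1_shift f (-r)
  simp only [← sub_eq_add_neg] at e
  linarith

lemma n1_D2_le {f'' : ℝ → ℝ} (hd : ∀ x, HasDerivAt f (f' x) x) (hd' : ∀ x, HasDerivAt f' (f'' x) x)
    (hc : Continuous f'') (hf : Integrable f) (hi : Integrable f') (hi' : Integrable f'') (hr : 0 ≤ r) : n1 (D2 f r) ≤ r ^ 2 * n1 f'' := by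
  have hc' : Continuous f' := continuous_iff_continuousAt.mpr fun x => (hd' x).continuousAt
  have a := n1_diff (f := fun s => f (s + r) - f s) (f' := fun s => f' (s + r) - f' s)
    (fun x => ((hd (x + r)).comp_add_const x r).sub (hd x)) (by fun_prop)
    ((hf.comp_add_right r).sub hf) ((hi.comp_add_right r).sub hi) hr
  have b := n1_diff hd' hc hi hi' hr
  have e : n1 (D2 f r) = n1 (fun s => (f (s + r + r) - f (s + r)) - (f (s + r) - f s)) := by
    rw [← n1_shift (D2 f r) r]
    unfold n1 D2
    congr 1; ext s
    rw [← abs_neg]; congr 1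
    show -(2 * f (s + r) - f (s + r + r) - f (s + r - r)) = _
    rw [add_sub_cancel_right]; ring
  rw [e]
  calc _ ≤ _ := a
    _ ≤ r * (r * n1 f'') := by gcongr
    _ = _ := by ring

def kα (α r : ℝ) : ℝ := if r ≤ 1 then r ^ (1 - α) else r ^ (-1 - α)

lemma kα_nonneg (α : ℝ) (hr : 0 < r) : 0 ≤ kα α r := by
  unfold kα; split_ifs <;> positivity

lemma kα_int (hα : α ∈ Ioo 0 2) : IntegrableOn (kα α) (Ioi 0) := by
  rw [← Set.Ioc_union_Ioi_eq_Ioi zero_le_one]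
  refine IntegrableOn.union ?_ ?_
  · have h : IntegrableOn (fun r : ℝ => r ^ (1 - α)) (Ioc 0 1) := by
      rw [← intervalIntegrable_iff_integrableOn_Ioc_of_le zero_le_one]
      exact intervalIntegral.intervalIntegrable_rpow' (by linarith [hα.2])
    exact h.congr_fun (fun r hr => by simp [kα, hr.2]) measurableSet_Ioc
  · have h : IntegrableOn (fun r : ℝ => r ^ (-1 - α)) (Ioi 1) :=
      integrableOn_Ioi_rpow_of_lt (by linarith [hα.1]) one_pos
    exact h.congr_fun (fun r hr => by
      have h1 : ¬ r ≤ 1 := not_le.mpr (show (1 : ℝ) < r from hr)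
      simp [kα, h1]) measurableSet_Ioi

def cα (α : ℝ) : ℝ := ∫ r in Ioi 0, kα α r

lemma cα_nonneg (α : ℝ) : 0 ≤ cα α := setIntegral_nonneg measurableSet_Ioi fun _ hr => kα_nonneg α hr

lemma rpow_kα (hr : 0 < r) (hr1 : r ≤ 1) : r ^ (-1 - α) * r ^ 2 = kα α r := by
  rw [kα, if_pos hr1, ← rpow_natCast r 2, ← Real.rpow_add hr]; congr 1; push_cast; ring

lemma kα_dom {A0 A2 : ℝ} (hr : 0 < r) (hA0 : 0 ≤ A0) (hA2 : 0 ≤ A2) (h0 : X ≤ A0)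
    (h2 : r ≤ 1 → X ≤ r ^ 2 * A2) : r ^ (-1 - α) * X ≤ (A0 + A2) * kα α r := by
  have hp : 0 < r ^ (-1 - α) := by positivity
  by_cases h : r ≤ 1
  · have := rpow_kα (α := α) hr h
    calc r ^ (-1 - α) * X ≤ r ^ (-1 - α) * (r ^ 2 * A2) := by gcongr; exact h2 h
      _ = A2 * kα α r := by rw [← this]; ring
      _ ≤ _ := by have := kα_nonneg α hr; nlinarith
  · rw [kα, if_neg h]
    calc r ^ (-1 - α) * X ≤ r ^ (-1 - α) * A0 := by gcongr
      _ ≤ _ := by nlinarith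

def LLf (α : ℝ) (b f : ℝ → ℝ) : ℝ :=
  (1 / π) * ∫ r in Ioi (0 : ℝ), r ^ (-1 - α) * ∫ s, b s * D2 f r s

lemma bD2_int (h : Bd M b) (hf : Integrable f) (r : ℝ) :
    Integrable (fun s => b s * D2 f r s) :=
  (D2_int hf r).bdd_mul (c := M) h.c.aestronglyMeasurable (ae_of_all _ h.le)

lemma bD2_le (h : Bd M b) (hf : Integrable f) (r : ℝ) :
    |∫ s, b s * D2 f r s| ≤ M * n1 (D2 f r) := by
  unfold n1; rw [← integral_const_mul]
  refine norm_integral_le_of_norm_le (f := fun s => b s * D2 f r s) ((D2_int hf r).abs.const_mul M) (ae_of_all _ fun s => ?_)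
  rw [norm_mul]; exact mul_le_mul_of_nonneg_right (h.le s) (abs_nonneg _)

lemma D2_prod (hα : α ∈ Ioo 0 2) (h : Bd M b) (ψ : TF) :
    Integrable (fun p : ℝ × ℝ => p.1 ^ (-1 - α) * (b p.2 * D2 ψ.f0 p.1 p.2))
      ((volume.restrict (Ioi 0)).prod volume) := by
  have hm : Measurable (fun p : ℝ × ℝ => p.1 ^ (-1 - α) * (b p.2 * D2 ψ.f0 p.1 p.2)) :=
    (measurable_fst.pow_const _).mul ((h.c.measurable.comp measurable_snd).mul (D2_cont ψ.c0).measurable)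
  rw [integrable_prod_iff hm.aestronglyMeasurable]
  constructor
  · exact ae_of_all _ fun r => (bD2_int h ψ.i0 r).const_mul (r ^ (-1 - α))
  · refine Integrable.mono' ((kα_int hα).const_mul (M * (4 * n1 ψ.f0) + M * n1 ψ.f2))
      hm.norm.aestronglyMeasurable.integral_prod_right' ?_
    refine (ae_restrict_iff' measurableSet_Ioi).mpr (ae_of_all _ fun r hr => ?_)
    have hr : 0 < r := hr
    have hM := h.nonneg
    have := n1_nonneg ψ.f0
    have := n1_nonneg ψ.f2
    rw [norm_of_nonneg (integral_nonneg fun _ => norm_nonneg _)]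
    have e : ∀ s, ‖r ^ (-1 - α) * (b s * D2 ψ.f0 r s)‖ = r ^ (-1 - α) * (|b s| * |D2 ψ.f0 r s|) := fun s => by
      rw [norm_mul, norm_mul, norm_of_nonneg (by positivity : 0 ≤ r ^ (-1 - α))]; rfl
    simp_rw [e]
    rw [integral_const_mul]
    have hle : ∫ s, |b s| * |D2 ψ.f0 r s| ≤ M * n1 (D2 ψ.f0 r) := by
      unfold n1; rw [← integral_const_mul]
      refine integral_mono ?_ ((D2_int ψ.i0 r).abs.const_mul M) fun s =>
        mul_le_mul_of_nonneg_right (h.le s) (abs_nonneg _)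
      simpa [abs_mul] using (bD2_int h ψ.i0 r).abs
    refine kα_dom hr (by positivity) (by positivity) ?_ fun h1 => ?_
    · exact hle.trans (mul_le_mul_of_nonneg_left (n1_D2_le4 ψ.i0 r) hM)
    · refine hle.trans ?_
      have := n1_D2_le ψ.h0 ψ.h1 ψ.c2 ψ.i0 ψ.i1 ψ.i2 hr.le
      nlinarith

lemma LLf_integrand (hα : α ∈ Ioo 0 2) (h : Bd M b) (ψ : TF) :
    IntegrableOn (fun r : ℝ => r ^ (-1 - α) * ∫ s, b s * D2 ψ.f0 r s) (Ioi 0) := by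
  have := (D2_prod hα h ψ).integral_prod_left
  simp only [integral_const_mul] at this
  exact this

lemma LLf_le (hα : α ∈ Ioo 0 2) {A0 A2 : ℝ} (hA0 : 0 ≤ A0) (hA2 : 0 ≤ A2)
    (h0 : ∀ r, 0 < r → |∫ s, b s * D2 f r s| ≤ A0)
    (h2 : ∀ r, 0 < r → r ≤ 1 → |∫ s, b s * D2 f r s| ≤ r ^ 2 * A2) :
    |LLf α b f| ≤ (A0 + A2) * cα α := by
  unfold LLf cα
  rw [abs_mul, abs_of_pos (by positivity : 0 < 1 / π), ← integral_const_mul]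
  have : |∫ r in Ioi (0 : ℝ), r ^ (-1 - α) * ∫ s, b s * D2 f r s| ≤ ∫ r in Ioi 0, (A0 + A2) * kα α r := by
    refine norm_integral_le_of_norm_le (f := fun r : ℝ => r ^ (-1 - α) * ∫ s, b s * D2 f r s) ((kα_int hα).const_mul _) ?_
    refine (ae_restrict_iff' measurableSet_Ioi).mpr (ae_of_all _ fun r hr => ?_)
    have hr : 0 < r := hr
    rw [norm_mul, norm_of_nonneg (by positivity : 0 ≤ r ^ (-1 - α))]
    exact kα_dom hr hA0 hA2 (h0 r hr) (h2 r hr)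
  have hpi : 1 / π ≤ 1 := by
    rw [div_le_one pi_pos]; linarith [pi_gt_three]
  calc _ ≤ 1 * |∫ r in Ioi (0 : ℝ), r ^ (-1 - α) * ∫ s, b s * D2 f r s| := by gcongr
    _ ≤ _ := by rw [one_mul]; exact this

lemma LLf_bound (hα : α ∈ Ioo 0 2) (h : Bd M b) (ψ : TF) :
    |LLf α b ψ.f0| ≤ (M * (4 * n1 ψ.f0) + M * n1 ψ.f2) * cα α := by
  have hM := h.nonneg
  have := n1_nonneg ψ.f0
  have := n1_nonneg ψ.f2
  refine LLf_le hα (by positivity) (by positivity) (fun r hr => ?_) fun r hr h1 => ?_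
  · exact (bD2_le h ψ.i0 r).trans (mul_le_mul_of_nonneg_left (n1_D2_le4 ψ.i0 r) hM)
  · refine (bD2_le h ψ.i0 r).trans ?_
    have := n1_D2_le ψ.h0 ψ.h1 ψ.c2 ψ.i0 ψ.i1 ψ.i2 hr.le
    nlinarith

lemma LLf_cont (hα : α ∈ Ioo 0 2) {ι : Type*} {l : Filter ι} [l.IsCountablyGenerated]
    {b : ι → ℝ → ℝ} (h : ∀ᶠ i in l, Bd M (b i))
    (hb : ∀ x, Tendsto (fun i => b i x) l (𝓝 (b0 x))) (ψ : TF) :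
    Tendsto (fun i => LLf α (b i) ψ.f0) l (𝓝 (LLf α b0 ψ.f0)) := by
  unfold LLf
  refine Tendsto.const_mul _ ?_
  refine tendsto_integral_filter_of_dominated_convergence
    (fun r => (M * (4 * n1 ψ.f0) + M * n1 ψ.f2) * kα α r) ?_ ?_ ((kα_int hα).const_mul _) ?_
  · filter_upwards [h] with i hi using (LLf_integrand hα hi ψ).aestronglyMeasurable
  · filter_upwards [h] with i hi
    refine (ae_restrict_iff' measurableSet_Ioi).mpr (ae_of_all _ fun r hr => ?_)
    have hr : 0 < r := hr
    have hM := hi.nonneg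
    have := n1_nonneg ψ.f0
    have := n1_nonneg ψ.f2
    rw [norm_mul, norm_of_nonneg (by positivity : 0 ≤ r ^ (-1 - α))]
    refine kα_dom hr (by positivity) (by positivity) ?_ fun h1 => ?_
    · exact (bD2_le hi ψ.i0 r).trans (mul_le_mul_of_nonneg_left (n1_D2_le4 ψ.i0 r) hM)
    · refine (bD2_le hi ψ.i0 r).trans ?_
      have := n1_D2_le ψ.h0 ψ.h1 ψ.c2 ψ.i0 ψ.i1 ψ.i2 hr.le
      nlinarith
  · refine ae_of_all _ fun r => Tendsto.const_mul _ ?_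
    refine tendsto_integral_filter_of_dominated_convergence (fun s => M * |D2 ψ.f0 r s|) ?_ ?_
      ((D2_int ψ.i0 r).abs.const_mul M) ?_
    · filter_upwards [h] with i hi using (bD2_int hi ψ.i0 r).aestronglyMeasurable
    · filter_upwards [h] with i hi
      refine ae_of_all _ fun s => ?_
      rw [norm_mul]; exact mul_le_mul_of_nonneg_right (hi.le s) (abs_nonneg _)
    · exact ae_of_all _ fun s => (hb s).mul_const _

lemma D2_symm (h : Bd M b) (hf : Integrable f) (r : ℝ) :
    ∫ s, b s * D2 f r s = ∫ s, f s * D2 b r s := by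
  have i0 : ∀ c, Integrable (fun s => b s * f (s + c)) := fun c =>
    (hf.comp_add_right c).bdd_mul (c := M) h.c.aestronglyMeasurable (ae_of_all _ h.le)
  have j0 : ∀ c, Integrable (fun s => f s * b (s + c)) := fun c =>
    hf.mul_bdd (c := M) (h.c.comp (continuous_add_const c)).aestronglyMeasurable (ae_of_all _ fun s => h.le _)
  have e1 : ∀ s, b s * D2 f r s = 2 * (b s * f (s + 0)) - b s * f (s + r) - b s * f (s + -r) := fun s => by
    unfold D2; rw [add_zero, ← sub_eq_add_neg]; ring
  have e2 : ∀ s, f s * D2 b r s = 2 * (f s * b (s + 0)) - f s * b (s + -r) - f s * b (s + r) := fun s => by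
    unfold D2; rw [add_zero, ← sub_eq_add_neg]; ring
  have sh : ∀ c, ∫ s, b s * f (s + c) = ∫ s, f s * b (s + -c) := fun c => by
    rw [← integral_add_right_eq_self (fun s => b s * f (s + c)) (-c)]
    congr 1; ext s; rw [neg_add_cancel_right]; ring
  simp_rw [e1, e2]
  have i01 : Integrable (fun s => 2 * (b s * f (s + 0)) - b s * f (s + r)) := ((i0 0).const_mul 2).sub (i0 r)
  have j01 : Integrable (fun s => 2 * (f s * b (s + 0)) - f s * b (s + -r)) := ((j0 0).const_mul 2).sub (j0 (-r))
  rw [integral_sub i01 (i0 (-r)), integral_sub ((i0 0).const_mul 2) (i0 r),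
    integral_sub j01 (j0 r), integral_sub ((j0 0).const_mul 2) (j0 (-r)),
    integral_const_mul, integral_const_mul, sh 0, sh r, sh (-r)]
  simp

lemma inv_sq_le_lor (s : ℝ) : C / (1 + |s| ^ 2) = C * ((s - 0) ^ 2 + 1 ^ 2)⁻¹ := by
  rw [div_eq_mul_inv, sq_abs, sub_zero]; ring_nf

lemma contour {A : ℂ → ℂ} (hc : ContinuousOn A {z | 0 ≤ z.im})
    (hd : DifferentiableOn ℂ A {z | 0 < z.im}) (hb : ∀ z : ℂ, 0 ≤ z.im → ‖A z‖ ≤ C / (1 + ‖z‖ ^ 2)) :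
    Integrable (fun x : ℝ => A x) ∧ ∫ x : ℝ, A x = 0 := by
  have hC : 0 ≤ C := by
    have h0 := (norm_nonneg _).trans (hb 0 (by simp))
    simpa using h0
  have hcr : Continuous (fun x : ℝ => A x) :=
    hc.comp_continuous continuous_ofReal (fun x => by simp)
  have hi : Integrable (fun x : ℝ => A x) := by
    refine Integrable.mono' ((integrable_lor 0 one_pos).const_mul C) hcr.aestronglyMeasurable
      (ae_of_all _ fun x => ?_)
    have := hb x (by simp)
    rw [norm_real, norm_eq_abs, inv_sq_le_lor] at this
    exact this
  refine ⟨hi, ?_⟩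
  have ht := intervalIntegral_tendsto_integral hi tendsto_neg_atTop_atBot tendsto_id (ι := ℝ)
  refine tendsto_nhds_unique ht ?_
  have hb0 : Tendsto (fun L : ℝ => 4 * C / L) atTop (𝓝 0) := tendsto_const_nhds.div_atTop tendsto_id
  refine squeeze_zero_norm' ?_ hb0
  filter_upwards [eventually_gt_atTop 0] with L hL
  have key := Complex.integral_boundary_rect_eq_zero_of_continuousOn_of_differentiableOn A (-L : ℂ) (L + L * I)
    (hc.mono fun z hz => by
      have h2 := hz.2
      simp at h2
      rw [uIcc_of_le hL.le] at h2
      exact h2.1)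
    (hd.mono fun z hz => by
      have h2 := hz.2
      simp [hL.le] at h2
      exact h2.1)
  simp only [Complex.neg_re, ofReal_re, Complex.neg_im, ofReal_im, neg_zero, Complex.ofReal_zero,
    zero_mul, add_zero, Complex.add_re, mul_re, I_re, mul_zero, I_im, mul_one,
    sub_self, Complex.add_im, mul_im, zero_add] at key
  have hbd : ∀ z : ℂ, 0 ≤ z.im → L ≤ ‖z‖ → ‖A z‖ ≤ C / L ^ 2 := fun z hz hl => by
    refine (hb z hz).trans ?_
    have : L ^ 2 ≤ ‖z‖ ^ 2 := by gcongr
    gcongr; linarith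
  have t1 : ‖∫ x in (-L)..L, A (x + L * I)‖ ≤ C / L ^ 2 * |L - -L| :=
    intervalIntegral.norm_integral_le_of_norm_le_const fun x _ => by
      refine hbd _ (by simp [hL.le]) ?_
      have := abs_im_le_norm (x + L * I : ℂ)
      simp at this
      exact (le_abs_self _).trans this
  have t2 : ‖∫ y in 0..L, A (L + y * I)‖ ≤ C / L ^ 2 * |L - 0| :=
    intervalIntegral.norm_integral_le_of_norm_le_const fun y hy => by
      rw [uIoc_of_le hL.le] at hy
      refine hbd _ (by simp [hy.1.le]) ?_
      have := abs_re_le_norm (L + y * I : ℂ)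
      simp at this
      exact (le_abs_self _).trans this
  have t3 : ‖∫ y in 0..L, A (((-L : ℝ) : ℂ) + y * I)‖ ≤ C / L ^ 2 * |L - 0| :=
    intervalIntegral.norm_integral_le_of_norm_le_const fun y hy => by
      rw [uIoc_of_le hL.le] at hy
      refine hbd _ (by simp [hy.1.le]) ?_
      have := abs_re_le_norm (((-L : ℝ) : ℂ) + y * I : ℂ)
      simp at this
      simpa using (le_abs_self _).trans this
  have e : (∫ x in (-L)..L, A x) = (∫ x in (-L)..L, A (x + L * I)) -
      I • (∫ y in 0..L, A (L + y * I)) +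
      I • ∫ y in 0..L, A (((-L : ℝ) : ℂ) + y * I) := by
    rw [← sub_eq_zero, ← key]; ring
  show ‖∫ x in (-L)..(id L), A x‖ ≤ _
  rw [id, e]
  refine (norm_add_le _ _).trans ?_
  refine (add_le_add_left (norm_sub_le _ _) _).trans ?_
  rw [norm_smul, norm_smul, norm_I, one_mul, one_mul]
  refine (add_le_add (add_le_add t1 t2) t3).trans (le_of_eq ?_)
  rw [sub_neg_eq_add, sub_zero, abs_of_pos hL, abs_of_pos (by linarith)]
  field_simp; ring

lemma contour' {A : ℂ → ℂ} {D : ℝ} (hR : 1 ≤ R) (hc : ContinuousOn A {z | 0 ≤ z.im})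
    (hd : DifferentiableOn ℂ A {z | 0 < z.im})
    (hb : ∀ z : ℂ, 0 ≤ z.im → R ≤ ‖z‖ → ‖A z‖ ≤ D / ‖z‖ ^ 2) :
    Integrable (fun x : ℝ => A x) ∧ ∫ x : ℝ, A x = 0 := by
  have hK : IsCompact (closedBall (0 : ℂ) R ∩ {z | 0 ≤ z.im}) :=
    (isCompact_closedBall 0 R).inter_right (isClosed_le continuous_const continuous_im)
  obtain ⟨C1, hC1⟩ := hK.exists_bound_of_continuousOn (hc.mono Set.inter_subset_right)
  have hC1n : 0 ≤ C1 := (norm_nonneg _).trans (hC1 0 (by simp; linarith))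
  refine contour (C := C1 * (1 + R ^ 2) + 2 * |D|) hc hd fun z hz => ?_
  have hp : 0 < 1 + ‖z‖ ^ 2 := by positivity
  rw [le_div_iff₀ hp]
  by_cases h : ‖z‖ ≤ R
  · have h1 := hC1 z ⟨by simpa using h, hz⟩
    have h2 : ‖z‖ ^ 2 ≤ R ^ 2 := by gcongr
    calc ‖A z‖ * (1 + ‖z‖ ^ 2) ≤ C1 * (1 + R ^ 2) := by gcongr
      _ ≤ _ := by have := abs_nonneg D; linarith
  · push Not at h
    have h1 := hb z hz h.le
    have hz1 : 1 ≤ ‖z‖ := hR.trans h.le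
    have h2 : 1 ≤ ‖z‖ ^ 2 := one_le_pow₀ hz1
    calc ‖A z‖ * (1 + ‖z‖ ^ 2) ≤ D / ‖z‖ ^ 2 * (1 + ‖z‖ ^ 2) := by gcongr
      _ ≤ |D| / ‖z‖ ^ 2 * (2 * ‖z‖ ^ 2) := by
          gcongr
          · exact le_abs_self D
          · linarith
      _ = 2 * |D| := by field_simp
      _ ≤ _ := by have : 0 ≤ C1 * (1 + R ^ 2) := by positivity
                  linarith

lemma conj_sub_ne (hz : 0 < z.im) {w : ℂ} (hw : 0 ≤ w.im) : w - (starRingEnd ℂ) z ≠ 0 := by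
  intro h
  have := congrArg im h
  simp at this
  linarith

lemma mul_conj_sub (z : ℂ) (s : ℝ) : ((s : ℂ) - z) * (s - (starRingEnd ℂ) z) = (((s - z.re) ^ 2 + z.im ^ 2 : ℝ) : ℂ) := by
  apply Complex.ext
  · rw [ofReal_re]; simp; ring
  · rw [ofReal_im]; simp; ring

lemma GC_poisson (h : Bd M b) (hz : 0 < z.im) (hε : 0 < ε) :
    ∫ s : ℝ, ((z.im / π * ((s - z.re) ^ 2 + z.im ^ 2)⁻¹ : ℝ) : ℂ) * GC b (s + ε * I)
      = GC b (z + ε * I) := by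
  set G : ℂ → ℂ := fun w => GC b (w + ε * I) with hG
  have him : ∀ w : ℂ, (w + ε * I).im = w.im + ε := fun w => by simp
  have hGd : DifferentiableOn ℂ G {w | -ε < w.im} := by
    intro w hw
    have hw : -ε < w.im := hw
    have : DifferentiableAt ℂ (GC b) (w + ε * I) := GC_diff h (by rw [him]; linarith)
    exact (this.comp w (by fun_prop : DifferentiableAt ℂ (fun w : ℂ => w + ε * I) w)).differentiableWithinAt
  have hopen : IsOpen {w : ℂ | -ε < w.im} := isOpen_lt continuous_const continuous_im
  have hds : DifferentiableOn ℂ (dslope G z) {w | -ε < w.im} :=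
    (Complex.differentiableOn_dslope (hopen.mem_nhds (by show -ε < z.im; linarith))).mpr hGd
  have hGb : ∀ w : ℂ, 0 ≤ w.im → ‖G w‖ ≤ M ^ 2 / ε ^ 2 := fun w hw => by
    refine (GC_bound h (by rw [him]; linarith)).trans ?_
    rw [him]; gcongr; linarith
  have hdiv : DifferentiableOn ℂ (fun w => dslope G z w / (w - (starRingEnd ℂ) z)) {w | 0 ≤ w.im} :=
    (hds.mono fun w hw => by show -ε < w.im; have : 0 ≤ w.im := hw; linarith).div (by fun_prop)
      fun w hw => conj_sub_ne hz hw
  obtain ⟨hi, h0⟩ := contour' (A := fun w => dslope G z w / (w - (starRingEnd ℂ) z)) (R := 1 + 2 * ‖z‖)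
    (D := 8 * (M ^ 2 / ε ^ 2)) (by linarith [norm_nonneg z]) hdiv.continuousOn
    (hdiv.mono fun w hw => (show 0 ≤ w.im from le_of_lt hw)) fun w hw hR => by
      have hn := norm_nonneg z
      have hw1 : ‖w‖ / 2 ≤ ‖w - z‖ := by
        have := norm_sub_norm_le w z; linarith
      have hw2 : ‖w‖ / 2 ≤ ‖w - (starRingEnd ℂ) z‖ := by
        have := norm_sub_norm_le w ((starRingEnd ℂ) z); rw [Complex.norm_conj] at this; linarith
      have hwp : 0 < ‖w‖ := by linarith
      have hne : w ≠ z := fun e => by rw [e, sub_self, norm_zero] at hw1; rw [e] at hwp; linarith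
      rw [dslope_of_ne _ hne, slope_def_field, norm_div, norm_div]
      have hGG : ‖G w - G z‖ ≤ 2 * (M ^ 2 / ε ^ 2) := by
        have := norm_sub_le (G w) (G z); linarith [hGb w hw, hGb z hz.le]
      calc ‖G w - G z‖ / ‖w - z‖ / ‖w - (starRingEnd ℂ) z‖ ≤ 2 * (M ^ 2 / ε ^ 2) / (‖w‖ / 2) / (‖w‖ / 2) := by gcongr
        _ = _ := by field_simp; ring
  have hne : ∀ s : ℝ, (s : ℂ) - z ≠ 0 := fun s e => by
    have := congrArg im e
    simp at this
    linarith
  have e : ∀ s : ℝ, dslope G z s / (s - (starRingEnd ℂ) z) =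
      ((((s - z.re) ^ 2 + z.im ^ 2)⁻¹ : ℝ) : ℂ) * G s - ((((s - z.re) ^ 2 + z.im ^ 2)⁻¹ : ℝ) : ℂ) * G z := fun s => by
    rw [dslope_of_ne _ (sub_ne_zero.mp (hne s)), slope_def_field, div_div, mul_conj_sub, Complex.ofReal_inv]
    rw [← mul_sub, div_eq_inv_mul]
  simp_rw [e] at h0
  have ilor : Integrable (fun s : ℝ => ((((s - z.re) ^ 2 + z.im ^ 2)⁻¹ : ℝ) : ℂ)) := (integrable_lor z.re hz).ofReal
  have i2 := ilor.mul_const (G z)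
  have i1 : Integrable (fun s : ℝ => ((((s - z.re) ^ 2 + z.im ^ 2)⁻¹ : ℝ) : ℂ) * G s) := by
    have := hi
    simp_rw [e] at this
    exact (this.add i2).congr (ae_of_all _ fun s => by simp)
  rw [integral_sub i1 i2, integral_mul_const, integral_complex_ofReal, integral_lor z.re hz, sub_eq_zero] at h0
  have : ∀ s : ℝ, ((z.im / π * ((s - z.re) ^ 2 + z.im ^ 2)⁻¹ : ℝ) : ℂ) * GC b (s + ε * I) =
     ((z.im / π : ℝ) : ℂ) * (((((s - z.re) ^ 2 + z.im ^ 2)⁻¹ : ℝ) : ℂ) * G s) := fun s => by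
    rw [hG]; push_cast; ring
  simp_rw [this]
  rw [integral_const_mul, h0, ← mul_assoc, ← Complex.ofReal_mul]
  have : z.im / π * (π / z.im) = 1 := by field_simp
  rw [this]; simp [hG]

def phi (r : ℝ) : ℝ := r * log r

lemma phi_cont : Continuous phi := Real.continuous_mul_log

def kap (ε r : ℝ) : ℝ := phi (r + ε) + phi (r - ε) - 2 * phi r

lemma kap_cont (ε : ℝ) : Continuous (kap ε) := by
  have := phi_cont
  unfold kap; fun_prop

lemma phi_scale (hε : 0 < ε) (r : ℝ) : phi (ε * r) = ε * phi r + (ε * log ε) * r := by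
  unfold phi
  by_cases h : r = 0
  · simp [h]
  · rw [log_mul hε.ne' h]; ring

lemma kap_scale (hε : 0 < ε) (r : ℝ) : kap ε (ε * r) = ε * kap 1 r := by
  unfold kap
  have h1 : ε * r + ε = ε * (r + 1) := by ring
  have h2 : ε * r - ε = ε * (r - 1) := by ring
  rw [h1, h2, phi_scale hε, phi_scale hε, phi_scale hε]; ring

lemma phi_odd (r : ℝ) : phi (-r) = - phi r := by unfold phi; rw [log_neg_eq_log]; ring

lemma kap_odd (ε r : ℝ) : kap ε (-r) = - kap ε r := by
  unfold kap
  have h1 : -r + ε = -(r - ε) := by ring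
  have h2 : -r - ε = -(r + ε) := by ring
  rw [h1, h2, phi_odd, phi_odd, phi_odd]; ring

def mm (σ : ℝ) : ℝ := σ * kap 1 σ

def dm (σ : ℝ) : ℝ := (2 * σ + 1) * log (σ + 1) + (2 * σ - 1) * log (σ - 1) - 4 * phi σ

lemma mm_cont : Continuous mm := continuous_id.mul (kap_cont 1)

lemma phi_deriv (hr : r ≠ 0) : HasDerivAt phi (log r + 1) r := Real.hasDerivAt_mul_log hr

lemma mm_deriv (h0 : σ ≠ 0) (h1 : σ ≠ 1) (h2 : σ ≠ -1) : HasDerivAt mm (dm σ) σ := by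
  have a := (phi_deriv (r := σ + 1) (fun h => h2 (by linarith))).comp_add_const σ 1
  have b := (phi_deriv (r := σ - 1) (fun h => h1 (by linarith))).comp_sub_const σ 1
  have c := (phi_deriv h0).const_mul 2
  have := (hasDerivAt_id' σ).fun_mul ((a.fun_add b).fun_sub c)
  refine this.congr_deriv ?_
  unfold dm phi; ring

lemma dm_meas : Measurable dm := by
  have := phi_cont.measurable
  unfold dm; fun_prop

lemma dm_intInt (a b : ℝ) : IntervalIntegrable dm volume a b := by
  unfold dm
  have l1 : IntervalIntegrable (fun σ : ℝ => log (σ + 1)) volume a b := by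
    have := (intervalIntegral.intervalIntegrable_log' (a := a + 1) (b := b + 1)).comp_add_right 1
    simpa using this
  have l2 : IntervalIntegrable (fun σ : ℝ => log (σ - 1)) volume a b := by
    have := (intervalIntegral.intervalIntegrable_log' (a := a - 1) (b := b - 1)).comp_sub_right 1
    simpa using this
  exact ((l1.continuousOn_mul (by fun_prop)).add (l2.continuousOn_mul (by fun_prop))).sub
    ((phi_cont.intervalIntegrable _ _).const_mul 4)

lemma mm_ftc (hσ : 0 ≤ σ) : ∫ u in 0..σ, dm u = mm σ := by
  have := integral_eq_of_hasDerivAt_off_countable_of_le mm dm hσ (s := {0, 1, -1}) (Set.toFinite _).countable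
    mm_cont.continuousOn (fun x hx => by
      have := hx.2
      simp at this
      exact mm_deriv this.1 this.2.1 this.2.2) (dm_intInt 0 σ)
  rw [this]; simp [mm]

lemma log_exp2 {u : ℝ} (hu : |u| ≤ 1 / 2) : |log (1 - u) + u + u ^ 2 / 2| ≤ 2 * |u| ^ 3 := by
  have := Real.abs_log_sub_add_sum_range_le (x := u) (by linarith) 2
  simp [Finset.sum_range_succ] at this
  have e : log (1 - u) + u + u ^ 2 / 2 = u + u ^ 2 / (1 + 1) + log (1 - u) := by ring
  rw [e]
  refine this.trans ?_
  rw [div_le_iff₀ (by linarith)]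
  have : 0 ≤ |u| ^ 3 := by positivity
  nlinarith

lemma dm_tail (hσ : 2 ≤ σ) : |dm σ| ≤ 10 / σ ^ 2 := by
  set u := σ⁻¹ with hu
  have hσ0 : 0 < σ := by linarith
  have hu0 : 0 < u := by positivity
  have hu1 : u ≤ 1 / 2 := by rw [hu, one_div]; exact inv_anti₀ (by norm_num) hσ
  have e : dm σ = σ * ((2 + u) * log (1 - (-u)) + (2 - u) * log (1 - u)) := by
    unfold dm phi
    have h1 : σ + 1 = σ * (1 - (-u)) := by rw [hu]; field_simp; ring
    have h2 : σ - 1 = σ * (1 - u) := by rw [hu]; field_simp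
    rw [h1, h2, log_mul hσ0.ne' (by linarith), log_mul hσ0.ne' (by linarith)]
    have h3 : σ * u = 1 := by rw [hu]; field_simp
    linear_combination (-log (1 - -u) + log (1-u)) * h3
  have a := log_exp2 (u := -u) (by rw [abs_neg, abs_of_pos hu0]; exact hu1)
  have b := log_exp2 (u := u) (by rw [abs_of_pos hu0]; exact hu1)
  rw [abs_neg, abs_of_pos hu0] at a
  rw [abs_of_pos hu0] at b
  rw [e, abs_mul, abs_of_pos hσ0]
  have key : |(2 + u) * log (1 - (-u)) + (2 - u) * log (1 - u)| ≤ 10 * u ^ 3 := by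
    have : (2 + u) * log (1 - (-u)) + (2 - u) * log (1 - u) =
      (2 + u) * (log (1 - -u) + -u + (-u) ^ 2 / 2) + (2 - u) * (log (1 - u) + u + u ^ 2 / 2) := by ring
    rw [this]
    refine (abs_add_le _ _).trans ?_
    rw [abs_mul, abs_mul, abs_of_pos (by linarith : 0 < 2 + u), abs_of_pos (by linarith : 0 < 2 - u)]
    have : 0 < u ^ 3 := by positivity
    nlinarith
  calc σ * _ ≤ σ * (10 * u ^ 3) := by gcongr
    _ = 10 / σ ^ 2 := by rw [hu]; field_simp

lemma dm_int : IntegrableOn dm (Ioi 0) := by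
  rw [← Set.Ioc_union_Ioi_eq_Ioi (zero_le_two)]
  refine IntegrableOn.union ?_ ?_
  · rw [← intervalIntegrable_iff_integrableOn_Ioc_of_le zero_le_two]; exact dm_intInt 0 2
  · have h : IntegrableOn (fun r : ℝ => 10 * r ^ (-2 : ℝ)) (Ioi 2) :=
      (integrableOn_Ioi_rpow_of_lt (by norm_num) two_pos).const_mul 10
    refine Integrable.mono' h dm_meas.aestronglyMeasurable ?_
    refine (ae_restrict_iff' measurableSet_Ioi).mpr (ae_of_all _ fun r hr => ?_)
    have hr : 2 < r := hr
    refine (dm_tail hr.le).trans (le_of_eq ?_)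
    rw [rpow_neg (by linarith)]; norm_num; rfl

lemma mm_lim : Tendsto mm atTop (𝓝 1) := by
  have hb : Tendsto (fun σ : ℝ => 10 / σ) atTop (𝓝 0) := tendsto_const_nhds.div_atTop tendsto_id
  rw [tendsto_iff_norm_sub_tendsto_zero]
  refine squeeze_zero' (Eventually.of_forall fun _ => norm_nonneg _) ?_ hb
  filter_upwards [eventually_ge_atTop 2] with σ hσ
  set u := σ⁻¹ with hu
  have hσ0 : 0 < σ := by linarith
  have hu0 : 0 < u := by positivity
  have hu1 : u ≤ 1 / 2 := by rw [hu, one_div]; exact inv_anti₀ (by norm_num) hσ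
  have h3 : σ * u = 1 := by rw [hu]; field_simp
  have e : mm σ = σ ^ 2 * ((1 + u) * log (1 - (-u)) + (1 - u) * log (1 - u)) := by
    unfold mm kap phi
    have h1 : σ + 1 = σ * (1 - (-u)) := by rw [hu]; field_simp; ring
    have h2 : σ - 1 = σ * (1 - u) := by rw [hu]; field_simp
    rw [h1, h2, log_mul hσ0.ne' (by linarith), log_mul hσ0.ne' (by linarith)]
    ring
  have a := log_exp2 (u := -u) (by rw [abs_neg, abs_of_pos hu0]; exact hu1)
  have b := log_exp2 (u := u) (by rw [abs_of_pos hu0]; exact hu1)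
  rw [abs_neg, abs_of_pos hu0] at a
  rw [abs_of_pos hu0] at b
  have e2 : mm σ - 1 = σ ^ 2 * ((1 + u) * (log (1 - -u) + -u + (-u) ^ 2 / 2) + (1 - u) * (log (1 - u) + u + u ^ 2 / 2)) := by
    rw [e]
    linear_combination (σ * u + 1) * h3
  rw [e2, norm_eq_abs, abs_mul, abs_of_pos (by positivity : 0 < σ ^ 2)]
  have key : |(1 + u) * (log (1 - -u) + -u + (-u) ^ 2 / 2) + (1 - u) * (log (1 - u) + u + u ^ 2 / 2)| ≤ 10 * u ^ 3 := by
    refine (abs_add_le _ _).trans ?_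
    rw [abs_mul, abs_mul, abs_of_pos (by linarith : 0 < 1 + u), abs_of_pos (by linarith : 0 < 1 - u)]
    have : 0 < u ^ 3 := by positivity
    nlinarith
  calc σ ^ 2 * _ ≤ σ ^ 2 * (10 * u ^ 3) := by gcongr
    _ = 10 / σ := by rw [hu]; field_simp

lemma dm_total : ∫ u in Ioi (0 : ℝ), dm u = 1 := by
  have := intervalIntegral_tendsto_integral_Ioi 0 dm_int tendsto_id
  refine tendsto_nhds_unique this (mm_lim.congr' ?_)
  filter_upwards [eventually_ge_atTop 0] with σ hσ using (mm_ftc hσ).symm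

def VV (σ : ℝ) : ℝ := ∫ u in Ioc 0 σ, |dm u|

lemma VV_bound : ∃ C, 0 < C ∧ ∀ σ, 0 ≤ σ → VV σ ≤ C * σ ∧ VV σ ≤ C := by
  have hc : ContinuousOn dm (Icc 0 (1 / 2)) := by
    have := phi_cont
    unfold dm
    refine ContinuousOn.sub (ContinuousOn.add ?_ ?_) (by fun_prop)
    · refine ContinuousOn.mul (by fun_prop) (ContinuousOn.log (by fun_prop) fun x hx => ?_)
      have := hx.1; linarith
    · refine ContinuousOn.mul (by fun_prop) (ContinuousOn.log (by fun_prop) fun x hx => ?_)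
      have := hx.2; intro h; linarith
  obtain ⟨C1, hC1⟩ := isCompact_Icc.exists_bound_of_continuousOn hc
  have hC1n : 0 ≤ C1 := (norm_nonneg _).trans (hC1 0 (by norm_num))
  set C2 := ∫ u in Ioi (0 : ℝ), |dm u| with hC2
  have hC2n : 0 ≤ C2 := integral_nonneg fun _ => abs_nonneg _
  have hV2 : ∀ σ, VV σ ≤ C2 := fun σ =>
    setIntegral_mono_set dm_int.abs (ae_of_all _ fun _ => abs_nonneg _) (ae_of_all _ fun x hx => hx.1)
  refine ⟨C1 + 2 * C2 + 1, by positivity, fun σ hσ => ⟨?_, by linarith [hV2 σ]⟩⟩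
  by_cases h : σ ≤ 1 / 2
  · have : VV σ ≤ C1 * σ := by
      have := norm_setIntegral_le_of_norm_le_const (μ := volume) (s := Ioc 0 σ) (f := fun u => |dm u|) (C := C1)
        (by simp) (fun x hx => by
          rw [norm_eq_abs, abs_abs]
          exact hC1 x ⟨hx.1.le, hx.2.trans h⟩)
      rw [Real.volume_real_Ioc, sub_zero, max_eq_left hσ] at this
      exact (le_abs_self _).trans this
    nlinarith
  · push Not at h
    have := hV2 σ
    nlinarith

lemma mm_even (σ : ℝ) : mm (-σ) = mm σ := by unfold mm; rw [kap_odd]; ring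

lemma mm_le_VV (σ : ℝ) : |mm σ| ≤ VV |σ| := by
  have h : mm σ = mm |σ| := by
    rcases abs_choice σ with h | h <;> rw [h]
    rw [mm_even]
  rw [h, ← mm_ftc (abs_nonneg σ), integral_of_le (abs_nonneg σ)]
  exact abs_integral_le_integral_abs

lemma kap1_bound : ∃ C, 0 < C ∧ ∀ σ, |kap 1 σ| ≤ C / (1 + |σ|) := by
  obtain ⟨C, hC, h⟩ := VV_bound
  refine ⟨2 * C, by positivity, fun σ => ?_⟩
  by_cases h0 : σ = 0
  · have : kap 1 0 = 0 := by have := kap_odd 1 0; simp at this; linarith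
    rw [h0, this]; simp; linarith
  · have hp : 0 < |σ| := abs_pos.mpr h0
    have h1 := (mm_le_VV σ).trans (h |σ| hp.le).1
    have h2 := (mm_le_VV σ).trans (h |σ| hp.le).2
    unfold mm at h1 h2
    rw [abs_mul] at h1 h2
    have h3 : |kap 1 σ| ≤ C := by
      by_contra hcon; push Not at hcon; nlinarith
    rw [le_div_iff₀ (by positivity)]
    nlinarith

lemma kap_bound (hε : 0 < ε) : ∃ C, 0 < C ∧ ∀ r, |kap ε r| ≤ C / (1 + |r|) := by
  obtain ⟨C, hC, h⟩ := kap1_bound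
  refine ⟨C * ε * (1 + ε), by positivity, fun r => ?_⟩
  have e : kap ε r = ε * kap 1 (r / ε) := by
    rw [← kap_scale hε]; congr 1; field_simp
  rw [e, abs_mul, abs_of_pos hε]
  have h1 := h (r / ε)
  rw [abs_div, abs_of_pos hε] at h1
  have hr := abs_nonneg r
  calc ε * |kap 1 (r / ε)| ≤ ε * (C / (1 + |r| / ε)) := by gcongr
    _ ≤ C * ε * (1 + ε) / (1 + |r|) := by
      rw [le_div_iff₀ (by positivity)]
      have : ε * (C / (1 + |r| / ε)) = ε * C * ε / (ε + |r|) := by field_simp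
      rw [this, div_mul_eq_mul_div, div_le_iff₀ (by positivity)]
      have h4 : 0 ≤ ε * C * (ε ^ 2 + |r|) := by positivity
      nlinarith

def JI (J : ℝ → ℝ) : Prop := Integrable (fun s => J s / (1 + |s|))

lemma JI.aesm (h : JI J) : AEStronglyMeasurable J := by
  have : J = fun s => (J s / (1 + |s|)) * (1 + |s|) := by
    ext s; have : 1 + |s| ≠ 0 := by positivity
    field_simp
  rw [this]
  exact h.aestronglyMeasurable.mul (by fun_prop : Continuous fun s : ℝ => 1 + |s|).aestronglyMeasurable

lemma JI.int_of_le (h : JI J) {E : Type*} [NormedAddCommGroup E] {f : ℝ → E} (hf : AEStronglyMeasurable f)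
    (hb : ∀ s, ‖f s‖ ≤ C * (|J s| / (1 + |s|))) : Integrable f := by
  refine Integrable.mono' (Integrable.const_mul (Integrable.norm h) C) hf (ae_of_all _ fun s => ?_)
  refine (hb s).trans (le_of_eq ?_)
  rw [norm_div, norm_eq_abs, norm_of_nonneg (by positivity : 0 ≤ 1 + |s|)]

lemma one_add_le : 1 + |s| ≤ 1 + |x| + |x - s| := by
  have := abs_sub_abs_le_abs_sub s x
  rw [abs_sub_comm] at this; linarith

def hx (J : ℝ → ℝ) (x r : ℝ) : ℝ := ∫ y in {y : ℝ | r < |x - y|}, J y / (x - y)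

lemma meas_far (x r : ℝ) : MeasurableSet {y : ℝ | r < |x - y|} :=
  (isOpen_lt continuous_const (by fun_prop)).measurableSet

lemma JI.far (h : JI J) (x : ℝ) (hr : 0 < r) :
    IntegrableOn (fun y => J y / (x - y)) {y : ℝ | r < |x - y|} := by
  rw [← integrable_indicator_iff (meas_far x r)]
  refine h.int_of_le (C := (1 + |x|) / r + 1) ?_ fun s => ?_
  · refine AEStronglyMeasurable.indicator ?_ (meas_far x r)
    simp_rw [div_eq_mul_inv]
    exact h.aesm.mul (by fun_prop : Measurable fun y : ℝ => (x - y)⁻¹).aestronglyMeasurable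
  · by_cases hs : r < |x - s|
    · have hm : s ∈ {y : ℝ | r < |x - y|} := hs
      rw [indicator_of_mem hm, norm_div, norm_eq_abs, norm_eq_abs]
      have hp : 0 < |x - s| := hr.trans hs
      have h1 := one_add_le (x := x) (s := s)
      rw [div_le_iff₀ hp, mul_div_assoc', div_mul_eq_mul_div, le_div_iff₀ (by positivity)]
      have h2 : 1 + |s| ≤ ((1 + |x|) / r + 1) * |x - s| := by
        have : 1 + |x| ≤ (1 + |x|) / r * |x - s| := by
          rw [div_mul_eq_mul_div, le_div_iff₀ hr]; gcongr
        linarith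
      calc |J s| * (1 + |s|) ≤ |J s| * (((1 + |x|) / r + 1) * |x - s|) := by gcongr
        _ = _ := by ring
    · have hm : s ∉ {y : ℝ | r < |x - y|} := hs
      rw [indicator_of_notMem hm]; simp; positivity

lemma hx_bdd (h : JI J) {c : ℝ} (hc : Tendsto (hx J x) (𝓝[>] 0) (𝓝 c)) :
    ∃ D, ∀ r, 0 < r → |hx J x r| ≤ D := by
  have h1 : ∀ᶠ r in 𝓝[>] (0 : ℝ), |hx J x r| ≤ |c| + 1 :=
    (hc.abs.eventually (gt_mem_nhds (by linarith : |c| < |c| + 1))).mono fun _ h => le_of_lt h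
  rw [eventually_nhdsWithin_iff, Metric.eventually_nhds_iff] at h1
  obtain ⟨δ, hδ, h1⟩ := h1
  set D0 := ∫ y in {y : ℝ | δ / 2 < |x - y|}, |J y / (x - y)| with hD0
  have hD0n : 0 ≤ D0 := integral_nonneg fun _ => abs_nonneg _
  refine ⟨|c| + 1 + D0, fun r hr => ?_⟩
  by_cases hrd : r < δ
  · have := h1 (y := r) (by simpa [abs_of_pos hr] using hrd) hr
    linarith
  · push Not at hrd
    have : |hx J x r| ≤ D0 := by
      refine (abs_integral_le_integral_abs).trans ?_
      refine setIntegral_mono_set (h.far x (by linarith)).abs (ae_of_all _ fun _ => abs_nonneg _)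
        (ae_of_all _ fun y hy => ?_)
      have hy : r < |x - y| := hy
      show δ / 2 < |x - y|
      linarith
    have := abs_nonneg c
    linarith

lemma kap_eq_mm (hε : 0 < ε) (hr : r ≠ 0) : kap ε r / ε ^ 2 = (1 / r) * mm (r / ε) := by
  have e : kap ε r = ε * kap 1 (r / ε) := by
    rw [← kap_scale hε]; congr 1; field_simp
  rw [e]; unfold mm; field_simp

lemma A1_fub (h : JI J) (x : ℝ) (hε : 0 < ε) :
    Integrable (fun σ => dm σ * hx J x (ε * σ)) (volume.restrict (Ioi 0)) ∧
    (∫ s, J s * kap ε (x - s)) / ε ^ 2 = ∫ σ in Ioi 0, dm σ * hx J x (ε * σ) := by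
  obtain ⟨C, hC, hV⟩ := VV_bound
  let f : ℝ × ℝ → ℝ := fun p => {p : ℝ × ℝ | ε * p.2 < |x - p.1|}.indicator (fun p => J p.1 / (x - p.1) * dm p.2) p
  have hS : MeasurableSet {p : ℝ × ℝ | ε * p.2 < |x - p.1|} :=
    (isOpen_lt (by fun_prop) (by fun_prop)).measurableSet
  have hfm : AEStronglyMeasurable f (volume.prod (volume.restrict (Ioi 0))) := by
    refine AEStronglyMeasurable.indicator ?_ hS
    refine AEStronglyMeasurable.mul ?_ (dm_meas.comp measurable_snd).aestronglyMeasurable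
    have := h.aesm.mul (by fun_prop : Measurable fun y : ℝ => (x - y)⁻¹).aestronglyMeasurable
    simp_rw [div_eq_mul_inv]
    exact this.comp_fst
  have fe : ∀ s σ, f (s, σ) = J s / (x - s) * (Iio (|x - s| / ε)).indicator dm σ := fun s σ => by
    have hiff : ε * σ < |x - s| ↔ σ ∈ Iio (|x - s| / ε) := by
      rw [Set.mem_Iio, lt_div_iff₀ hε, mul_comm]
    by_cases hh : ε * σ < |x - s|
    · have hm : (s, σ) ∈ {p : ℝ × ℝ | ε * p.2 < |x - p.1|} := hh
      simp only [f]
      rw [indicator_of_mem hm, indicator_of_mem (hiff.mp hh)]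
    · have hm : (s, σ) ∉ {p : ℝ × ℝ | ε * p.2 < |x - p.1|} := hh
      simp only [f]
      rw [indicator_of_notMem hm, indicator_of_notMem (fun hc => hh (hiff.mpr hc))]; simp
  have inter : ∀ ρ : ℝ, Iio ρ ∩ Ioi 0 = Ioo 0 ρ := fun ρ => by ext; simp [and_comm]
  have hfi : Integrable f (volume.prod (volume.restrict (Ioi 0))) := by
    rw [integrable_prod_iff hfm]
    constructor
    · refine ae_of_all _ fun s => ?_
      simp_rw [fe]
      exact (Integrable.indicator dm_int measurableSet_Iio).const_mul _
    · refine h.int_of_le (C := C * (2 + |x|) * (1 + 1 / ε)) hfm.norm.integral_prod_right' fun s => ?_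
      rw [norm_of_nonneg (integral_nonneg fun _ => norm_nonneg _)]
      have e1 : ∀ σ, ‖f (s, σ)‖ = |J s / (x - s)| * (Iio (|x - s| / ε)).indicator (fun σ => |dm σ|) σ := fun σ => by
        rw [fe, norm_mul, norm_indicator_eq_indicator_norm]; rfl
      simp_rw [e1]
      rw [integral_const_mul, integral_indicator measurableSet_Iio, Measure.restrict_restrict measurableSet_Iio, inter,
        ← integral_Ioc_eq_integral_Ioo]
      have hρ : 0 ≤ |x - s| / ε := by positivity
      have v := hV _ hρ
      change |J s / (x - s)| * VV (|x - s| / ε) ≤ _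
      by_cases hxs : x - s = 0
      · rw [hxs]; simp; positivity
      have hp : 0 < |x - s| := abs_pos.mpr hxs
      have h1 := one_add_le (x := x) (s := s)
      have key : VV (|x - s| / ε) / |x - s| ≤ C * (2 + |x|) * (1 + 1 / ε) / (1 + |s|) := by
        have hxn := abs_nonneg x
        rw [div_le_div_iff₀ hp (by positivity)]
        have hVn : 0 ≤ VV (|x - s| / ε) := integral_nonneg fun _ => abs_nonneg _
        rcases le_total 1 |x - s| with h2 | h2
        · calc VV (|x - s| / ε) * (1 + |s|) ≤ C * ((2 + |x|) * |x - s|) := by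
                gcongr
                · exact v.2
                · nlinarith
            _ = C * (2 + |x|) * 1 * |x - s| := by ring
            _ ≤ _ := by gcongr; have : 0 < 1 / ε := by positivity
                        linarith
        · calc VV (|x - s| / ε) * (1 + |s|) ≤ (C * (|x - s| / ε)) * (2 + |x|) := by
                exact mul_le_mul v.1 (by linarith) (by positivity) (by positivity)
            _ = C * (2 + |x|) * (1 / ε) * |x - s| := by ring
            _ ≤ _ := by
                refine mul_le_mul_of_nonneg_right ?_ hp.le
                exact mul_le_mul_of_nonneg_left (by linarith) (by positivity)
      calc |J s / (x - s)| * VV (|x - s| / ε) = |J s| * (VV (|x - s| / ε) / |x - s|) := by rw [abs_div]; ring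
        _ ≤ |J s| * (C * (2 + |x|) * (1 + 1 / ε) / (1 + |s|)) := by gcongr
        _ = _ := by ring
  have eσ : ∀ σ, ∫ s, f (s, σ) = dm σ * hx J x (ε * σ) := fun σ => by
    have : ∀ s, f (s, σ) = {y : ℝ | ε * σ < |x - y|}.indicator (fun s => J s / (x - s)) s * dm σ := fun s => by
      by_cases hh : ε * σ < |x - s|
      · have hm : (s, σ) ∈ {p : ℝ × ℝ | ε * p.2 < |x - p.1|} := hh
        have hm' : s ∈ {y : ℝ | ε * σ < |x - y|} := hh
        simp only [f]
        rw [indicator_of_mem hm, indicator_of_mem hm']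
      · have hm : (s, σ) ∉ {p : ℝ × ℝ | ε * p.2 < |x - p.1|} := hh
        have hm' : s ∉ {y : ℝ | ε * σ < |x - y|} := hh
        simp only [f]
        rw [indicator_of_notMem hm, indicator_of_notMem hm']; simp
    simp_rw [this]
    rw [integral_mul_const, integral_indicator (meas_far x _), mul_comm]; rfl
  have hI := hfi.integral_prod_right
  simp_rw [eσ] at hI
  refine ⟨hI, ?_⟩
  have sw := integral_integral_swap (f := fun s σ => f (s, σ)) hfi
  simp_rw [eσ] at sw
  rw [← sw, ← integral_div]
  refine integral_congr_ae ?_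
  have hne : ∀ᵐ s : ℝ, s ≠ x := by simp [ae_iff]
  filter_upwards [hne] with s hs
  have hxs : x - s ≠ 0 := sub_ne_zero.mpr hs.symm
  simp_rw [fe]
  rw [integral_const_mul, integral_indicator measurableSet_Iio, Measure.restrict_restrict measurableSet_Iio, inter,
    ← integral_Ioc_eq_integral_Ioo, ← integral_of_le (by positivity), mm_ftc (by positivity),
    mul_div_assoc, kap_eq_mm hε hxs]
  have : mm (|x - s| / ε) = mm ((x - s) / ε) := by
    rcases abs_choice (x - s) with h | h <;> rw [h]
    rw [neg_div, mm_even]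
  rw [this]; ring

lemma A1 (h : JI J) {c : ℝ} (hc : Tendsto (hx J x) (𝓝[>] 0) (𝓝 c)) :
    Tendsto (fun ε => (∫ s, J s * kap ε (x - s)) / ε ^ 2) (𝓝[>] 0) (𝓝 c) := by
  obtain ⟨D, hD⟩ := hx_bdd h hc
  have e : c = ∫ σ in Ioi 0, dm σ * c := by rw [integral_mul_const, dm_total, one_mul]
  have : Tendsto (fun ε => ∫ σ in Ioi 0, dm σ * hx J x (ε * σ)) (𝓝[>] 0) (𝓝 c) := by
    rw [e]
    refine tendsto_integral_filter_of_dominated_convergence (fun σ => D * |dm σ|) ?_ ?_ (dm_int.abs.const_mul D) ?_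
    · filter_upwards [self_mem_nhdsWithin] with ε hε using (A1_fub h x hε).1.aestronglyMeasurable
    · filter_upwards [self_mem_nhdsWithin] with ε hε
      refine (ae_restrict_iff' measurableSet_Ioi).mpr (ae_of_all _ fun σ hσ => ?_)
      rw [norm_mul, mul_comm]
      exact mul_le_mul_of_nonneg_right (hD _ (mul_pos (mem_Ioi.mp hε) (mem_Ioi.mp hσ))) (abs_nonneg _)
    · refine (ae_restrict_iff' measurableSet_Ioi).mpr (ae_of_all _ fun σ hσ => ?_)
      refine (hc.comp ?_).const_mul _
      refine tendsto_nhdsWithin_iff.mpr ⟨?_, ?_⟩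
      · have : Tendsto (fun ε : ℝ => ε * σ) (𝓝 0) (𝓝 (0 * σ)) := (continuous_id.mul continuous_const).tendsto 0
        rw [zero_mul] at this
        exact this.mono_left nhdsWithin_le_nhds
      · filter_upwards [self_mem_nhdsWithin] with ε hε using mul_pos (mem_Ioi.mp hε) (mem_Ioi.mp hσ)
  refine this.congr' ?_
  filter_upwards [self_mem_nhdsWithin] with ε hε using (A1_fub h x hε).2.symm

lemma schwarz_le {A : ℝ → ℝ} {q : ℝ} (hA : ContinuousOn A (Icc p q))
    (h0 : A p = 0) (h1 : A q = 0)
    (h : ∀ x ∈ Ioo p q, Tendsto (fun ε => (A (x + ε) + A (x - ε) - 2 * A x) / ε ^ 2) (𝓝[>] 0) (𝓝 0)) :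
    ∀ x ∈ Icc p q, A x ≤ 0 := by
  have key : ∀ δ > 0, ∀ x ∈ Icc p q, A x + δ * ((x - p) * (x - q)) ≤ 0 := by
    intro δ hδ
    by_contra! hcon
    obtain ⟨x1, hx1, hx1p⟩ := hcon
    have hc : ContinuousOn (fun x => A x + δ * ((x - p) * (x - q))) (Icc p q) := by fun_prop
    obtain ⟨x0, hx0, hmax⟩ := isCompact_Icc.exists_isMaxOn ⟨x1, hx1⟩ hc
    have hpos : 0 < A x0 + δ * ((x0 - p) * (x0 - q)) := lt_of_lt_of_le hx1p (hmax hx1)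
    have hxp : x0 ≠ p := fun he => by rw [he, h0] at hpos; simp at hpos
    have hxq : x0 ≠ q := fun he => by rw [he, h1] at hpos; simp at hpos
    have hx0' : x0 ∈ Ioo p q := ⟨lt_of_le_of_ne hx0.1 hxp.symm, lt_of_le_of_ne hx0.2 hxq⟩
    have ev1 := (h x0 hx0').eventually (lt_mem_nhds (by linarith : -(2 * δ) < 0))
    have ev2 : ∀ᶠ ε in 𝓝[>] (0 : ℝ), ε < min (x0 - p) (q - x0) :=
      (eventually_lt_nhds (by simp [hx0'.1, hx0'.2])).filter_mono nhdsWithin_le_nhds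
    obtain ⟨ε, ⟨e1, e2⟩, e3⟩ := ((ev1.and ev2).and self_mem_nhdsWithin).exists
    have e3 : 0 < ε := e3
    have e4 := (lt_min_iff.mp e2).1
    have e5 := (lt_min_iff.mp e2).2
    have m1 : A (x0 + ε) + δ * ((x0 + ε - p) * (x0 + ε - q)) ≤ A x0 + δ * ((x0 - p) * (x0 - q)) :=
      hmax (show x0 + ε ∈ Icc p q from ⟨by linarith, by linarith⟩)
    have m2 : A (x0 - ε) + δ * ((x0 - ε - p) * (x0 - ε - q)) ≤ A x0 + δ * ((x0 - p) * (x0 - q)) :=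
      hmax (show x0 - ε ∈ Icc p q from ⟨by linarith, by linarith⟩)
    rw [lt_div_iff₀ (by positivity)] at e1
    nlinarith
  intro x hx
  by_contra! hx2
  have hn : 0 ≤ (x - p) * (q - x) := mul_nonneg (by linarith [hx.1]) (by linarith [hx.2])
  have := key (A x / (2 * ((x - p) * (q - x) + 1))) (by positivity) x hx
  have e : A x / (2 * ((x - p) * (q - x) + 1)) * ((x - p) * (x - q)) = - (A x / 2) * ((x - p) * (q - x) / ((x - p) * (q - x) + 1)) := by
    field_simp; ring
  have h3 : (x - p) * (q - x) / ((x - p) * (q - x) + 1) ≤ 1 := by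
    rw [div_le_one (by positivity)]; linarith
  rw [e] at this
  nlinarith

lemma schwarz {A : ℝ → ℝ} (hr : 0 < r) (hA : ContinuousOn A (Icc (x - r) (x + r)))
    (h : ∀ y ∈ Ioo (x - r) (x + r), Tendsto (fun ε => (A (y + ε) + A (y - ε) - 2 * A y) / ε ^ 2) (𝓝[>] 0) (𝓝 0)) :
    A (x + r) + A (x - r) - 2 * A x = 0 := by
  set m := (A (x + r) - A (x - r)) / (2 * r) with hm
  have hm2 : m * (2 * r) = A (x + r) - A (x - r) := by rw [hm]; field_simp
  have hx : x ∈ Icc (x - r) (x + r) := ⟨by linarith, by linarith⟩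
  have a1 := schwarz_le (A := fun y => A y - (A (x - r) + m * (y - (x - r)))) (p := x - r) (q := x + r)
    (by fun_prop) (by ring) (by nlinarith) (fun y hy => by
      refine (h y hy).congr fun ε => ?_
      congr 1; ring) x hx
  have a2 := schwarz_le (A := fun y => -(A y - (A (x - r) + m * (y - (x - r))))) (p := x - r) (q := x + r)
    (by fun_prop) (by ring) (by nlinarith) (fun y hy => by
      have := (h y hy).neg
      rw [neg_zero] at this
      refine this.congr fun ε => ?_
      rw [← neg_div]; congr 1; ring) x hx
  nlinarith

def kX (X x s : ℝ) : ℝ := phi (x - s) - {s : ℝ | 2 * X < |s|}.indicator (fun s => phi (-s) + x * (log s + 1)) s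

lemma kX_bound (hX : 1 ≤ X) : ∃ C, ∀ x s, |x| ≤ X → |kX X x s| ≤ C / (1 + |s|) := by
  obtain ⟨P, hP⟩ := (isCompact_Icc (a := -(3 * X)) (b := 3 * X)).exists_bound_of_continuousOn phi_cont.continuousOn
  have hP0 : 0 ≤ P := (norm_nonneg _).trans (hP 0 ⟨by linarith, by linarith⟩)
  refine ⟨P * (1 + 2 * X) + 8 * X ^ 2, fun x s hx => ?_⟩
  rw [le_div_iff₀ (by positivity)]
  have hxb := abs_le.mp hx
  by_cases hs : 2 * X < |s|
  · have hm : s ∈ {s : ℝ | 2 * X < |s|} := hs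
    unfold kX; rw [indicator_of_mem hm]
    have hs0 : s ≠ 0 := by rintro rfl; simp at hs; linarith
    have hsp : 0 < |s| := abs_pos.mpr hs0
    set u := x / s with hu
    have hxu : x = u * s := by rw [hu]; field_simp
    have hua : |u| ≤ 1 / 2 := by
      rw [hu, abs_div, div_le_iff₀ hsp]; linarith
    have hub := abs_le.mp hua
    have e : phi (x - s) - (phi (-s) + x * (log s + 1)) = -s * ((1 - u) * log (1 - u) + u) := by
      unfold phi
      have : log (x - s) = log s + log (1 - u) := by
        rw [← log_mul hs0 (by linarith), ← log_neg_eq_log]; congr 1; rw [hxu]; ring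
      rw [this, log_neg_eq_log, hxu]; ring
    have l := log_exp2 hua
    set ee := log (1 - u) + u + u ^ 2 / 2 with hee
    have e2 : (1 - u) * log (1 - u) + u = u ^ 2 / 2 + u ^ 3 / 2 + (1 - u) * ee := by rw [hee]; ring
    have l2 : |(1 - u) * log (1 - u) + u| ≤ 4 * u ^ 2 := by
      rw [e2]
      have a1 : |u| ^ 3 ≤ u ^ 2 / 2 := by
        rw [← sq_abs u]; nlinarith [abs_nonneg u, sq_nonneg |u|]
      have a2 : |(1 - u) * ee| ≤ 3 / 2 * (u ^ 2) := by
        rw [abs_mul]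
        have : |1 - u| ≤ 3 / 2 := abs_le.mpr ⟨by linarith, by linarith⟩
        calc |1 - u| * |ee| ≤ 3 / 2 * (2 * |u| ^ 3) := by gcongr
          _ ≤ _ := by linarith
      have a3 : |u ^ 3 / 2| ≤ u ^ 2 / 4 := by rw [abs_div, abs_pow]; norm_num; linarith
      have a4 : |u ^ 2 / 2| = u ^ 2 / 2 := abs_of_nonneg (by positivity)
      calc _ ≤ |u ^ 2 / 2| + |u ^ 3 / 2| + |(1 - u) * ee| := abs_add_three _ _ _
        _ ≤ _ := by rw [a4]; nlinarith [sq_nonneg u]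
    rw [e, abs_mul, abs_neg]
    have : |s| * (4 * u ^ 2) * (1 + |s|) ≤ 8 * X ^ 2 := by
      have e3 : |s| ^ 2 * u ^ 2 = x ^ 2 := by rw [hxu, sq_abs]; ring
      have e4 : x ^ 2 ≤ X ^ 2 := by rw [← sq_abs x]; gcongr
      have : 1 + |s| ≤ 2 * |s| := by linarith
      calc |s| * (4 * u ^ 2) * (1 + |s|) ≤ |s| * (4 * u ^ 2) * (2 * |s|) := by gcongr
        _ = 8 * (|s| ^ 2 * u ^ 2) := by ring
        _ ≤ _ := by rw [e3]; linarith
    calc |s| * |(1 - u) * log (1 - u) + u| * (1 + |s|) ≤ |s| * (4 * u ^ 2) * (1 + |s|) := by gcongr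
      _ ≤ _ := by nlinarith
  · have hm : s ∉ {s : ℝ | 2 * X < |s|} := hs
    unfold kX; rw [indicator_of_notMem hm, sub_zero]
    push Not at hs
    have hsb := abs_le.mp hs
    have := hP (x - s) ⟨by linarith, by linarith⟩
    calc |phi (x - s)| * (1 + |s|) ≤ P * (1 + 2 * X) := by gcongr; exact this
      _ ≤ _ := by nlinarith [sq_nonneg X]

lemma kX_cont (X s : ℝ) : Continuous fun x => kX X x s := by
  unfold kX
  refine (phi_cont.comp (by fun_prop)).sub ?_
  by_cases hs : s ∈ {s : ℝ | 2 * X < |s|}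
  · simp_rw [indicator_of_mem hs]; fun_prop
  · simp_rw [indicator_of_notMem hs]; fun_prop

lemma kX_meas (X x : ℝ) : Measurable fun s => kX X x s := by
  unfold kX
  refine (phi_cont.measurable.comp (by fun_prop)).sub (Measurable.indicator ?_ ?_)
  · exact (phi_cont.measurable.comp measurable_neg).add (by fun_prop)
  · exact (isOpen_lt continuous_const continuous_abs).measurableSet

lemma kX_diff (X x r s : ℝ) : kX X (x + r) s + kX X (x - r) s - 2 * kX X x s = kap r (x - s) := by
  unfold kX kap
  have e1 : x + r - s = x - s + r := by ring
  have e2 : x - r - s = x - s - r := by ring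
  rw [e1, e2]
  by_cases hs : s ∈ {s : ℝ | 2 * X < |s|}
  · simp_rw [indicator_of_mem hs]; ring
  · simp_rw [indicator_of_notMem hs]; ring

lemma kX_int (h : JI J) (hX : 1 ≤ X) (hx : |x| ≤ X) : Integrable fun s => J s * kX X x s := by
  obtain ⟨C, hC⟩ := kX_bound hX
  refine h.int_of_le (C := C) (h.aesm.mul (kX_meas X x).aestronglyMeasurable) fun s => ?_
  rw [norm_mul, norm_eq_abs, norm_eq_abs]
  calc |J s| * |kX X x s| ≤ |J s| * (C / (1 + |s|)) := by gcongr; exact hC x s hx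
    _ = _ := by ring

lemma H2_lim {b' : ℝ} (hc : Continuous b) (hd : HasDerivAt b b' x) :
    Tendsto (fun ε => (∫ σ in 0..ε, (b (x + σ) - b (x - σ))) / ε ^ 2) (𝓝[>] 0) (𝓝 b') := by
  rw [Metric.tendsto_nhds]
  intro η hη
  have hl := hd.isLittleO
  rw [Asymptotics.isLittleO_iff] at hl
  have hl := hl (c := η / 4) (by positivity)
  rw [Metric.eventually_nhds_iff] at hl
  obtain ⟨δ, hδ, hl⟩ := hl
  rw [eventually_nhdsWithin_iff, Metric.eventually_nhds_iff]
  refine ⟨δ, hδ, fun ε hε hε0 => ?_⟩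
  have hε0 : 0 < ε := hε0
  rw [dist_eq, sub_zero, abs_of_pos hε0] at hε
  have e : ∫ σ in 0..ε, 2 * σ * b' = ε ^ 2 * b' := by
    rw [intervalIntegral.integral_mul_const, intervalIntegral.integral_const_mul, integral_id]; ring
  have i1 : IntervalIntegrable (fun σ => b (x + σ) - b (x - σ)) volume 0 ε := (by fun_prop : Continuous _).intervalIntegrable _ _
  have i2 : IntervalIntegrable (fun σ : ℝ => 2 * σ * b') volume 0 ε := (by fun_prop : Continuous _).intervalIntegrable _ _
  have bd : |(∫ σ in 0..ε, (b (x + σ) - b (x - σ))) - ε ^ 2 * b'| ≤ η / 2 * ε * ε := by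
    rw [← e, ← intervalIntegral.integral_sub i1 i2]
    have := intervalIntegral.norm_integral_le_of_norm_le_const (a := 0) (b := ε) (C := η / 2 * ε)
      (f := fun σ => b (x + σ) - b (x - σ) - 2 * σ * b') ?_
    · rwa [norm_eq_abs, sub_zero, abs_of_pos hε0] at this
    · intro σ hσ
      rw [uIoc_of_le hε0.le] at hσ
      have s1 := hl (y := x + σ) (by rw [dist_eq]; simp [abs_of_pos hσ.1]; linarith [hσ.2])
      have s2 := hl (y := x - σ) (by rw [dist_eq]; simp [abs_of_pos hσ.1]; linarith [hσ.2])
      have ea : b (x + σ) - b (x - σ) - 2 * σ * b' = (b (x + σ) - b x - (x + σ - x) • b') - (b (x - σ) - b x - (x - σ - x) • b') := by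
        simp only [smul_eq_mul]; ring
      rw [ea]
      refine (norm_sub_le _ _).trans ((add_le_add s1 s2).trans ?_)
      simp [abs_of_pos hσ.1]
      nlinarith [hσ.2]
  rw [dist_eq, div_sub' (by positivity), abs_div, abs_of_pos (by positivity : 0 < ε ^ 2), div_lt_iff₀ (by positivity)]
  refine lt_of_le_of_lt bd ?_
  nlinarith [mul_pos hη (mul_pos hε0 hε0)]

lemma H2_diff (hc : Continuous b) (x ε : ℝ) :
    (∫ s in 0..(x + ε), b s) + (∫ s in 0..(x - ε), b s) - 2 * (∫ s in 0..x, b s) =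
      ∫ σ in 0..ε, (b (x + σ) - b (x - σ)) := by
  have i : ∀ u v, IntervalIntegrable b volume u v := fun u v => hc.intervalIntegrable _ _
  have i1 : IntervalIntegrable (fun σ => b (x + σ)) volume 0 ε := (by fun_prop : Continuous _).intervalIntegrable _ _
  have i2 : IntervalIntegrable (fun σ : ℝ => b (x - σ)) volume 0 ε := (by fun_prop : Continuous _).intervalIntegrable _ _
  rw [intervalIntegral.integral_sub i1 i2, intervalIntegral.integral_comp_add_left, intervalIntegral.integral_comp_sub_left]
  rw [← integral_add_adjacent_intervals (i 0 x) (i x (x + ε)),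
    ← integral_add_adjacent_intervals (i 0 (x - ε)) (i (x - ε) x)]
  simp; ring

lemma A2 {b' : ℝ → ℝ} (h : JI J) (hb : Continuous b) (hd : ∀ x, HasDerivAt b (b' x) x)
    (hc : ∀ x, Tendsto (hx J x) (𝓝[>] 0) (𝓝 (π * b' x))) (x : ℝ) (hε : 0 < ε) :
    ∫ s, J s * kap ε (x - s) = π * ∫ σ in 0..ε, (b (x + σ) - b (x - σ)) := by
  set X := 1 + |x| + ε with hX
  have hX1 : 1 ≤ X := by have := abs_nonneg x; linarith
  obtain ⟨C, hC⟩ := kX_bound hX1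
  have hsub : ∀ y ∈ Icc (x - ε) (x + ε), |y| ≤ X := fun y hy => by
    have h1 : |y - x| ≤ ε := abs_le.mpr ⟨by linarith [hy.1], by linarith [hy.2]⟩
    have h2 := abs_sub_abs_le_abs_sub y x
    linarith
  let A : ℝ → ℝ := fun y => (∫ s, J s * kX X y s) - π * ∫ s in 0..y, b s
  have dA : ∀ y r, y + r ∈ Icc (x - ε) (x + ε) → y - r ∈ Icc (x - ε) (x + ε) → y ∈ Icc (x - ε) (x + ε) →
      A (y + r) + A (y - r) - 2 * A y = (∫ s, J s * kap r (y - s)) - π * ∫ σ in 0..r, (b (y + σ) - b (y - σ)) := by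
    intro y r h1 h2 h3
    rw [← H2_diff hb]
    have : ∫ s, J s * kap r (y - s) = (∫ s, J s * kX X (y + r) s) + (∫ s, J s * kX X (y - r) s) - 2 * ∫ s, J s * kX X y s := by
      rw [← integral_add (kX_int h hX1 (hsub _ h1)) (kX_int h hX1 (hsub _ h2)), ← integral_const_mul,
        ← integral_sub ((kX_int h hX1 (hsub _ h1)).fun_add (kX_int h hX1 (hsub _ h2))) ((kX_int h hX1 (hsub _ h3)).const_mul 2)]
      refine integral_congr_ae (ae_of_all _ fun s => ?_)
      simp only
      rw [← kX_diff X]; ring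
    rw [this]; simp only [A]; ring
  have hcA : ContinuousOn A (Icc (x - ε) (x + ε)) := by
    refine ContinuousOn.sub ?_ ?_
    · refine continuousOn_of_dominated (bound := fun s => C * (|J s / (1 + |s|)|)) ?_ ?_ ?_ ?_
      · intro y hy; exact (kX_int h hX1 (hsub y hy)).aestronglyMeasurable
      · intro y hy; refine ae_of_all _ fun s => ?_
        rw [norm_mul, norm_eq_abs, norm_eq_abs]
        calc |J s| * |kX X y s| ≤ |J s| * (C / (1 + |s|)) := by gcongr; exact hC y s (hsub y hy)
          _ = _ := by rw [abs_div, abs_of_pos (by positivity : 0 < 1 + |s|)]; ring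
      · exact Integrable.const_mul (Integrable.abs h) C
      · exact ae_of_all _ fun s => (continuous_const.mul (kX_cont X s)).continuousOn
    · exact (continuous_const.mul (intervalIntegral.continuous_primitive (fun u v => hb.intervalIntegrable _ _) 0)).continuousOn
  have := schwarz hε hcA fun y hy => by
    have t1 := (A1 h (hc y)).sub ((H2_lim hb (hd y)).const_mul π)
    rw [sub_self] at t1
    refine t1.congr' ?_
    have ev2 : ∀ᶠ r in 𝓝[>] (0 : ℝ), r < min (y - (x - ε)) (x + ε - y) :=
      (eventually_lt_nhds (by simp [hy.1, hy.2])).filter_mono nhdsWithin_le_nhds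
    filter_upwards [ev2, self_mem_nhdsWithin] with r e2 e3
    have e3 : 0 < r := e3
    have e4 := (lt_min_iff.mp e2).1
    have e5 := (lt_min_iff.mp e2).2
    rw [dA y r ⟨by linarith, by linarith⟩ ⟨by linarith, by linarith⟩ ⟨hy.1.le, hy.2.le⟩]; ring
  rw [dA x ε ⟨by linarith, by linarith⟩ ⟨by linarith, by linarith⟩ ⟨by linarith, by linarith⟩] at this
  linarith

def EE (ζ : ℂ) : ℂ := ζ * Complex.log (-I * ζ)

lemma slit (h : 0 ≤ ζ.im) (h0 : ζ ≠ 0) : -I * ζ ∈ Complex.slitPlane := by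
  rw [Complex.mem_slitPlane_iff]
  simp only [mul_re, Complex.neg_re, I_re, Complex.neg_im, I_im, mul_im]
  rcases h.lt_or_eq with h1 | h1
  · left; simpa using h1
  · right; simp
    intro h2; exact h0 (Complex.ext h2 h1.symm)

lemma EE_deriv (h : 0 ≤ ζ.im) (h0 : ζ ≠ 0) : HasDerivAt EE (Complex.log (-I * ζ) + 1) ζ := by
  have h1 : HasDerivAt (fun ζ : ℂ => -I * ζ) (-I * 1) ζ := (hasDerivAt_id' ζ).const_mul _
  have h2 := (hasDerivAt_id' ζ).fun_mul (h1.clog (slit h h0))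
  have := I_ne_zero
  exact h2.congr_deriv (by field_simp)

lemma log_deriv (h : 0 ≤ ζ.im) (h0 : ζ ≠ 0) : HasDerivAt (fun ζ => Complex.log (-I * ζ)) (1 / ζ) ζ := by
  have h1 : HasDerivAt (fun ζ : ℂ => -I * ζ) (-I * 1) ζ := (hasDerivAt_id' ζ).const_mul _
  convert h1.clog (slit h h0) using 1
  have := I_ne_zero
  field_simp

lemma EE_cont : ContinuousOn EE {z | 0 ≤ z.im} := by
  intro ζ hζ
  by_cases h0 : ζ = 0
  · subst h0
    refine ContinuousAt.continuousWithinAt ?_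
    have e0 : EE 0 = 0 := by simp [EE]
    rw [ContinuousAt, e0, tendsto_zero_iff_norm_tendsto_zero]
    have hb : ∀ ζ : ℂ, ‖EE ζ‖ ≤ |phi ‖ζ‖| + π * ‖ζ‖ := fun ζ => by
      unfold EE phi
      rw [norm_mul, abs_mul, abs_norm]
      have h1 : ‖Complex.log (-I * ζ)‖ ≤ |log ‖ζ‖| + π := by
        refine (Complex.norm_le_abs_re_add_abs_im _).trans (add_le_add ?_ ?_)
        · rw [Complex.log_re]; simp
        · rw [Complex.log_im]; exact Complex.abs_arg_le_pi _
      calc ‖ζ‖ * ‖Complex.log (-I * ζ)‖ ≤ ‖ζ‖ * (|log ‖ζ‖| + π) := by gcongr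
        _ = _ := by ring
    refine squeeze_zero (fun _ => norm_nonneg _) hb ?_
    have hc : Continuous fun ζ : ℂ => |phi ‖ζ‖| + π * ‖ζ‖ := (phi_cont.comp continuous_norm).abs.add (by fun_prop)
    have := hc.tendsto 0
    simpa [phi] using this
  · exact (EE_deriv hζ h0).continuousAt.continuousWithinAt

lemma EE_real (x : ℝ) : EE x = phi x - I * ((π / 2 * |x| : ℝ) : ℂ) := by
  unfold EE phi
  rcases lt_trichotomy x 0 with h | h | h
  · have : -I * (x : ℂ) = ((-x : ℝ) : ℂ) * I := by push_cast; ring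
    rw [this, Complex.log_ofReal_mul (by linarith) I_ne_zero, Complex.log_I, log_neg_eq_log, abs_of_neg h]
    push_cast; ring
  · subst h; simp
  · have : -I * (x : ℂ) = (x : ℂ) * -I := by ring
    rw [this, Complex.log_ofReal_mul h (neg_ne_zero.mpr I_ne_zero), Complex.log_neg_I, abs_of_pos h]
    push_cast; ring

def hat (ε r : ℝ) : ℝ := (|r + ε| + |r - ε| - 2 * |r|) / 2

lemma hat_cont (ε : ℝ) : Continuous (hat ε) := by unfold hat; fun_prop

def KK (ε : ℝ) (ζ : ℂ) : ℂ := EE (ζ + ε) + EE (ζ - ε) - 2 * EE ζ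

lemma KK_real (ε x : ℝ) : KK ε x = kap ε x - I * π * hat ε x := by
  unfold KK kap hat
  have e1 : (x : ℂ) + ε = ((x + ε : ℝ) : ℂ) := by push_cast; ring
  have e2 : (x : ℂ) - ε = ((x - ε : ℝ) : ℂ) := by push_cast; ring
  rw [e1, e2, EE_real, EE_real, EE_real]
  push_cast; ring

lemma KK_cont (ε : ℝ) : ContinuousOn (KK ε) {z | 0 ≤ z.im} := by
  unfold KK
  refine ((EE_cont.comp (by fun_prop) ?_).add (EE_cont.comp (by fun_prop) ?_)).sub (continuousOn_const.mul EE_cont)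
  · intro z hz; simpa using hz
  · intro z hz; simpa using hz

lemma KK_diff (ε : ℝ) : DifferentiableOn ℂ (KK ε) {z | 0 < z.im} := by
  intro z hz
  have hz : 0 < z.im := hz
  have d : ∀ w : ℂ, 0 < w.im → DifferentiableAt ℂ EE w := fun w hw =>
    (EE_deriv hw.le (fun h => by rw [h] at hw; simp at hw)).differentiableAt
  refine DifferentiableAt.differentiableWithinAt ?_
  unfold KK
  have h1 : DifferentiableAt ℂ (fun z : ℂ => EE (z + ε)) z := (d _ (by simpa using hz)).comp z (by fun_prop)
  have h2 : DifferentiableAt ℂ (fun z : ℂ => EE (z - ε)) z := (d _ (by simpa using hz)).comp z (by fun_prop)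
  exact (h1.add h2).sub ((differentiableAt_const _).mul (d z hz))

lemma KK_bound (hε : 0 < ε) (h : 0 ≤ ζ.im) (hζ : 2 * ε ≤ ‖ζ‖) : ‖KK ε ζ‖ ≤ 4 * ε ^ 2 / ‖ζ‖ := by
  have hp : 0 < ‖ζ‖ := by linarith
  have nb : ∀ t ∈ Icc (0 : ℝ) ε, ‖ζ‖ / 2 ≤ ‖ζ + t‖ ∧ ‖ζ‖ / 2 ≤ ‖ζ - t‖ := fun t ht => by
    have a1 := norm_sub_le (ζ + t) t
    have a2 := norm_add_le (ζ - t) t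
    simp only [add_sub_cancel_right, sub_add_cancel, norm_real, norm_eq_abs, abs_of_nonneg ht.1] at a1 a2
    constructor <;> linarith [ht.2]
  have ne : ∀ t ∈ Icc (0 : ℝ) ε, ζ + t ≠ 0 ∧ ζ - t ≠ 0 := fun t ht => by
    constructor <;> rw [← norm_pos_iff]
    · linarith [(nb t ht).1]
    · linarith [(nb t ht).2]
  have ip : ∀ t : ℝ, 0 ≤ (ζ + t).im ∧ 0 ≤ (ζ - t).im := fun t => by simpa using h
  have dp : ∀ t : ℝ, HasDerivAt (fun t : ℝ => ζ + (t : ℂ)) 1 t := fun t => (ofRealCLM.hasDerivAt (x := t)).const_add ζ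
  have dn : ∀ t : ℝ, HasDerivAt (fun t : ℝ => ζ - (t : ℂ)) (-1) t := fun t => (ofRealCLM.hasDerivAt (x := t)).const_sub ζ
  let g : ℝ → ℂ := fun t => Complex.log (-I * (ζ + t)) - Complex.log (-I * (ζ - t))
  have dg : ∀ t ∈ Icc (0 : ℝ) ε, HasDerivAt g (1 / (ζ + t) + 1 / (ζ - t)) t := fun t ht => by
    have h1 := (log_deriv (ip t).1 (ne t ht).1).comp t (dp t)
    have h2 := (log_deriv (ip t).2 (ne t ht).2).comp t (dn t)
    exact (h1.sub h2).congr_deriv (by ring)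
  have gb : ∀ t ∈ Icc (0 : ℝ) ε, ‖g t‖ ≤ 4 / ‖ζ‖ * ε := fun t ht => by
    have := norm_image_sub_le_of_norm_deriv_le_segment' (f := g) (C := 4 / ‖ζ‖) (fun t ht => (dg t ht).hasDerivWithinAt) (fun t ht => by
      have ht' : t ∈ Icc (0 : ℝ) ε := ⟨ht.1, ht.2.le⟩
      have n := nb t ht'
      refine (norm_add_le _ _).trans ?_
      rw [norm_div, norm_div, norm_one]
      have b1 : 1 / ‖ζ + t‖ ≤ 1 / (‖ζ‖ / 2) := one_div_le_one_div_of_le (by linarith) n.1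
      have b2 : 1 / ‖ζ - t‖ ≤ 1 / (‖ζ‖ / 2) := one_div_le_one_div_of_le (by linarith) n.2
      have : 1 / (‖ζ‖ / 2) = 2 / ‖ζ‖ := by field_simp
      have e : 4 / ‖ζ‖ = 2 / ‖ζ‖ + 2 / ‖ζ‖ := by ring
      linarith) t ht
    have g0 : g 0 = 0 := by simp [g]
    rw [g0, sub_zero, sub_zero] at this
    refine this.trans ?_
    gcongr; exact ht.2
  let f : ℝ → ℂ := fun t => EE (ζ + t) + EE (ζ - t)
  have df : ∀ t ∈ Icc (0 : ℝ) ε, HasDerivAt f (g t) t := fun t ht => by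
    have h1 := (EE_deriv (ip t).1 (ne t ht).1).comp t (dp t)
    have h2 := (EE_deriv (ip t).2 (ne t ht).2).comp t (dn t)
    exact (h1.add h2).congr_deriv (by simp only [g]; ring)
  have := norm_image_sub_le_of_norm_deriv_le_segment' (f := f) (C := 4 / ‖ζ‖ * ε) (fun t ht => (df t ht).hasDerivWithinAt)
    (fun t ht => gb t ⟨ht.1, ht.2.le⟩) ε ⟨hε.le, le_rfl⟩
  have e : f ε - f 0 = KK ε ζ := by simp [f, KK]; ring
  rw [e] at this
  refine this.trans (le_of_eq ?_); ring

lemma hat_eq (hε : 0 < ε) : hat ε r = max (ε - |r|) 0 := by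
  unfold hat
  rcases le_total 0 r with h | h
  · rw [abs_of_nonneg h, abs_of_nonneg (by linarith : 0 ≤ r + ε)]
    rcases le_total ε r with h1 | h1
    · rw [abs_of_nonneg (by linarith : 0 ≤ r - ε), max_eq_right (by linarith)]; ring
    · rw [abs_of_nonpos (by linarith : r - ε ≤ 0), max_eq_left (by linarith)]; ring
  · rw [abs_of_nonpos h, abs_of_nonpos (by linarith : r - ε ≤ 0)]
    rcases le_total r (-ε) with h1 | h1
    · rw [abs_of_nonpos (by linarith : r + ε ≤ 0), max_eq_right (by linarith)]; ring
    · rw [abs_of_nonneg (by linarith : 0 ≤ r + ε), max_eq_left (by linarith)]; ring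

lemma hat_nonneg (hε : 0 < ε) (r : ℝ) : 0 ≤ hat ε r := by rw [hat_eq hε]; exact le_max_right _ _

lemma hat_supp (hε : 0 < ε) (h : ε < |r|) : hat ε r = 0 := by rw [hat_eq hε, max_eq_right (by linarith)]

lemma hat_int (hε : 0 < ε) : Integrable (hat ε) :=
  (hat_cont ε).integrable_of_hasCompactSupport (HasCompactSupport.of_support_subset_isCompact (isCompact_Icc (a := -ε) (b := ε))
    fun r hr => by
      by_contra hc
      have : ε < |r| := by
        rw [lt_abs]; by_contra! h2; exact hc ⟨by linarith [h2.2], h2.1⟩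
      exact hr (hat_supp hε this))

lemma hat_total (hε : 0 < ε) : ∫ r, hat ε r = ε ^ 2 := by
  have hs : ∀ r, r ∉ Icc (-ε) ε → hat ε r = 0 := fun r hc => hat_supp hε (by
    rw [lt_abs]; by_contra! h2; exact hc ⟨by linarith [h2.2], h2.1⟩)
  rw [← setIntegral_eq_integral_of_forall_compl_eq_zero hs, integral_Icc_eq_integral_Ioc,
    ← integral_of_le (by linarith),
    ← integral_add_adjacent_intervals (b := 0) ((hat_cont ε).intervalIntegrable _ _) ((hat_cont ε).intervalIntegrable _ _)]
  have e1 : ∫ r in (-ε)..0, hat ε r = ∫ r in (-ε)..0, (ε + r) := integral_congr fun r hr => by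
    rw [uIcc_of_le (by linarith)] at hr
    rw [hat_eq hε, abs_of_nonpos hr.2, max_eq_left (by linarith [hr.1])]; ring
  have e2 : ∫ r in 0..ε, hat ε r = ∫ r in 0..ε, (ε - r) := integral_congr fun r hr => by
    rw [uIcc_of_le (by linarith)] at hr
    rw [hat_eq hε, abs_of_nonneg hr.1, max_eq_left (by linarith [hr.2])]
  rw [e1, e2, intervalIntegral.integral_add (by simp) (by simp), intervalIntegral.integral_sub (by simp) (by simp)]
  simp; ring

section

lemma segbd {f f' : ℝ → ℂ} (hf : ∀ s, HasDerivAt f (f' s) s) (hC : ∀ s ∈ uIcc x y, ‖f' s‖ ≤ C) :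
    ‖f y - f x‖ ≤ C * |y - x| := by
  have := (convex_uIcc x y).norm_image_sub_le_of_norm_hasDerivWithin_le (f := f) (f' := f') (fun s _ => (hf s).hasDerivWithinAt)
    hC Set.left_mem_uIcc Set.right_mem_uIcc
  rwa [norm_eq_abs] at this

structure QQ (C : ℝ) (q : ℂ → ℂ) (q1 q2 : ℝ → ℂ) : Prop where
  c : ContinuousOn q {z | 0 ≤ z.im}
  d : DifferentiableOn ℂ q {z | 0 < z.im}
  b0 : ∀ ζ : ℂ, 0 ≤ ζ.im → ‖q ζ‖ ≤ C / (1 + ‖ζ‖) ^ 3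
  h1 : ∀ x : ℝ, HasDerivAt (fun x : ℝ => q x) (q1 x) x
  h2 : ∀ x : ℝ, HasDerivAt q1 (q2 x) x
  b1 : ∀ x : ℝ, ‖q1 x‖ ≤ C / (1 + |x|)
  b2 : ∀ x : ℝ, ‖q2 x‖ ≤ C

variable {C : ℝ} {q : ℂ → ℂ} {q1 q2 : ℝ → ℂ}

lemma QQ.C0 (h : QQ C q q1 q2) : 0 ≤ C := (norm_nonneg _).trans (h.b2 0)

lemma QQ.cr (h : QQ C q q1 q2) : Continuous fun x : ℝ => q x :=
  continuous_iff_continuousAt.mpr fun x => (h.h1 x).continuousAt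

lemma QQ.c1 (h : QQ C q q1 q2) : Continuous q1 :=
  continuous_iff_continuousAt.mpr fun x => (h.h2 x).continuousAt

lemma QQ.br (h : QQ C q q1 q2) (x : ℝ) : ‖q x‖ ≤ C / (1 + |x|) ^ 3 := by
  have := h.b0 x (by simp); simpa using this

lemma int_one_add : Integrable fun x : ℝ => 1 / (1 + |x|) ^ 2 := by
  refine Integrable.mono' integrable_inv_one_add_sq ?_ (ae_of_all _ fun x => ?_)
  · exact (by fun_prop : Measurable fun x : ℝ => 1 / (1 + |x|) ^ 2).aestronglyMeasurable
  · rw [norm_of_nonneg (by positivity), one_div]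
    have : 1 + x ^ 2 ≤ (1 + |x|) ^ 2 := by nlinarith [sq_abs x, abs_nonneg x]
    gcongr

lemma QQ.i0 (h : QQ C q q1 q2) : Integrable fun x : ℝ => (1 + |x|) * ‖q x‖ := by
  refine Integrable.mono' (int_one_add.const_mul C) ?_ (ae_of_all _ fun x => ?_)
  · exact ((by fun_prop : Continuous fun x : ℝ => 1 + |x|).mul h.cr.norm).aestronglyMeasurable
  · rw [norm_of_nonneg (by positivity)]
    calc (1 + |x|) * ‖q x‖ ≤ (1 + |x|) * (C / (1 + |x|) ^ 3) := by gcongr; exact h.br x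
      _ = _ := by field_simp

lemma QQ.ir (h : QQ C q q1 q2) : Integrable fun x : ℝ => q x := by
  refine Integrable.mono' h.i0 h.cr.aestronglyMeasurable (ae_of_all _ fun x => ?_)
  nlinarith [norm_nonneg (q x), abs_nonneg x]

lemma QQ.contour (h : QQ C q q1 q2) (hε : 0 < ε) (s : ℝ) :
    ∫ x : ℝ, q x * (kap ε (x - s) : ℂ) = I * π * ∫ x : ℝ, q x * (hat ε (x - s) : ℂ) := by
  have hC := h.C0
  have sh : ∀ z : ℂ, (z - s).im = z.im := fun z => by simp
  have k := contour' (A := fun ζ => q ζ * KK ε (ζ - s)) (D := C * (8 * ε ^ 2)) (R := 1 + 2 * |s| + 4 * ε)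
    (by have := abs_nonneg s; linarith)
    (h.c.mul ((KK_cont ε).comp (by fun_prop) (fun z hz => by simpa using hz)))
    (h.d.mul ((KK_diff ε).comp (by fun_prop) (fun z hz => by simpa using hz)))
    (fun z hz hR => by
      have hs : ‖z‖ - |s| ≤ ‖z - s‖ := by
        have := norm_sub_norm_le z s; simpa using this
      have hz2 : ‖z‖ / 2 ≤ ‖z - s‖ := by linarith
      have hzp : 0 < ‖z‖ := by linarith [abs_nonneg s]
      have k1 := KK_bound hε (ζ := z - s) (by simpa using hz) (by linarith [abs_nonneg s])
      have k2 : ‖KK ε (z - s)‖ ≤ 8 * ε ^ 2 / ‖z‖ := k1.trans (by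
        rw [div_le_div_iff₀ (by linarith) hzp]; nlinarith [sq_nonneg ε])
      have k3 : ‖q z‖ ≤ C / ‖z‖ := (h.b0 z hz).trans (by
        gcongr
        have : 1 + ‖z‖ ≤ (1 + ‖z‖) ^ 3 := by nlinarith [sq_nonneg ‖z‖]
        linarith)
      rw [norm_mul]
      calc ‖q z‖ * ‖KK ε (z - s)‖ ≤ C / ‖z‖ * (8 * ε ^ 2 / ‖z‖) := by gcongr
        _ = _ := by field_simp)
  have e : ∀ x : ℝ, q x * KK ε (x - s) = q x * (kap ε (x - s) : ℂ) - I * π * (q x * (hat ε (x - s) : ℂ)) := fun x => by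
    have : (x : ℂ) - s = ((x - s : ℝ) : ℂ) := by push_cast; ring
    rw [this, KK_real]; ring
  have hh : Integrable fun x : ℝ => q x * (hat ε (x - s) : ℂ) := by
    have := (((hat_int hε).comp_sub_right s).ofReal (𝕜 := ℂ)).bdd_mul (c := C) h.cr.aestronglyMeasurable (ae_of_all _ fun x => (h.br x).trans ?_)
    · exact this
    · exact div_le_self hC (one_le_pow₀ (by linarith [abs_nonneg x]))
  have k0 := k.2
  have ki := k.1
  simp only [e] at k0 ki
  have hk : Integrable fun x : ℝ => q x * (kap ε (x - s) : ℂ) := by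
    have := ki.add (hh.const_mul (I * π))
    refine this.congr (ae_of_all _ fun x => ?_)
    simp
  rw [integral_sub hk (hh.const_mul _), integral_const_mul] at k0
  exact sub_eq_zero.mp k0

lemma QQ.fub (h : QQ C q q1 q2) (hJ : JI J) (hε : 0 < ε) :
    Integrable (fun s => (J s : ℂ) * ∫ x : ℝ, q x * (hat ε (x - s) : ℂ)) ∧
    ∫ x : ℝ, q x * ((∫ s, J s * kap ε (x - s) : ℝ) : ℂ) =
      I * π * ∫ s, (J s : ℂ) * ∫ x : ℝ, q x * (hat ε (x - s) : ℂ) := by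
  obtain ⟨Ck, hCk, hk⟩ := kap_bound hε
  have hP : Integrable (fun p : ℝ × ℝ => q p.1 * ((J p.2 : ℂ) * (kap ε (p.1 - p.2) : ℂ))) (volume.prod volume) := by
    have dom : Integrable (fun p : ℝ × ℝ => ((1 + |p.1|) * ‖q p.1‖) * (Ck * |J p.2 / (1 + |p.2|)|)) (volume.prod volume) :=
      h.i0.mul_prod (Integrable.const_mul (Integrable.abs hJ) Ck)
    refine Integrable.mono' dom ?_ (ae_of_all _ fun p => ?_)
    · refine AEStronglyMeasurable.mul (h.cr.comp continuous_fst).aestronglyMeasurable ?_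
      refine AEStronglyMeasurable.mul ?_ ?_
      · exact continuous_ofReal.comp_aestronglyMeasurable hJ.aesm.comp_snd
      · exact (continuous_ofReal.comp ((kap_cont ε).comp (by fun_prop : Continuous fun p : ℝ × ℝ => p.1 - p.2))).aestronglyMeasurable
    · rw [norm_mul, norm_mul, norm_real, norm_real, norm_eq_abs, norm_eq_abs]
      have k1 : |kap ε (p.1 - p.2)| ≤ Ck * ((1 + |p.1|) / (1 + |p.2|)) := by
        refine (hk _).trans ?_
        rw [mul_div_assoc', div_le_div_iff₀ (by positivity) (by positivity)]
        have := one_add_le (x := p.1) (s := p.2)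
        have h2 : 1 + |p.2| ≤ (1 + |p.1|) * (1 + |p.1 - p.2|) := by nlinarith [abs_nonneg p.1, abs_nonneg (p.1 - p.2)]
        nlinarith
      rw [abs_div, abs_of_pos (by positivity : 0 < 1 + |p.2|)]
      calc ‖q p.1‖ * (|J p.2| * |kap ε (p.1 - p.2)|) ≤ ‖q p.1‖ * (|J p.2| * (Ck * ((1 + |p.1|) / (1 + |p.2|)))) := by gcongr
        _ = _ := by ring
  have sw := integral_integral_swap (f := fun x s : ℝ => q x * ((J s : ℂ) * (kap ε (x - s) : ℂ))) hP
  have e1 : ∀ x : ℝ, ∫ s, q x * ((J s : ℂ) * (kap ε (x - s) : ℂ)) = q x * ((∫ s, J s * kap ε (x - s) : ℝ) : ℂ) := fun x => by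
    rw [integral_const_mul, ← integral_complex_ofReal]; push_cast; rfl
  have e2 : ∀ s : ℝ, ∫ x : ℝ, q x * ((J s : ℂ) * (kap ε (x - s) : ℂ)) = I * π * ((J s : ℂ) * ∫ x : ℝ, q x * (hat ε (x - s) : ℂ)) := fun s => by
    have : ∀ x : ℝ, q x * ((J s : ℂ) * (kap ε (x - s) : ℂ)) = (J s : ℂ) * (q x * (kap ε (x - s) : ℂ)) := fun x => by ring
    simp_rw [this]
    rw [integral_const_mul, h.contour hε]; ring
  have hI := hP.integral_prod_right
  simp only [e2] at hI
  have hne : I * π ≠ 0 := mul_ne_zero I_ne_zero (by exact_mod_cast pi_ne_zero)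
  constructor
  · have := hI.const_mul (I * π)⁻¹
    refine this.congr (ae_of_all _ fun s => ?_)
    simp only
    rw [← mul_assoc, inv_mul_cancel₀ hne, one_mul]
  · simp_rw [e1, e2] at sw
    rw [sw, integral_const_mul]

lemma QQ.hat_err (h : QQ C q q1 q2) (hε : 0 < ε) (hε1 : ε ≤ 1) (s : ℝ) :
    ‖(∫ x : ℝ, q x * (hat ε (x - s) : ℂ)) - ε ^ 2 * q s‖ ≤ 2 * C * ε ^ 3 / (1 + |s|) := by
  have hC := h.C0
  have hi := (hat_int hε).comp_sub_right s
  have et : ∫ x, hat ε (x - s) = ε ^ 2 := by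
    rw [integral_sub_right_eq_self (fun x => hat ε x) s, hat_total hε]
  have hh : Integrable fun x : ℝ => q x * (hat ε (x - s) : ℂ) := by
    have := (hi.ofReal (𝕜 := ℂ)).bdd_mul (c := C) h.cr.aestronglyMeasurable (ae_of_all _ fun x => (h.br x).trans ?_)
    · exact this
    · exact div_le_self hC (one_le_pow₀ (by linarith [abs_nonneg x]))
  have hc : Integrable fun x : ℝ => q s * (hat ε (x - s) : ℂ) := (hi.ofReal (𝕜 := ℂ)).const_mul _
  have e : (ε : ℂ) ^ 2 * q s = ∫ x : ℝ, q s * (hat ε (x - s) : ℂ) := by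
    rw [integral_const_mul, integral_complex_ofReal, et]; push_cast; ring
  rw [e, ← integral_sub hh hc]
  have := norm_integral_le_of_norm_le (f := fun x : ℝ => q x * (hat ε (x - s) : ℂ) - q s * (hat ε (x - s) : ℂ)) (hi.const_mul (2 * C * ε / (1 + |s|))) (ae_of_all _ fun x => ?_)
  · rw [integral_const_mul, et] at this
    refine this.trans (le_of_eq ?_); ring
  · rw [← sub_mul, norm_mul, norm_real, norm_of_nonneg (hat_nonneg hε _)]
    by_cases hx : ε < |x - s|
    · rw [hat_supp hε hx]; simp
    · push Not at hx
      refine mul_le_mul_of_nonneg_right ?_ (hat_nonneg hε _)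
      have := segbd (x := s) (y := x) (C := 2 * C / (1 + |s|)) h.h1 (fun y hy => (h.b1 y).trans ?_)
      · refine this.trans ?_
        calc 2 * C / (1 + |s|) * |x - s| ≤ 2 * C / (1 + |s|) * ε := by gcongr
          _ = _ := by ring
      · rw [div_le_div_iff₀ (by positivity) (by positivity)]
        have h1 : |y - s| ≤ |x - s| := Set.abs_sub_left_of_mem_uIcc hy
        have h2 := abs_sub_abs_le_abs_sub s y
        rw [abs_sub_comm s y] at h2
        nlinarith [abs_nonneg y, abs_nonneg s]

lemma QQ.b_err (h : QQ C q q1 q2) (hb : Bd M b) (hbi : Integrable b) (hε : 0 < ε) :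
    ‖(∫ x : ℝ, q x * ((∫ σ in 0..ε, (b (x + σ) - b (x - σ)) : ℝ) : ℂ)) + ε ^ 2 * ∫ x, (b x : ℂ) * q1 x‖ ≤ 2 * C * n1 b * ε ^ 3 := by
  have hC := h.C0
  have hP : Integrable (fun p : ℝ × ℝ => q p.1 * ((b (p.1 + p.2) - b (p.1 - p.2) : ℝ) : ℂ)) (volume.prod (volume.restrict (Ioc 0 ε))) := by
    have dom : Integrable (fun p : ℝ × ℝ => ‖q p.1‖ * (2 * M)) (volume.prod (volume.restrict (Ioc 0 ε))) :=
      h.ir.norm.mul_prod (integrable_const _)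
    have hbc := hb.c
    refine Integrable.mono' dom ?_ (ae_of_all _ fun p => ?_)
    · exact ((h.cr.comp continuous_fst).mul (continuous_ofReal.comp
        (by fun_prop : Continuous fun p : ℝ × ℝ => b (p.1 + p.2) - b (p.1 - p.2)))).aestronglyMeasurable
    · rw [norm_mul, norm_real, norm_eq_abs]
      have := (abs_sub _ _).trans (add_le_add (hb.le (p.1 + p.2)) (hb.le (p.1 - p.2)))
      gcongr; linarith
  have sw := integral_integral_swap (f := fun x σ : ℝ => q x * ((b (x + σ) - b (x - σ) : ℝ) : ℂ)) hP
  have e1 : ∀ x : ℝ, ∫ σ in Ioc 0 ε, q x * ((b (x + σ) - b (x - σ) : ℝ) : ℂ) = q x * ((∫ σ in 0..ε, (b (x + σ) - b (x - σ)) : ℝ) : ℂ) := fun x => by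
    rw [integral_const_mul, integral_of_le hε.le, integral_complex_ofReal]
  simp_rw [e1] at sw
  have iq : ∀ σ : ℝ, Integrable fun x : ℝ => q ((x - σ : ℝ) : ℂ) * (b x : ℂ) := fun σ => by
    refine (hbi.ofReal (𝕜 := ℂ)).bdd_mul (c := C) (h.cr.comp (by fun_prop : Continuous fun x : ℝ => x - σ)).aestronglyMeasurable (ae_of_all _ fun x => (h.br _).trans ?_)
    exact div_le_self hC (one_le_pow₀ (by linarith [abs_nonneg (x - σ)]))
  have iq1 : Integrable fun x : ℝ => (b x : ℂ) * q1 x := by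
    have := (hbi.ofReal (𝕜 := ℂ)).bdd_mul (c := C) h.c1.aestronglyMeasurable (ae_of_all _ fun x => (h.b1 _).trans ?_)
    · exact this.congr (ae_of_all _ fun x => mul_comm _ _)
    · exact div_le_self hC (by linarith [abs_nonneg x])
  have e2 : ∀ σ : ℝ, ∫ x : ℝ, q x * ((b (x + σ) - b (x - σ) : ℝ) : ℂ) = ∫ x : ℝ, (q ((x - σ : ℝ) : ℂ) - q ((x + σ : ℝ) : ℂ)) * (b x : ℂ) := fun σ => by
    have j : ∀ σ : ℝ, Integrable fun x : ℝ => q x * (b (x + σ) : ℂ) := fun σ => by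
      have := (iq σ).comp_add_right σ
      simpa using this
    have a1 : ∀ σ : ℝ, ∫ x : ℝ, q x * (b (x + σ) : ℂ) = ∫ x : ℝ, q ((x - σ : ℝ) : ℂ) * (b x : ℂ) := fun σ => by
      rw [← integral_add_right_eq_self (fun x : ℝ => q ((x - σ : ℝ) : ℂ) * (b x : ℂ)) σ]
      simp
    have a2 := a1 (-σ)
    have j2 := j (-σ)
    have i2 := iq (-σ)
    simp only [sub_neg_eq_add, ← sub_eq_add_neg] at a2 j2 i2
    have : ∀ x : ℝ, q x * ((b (x + σ) - b (x - σ) : ℝ) : ℂ) = q x * (b (x + σ) : ℂ) - q x * (b (x - σ) : ℂ) := fun x => by push_cast; ring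
    simp_rw [this, sub_mul]
    rw [integral_sub (j σ) j2, integral_sub (iq σ) i2, a1, a2]
  have e3 : ∀ σ ∈ Ioc 0 ε, ‖(∫ x : ℝ, q x * ((b (x + σ) - b (x - σ) : ℝ) : ℂ)) + 2 * σ * ∫ x, (b x : ℂ) * q1 x‖ ≤ 2 * C * n1 b * ε ^ 2 := fun σ hσ => by
    rw [e2, ← integral_const_mul]
    have i2 := iq (-σ)
    simp only [sub_neg_eq_add] at i2
    have i3 : Integrable fun x : ℝ => (q ((x - σ : ℝ) : ℂ) - q ((x + σ : ℝ) : ℂ)) * (b x : ℂ) := by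
      simp_rw [sub_mul]; exact (iq σ).sub i2
    rw [← integral_add i3 (iq1.const_mul _)]
    have := norm_integral_le_of_norm_le (f := fun x : ℝ => (q ((x - σ : ℝ) : ℂ) - q ((x + σ : ℝ) : ℂ)) * (b x : ℂ) + 2 * σ * ((b x : ℂ) * q1 x))
      (hbi.abs.const_mul (2 * C * ε ^ 2)) (ae_of_all _ fun x => ?_)
    · rw [integral_const_mul] at this
      refine this.trans (le_of_eq ?_); unfold n1; ring
    · have : (q ((x - σ : ℝ) : ℂ) - q ((x + σ : ℝ) : ℂ)) * (b x : ℂ) + 2 * σ * ((b x : ℂ) * q1 x) = (q ((x - σ : ℝ) : ℂ) - q ((x + σ : ℝ) : ℂ) + 2 * σ * q1 x) * (b x : ℂ) := by ring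
      rw [this, norm_mul, norm_real, norm_eq_abs]
      refine mul_le_mul_of_nonneg_right ?_ (abs_nonneg _)
      let f : ℝ → ℂ := fun t => q ((x - t : ℝ) : ℂ) - q ((x + t : ℝ) : ℂ) + 2 * t * q1 x
      have df : ∀ t, HasDerivAt f (-(q1 (x - t) - q1 x) - (q1 (x + t) - q1 x)) t := fun t => by
        have d1 := (h.h1 (x - t)).scomp t ((hasDerivAt_id' t).const_sub x)
        have d2 := (h.h1 (x + t)).scomp t ((hasDerivAt_id' t).const_add x)
        have d3 : HasDerivAt (fun t : ℝ => 2 * (t : ℂ) * q1 x) (2 * 1 * q1 x) t :=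
          ((ofRealCLM.hasDerivAt (x := t)).const_mul (2 : ℂ)).mul_const _
        exact ((d1.sub d2).add d3).congr_deriv (by simp; ring)
      have fb := segbd (x := 0) (y := σ) (C := 2 * C * ε) df (fun t ht => by
        rw [uIcc_of_le hσ.1.le] at ht
        have s1 := segbd (x := x) (y := x - t) h.h2 (fun y _ => h.b2 y)
        have s2 := segbd (x := x) (y := x + t) h.h2 (fun y _ => h.b2 y)
        have t1 : |x - t - x| = t := by rw [sub_sub_cancel_left, abs_neg, abs_of_nonneg ht.1]
        have t2 : |x + t - x| = t := by rw [add_sub_cancel_left, abs_of_nonneg ht.1]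
        rw [t1] at s1; rw [t2] at s2
        refine (norm_sub_le _ _).trans ?_
        rw [norm_neg]
        have : C * t ≤ C * ε := by gcongr; linarith [ht.2, hσ.2]
        linarith)
      have f0 : f 0 = 0 := by simp [f]
      rw [f0, sub_zero, sub_zero, abs_of_pos hσ.1] at fb
      refine fb.trans ?_
      have : 2 * C * ε * σ ≤ 2 * C * ε * ε := by gcongr; exact hσ.2
      linarith
  rw [sw]
  have e4 : (ε : ℂ) ^ 2 * ∫ x, (b x : ℂ) * q1 x = ∫ σ in Ioc 0 ε, 2 * (σ : ℂ) * ∫ x, (b x : ℂ) * q1 x := by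
    rw [integral_mul_const, ← integral_of_le hε.le, intervalIntegral.integral_const_mul]
    rw [show (∫ σ in 0..ε, (σ : ℂ)) = ((∫ σ in 0..ε, σ : ℝ) : ℂ) from intervalIntegral.integral_ofReal, integral_id]
    push_cast; ring
  have hI := hP.integral_prod_right
  have hc4 : IntegrableOn (fun σ : ℝ => 2 * (σ : ℂ) * ∫ x, (b x : ℂ) * q1 x) (Ioc 0 ε) :=
    (by fun_prop : Continuous fun σ : ℝ => 2 * (σ : ℂ) * ∫ x, (b x : ℂ) * q1 x).integrableOn_Ioc
  rw [e4, ← integral_add hI hc4]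
  have := norm_setIntegral_le_of_norm_le_const (μ := volume) (s := Ioc 0 ε) (C := 2 * C * n1 b * ε ^ 2) (by simp) e3
  refine this.trans (le_of_eq ?_)
  simp [hε.le]; ring

end

def A2P (J b : ℝ → ℝ) : Prop := ∀ x ε : ℝ, 0 < ε → ∫ s, J s * kap ε (x - s) = π * ∫ σ in 0..ε, (b (x + σ) - b (x - σ))

lemma JI.intq (hJ : JI J) {f : ℝ → ℂ} (hf : Continuous f) (hb : ∀ s, ‖f s‖ ≤ C / (1 + |s|)) :
    Integrable fun s => (J s : ℂ) * f s := by
  refine hJ.int_of_le (C := C) ((continuous_ofReal.comp_aestronglyMeasurable hJ.aesm).mul hf.aestronglyMeasurable) fun s => ?_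
  rw [norm_mul, norm_real, norm_eq_abs]
  calc |J s| * ‖f s‖ ≤ |J s| * (C / (1 + |s|)) := by gcongr; exact hb s
    _ = _ := by ring

lemma QQ.core {q : ℂ → ℂ} {q1 q2 : ℝ → ℂ} (h : QQ C q q1 q2) (hJ : JI J) (hb : Bd M b) (hbi : Integrable b)
    (hA : A2P J b) : I * ∫ s : ℝ, (J s : ℂ) * q s = - ∫ s : ℝ, (b s : ℂ) * q1 s := by
  have hC := h.C0
  set nJ := ∫ s, |J s / (1 + |s|)| with hnJ
  have hq : Integrable fun s : ℝ => (J s : ℂ) * q s := hJ.intq h.cr (C := C) fun s => (h.br s).trans (by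
    gcongr
    have : 1 ≤ 1 + |s| := by linarith [abs_nonneg s]
    exact le_self_pow₀ this (by norm_num))
  have key : ∀ ε : ℝ, 0 < ε → ε ≤ 1 → ‖(I * ∫ s : ℝ, (J s : ℂ) * q s) + ∫ s : ℝ, (b s : ℂ) * q1 s‖ ≤ (2 * C * nJ + 2 * C * n1 b) * ε := by
    intro ε hε hε1
    obtain ⟨fi, fe⟩ := h.fub hJ hε
    have be := h.b_err hb hbi hε
    have he : ‖(∫ s, (J s : ℂ) * ∫ x : ℝ, q x * (hat ε (x - s) : ℂ)) - ε ^ 2 * ∫ s : ℝ, (J s : ℂ) * q s‖ ≤ 2 * C * ε ^ 3 * nJ := by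
      rw [← integral_const_mul, ← integral_sub fi (hq.const_mul _)]
      have := norm_integral_le_of_norm_le (f := fun s : ℝ => (J s : ℂ) * (∫ x : ℝ, q x * (hat ε (x - s) : ℂ)) - ε ^ 2 * ((J s : ℂ) * q s))
        (Integrable.const_mul (Integrable.abs hJ) (2 * C * ε ^ 3)) (ae_of_all _ fun s => ?_)
      · rwa [integral_const_mul] at this
      · have e : (J s : ℂ) * (∫ x : ℝ, q x * (hat ε (x - s) : ℂ)) - ε ^ 2 * ((J s : ℂ) * q s) = (J s : ℂ) * ((∫ x : ℝ, q x * (hat ε (x - s) : ℂ)) - ε ^ 2 * q s) := by ring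
        rw [e, norm_mul, norm_real, norm_eq_abs, abs_div, abs_of_pos (by positivity : 0 < 1 + |s|)]
        calc _ ≤ |J s| * (2 * C * ε ^ 3 / (1 + |s|)) := by gcongr; exact h.hat_err hε hε1 s
          _ = _ := by ring
    have e1 : ∫ x : ℝ, q x * ((∫ s, J s * kap ε (x - s) : ℝ) : ℂ) = π * ∫ x : ℝ, q x * ((∫ σ in 0..ε, (b (x + σ) - b (x - σ)) : ℝ) : ℂ) := by
      rw [← integral_const_mul]
      refine integral_congr_ae (ae_of_all _ fun x => ?_)
      simp only
      rw [hA x ε hε]; push_cast; ring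
    rw [e1] at fe
    have hpi : (π : ℂ) ≠ 0 := by exact_mod_cast pi_ne_zero
    have fe2 : ∫ x : ℝ, q x * ((∫ σ in 0..ε, (b (x + σ) - b (x - σ)) : ℝ) : ℂ) = I * ∫ s, (J s : ℂ) * ∫ x : ℝ, q x * (hat ε (x - s) : ℂ) := by
      apply mul_left_cancel₀ hpi; rw [fe]; ring
    rw [fe2] at be
    set U := ∫ s, (J s : ℂ) * ∫ x : ℝ, q x * (hat ε (x - s) : ℂ)
    set V := ∫ s : ℝ, (J s : ℂ) * q s
    set W := ∫ s : ℝ, (b s : ℂ) * q1 s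
    have e2 : (ε : ℂ) ^ 2 * (I * V + W) = (I * U + ε ^ 2 * W) - I * (U - ε ^ 2 * V) := by ring
    have e3 : ‖(ε : ℂ) ^ 2 * (I * V + W)‖ ≤ 2 * C * n1 b * ε ^ 3 + 2 * C * ε ^ 3 * nJ := by
      rw [e2]; refine (norm_sub_le _ _).trans ?_
      rw [norm_mul, norm_I, one_mul]
      exact add_le_add be he
    rw [norm_mul, norm_pow, norm_real, norm_of_nonneg hε.le] at e3
    have : ε ^ 2 * ‖I * V + W‖ ≤ ε ^ 2 * ((2 * C * nJ + 2 * C * n1 b) * ε) := by linarith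
    exact le_of_mul_le_mul_left this (by positivity)
  have hz : (I * ∫ s : ℝ, (J s : ℂ) * q s) + ∫ s : ℝ, (b s : ℂ) * q1 s = 0 := by
    rw [← norm_le_zero_iff]
    have t : Tendsto (fun ε : ℝ => (2 * C * nJ + 2 * C * n1 b) * ε) (𝓝[>] 0) (𝓝 0) := by
      have : Tendsto (fun ε : ℝ => (2 * C * nJ + 2 * C * n1 b) * ε) (𝓝 0) (𝓝 ((2 * C * nJ + 2 * C * n1 b) * 0)) := (by fun_prop : Continuous fun ε : ℝ => (2 * C * nJ + 2 * C * n1 b) * ε).tendsto 0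
      rw [mul_zero] at this
      exact this.mono_left nhdsWithin_le_nhds
    refine ge_of_tendsto t ?_
    filter_upwards [self_mem_nhdsWithin, (eventually_le_nhds (zero_lt_one' ℝ)).filter_mono nhdsWithin_le_nhds] with ε h1 h2
    exact key ε h1 h2
  exact eq_neg_of_add_eq_zero_left hz

lemma low (hc : c.im < 0) (hζ : 0 ≤ ζ.im) : 1 + ‖ζ‖ ≤ ((1 + ‖c‖) / (-c.im) + 1) * ‖ζ - c‖ := by
  have h1 : -c.im ≤ ‖ζ - c‖ := by
    have := im_le_norm (ζ - c); simp at this; linarith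
  have h2 : ‖ζ‖ ≤ ‖ζ - c‖ + ‖c‖ := by have := norm_add_le (ζ - c) c; simpa using this
  have : 1 + ‖c‖ ≤ (1 + ‖c‖) / (-c.im) * ‖ζ - c‖ := by
    rw [div_mul_eq_mul_div, le_div_iff₀ (by linarith)]; gcongr
  linarith

lemma low' (hc : c.im < 0) : ∃ m : ℝ, 0 < m ∧ ∀ ζ : ℂ, 0 ≤ ζ.im → ‖(ζ - c)⁻¹‖ ≤ m / (1 + ‖ζ‖) := by
  have hm : 0 < (1 + ‖c‖) / (-c.im) + 1 := by
    have : 0 < -c.im := by linarith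
    positivity
  refine ⟨_, hm, fun ζ hζ => ?_⟩
  have h := low hc hζ
  have hp : 0 < ‖ζ - c‖ := by
    by_contra! hh
    have : ‖ζ - c‖ = 0 := le_antisymm hh (norm_nonneg _)
    rw [this] at h; linarith [norm_nonneg ζ]
  rw [norm_inv, le_div_iff₀ (by positivity), inv_mul_le_iff₀ hp]; linarith

lemma lowne (hc : c.im < 0) (hζ : 0 ≤ ζ.im) : ζ - c ≠ 0 := fun h => by
  have := congrArg im h; simp at this; linarith

lemma inv_deriv (hc : c.im < 0) (n : ℕ) (x : ℝ) :
    HasDerivAt (fun x : ℝ => ((x : ℂ) - c)⁻¹ ^ n) (-(n : ℂ) * ((x : ℂ) - c)⁻¹ ^ (n + 1)) x := by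
  have h0 := lowne hc (ζ := (x : ℂ)) (by simp)
  have h1 : HasDerivAt (fun x : ℝ => (x : ℂ) - c) 1 x := (ofRealCLM.hasDerivAt (x := x)).sub_const c
  refine ((h1.fun_inv h0).fun_pow n).congr_deriv ?_
  rcases n with _ | n
  · simp
  · rw [Nat.add_sub_cancel, neg_div, one_div, ← inv_pow]; push_cast; ring

lemma A3 (hJ : JI J) (hb : Bd M b) (hbi : Integrable b)
    (hA : A2P J b) (hc : c.im < 0) :
    I * ∫ s : ℝ, (J s : ℂ) * ((s : ℂ) - c)⁻¹ = ∫ s : ℝ, (b s : ℂ) * ((s : ℂ) - c)⁻¹ ^ 2 := by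
  let F : ℂ → ℂ := fun c => ∫ s : ℝ, (J s : ℂ) * ((s : ℂ) - c)⁻¹
  let G : ℂ → ℂ := fun c => ∫ s : ℝ, (b s : ℂ) * ((s : ℂ) - c)⁻¹ ^ 2
  have ci : ∀ c : ℂ, c.im < 0 → Continuous fun s : ℝ => ((s : ℂ) - c)⁻¹ := fun c hc =>
    Continuous.inv₀ (by fun_prop) fun s => lowne hc (by simp)
  have iF : ∀ c : ℂ, c.im < 0 → Integrable fun s : ℝ => (J s : ℂ) * ((s : ℂ) - c)⁻¹ := fun c hc => by
    obtain ⟨m, _, hm⟩ := low' hc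
    exact hJ.intq (ci c hc) (C := m) fun s => by simpa using hm s (by simp)
  have nb : ∀ c : ℂ, c.im < 0 → ∀ s : ℝ, ‖((s : ℂ) - c)⁻¹‖ ≤ 1 / (-c.im) := fun c hc s => by
    rw [norm_inv, ← one_div]
    refine one_div_le_one_div_of_le (by linarith) ?_
    have := im_le_norm ((s : ℂ) - c); simpa using this
  have iG : ∀ c : ℂ, c.im < 0 → Integrable fun s : ℝ => (b s : ℂ) * ((s : ℂ) - c)⁻¹ ^ 2 := fun c hc => by
    have := (hbi.ofReal (𝕜 := ℂ)).bdd_mul (c := (1 / (-c.im)) ^ 2) ((ci c hc).pow 2).aestronglyMeasurable (ae_of_all _ fun s => by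
      rw [Pi.pow_apply, norm_pow]; exact pow_le_pow_left₀ (norm_nonneg _) (nb c hc s) 2)
    exact this.congr (ae_of_all _ fun x => by simp [mul_comm])
  have main : ∀ L : ℝ, 0 < L → I * (F c - 2 * F (c - I * L) + F (c - 2 * (I * L))) =
      G c - 2 * G (c - I * L) + G (c - 2 * (I * L)) := by
    intro L hL
    set c1 := c - I * L with hc1
    set c2 := c - 2 * (I * L) with hc2
    have i1 : c1.im < 0 := by simp [hc1]; linarith
    have i2 : c2.im < 0 := by simp [hc2]; linarith
    obtain ⟨m0, hm0, k0⟩ := low' hc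
    obtain ⟨m1, hm1, k1⟩ := low' i1
    obtain ⟨m2, hm2, k2⟩ := low' i2
    let q : ℂ → ℂ := fun ζ => (ζ - c)⁻¹ - 2 * (ζ - c1)⁻¹ + (ζ - c2)⁻¹
    let q1 : ℝ → ℂ := fun x => -((x : ℂ) - c)⁻¹ ^ 2 + 2 * ((x : ℂ) - c1)⁻¹ ^ 2 - ((x : ℂ) - c2)⁻¹ ^ 2
    let q2 : ℝ → ℂ := fun x => 2 * ((x : ℂ) - c)⁻¹ ^ 3 - 4 * ((x : ℂ) - c1)⁻¹ ^ 3 + 2 * ((x : ℂ) - c2)⁻¹ ^ 3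
    have real : ∀ {m : ℝ} {c : ℂ}, (∀ ζ : ℂ, 0 ≤ ζ.im → ‖(ζ - c)⁻¹‖ ≤ m / (1 + ‖ζ‖)) → ∀ x : ℝ, ‖((x : ℂ) - c)⁻¹‖ ≤ m / (1 + |x|) := fun k x => by
      simpa using k x (by simp)
    have real' : ∀ {m : ℝ} {c : ℂ}, 0 < m → (∀ ζ : ℂ, 0 ≤ ζ.im → ‖(ζ - c)⁻¹‖ ≤ m / (1 + ‖ζ‖)) → ∀ x : ℝ, ‖((x : ℂ) - c)⁻¹‖ ≤ m := fun hm k x =>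
      (real k x).trans (div_le_self hm.le (by linarith [abs_nonneg x]))
    have sq : ∀ {m : ℝ} {c : ℂ}, 0 < m → (∀ ζ : ℂ, 0 ≤ ζ.im → ‖(ζ - c)⁻¹‖ ≤ m / (1 + ‖ζ‖)) → ∀ x : ℝ, ‖((x : ℂ) - c)⁻¹ ^ 2‖ ≤ m ^ 2 / (1 + |x|) := fun {m c} hm k x => by
      rw [norm_pow, pow_two, pow_two, mul_div_assoc]
      exact mul_le_mul (real' hm k x) (real k x) (norm_nonneg _) hm.le
    have cu : ∀ {m : ℝ} {c : ℂ}, 0 < m → (∀ ζ : ℂ, 0 ≤ ζ.im → ‖(ζ - c)⁻¹‖ ≤ m / (1 + ‖ζ‖)) → ∀ x : ℝ, ‖((x : ℂ) - c)⁻¹ ^ 3‖ ≤ m ^ 3 := fun {m c} hm k x => by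
      rw [norm_pow]; exact pow_le_pow_left₀ (norm_nonneg _) (real' hm k x) 3
    have Q : QQ (2 * L ^ 2 * (m0 * m1 * m2) + (m0 ^ 2 + 2 * m1 ^ 2 + m2 ^ 2) + (2 * m0 ^ 3 + 4 * m1 ^ 3 + 2 * m2 ^ 3)) q q1 q2 := by
      have cz : ∀ c : ℂ, c.im < 0 → ContinuousOn (fun ζ => (ζ - c)⁻¹) {z : ℂ | 0 ≤ z.im} := fun c hc =>
        ContinuousOn.inv₀ (by fun_prop) fun ζ hζ => lowne hc hζ
      have dz : ∀ c : ℂ, c.im < 0 → DifferentiableOn ℂ (fun ζ => (ζ - c)⁻¹) {z : ℂ | 0 < z.im} := fun c hc =>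
        DifferentiableOn.inv (by fun_prop) fun ζ hζ => lowne hc (le_of_lt hζ)
      refine ⟨?_, ?_, ?_, ?_, ?_, ?_, ?_⟩
      · exact ((cz c hc).sub (continuousOn_const.mul (cz c1 i1))).add (cz c2 i2)
      · exact ((dz c hc).sub ((differentiableOn_const _).mul (dz c1 i1))).add (dz c2 i2)
      · intro ζ hζ
        have n0 := lowne hc hζ
        have n1' := lowne i1 hζ
        have n2 := lowne i2 hζ
        have e : q ζ = -(2 * (L : ℂ) ^ 2) * ((ζ - c)⁻¹ * (ζ - c1)⁻¹ * (ζ - c2)⁻¹) := by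
          simp only [q]
          field_simp
          rw [hc1, hc2]; ring_nf
          rw [I_sq]; ring
        rw [e, norm_mul, norm_mul, norm_mul, norm_neg, norm_mul, norm_pow, norm_real, norm_of_nonneg hL.le]
        have : ‖(ζ - c)⁻¹‖ * ‖(ζ - c1)⁻¹‖ * ‖(ζ - c2)⁻¹‖ ≤ m0 / (1 + ‖ζ‖) * (m1 / (1 + ‖ζ‖)) * (m2 / (1 + ‖ζ‖)) := by
          gcongr
          · exact k0 ζ hζ
          · exact k1 ζ hζ
          · exact k2 ζ hζ
        have e2 : ‖(2 : ℂ)‖ = 2 := by simp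
        rw [e2]
        calc _ ≤ 2 * L ^ 2 * (m0 / (1 + ‖ζ‖) * (m1 / (1 + ‖ζ‖)) * (m2 / (1 + ‖ζ‖))) := by gcongr
          _ = (2 * L ^ 2 * (m0 * m1 * m2)) / (1 + ‖ζ‖) ^ 3 := by field_simp
          _ ≤ _ := by
            gcongr
            have : 0 < (m0 ^ 2 + 2 * m1 ^ 2 + m2 ^ 2) + (2 * m0 ^ 3 + 4 * m1 ^ 3 + 2 * m2 ^ 3) := by positivity
            linarith
      · intro x
        have d : ∀ c : ℂ, c.im < 0 → HasDerivAt (fun x : ℝ => ((x : ℂ) - c)⁻¹) (-((x : ℂ) - c)⁻¹ ^ 2) x := fun c hc => by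
          have := inv_deriv hc 1 x; simpa using this
        exact (((d c hc).fun_sub ((d c1 i1).const_mul 2)).fun_add (d c2 i2)).congr_deriv (by simp only [q1]; ring)
      · intro x
        have d : ∀ c : ℂ, c.im < 0 → HasDerivAt (fun x : ℝ => ((x : ℂ) - c)⁻¹ ^ 2) (-2 * ((x : ℂ) - c)⁻¹ ^ 3) x := fun c hc => by
          have := inv_deriv hc 2 x; simpa using this
        exact (((d c hc).fun_neg.fun_add ((d c1 i1).const_mul 2)).fun_sub (d c2 i2)).congr_deriv (by simp only [q2]; ring)
      · intro x
        have : ‖q1 x‖ ≤ m0 ^ 2 / (1 + |x|) + 2 * (m1 ^ 2 / (1 + |x|)) + m2 ^ 2 / (1 + |x|) := by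
          refine (norm_sub_le _ _).trans (add_le_add ((norm_add_le _ _).trans (add_le_add ?_ ?_)) (sq hm2 k2 x))
          · rw [norm_neg]; exact sq hm0 k0 x
          · rw [norm_mul]; norm_num; have := sq hm1 k1 x; simpa using this
        refine this.trans ?_
        calc _ = (m0 ^ 2 + 2 * m1 ^ 2 + m2 ^ 2) / (1 + |x|) := by ring
          _ ≤ _ := by
            refine div_le_div_of_nonneg_right ?_ (by positivity)
            have : 0 < 2 * L ^ 2 * (m0 * m1 * m2) + (2 * m0 ^ 3 + 4 * m1 ^ 3 + 2 * m2 ^ 3) := by positivity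
            linarith
      · intro x
        have : ‖q2 x‖ ≤ 2 * m0 ^ 3 + 4 * m1 ^ 3 + 2 * m2 ^ 3 := by
          refine (norm_add_le _ _).trans (add_le_add ((norm_sub_le _ _).trans (add_le_add ?_ ?_)) ?_)
          · rw [norm_mul]; norm_num; have := cu hm0 k0 x; simpa using this
          · rw [norm_mul]; norm_num; have := cu hm1 k1 x; simpa using this
          · rw [norm_mul]; norm_num; have := cu hm2 k2 x; simpa using this
        have h2 : 0 < 2 * L ^ 2 * (m0 * m1 * m2) + (m0 ^ 2 + 2 * m1 ^ 2 + m2 ^ 2) := by positivity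
        linarith
    have co := Q.core hJ hb hbi hA
    have eF : ∫ s : ℝ, (J s : ℂ) * q s = F c - 2 * F c1 + F c2 := by
      have i3 := (iF c hc).sub ((iF c1 i1).const_mul 2)
      simp only [Pi.sub_def] at i3
      simp only [F]
      rw [← integral_const_mul, ← integral_sub (iF c hc) ((iF c1 i1).const_mul 2), ← integral_add i3 (iF c2 i2)]
      refine integral_congr_ae (ae_of_all _ fun s => ?_); simp only [q]; ring
    have eG : - ∫ s : ℝ, (b s : ℂ) * q1 s = G c - 2 * G c1 + G c2 := by
      have i3 := (iG c hc).sub ((iG c1 i1).const_mul 2)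
      simp only [Pi.sub_def] at i3
      simp only [G]
      rw [← integral_const_mul, ← integral_sub (iG c hc) ((iG c1 i1).const_mul 2), ← integral_add i3 (iG c2 i2), ← integral_neg]
      refine integral_congr_ae (ae_of_all _ fun s => ?_); simp only [q1]; ring
    rw [← eF, ← eG, co]
  have limI : ∀ k : ℝ, 0 < k → ∀ s : ℝ, Tendsto (fun L : ℝ => ((s : ℂ) - (c - k * (I * L)))⁻¹) atTop (𝓝 0) := fun k hk s => by
    rw [tendsto_zero_iff_norm_tendsto_zero]
    have t1 : Tendsto (fun L : ℝ => 1 / (k * L)) atTop (𝓝 0) := by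
      simp only [one_div]
      exact tendsto_inv_atTop_zero.comp (tendsto_id.const_mul_atTop hk)
    refine squeeze_zero' (Eventually.of_forall fun _ => norm_nonneg _) ?_ t1
    filter_upwards [eventually_gt_atTop 0] with L hL
    refine (nb _ (by simp; nlinarith) s).trans (one_div_le_one_div_of_le (by positivity) ?_)
    simp; linarith
  have dom : ∀ k : ℝ, 0 < k → ∀ L : ℝ, 0 < L → ∀ s : ℝ, ‖((s : ℂ) - (c - k * (I * L)))⁻¹‖ ≤ ‖((s : ℂ) - c)⁻¹‖ := fun k hk L hL s => by
    have hkL : 0 < k * L := by positivity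
    rw [norm_inv, norm_inv]
    have hp : 0 < ‖(s : ℂ) - c‖ := norm_pos_iff.mpr (lowne hc (by simp))
    refine inv_anti₀ hp ?_
    rw [Complex.norm_def, Complex.norm_def]
    refine Real.sqrt_le_sqrt ?_
    simp [normSq_apply]
    nlinarith
  have tF : ∀ k : ℝ, 0 < k → Tendsto (fun L : ℝ => F (c - k * (I * L))) atTop (𝓝 0) := fun k hk => by
    have : (0 : ℂ) = ∫ s : ℝ, (J s : ℂ) * 0 := by simp
    rw [this]
    refine tendsto_integral_filter_of_dominated_convergence (fun s => ‖(J s : ℂ) * ((s : ℂ) - c)⁻¹‖) ?_ ?_ (iF c hc).norm ?_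
    · filter_upwards [eventually_gt_atTop 0] with L hL
      exact (iF _ (by simp; nlinarith)).aestronglyMeasurable
    · filter_upwards [eventually_gt_atTop 0] with L hL
      refine ae_of_all _ fun s => ?_
      rw [norm_mul, norm_mul]; gcongr; exact dom k hk L hL s
    · exact ae_of_all _ fun s => (limI k hk s).const_mul _
  have tG : ∀ k : ℝ, 0 < k → Tendsto (fun L : ℝ => G (c - k * (I * L))) atTop (𝓝 0) := fun k hk => by
    have : (0 : ℂ) = ∫ s : ℝ, (b s : ℂ) * 0 ^ 2 := by simp
    rw [this]
    refine tendsto_integral_filter_of_dominated_convergence (fun s => ‖(b s : ℂ) * ((s : ℂ) - c)⁻¹ ^ 2‖) ?_ ?_ (iG c hc).norm ?_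
    · filter_upwards [eventually_gt_atTop 0] with L hL
      exact (iG _ (by simp; nlinarith)).aestronglyMeasurable
    · filter_upwards [eventually_gt_atTop 0] with L hL
      refine ae_of_all _ fun s => ?_
      rw [norm_mul, norm_mul, norm_pow, norm_pow]; gcongr; exact dom k hk L hL s
    · exact ae_of_all _ fun s => ((limI k hk s).pow 2).const_mul _
  have tF1 := tF 1 one_pos
  have tF2 := tF 2 two_pos
  have tG1 := tG 1 one_pos
  have tG2 := tG 2 two_pos
  push_cast at tF1 tF2 tG1 tG2
  simp only [one_mul] at tF1 tG1
  have lim1 := ((tendsto_const_nhds (x := F c)).sub (tF1.const_mul 2)).add tF2 |>.const_mul I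
  have lim2 := ((tendsto_const_nhds (x := G c)).sub (tG1.const_mul 2)).add tG2
  have := tendsto_nhds_unique (lim1.congr' (by filter_upwards [eventually_gt_atTop 0] with L hL using main L hL)) lim2
  simp only [mul_zero, sub_zero, add_zero] at this
  exact this

lemma F_eq_g (hJ : JI J) (hb : Bd M b) (hbi : Integrable b)
    (hA : A2P J b) (hz : 0 < z.im) :
    gC b z = (1 / π : ℂ) * ∫ s : ℝ, (J s : ℂ) * (z - s)⁻¹ := by
  have h := congrArg (starRingEnd ℂ) (A3 hJ hb hbi hA (c := (starRingEnd ℂ) z) (by simpa using hz))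
  rw [map_mul, ← integral_conj, ← integral_conj] at h
  simp only [map_mul, map_pow, map_inv₀, map_sub, Complex.conj_conj, Complex.conj_ofReal, Complex.conj_I] at h
  have e1 : ∫ s : ℝ, (J s : ℂ) * (z - s)⁻¹ = - ∫ s : ℝ, (J s : ℂ) * ((s : ℂ) - z)⁻¹ := by
    rw [← integral_neg]; refine integral_congr_ae (ae_of_all _ fun s => ?_)
    simp only
    rw [← neg_sub, inv_neg]; ring
  have e2 : ∫ s : ℝ, (b s : ℂ) / (z - s) ^ 2 = ∫ s : ℝ, (b s : ℂ) * ((s : ℂ) - z)⁻¹ ^ 2 := by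
    refine integral_congr_ae (ae_of_all _ fun s => ?_)
    simp only
    rw [← neg_sub, neg_sq, div_eq_mul_inv, inv_pow]
  unfold gC
  rw [e1, e2, ← h]
  have := Complex.I_mul_I
  linear_combination ((1 / (π : ℂ)) * ∫ s : ℝ, (J s : ℂ) * ((s : ℂ) - z)⁻¹) * this

def Rk (v r : ℝ) : ℝ := (r ^ 2 - v ^ 2) / (r ^ 2 + v ^ 2) ^ 2

def Ik (v r : ℝ) : ℝ := r * v / (r ^ 2 + v ^ 2) ^ 2

lemma lor_pos (hv : 0 < v) (r : ℝ) : 0 < r ^ 2 + v ^ 2 := by positivity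

lemma Rk_cont (hv : 0 < v) : Continuous (Rk v) :=
  Continuous.div (by fun_prop) (by fun_prop) fun r => by have := lor_pos hv r; positivity

lemma Ik_cont (hv : 0 < v) : Continuous (Ik v) :=
  Continuous.div (by fun_prop) (by fun_prop) fun r => by have := lor_pos hv r; positivity

lemma Rk_le (hv : 0 < v) (r : ℝ) : |Rk v r| ≤ (r ^ 2 + v ^ 2)⁻¹ := by
  have := lor_pos hv r
  rw [Rk, abs_div, abs_of_pos (by positivity : 0 < (r ^ 2 + v ^ 2) ^ 2), div_le_iff₀ (by positivity), pow_two (r ^ 2 + v ^ 2), ← mul_assoc, inv_mul_cancel₀ this.ne', one_mul, abs_le]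
  constructor <;> nlinarith [sq_nonneg r, sq_nonneg v]

lemma Ik_le (hv : 0 < v) (r : ℝ) : |Ik v r| ≤ (r ^ 2 + v ^ 2)⁻¹ := by
  have := lor_pos hv r
  rw [Ik, abs_div, abs_of_pos (by positivity : 0 < (r ^ 2 + v ^ 2) ^ 2), div_le_iff₀ (by positivity), pow_two (r ^ 2 + v ^ 2), ← mul_assoc, inv_mul_cancel₀ this.ne', one_mul, abs_le]
  constructor <;> nlinarith [sq_nonneg (r - v), sq_nonneg (r + v)]

lemma lor0 (hv : 0 < v) : Integrable fun r : ℝ => (r ^ 2 + v ^ 2)⁻¹ := by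
  simpa using integrable_lor 0 hv

lemma lor0_int (hv : 0 < v) : ∫ r : ℝ, (r ^ 2 + v ^ 2)⁻¹ = π / v := by
  simpa using integral_lor 0 hv

lemma Rk_int (hv : 0 < v) : Integrable (Rk v) :=
  (lor0 hv).mono' (Rk_cont hv).aestronglyMeasurable (ae_of_all _ (Rk_le hv))

lemma Ik_int (hv : 0 < v) : Integrable (Ik v) :=
  (lor0 hv).mono' (Ik_cont hv).aestronglyMeasurable (ae_of_all _ (Ik_le hv))

lemma Rk_zero (hv : 0 < v) : ∫ r, Rk v r = 0 := by
  have hd : ∀ r, HasDerivAt (fun r : ℝ => -r / (r ^ 2 + v ^ 2)) (Rk v r) r := fun r => by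
    have := lor_pos hv r
    refine (((hasDerivAt_id' r).fun_neg).fun_div (((hasDerivAt_id' r).fun_pow 2).add_const (v ^ 2)) this.ne').congr_deriv ?_
    rw [Rk]; congr 1; simp; ring
  have ht : Tendsto (fun r : ℝ => -r / (r ^ 2 + v ^ 2)) (cocompact ℝ) (𝓝 0) := by
    have h1 : Tendsto (fun r : ℝ => ‖r‖⁻¹) (cocompact ℝ) (𝓝 0) := tendsto_inv_atTop_zero.comp (tendsto_norm_cocompact_atTop)
    refine squeeze_zero_norm (fun r => ?_) h1
    have := lor_pos hv r
    rw [norm_div, norm_neg, norm_of_nonneg this.le]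
    rcases eq_or_ne r 0 with h | h
    · simp [h]
    · have h' : 0 < ‖r‖ := norm_pos_iff.mpr h
      rw [div_le_iff₀ this, ← div_eq_inv_mul, le_div_iff₀ h', norm_eq_abs, abs_mul_abs_self]
      nlinarith
  rw [← Metric.cobounded_eq_cocompact] at ht
  rw [Real.cobounded_eq] at ht
  have := integral_of_hasDerivAt_of_tendsto hd (Rk_int hv) (ht.mono_left le_sup_left) (ht.mono_left le_sup_right)
  simpa using this

lemma bmul_int (h : Bd M b) (hk : Integrable k) (x : ℝ) :
    Integrable (fun r => b (x - r) * k r) ∧ Integrable (fun r => b (x + r) * k r) :=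
  ⟨hk.bdd_mul (c := M) ((h.c.comp (by fun_prop)).aestronglyMeasurable) (ae_of_all _ fun r => h.le _),
   hk.bdd_mul (c := M) ((h.c.comp (by fun_prop)).aestronglyMeasurable) (ae_of_all _ fun r => h.le _)⟩

lemma g_eq (h : Bd M b) (x : ℝ) (hv : 0 < v) :
    gC b (x + v * I) = (((1 / π) * ∫ r, (b (x + r) - b (x - r)) * Ik v r : ℝ) : ℂ) +
      (((1 / (2 * π)) * ∫ r, D2 b r x * Rk v r : ℝ) : ℂ) * I := by
  obtain ⟨r1, r2⟩ := bmul_int h (Rk_int hv) x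
  obtain ⟨i1, i2⟩ := bmul_int h (Ik_int hv) x
  have e0 : ∫ s : ℝ, (b s : ℂ) / ((x + v * I) - s) ^ 2 =
      ((∫ r, b (x - r) * Rk v r : ℝ) : ℂ) - 2 * ((∫ r, b (x - r) * Ik v r : ℝ) : ℂ) * I := by
    rw [← integral_sub_left_eq_self (fun s : ℝ => (b s : ℂ) / ((x + v * I) - s) ^ 2) volume x, ← integral_complex_ofReal, ← integral_complex_ofReal, mul_comm (2 : ℂ), mul_assoc, mul_comm _ (2 * I), ← integral_const_mul,
      ← integral_sub r1.ofReal (i1.ofReal.const_mul _)]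
    refine integral_congr_ae (ae_of_all _ fun r => ?_)
    have hp := (lor_pos hv r).ne'
    have e : ((x : ℂ) + v * I - ((x - r : ℝ) : ℂ)) = (r + v * I) := by push_cast; ring
    have ec : ((r : ℂ) + v * I) * (r - v * I) = ((r ^ 2 + v ^ 2 : ℝ) : ℂ) := by
      push_cast; ring_nf; rw [I_sq]; ring
    have hpc : ((r ^ 2 + v ^ 2 : ℝ) : ℂ) ≠ 0 := by exact_mod_cast hp
    have hn : ((r : ℂ) + v * I) ≠ 0 := fun hh => by rw [hh, zero_mul] at ec; exact hpc ec.symm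
    have e3 : ((((r : ℂ) + v * I)) ^ 2)⁻¹ = (Rk v r : ℂ) - 2 * I * (Ik v r : ℂ) := by
      rw [inv_eq_iff_eq_inv, ← one_div, eq_div_iff (by
        intro h0
        have : ((Rk v r : ℂ) - 2 * I * (Ik v r : ℂ)) * ((r : ℂ) + v * I) ^ 2 = 1 := by
          have : (Rk v r : ℂ) - 2 * I * (Ik v r : ℂ) = ((r : ℂ) - v * I) ^ 2 / ((r ^ 2 + v ^ 2 : ℝ) : ℂ) ^ 2 := by
            rw [Rk, Ik]; push_cast; rw [← mul_div_assoc, ← sub_div]; congr 1; ring_nf; rw [I_sq]; ring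
          rw [this, div_mul_eq_mul_div, ← mul_pow, mul_comm, ec, div_self (pow_ne_zero 2 hpc)]
        rw [h0, zero_mul] at this; exact zero_ne_one this)]
      have : (Rk v r : ℂ) - 2 * I * (Ik v r : ℂ) = ((r : ℂ) - v * I) ^ 2 / ((r ^ 2 + v ^ 2 : ℝ) : ℂ) ^ 2 := by
        rw [Rk, Ik]; push_cast; rw [← mul_div_assoc, ← sub_div]; congr 1; ring_nf; rw [I_sq]; ring
      rw [this, ← mul_div_assoc, ← mul_pow, ec, div_self (pow_ne_zero 2 hpc)]
    simp only [e]
    rw [div_eq_mul_inv, e3]; push_cast; ring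
  have f1 : ∫ r, b (x + r) * Ik v r = - ∫ r, b (x - r) * Ik v r := by
    rw [← integral_neg_eq_self, ← integral_neg]
    refine integral_congr_ae (ae_of_all _ fun r => ?_)
    simp only [Ik]; rw [← sub_eq_add_neg]; ring_nf
  have f2 : ∫ r, b (x + r) * Rk v r = ∫ r, b (x - r) * Rk v r := by
    rw [← integral_neg_eq_self]
    refine integral_congr_ae (ae_of_all _ fun r => ?_)
    simp only [Rk]; rw [← sub_eq_add_neg]; ring_nf
  have h1 : ∫ r, (b (x + r) - b (x - r)) * Ik v r = -2 * ∫ r, b (x - r) * Ik v r := by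
    simp only [sub_mul]; rw [integral_sub i2 i1, f1]; ring
  have h2 : ∫ r, D2 b r x * Rk v r = -2 * ∫ r, b (x - r) * Rk v r := by
    have i3 := ((Rk_int hv).const_mul (2 * b x)).sub r2
    simp only [Pi.sub_def] at i3
    simp only [D2, sub_mul]; rw [integral_sub i3 r1, integral_sub ((Rk_int hv).const_mul _) r2, integral_const_mul, Rk_zero hv, f2]; ring
  rw [gC, e0, h1, h2]
  push_cast
  have hpi : (π : ℂ) ≠ 0 := by exact_mod_cast pi_ne_zero
  field_simp
  ring_nf; rw [I_sq]; ring

lemma min_lor (r : ℝ) : r ^ 2 / (1 + r ^ 2) * (r ^ 2 + v ^ 2)⁻¹ ≤ (1 + r ^ 2)⁻¹ := by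
  rw [div_mul_eq_mul_div, div_eq_mul_inv]
  refine mul_le_of_le_one_left (by positivity) ?_
  rw [← div_eq_mul_inv]
  exact div_le_one_of_le₀ (by nlinarith [sq_nonneg v]) (by positivity)

lemma reg_bd (h1 : ∀ r, |b (x + r) - b (x - r)| ≤ C1 * |r|) (hv : 0 < v) :
    |(1 / π) * ∫ r, (b (x + r) - b (x - r)) * Ik v r| ≤ C1 := by
  have hC : 0 ≤ C1 := by have := (abs_nonneg _).trans (h1 1); simpa using this
  rw [abs_mul, abs_of_pos (by positivity : 0 < 1 / π), one_div, inv_mul_le_iff₀ pi_pos]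
  have := norm_integral_le_of_norm_le (f := fun r => (b (x + r) - b (x - r)) * Ik v r) ((lor0 hv).const_mul (C1 * v)) (ae_of_all _ fun r => ?_)
  · rw [integral_const_mul, lor0_int hv] at this
    rw [norm_eq_abs] at this
    refine this.trans (le_of_eq ?_); field_simp
  · have hp := lor_pos hv r
    rw [norm_mul, norm_eq_abs, norm_eq_abs]
    calc _ ≤ C1 * |r| * |Ik v r| := by gcongr; exact h1 r
      _ = C1 * v * ((r ^ 2) / (r ^ 2 + v ^ 2) ^ 2) := by
        rw [Ik, abs_div, abs_of_pos (by positivity : 0 < (r ^ 2 + v ^ 2) ^ 2), abs_mul, abs_of_pos hv, ← sq_abs r]; ring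
      _ ≤ _ := by
        gcongr
        rw [div_le_iff₀ (by positivity), pow_two (r ^ 2 + v ^ 2), ← mul_assoc, inv_mul_cancel₀ hp.ne']; nlinarith

lemma img_bd (h2 : ∀ r, |D2 b r x| ≤ C2 * (r ^ 2 / (1 + r ^ 2))) (hv : 0 < v) :
    |(1 / (2 * π)) * ∫ r, D2 b r x * Rk v r| ≤ C2 := by
  have hC : 0 ≤ C2 := by
    have := (abs_nonneg _).trans (h2 1); norm_num at this; linarith
  rw [abs_mul, abs_of_pos (by positivity : 0 < 1 / (2 * π)), one_div, inv_mul_le_iff₀ (by positivity)]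
  have := norm_integral_le_of_norm_le (f := fun r => D2 b r x * Rk v r) (integrable_inv_one_add_sq.const_mul C2) (ae_of_all _ fun r => ?_)
  · rw [integral_const_mul, integral_univ_inv_one_add_sq, norm_eq_abs] at this
    refine this.trans ?_; nlinarith [pi_pos, mul_nonneg hC pi_pos.le]
  · rw [norm_mul, norm_eq_abs, norm_eq_abs]
    calc _ ≤ C2 * (r ^ 2 / (1 + r ^ 2)) * (r ^ 2 + v ^ 2)⁻¹ := by
          gcongr
          · exact h2 r
          · exact Rk_le hv r
      _ ≤ _ := by rw [mul_assoc]; exact mul_le_mul_of_nonneg_left (min_lor r) hC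

lemma g_bd (h : Bd M b) (h1 : ∀ r, |b (x + r) - b (x - r)| ≤ C1 * |r|)
    (h2 : ∀ r, |D2 b r x| ≤ C2 * (r ^ 2 / (1 + r ^ 2))) (hv : 0 < v) : ‖gC b (x + v * I)‖ ≤ C1 + C2 := by
  rw [g_eq h x hv]
  refine (norm_add_le _ _).trans (add_le_add ?_ ?_)
  · rw [norm_real]; exact reg_bd h1 hv
  · rw [norm_mul, norm_I, mul_one, norm_real]; exact img_bd h2 hv

lemma re_lim (h : Bd M b) {b' : ℝ} (h1 : ∀ r, |b (x + r) - b (x - r)| ≤ C1 * |r|)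
    (hd : HasDerivAt b b' x) : Tendsto (fun v : ℝ => (gC b (x + v * I)).re) (𝓝[>] 0) (𝓝 b') := by
  have hC : 0 ≤ C1 := by have := (abs_nonneg _).trans (h1 1); simpa using this
  have e1 : ∀ v : ℝ, 0 < v → (gC b (x + v * I)).re = (1 / π) * ∫ σ, ((b (x + v * σ) - b (x - v * σ)) / v) * Ik 1 σ := by
    intro v hv
    rw [g_eq h x hv]
    simp only [Complex.add_re, ofReal_re, mul_re, I_re, I_im, ofReal_im, mul_zero, zero_mul, sub_zero, add_zero]
    congr 1
    have := Measure.integral_comp_mul_left (fun r => (b (x + r) - b (x - r)) * Ik v r) v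
    rw [abs_of_pos (inv_pos.mpr hv), smul_eq_mul, ← div_eq_inv_mul, eq_div_iff hv.ne'] at this
    rw [← this, ← integral_mul_const]
    refine integral_congr_ae (ae_of_all _ fun σ => ?_)
    have := lor_pos one_pos σ
    have e : (v * σ) ^ 2 + v ^ 2 = v ^ 2 * (σ ^ 2 + 1 ^ 2) := by ring
    simp only [Ik]; rw [e]; field_simp
  have eI : ∀ σ : ℝ, σ * Ik 1 σ = (1 / 2) * ((1 + σ ^ 2)⁻¹ + Rk 1 σ) := fun σ => by
    have := lor_pos one_pos σ
    have e : (1 + σ ^ 2) = σ ^ 2 + 1 ^ 2 := by ring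
    rw [Ik, Rk, e]; field_simp; ring
  have iI : Integrable fun σ : ℝ => σ * Ik 1 σ := by
    simp only [eI]; exact (integrable_inv_one_add_sq.fun_add (Rk_int one_pos)).const_mul _
  have vI : ∫ σ : ℝ, σ * Ik 1 σ = π / 2 := by
    simp only [eI]; rw [integral_const_mul, integral_add integrable_inv_one_add_sq (Rk_int one_pos), Rk_zero one_pos, integral_univ_inv_one_add_sq]; ring
  have t : Tendsto (fun v : ℝ => (1 / π) * ∫ σ, ((b (x + v * σ) - b (x - v * σ)) / v) * Ik 1 σ) (𝓝[>] 0) (𝓝 ((1 / π) * ∫ σ : ℝ, (2 * b') * (σ * Ik 1 σ))) := by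
    refine Tendsto.const_mul _ (tendsto_integral_filter_of_dominated_convergence (fun σ => C1 * (σ * Ik 1 σ)) ?_ ?_ (iI.const_mul _) ?_)
    · refine Eventually.of_forall fun v => Continuous.aestronglyMeasurable ?_
      have c := Ik_cont one_pos
      have c2 := h.c
      fun_prop
    · filter_upwards [self_mem_nhdsWithin] with v hv
      have hv : 0 < v := hv
      refine ae_of_all _ fun σ => ?_
      have : σ * Ik 1 σ = |σ| * |Ik 1 σ| := by
        rw [← abs_mul, abs_of_nonneg]; rw [Ik, mul_one, ← mul_div_assoc, ← pow_two]; positivity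
      rw [this, norm_mul, ← mul_assoc, norm_eq_abs, norm_eq_abs]
      gcongr
      rw [abs_div, abs_of_pos hv, div_le_iff₀ hv]
      have := h1 (v * σ); rw [abs_mul, abs_of_pos hv] at this; linarith
    · refine ae_of_all _ fun σ => ?_
      have d1 : HasDerivAt (fun v : ℝ => b (x + v * σ) - b (x - v * σ)) (2 * b' * σ) 0 := by
        have a1 : HasDerivAt (fun v : ℝ => x + v * σ) σ 0 := by simpa using ((hasDerivAt_id' (0:ℝ)).mul_const σ).const_add x
        have a2 : HasDerivAt (fun v : ℝ => x - v * σ) (-σ) 0 := by simpa using ((hasDerivAt_id' (0:ℝ)).mul_const σ).const_sub x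
        have b1 := HasDerivAt.comp (h₂ := b) (h₂' := b') 0 (by simpa using hd) a1
        have b2 := HasDerivAt.comp (h₂ := b) (h₂' := b') 0 (by simpa using hd) a2
        exact (b1.fun_sub b2).congr_deriv (by ring)
      have := (hasDerivAt_iff_tendsto_slope_zero.mp d1).mono_left (nhdsWithin_mono 0 (fun a (ha : 0 < a) => ne_of_gt ha) : 𝓝[>] (0:ℝ) ≤ 𝓝[≠] 0)
      have t2 := this.mul_const (Ik 1 σ)
      rw [mul_assoc] at t2
      refine t2.congr fun v => ?_
      simp; left; ring
  rw [integral_const_mul, vI] at t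
  have e : 1 / π * (2 * b' * (π / 2)) = b' := by field_simp
  rw [e] at t
  exact t.congr' (by filter_upwards [self_mem_nhdsWithin] with v hv using (e1 v hv).symm)

def Pk (ε u : ℝ) : ℝ := ε / π * (u ^ 2 + ε ^ 2)⁻¹

lemma Pk_cont (hε : 0 < ε) : Continuous (Pk ε) :=
  continuous_const.mul (Continuous.inv₀ (by fun_prop) fun u => (lor_pos hε u).ne')

lemma Pk_nonneg (hε : 0 < ε) (u : ℝ) : 0 ≤ Pk ε u := by unfold Pk; positivity

lemma Pk_int (hε : 0 < ε) : Integrable (Pk ε) := (lor0 hε).const_mul _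

lemma Pk_one (hε : 0 < ε) : ∫ u, Pk ε u = 1 := by
  unfold Pk; rw [integral_const_mul, lor0_int hε]; field_simp

lemma Pk_u (hε : 0 < ε) (u : ℝ) : Pk ε u * |u| ≤ 1 := by
  have := lor_pos hε u
  unfold Pk
  rw [div_mul_eq_mul_div, div_mul_eq_mul_div, div_le_one pi_pos, mul_assoc, mul_comm, mul_assoc, inv_mul_le_iff₀ this]
  have := pi_gt_three
  have h2 : u ^ 2 = |u| ^ 2 := (sq_abs u).symm
  nlinarith [sq_nonneg (|u| - ε), abs_nonneg u]

lemma im_eq (hJ : JI J) (hF : ∀ z : ℂ, 0 < z.im → gC b z = (1 / π : ℂ) * ∫ s : ℝ, (J s : ℂ) * (z - s)⁻¹)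
    (x : ℝ) (hε : 0 < ε) : (gC b (x + ε * I)).im = - ∫ s, J s * Pk ε (x - s) := by
  have hz : 0 < ((x : ℂ) + ε * I).im := by rwa [line_im]
  have hi : Integrable fun s : ℝ => (J s : ℂ) * ((x : ℂ) + ε * I - s)⁻¹ := by
    obtain ⟨m, _, hm⟩ := low' (c := (starRingEnd ℂ) ((x : ℂ) + ε * I)) (by simpa using hε)
    refine hJ.intq (C := m) (Continuous.inv₀ (by fun_prop) fun s => sub_ne hz s) fun s => ?_
    have := hm s (by simp)
    rw [← Complex.norm_conj, map_inv₀, map_sub, Complex.conj_conj, Complex.conj_ofReal, ← neg_sub, inv_neg, norm_neg] at this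
    simpa using this
  rw [hF _ hz, (by push_cast; rfl : (1 / π : ℂ) = ((1 / π : ℝ) : ℂ)), im_ofReal_mul]
  have : (∫ s : ℝ, (J s : ℂ) * ((x : ℂ) + ε * I - s)⁻¹).im = ∫ s : ℝ, ((J s : ℂ) * ((x : ℂ) + ε * I - s)⁻¹).im :=
    (integral_im hi).symm
  rw [this, ← integral_const_mul, ← integral_neg]
  refine integral_congr_ae (ae_of_all _ fun s => ?_)
  simp only [im_ofReal_mul, inv_im, Pk]
  have e : Complex.normSq ((x : ℂ) + ε * I - s) = (x - s) ^ 2 + ε ^ 2 := by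
    simp [normSq_apply]; ring
  rw [e]; simp; ring

lemma im_lim (hJ : JI J) (hF : ∀ z : ℂ, 0 < z.im → gC b z = (1 / π : ℂ) * ∫ s : ℝ, (J s : ℂ) * (z - s)⁻¹)
    {φ : ℝ → ℝ} (hφ : Continuous φ) (hs : ∀ x, φ x ≠ 0 → |x| ≤ R) (hm : ∀ x, |φ x| ≤ m) (hi : Integrable φ) :
    Tendsto (fun ε : ℝ => ∫ x : ℝ, φ x * (gC b (x + ε * I)).im) (𝓝[>] 0) (𝓝 (- ∫ x, φ x * J x)) := by
  have hm0 : 0 ≤ m := (abs_nonneg _).trans (hm 0)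
  have key : ∀ ε : ℝ, 0 < ε → ∀ x s : ℝ, (1 + |s|) * (Pk ε (x - s) * |φ x|) ≤ (1 + |R|) * m * Pk ε (x - s) + |φ x| := by
    intro ε hε x s
    rcases eq_or_ne (φ x) 0 with h | h
    · rw [h]; simp; have := Pk_nonneg hε (x - s); positivity
    · have h1 : 1 + |s| ≤ (1 + |R|) + |x - s| := by
        have := hs x h; have h3 := abs_sub_abs_le_abs_sub s x; rw [abs_sub_comm s x] at h3; linarith [le_abs_self R]
      have h2 := Pk_u hε (x - s)
      have h3 := Pk_nonneg hε (x - s)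
      calc (1 + |s|) * (Pk ε (x - s) * |φ x|) ≤ ((1 + |R|) + |x - s|) * (Pk ε (x - s) * |φ x|) := by gcongr
        _ = (1 + |R|) * |φ x| * Pk ε (x - s) + (Pk ε (x - s) * |x - s|) * |φ x| := by ring
        _ ≤ _ := add_le_add (by gcongr; exact hm x) (mul_le_of_le_one_left (abs_nonneg _) h2)
  have e1 : ∀ ε : ℝ, 0 < ε → ∫ x : ℝ, φ x * (gC b (x + ε * I)).im = - ∫ s, J s * ∫ x, φ x * Pk ε (x - s) := by
    intro ε hε
    have hPb : ∀ u, Pk ε u ≤ 1 / ε := fun u => by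
      unfold Pk
      have : (u ^ 2 + ε ^ 2)⁻¹ ≤ (ε ^ 2)⁻¹ := inv_anti₀ (by positivity) (by nlinarith [sq_nonneg u])
      calc _ ≤ ε / 1 * (ε ^ 2)⁻¹ := by
            gcongr; linarith [pi_gt_three]
        _ = _ := by field_simp
    have hprod : Integrable (Function.uncurry fun x s => φ x * (J s * Pk ε (x - s))) (volume.prod volume) := by
      have hp := (hi.abs.mul_prod hJ.abs).const_mul ((1 + |R|) * (1 / ε) + 1)
      refine hp.mono' ?_ (ae_of_all _ fun p => ?_)
      · have c := Pk_cont hε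
        exact (hφ.aestronglyMeasurable.comp_fst).mul ((hJ.aesm.comp_snd).mul (Continuous.aestronglyMeasurable (by fun_prop)))
      · simp only [Function.uncurry]
        rw [norm_mul, norm_mul, norm_eq_abs, norm_eq_abs, norm_of_nonneg (Pk_nonneg hε _), abs_div, abs_of_pos (by positivity : 0 < 1 + |p.2|)]
        rcases eq_or_ne (φ p.1) 0 with h | h
        · simp [h]
        have h1 : 1 + |p.2| ≤ (1 + |R|) + |p.1 - p.2| := by
          have := hs _ h; have h3 := abs_sub_abs_le_abs_sub p.2 p.1; rw [abs_sub_comm p.2 p.1] at h3; linarith [le_abs_self R]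
        have h2 := Pk_u hε (p.1 - p.2)
        have h3 := Pk_nonneg hε (p.1 - p.2)
        have h4 : Pk ε (p.1 - p.2) * (1 + |p.2|) ≤ (1 + |R|) * (1 / ε) + 1 := by
          calc _ ≤ Pk ε (p.1 - p.2) * ((1 + |R|) + |p.1 - p.2|) := by gcongr
            _ = (1 + |R|) * Pk ε (p.1 - p.2) + Pk ε (p.1 - p.2) * |p.1 - p.2| := by ring
            _ ≤ _ := by gcongr; exact hPb _
        calc _ = |φ p.1| * (|J p.2| / (1 + |p.2|)) * (Pk ε (p.1 - p.2) * (1 + |p.2|)) := by field_simp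
          _ ≤ |φ p.1| * (|J p.2| / (1 + |p.2|)) * ((1 + |R|) * (1 / ε) + 1) := by gcongr
          _ = _ := by ring
    calc _ = ∫ x : ℝ, -∫ s, φ x * (J s * Pk ε (x - s)) := by
          refine integral_congr_ae (ae_of_all _ fun x => ?_)
          simp only; rw [im_eq hJ hF x hε, integral_const_mul]; ring
      _ = - ∫ s, ∫ x, φ x * (J s * Pk ε (x - s)) := by rw [integral_neg, integral_integral_swap hprod]
      _ = _ := by
        congr 1; refine integral_congr_ae (ae_of_all _ fun s => ?_)
        simp only; rw [← integral_const_mul]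
        exact integral_congr_ae (ae_of_all _ fun x => by ring)
  have e2 : ∀ ε : ℝ, 0 < ε → ∀ s, ∫ x, φ x * Pk ε (x - s) = ∫ σ, φ (s + ε * σ) * Pk 1 σ := by
    intro ε hε s
    rw [← integral_add_left_eq_self (fun x => φ x * Pk ε (x - s)) s]
    have := Measure.integral_comp_mul_left (fun x => φ (s + x) * Pk ε (s + x - s)) ε
    rw [abs_of_pos (inv_pos.mpr hε), smul_eq_mul, ← div_eq_inv_mul, eq_div_iff hε.ne'] at this
    rw [← this, ← integral_mul_const]
    refine integral_congr_ae (ae_of_all _ fun σ => ?_)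
    have := lor_pos one_pos σ
    have e : (s + ε * σ - s) ^ 2 + ε ^ 2 = ε ^ 2 * (σ ^ 2 + 1 ^ 2) := by ring
    simp only [Pk]; rw [e]; field_simp
  have t : Tendsto (fun ε : ℝ => ∫ s, J s * ∫ x, φ x * Pk ε (x - s)) (𝓝[>] 0) (𝓝 (∫ s, J s * φ s)) := by
    refine tendsto_integral_filter_of_dominated_convergence (fun s => ((1 + |R|) * m + n1 φ) * |J s / (1 + |s|)|) ?_ ?_ (Integrable.const_mul (Integrable.abs hJ) _) ?_
    · filter_upwards [self_mem_nhdsWithin] with ε hε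
      have hε : 0 < ε := hε
      refine hJ.aesm.mul (Continuous.aestronglyMeasurable ?_)
      simp only [e2 ε hε]
      refine continuous_of_dominated (bound := fun σ => m * Pk 1 σ) (fun s => ?_) (fun s => ae_of_all _ fun σ => ?_) ((Pk_int one_pos).const_mul _) (ae_of_all _ fun σ => ?_)
      · have := Pk_cont one_pos; exact Continuous.aestronglyMeasurable (by fun_prop)
      · rw [norm_mul, norm_of_nonneg (Pk_nonneg one_pos σ)]; exact mul_le_mul_of_nonneg_right (hm _) (Pk_nonneg one_pos σ)
      · fun_prop
    · filter_upwards [self_mem_nhdsWithin] with ε hε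
      have hε : 0 < ε := hε
      refine ae_of_all _ fun s => ?_
      have hp : 0 < 1 + |s| := by positivity
      have ip : Integrable fun x => Pk ε (x - s) := (Pk_int hε).comp_sub_right s
      have : |∫ x, φ x * Pk ε (x - s)| * (1 + |s|) ≤ (1 + |R|) * m + n1 φ := by
        have b1 := norm_integral_le_of_norm_le (f := fun x => (φ x * Pk ε (x - s)) * (1 + |s|)) ((ip.const_mul ((1 + |R|) * m)).fun_add hi.abs) (ae_of_all _ fun x => by
          rw [norm_mul, norm_mul, norm_of_nonneg hp.le, norm_of_nonneg (Pk_nonneg hε _), norm_eq_abs]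
          have := key ε hε x s; linarith)
        rw [integral_mul_const, norm_mul, norm_of_nonneg hp.le, integral_add (ip.const_mul _) hi.abs, integral_const_mul, integral_sub_right_eq_self (fun x => Pk ε x) s, Pk_one hε, mul_one, norm_eq_abs] at b1
        exact b1
      rw [norm_mul, norm_eq_abs, norm_eq_abs, abs_div, abs_of_pos hp]
      rw [← le_div_iff₀ hp] at this
      calc _ ≤ |J s| * (((1 + |R|) * m + n1 φ) / (1 + |s|)) := by gcongr
        _ = _ := by ring
    · refine ae_of_all _ fun s => Tendsto.const_mul _ ?_
      have t1 : Tendsto (fun ε : ℝ => ∫ σ, φ (s + ε * σ) * Pk 1 σ) (𝓝[>] 0) (𝓝 (∫ σ, φ s * Pk 1 σ)) := by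
        refine tendsto_integral_filter_of_dominated_convergence (fun σ => m * Pk 1 σ) (Eventually.of_forall fun ε => ?_) (Eventually.of_forall fun ε => ae_of_all _ fun σ => ?_) ((Pk_int one_pos).const_mul _) (ae_of_all _ fun σ => ?_)
        · have := Pk_cont one_pos; exact Continuous.aestronglyMeasurable (by fun_prop)
        · rw [norm_mul, norm_of_nonneg (Pk_nonneg one_pos σ)]; exact mul_le_mul_of_nonneg_right (hm _) (Pk_nonneg one_pos σ)
        · have : Continuous fun ε : ℝ => φ (s + ε * σ) * Pk 1 σ := by fun_prop
          have := this.tendsto 0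
          simp only [zero_mul, add_zero] at this
          exact this.mono_left nhdsWithin_le_nhds
      rw [integral_const_mul, Pk_one one_pos, mul_one] at t1
      exact t1.congr' (by filter_upwards [self_mem_nhdsWithin] with ε hε using (e2 ε hε s).symm)
  have t' := t.neg
  have e3 : ∫ s, J s * φ s = ∫ x, φ x * J x := integral_congr_ae (ae_of_all _ fun s => by ring)
  rw [e3] at t'
  exact t'.congr' (by filter_upwards [self_mem_nhdsWithin] with ε hε using (e1 ε hε).symm)

lemma JI.int_cs {φ : ℝ → ℝ} (hJ : JI J) (hφ : Continuous φ) (hs : ∀ x, φ x ≠ 0 → |x| ≤ R) (hm : ∀ x, |φ x| ≤ m) :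
    Integrable fun x => φ x * J x := by
  refine hJ.int_of_le (C := m * (1 + |R|)) (hφ.aestronglyMeasurable.mul hJ.aesm) fun s => ?_
  rw [norm_mul, norm_eq_abs, norm_eq_abs]
  have hm0 : 0 ≤ m := (abs_nonneg _).trans (hm 0)
  rcases eq_or_ne (φ s) 0 with h | h
  · rw [h]; simp; positivity
  · have := hs s h
    have h1 : 1 + |s| ≤ 1 + |R| := by linarith [le_abs_self R]
    calc |φ s| * |J s| ≤ m * |J s| := by gcongr; exact hm s
      _ ≤ m * |J s| * ((1 + |R|) / (1 + |s|)) := le_mul_of_one_le_right (by positivity) ((one_le_div (by positivity)).mpr h1)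
      _ = _ := by ring

lemma quadB {b' : ℝ → ℝ} (hJ : JI J) (h : Bd M b) (hF : ∀ z : ℂ, 0 < z.im → gC b z = (1 / π : ℂ) * ∫ s : ℝ, (J s : ℂ) * (z - s)⁻¹)
    (hd : ∀ x, HasDerivAt b (b' x) x) (hc : Continuous b') (ψ : TF) (hs : ∀ x, ψ.f0 x ≠ 0 → |x| ≤ R) (hm : ∀ x, |ψ.f0 x * b' x| ≤ m) (hi : Integrable fun x => ψ.f0 x * b' x)
    (h1 : ∀ x, ψ.f0 x ≠ 0 → ∀ r, |b (x + r) - b (x - r)| ≤ C1 * |r|) (h2 : ∀ x, ψ.f0 x ≠ 0 → ∀ r, |D2 b r x| ≤ C2 * (r ^ 2 / (1 + r ^ 2))) :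
    (Qf b ψ 0 1).im / 2 = - ∫ x, ψ.f0 x * b' x * J x := by
  have t1 := im_lim hJ hF (φ := fun x => ψ.f0 x * b' x) (ψ.c0.mul hc) (fun x hx => hs x (left_ne_zero_of_mul hx)) hm hi
  have t2 : Tendsto (fun v : ℝ => (Th b ψ.f0 v).im / 2) (𝓝[>] 0) (𝓝 ((Qf b ψ 0 1).im / 2)) :=
    ((continuous_im.tendsto _).comp (Qf_tendsto h ψ one_pos)).div_const 2
  have lc : ∀ v : ℝ, 0 < v → Continuous fun x : ℝ => gC b (x + v * I) := fun v hv =>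
    continuous_iff_continuousAt.mpr fun x => ContinuousAt.comp (f := fun x : ℝ => (x : ℂ) + v * I) (gC_diff h (z := x + v * I) (by rwa [line_im])).continuousAt (by fun_prop)
  have gb : ∀ v : ℝ, 0 < v → ∀ x : ℝ, ‖gC b (x + v * I)‖ ≤ M / v := fun v hv x => by
    have := gC_bound h (z := x + v * I) (by rwa [line_im]); rwa [line_im] at this
  have iIm : ∀ v : ℝ, 0 < v → Integrable fun x : ℝ => ψ.f0 x * b' x * (gC b (x + v * I)).im := fun v hv =>
    hi.mul_bdd (c := M / v) (continuous_im.comp (lc v hv)).aestronglyMeasurable (ae_of_all _ fun x => (abs_im_le_norm _).trans (gb v hv x))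
  have t3 : Tendsto (fun v : ℝ => ∫ x : ℝ, ψ.f0 x * ((gC b (x + v * I)).re - b' x) * (gC b (x + v * I)).im) (𝓝[>] 0) (𝓝 0) := by
    suffices hh : Tendsto (fun v : ℝ => ∫ x : ℝ, ψ.f0 x * ((gC b (x + v * I)).re - b' x) * (gC b (x + v * I)).im) (𝓝[>] 0) (𝓝 (∫ x : ℝ, (0 : ℝ))) by
      rwa [integral_zero] at hh
    refine tendsto_integral_filter_of_dominated_convergence (fun x => ((C1 + C2) * |ψ.f0 x| + |ψ.f0 x * b' x|) * (C1 + C2)) ?_ ?_ (((ψ.i0.abs.const_mul _).fun_add hi.abs).mul_const _) ?_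
    · filter_upwards [self_mem_nhdsWithin] with v hv
      exact ((ψ.c0.mul ((Complex.continuous_re.comp (lc v hv)).sub hc)).mul (continuous_im.comp (lc v hv))).aestronglyMeasurable
    · filter_upwards [self_mem_nhdsWithin] with v hv
      refine ae_of_all _ fun x => ?_
      rcases eq_or_ne (ψ.f0 x) 0 with h0 | h0
      · simp [h0]
      have g1 := g_bd h (h1 x h0) (h2 x h0) hv
      have a1 := (abs_re_le_norm _).trans g1
      have a2 := (abs_im_le_norm _).trans g1
      rw [norm_mul, norm_eq_abs, norm_eq_abs, mul_sub]
      refine mul_le_mul ((abs_sub _ _).trans (add_le_add ?_ le_rfl)) a2 (abs_nonneg _) (by have := (norm_nonneg _).trans g1; positivity)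
      rw [abs_mul, mul_comm]; gcongr
    · refine ae_of_all _ fun x => ?_
      rcases eq_or_ne (ψ.f0 x) 0 with h0 | h0
      · simp [h0]
      have l1 := re_lim h (h1 x h0) (hd x)
      have l2 : Tendsto (fun v : ℝ => ψ.f0 x * ((gC b (x + v * I)).re - b' x)) (𝓝[>] 0) (𝓝 0) := by
        have := (l1.sub_const (b' x)).const_mul (ψ.f0 x); simpa using this
      refine bdd_le_mul_tendsto_zero' (C1 + C2) ?_ l2 |>.congr fun v => mul_comm _ _
      filter_upwards [self_mem_nhdsWithin] with v hv
      exact (abs_im_le_norm _).trans (g_bd h (h1 x h0) (h2 x h0) hv)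
  have t4 := t1.add t3
  rw [add_zero] at t4
  refine tendsto_nhds_unique (t2.congr' ?_) t4
  filter_upwards [self_mem_nhdsWithin] with v hv
  have hv : 0 < v := hv
  have i3 : Integrable fun x : ℝ => ψ.f0 x * ((gC b (x + v * I)).re - b' x) * (gC b (x + v * I)).im := by
    have a : Integrable fun x : ℝ => ψ.f0 x * ((gC b (x + v * I)).re * (gC b (x + v * I)).im) :=
      ψ.i0.mul_bdd (c := M / v * (M / v)) (((Complex.continuous_re.comp (lc v hv)).mul (continuous_im.comp (lc v hv))).aestronglyMeasurable) (ae_of_all _ fun x => by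
        simp only [norm_mul]
        exact mul_le_mul ((abs_re_le_norm _).trans (gb v hv x)) ((abs_im_le_norm _).trans (gb v hv x)) (norm_nonneg _) ((norm_nonneg _).trans (gb v hv x)))
    exact (a.sub (iIm v hv)).congr (ae_of_all _ fun x => by simp only [Pi.sub_apply]; ring)
  rw [← integral_add (iIm v hv) i3, Th]
  have e : (∫ s : ℝ, (ψ.f0 s : ℂ) * GC b (s + v * I)).im = ∫ s : ℝ, ((ψ.f0 s : ℂ) * GC b (s + v * I)).im := (integral_im (Th_integrable h ψ.i0 hv)).symm
  rw [e, ← integral_div]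
  refine integral_congr_ae (ae_of_all _ fun x => ?_)
  simp only [GC, pow_two, mul_im, ofReal_re, ofReal_im]; ring

structure Rg (C η : ℝ) (b : ℝ → ℝ) (x : ℝ) : Prop where
  a : ∀ r, |r| ≤ η → |b (x + r) - b x| ≤ C * |r|
  b : ∀ r, |r| ≤ η → |D2 b r x| ≤ C * r ^ 2

lemma Rg.h1 (h : Rg C η b x) (hb : Bd M b) (hη : 0 < η) (r : ℝ) :
    |b (x + r) - b (x - r)| ≤ (2 * C + 2 * M / η) * |r| := by
  have hM := hb.nonneg
  have hC : 0 ≤ C * η := by have := (abs_nonneg _).trans (h.a η (abs_of_pos hη).le); rwa [abs_of_pos hη] at this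
  have hC : 0 ≤ C := nonneg_of_mul_nonneg_left hC hη
  by_cases hr : |r| ≤ η
  · have a1 := h.a r hr
    have a2 := h.a (-r) (by rwa [abs_neg])
    rw [abs_neg, ← sub_eq_add_neg] at a2
    have : 0 ≤ 2 * M / η * |r| := by positivity
    have e : b (x + r) - b (x - r) = (b (x + r) - b x) - (b (x - r) - b x) := by ring
    rw [e]; refine (abs_sub _ _).trans ?_; linarith
  · push Not at hr
    have a1 := hb.le (x + r)
    have a2 := hb.le (x - r)
    have : 2 * M ≤ 2 * M / η * |r| := by rw [div_mul_eq_mul_div, le_div_iff₀ hη]; gcongr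
    have : 0 ≤ 2 * C * |r| := by positivity
    refine (abs_sub _ _).trans ?_; linarith

lemma D2_le4 (hb : Bd M b) (r x : ℝ) : |D2 b r x| ≤ 4 * M := by
  have a1 := abs_le.mp (hb.le (x + r)); have a2 := abs_le.mp (hb.le (x - r)); have a3 := abs_le.mp (hb.le x)
  unfold D2; rw [abs_le]; constructor <;> linarith

lemma Rg.h2 (h : Rg C η b x) (hb : Bd M b) (hη : 0 < η) (hη1 : η ≤ 1) (r : ℝ) :
    |D2 b r x| ≤ (2 * C + 8 * M / η ^ 2) * (r ^ 2 / (1 + r ^ 2)) := by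
  have hM := hb.nonneg
  have hC : 0 ≤ C * η := by have := (abs_nonneg _).trans (h.a η (abs_of_pos hη).le); rwa [abs_of_pos hη] at this
  have hC : 0 ≤ C := nonneg_of_mul_nonneg_left hC hη
  have hp : 0 < 1 + r ^ 2 := by positivity
  by_cases hr : |r| ≤ η
  · refine (h.b r hr).trans ?_
    rw [← mul_div_assoc, le_div_iff₀ hp]
    have h1 : r ^ 2 ≤ 1 := by rw [← sq_abs]; nlinarith [abs_nonneg r]
    have h2 : 0 ≤ 8 * M / η ^ 2 * r ^ 2 := by positivity
    nlinarith [mul_nonneg hC (sq_nonneg r), mul_nonneg (mul_nonneg hC (sq_nonneg r)) (sub_nonneg.mpr h1)]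
  · push Not at hr
    refine (D2_le4 hb r x).trans ?_
    have h1 : η ^ 2 ≤ r ^ 2 := by rw [← sq_abs r]; nlinarith
    have h2 : 4 * M * (1 + r ^ 2) ≤ 8 * M / η ^ 2 * r ^ 2 := by
      rw [div_mul_eq_mul_div, le_div_iff₀ (by positivity)]
      have h3 : η ^ 2 ≤ 1 := by nlinarith
      have : (1 + r ^ 2) * η ^ 2 ≤ 2 * r ^ 2 := by nlinarith [mul_nonneg (sq_nonneg r) (sub_nonneg.mpr h3)]
      nlinarith
    rw [← mul_div_assoc, le_div_iff₀ hp]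
    nlinarith [mul_nonneg hC (sq_nonneg r)]

lemma lap_point (hα : α ∈ Ioo 0 2) (hb : Bd M b) (h : Rg C η b x) (hη : 0 < η) (hη1 : η ≤ 1)
    (hL : Tendsto (fun ε : ℝ => (1 / π) * ∫ y in {y : ℝ | ε < |x - y|}, (b x - b y) / |x - y| ^ (1 + α)) (𝓝[>] 0) (𝓝 (L x))) :
    L x = (1 / π) * ∫ r in Ioi 0, r ^ (-1 - α) * D2 b r x := by
  have hM := hb.nonneg
  set C2 := 2 * C + 8 * M / η ^ 2 with hC2
  have h2 := h.h2 hb hη hη1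
  have hC2' : 0 ≤ C2 := by have := (abs_nonneg _).trans (h2 1); rw [← hC2] at this; norm_num at this; linarith
  have cont : ContinuousOn (fun r : ℝ => r ^ (-1 - α) * D2 b r x) (Ioi 0) := by
    have c := hb.c
    refine ContinuousOn.mul (ContinuousOn.rpow_const continuousOn_id fun r hr => Or.inl (ne_of_gt hr)) ?_
    unfold D2; fun_prop
  have hi : IntegrableOn (fun r : ℝ => r ^ (-1 - α) * D2 b r x) (Ioi 0) := by
    refine ((kα_int hα).const_mul (C2 + C2)).mono' (cont.aestronglyMeasurable measurableSet_Ioi) ((ae_restrict_iff' measurableSet_Ioi).mpr (ae_of_all _ fun r hr => ?_))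
    have hr : 0 < r := hr
    rw [norm_mul, norm_of_nonneg (by positivity), norm_eq_abs]
    have hp : 0 < 1 + r ^ 2 := by positivity
    refine kα_dom hr hC2' hC2' ((h2 r).trans ?_) fun _ => (h2 r).trans ?_
    · exact mul_le_of_le_one_right hC2' (div_le_one_of_le₀ (by linarith) hp.le)
    · rw [mul_comm]; exact mul_le_mul_of_nonneg_right (div_le_self (sq_nonneg r) (by nlinarith [sq_nonneg r])) hC2'
  have e1 : ∀ ε : ℝ, 0 < ε → ∫ y in {y : ℝ | ε < |x - y|}, (b x - b y) / |x - y| ^ (1 + α) = ∫ r in Ioi ε, r ^ (-1 - α) * D2 b r x := by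
    intro ε hε
    let k : ℝ → ℝ := fun r => (Ioi ε).indicator (fun r => r ^ (-1 - α)) r
    have ki : Integrable k := by
      rw [integrable_indicator_iff measurableSet_Ioi]
      exact integrableOn_Ioi_rpow_of_lt (by linarith [hα.1]) hε
    have key : ∀ c : ℝ, Integrable fun r => k r * (b x - b (x + c * r)) := fun c =>
      ki.mul_bdd (c := 2 * M) (by have := hb.c; exact Continuous.aestronglyMeasurable (by fun_prop)) (ae_of_all _ fun r => by
        refine (abs_sub _ _).trans ?_; linarith [hb.le x, hb.le (x + c * r)])
    have key1 : Integrable fun r => k r * (b x - b (x + r)) := by simpa using key 1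
    have key2 : Integrable fun r => k r * (b x - b (x - r)) := by simpa [sub_eq_add_neg] using key (-1)
    have key3 : Integrable fun r => k (-r) * (b x - b (x + r)) := by simpa [sub_eq_add_neg] using key2.comp_neg
    rw [← integral_indicator (meas_far x ε), ← integral_add_left_eq_self _ x, ← integral_indicator measurableSet_Ioi]
    calc _ = ∫ r, (k r * (b x - b (x + r)) + k (-r) * (b x - b (x + r))) := by
          refine integral_congr_ae (ae_of_all _ fun r => ?_)
          simp only [k, Set.indicator, Set.mem_setOf_eq, mem_Ioi]
          have e : |x - (x + r)| = |r| := by rw [sub_add_cancel_left, abs_neg]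
          rw [e]
          by_cases hr : ε < |r|
          · rw [if_pos hr, div_eq_mul_inv, ← rpow_neg (abs_nonneg r), neg_add, ← sub_eq_add_neg]
            rcases lt_abs.mp hr with h | h
            · rw [if_pos h, if_neg (by linarith), abs_of_pos (by linarith)]; ring
            · rw [if_pos h, if_neg (by linarith), abs_of_neg (by linarith)]; ring
          · rw [if_neg hr]; push Not at hr
            have := abs_le.mp hr
            rw [if_neg (by linarith), if_neg (by linarith)]; ring
      _ = (∫ r, k r * (b x - b (x + r))) + ∫ r, k r * (b x - b (x - r)) := by
          rw [integral_add key1 key3]; congr 1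
          rw [← integral_neg_eq_self]; simp [sub_eq_add_neg]
      _ = _ := by
          rw [← integral_add key1 key2]
          refine integral_congr_ae (ae_of_all _ fun r => ?_)
          simp only [k, Set.indicator, mem_Ioi, D2]
          split_ifs <;> ring
  have t : Tendsto (fun ε : ℝ => ∫ r in Ioi ε, r ^ (-1 - α) * D2 b r x) (𝓝[>] 0) (𝓝 (∫ r in Ioi 0, r ^ (-1 - α) * D2 b r x)) := by
    have : ∀ ε : ℝ, 0 < ε → ∫ r in Ioi ε, r ^ (-1 - α) * D2 b r x = ∫ r in Ioi 0, (Ioi ε).indicator (fun r => r ^ (-1 - α) * D2 b r x) r := fun ε hε => by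
      rw [setIntegral_indicator measurableSet_Ioi]; congr 2; rw [Set.inter_eq_right.mpr (Set.Ioi_subset_Ioi hε.le)]
    refine Tendsto.congr' (by filter_upwards [self_mem_nhdsWithin] with ε hε using (this ε hε).symm) ?_
    refine tendsto_integral_filter_of_dominated_convergence (fun r => ‖r ^ (-1 - α) * D2 b r x‖) (Eventually.of_forall fun ε => hi.aestronglyMeasurable.indicator measurableSet_Ioi) (Eventually.of_forall fun ε => ae_of_all _ fun r => norm_indicator_le_norm_self _ _) hi.norm ((ae_restrict_iff' measurableSet_Ioi).mpr (ae_of_all _ fun r hr => ?_))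
    refine tendsto_const_nhds.congr' ?_
    filter_upwards [nhdsWithin_le_nhds (Iio_mem_nhds (show (0:ℝ) < r from hr))] with ε hε
    have hm : r ∈ Ioi ε := hε
    rw [indicator_of_mem hm]
  refine tendsto_nhds_unique hL ((t.const_mul _).congr' ?_)
  filter_upwards [self_mem_nhdsWithin] with ε hε
  rw [e1 ε hε]

lemma lapB (hα : α ∈ Ioo 0 2) (hb : Bd M b) (hη : 0 < η) (hη1 : η ≤ 1) (ψ : TF)
    (h : ∀ x, ψ.f0 x ≠ 0 → Rg C η b x) (hL : IsFracLapPV α b L) :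
    Integrable (fun x => ψ.f0 x * L x) ∧ ∫ x, ψ.f0 x * L x = LLf α b ψ.f0 := by
  have hM := hb.nonneg
  have e : (fun x => ψ.f0 x * L x) = fun x => (1 / π) * ∫ r in Ioi 0, r ^ (-1 - α) * (ψ.f0 x * D2 b r x) := by
    ext x
    rcases eq_or_ne (ψ.f0 x) 0 with h0 | h0
    · simp [h0]
    · rw [lap_point hα hb (h x h0) hη hη1 (hL x), mul_left_comm, ← integral_const_mul]
      congr 2; ext r; ring
  set C2 := |2 * C + 8 * M / η ^ 2| with hC2
  have hC2' : 0 ≤ C2 := abs_nonneg _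
  have ip : Integrable (Function.uncurry fun x r : ℝ => r ^ (-1 - α) * (ψ.f0 x * D2 b r x)) (volume.prod (volume.restrict (Ioi 0))) := by
    have hp := ψ.i0.abs.mul_prod ((kα_int hα).const_mul (C2 + C2))
    refine hp.mono' ?_ ?_
    · have c := hb.c; have c0 := ψ.c0
      refine AEStronglyMeasurable.mul ?_ ((Continuous.aestronglyMeasurable (by unfold D2; fun_prop)))
      exact AEStronglyMeasurable.comp_snd (f := fun r : ℝ => r ^ (-1 - α)) (Measurable.aestronglyMeasurable (by fun_prop))
    · have : ∀ᵐ p : ℝ × ℝ ∂(volume.prod (volume.restrict (Ioi (0:ℝ)))), 0 < p.2 :=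
        Measure.quasiMeasurePreserving_snd.ae ((ae_restrict_iff' measurableSet_Ioi).mpr (ae_of_all _ fun r hr => hr))
      filter_upwards [this] with p hr
      simp only [Function.uncurry]
      rcases eq_or_ne (ψ.f0 p.1) 0 with h0 | h0
      · simp [h0]
      have hq : 0 < 1 + p.2 ^ 2 := by positivity
      have h2 : |D2 b p.2 p.1| ≤ C2 * (p.2 ^ 2 / (1 + p.2 ^ 2)) := ((h _ h0).h2 hb hη hη1 p.2).trans (mul_le_mul_of_nonneg_right (le_abs_self _) (by positivity))
      rw [norm_mul, norm_of_nonneg (by positivity), norm_mul, norm_eq_abs, norm_eq_abs, mul_left_comm]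
      refine mul_le_mul_of_nonneg_left (kα_dom hr hC2' hC2' (h2.trans ?_) fun _ => h2.trans ?_) (abs_nonneg _)
      · exact mul_le_of_le_one_right hC2' (div_le_one_of_le₀ (by linarith) hq.le)
      · rw [mul_comm]; exact mul_le_mul_of_nonneg_right (div_le_self (sq_nonneg _) (by nlinarith [sq_nonneg p.2])) hC2'
  constructor
  · rw [e]; exact ip.integral_prod_left.const_mul _
  · rw [e, integral_const_mul, integral_integral_swap ip, LLf]
    congr 2; ext r
    rw [integral_const_mul, D2_symm hb ψ.i0]

lemma A0 (hJ : IsHilbertPV J (deriv b)) (hs : ContDiff ℝ (⊤ : ℕ∞) b) :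
    ∃ J', JI J' ∧ IsHilbertPV J' (deriv b) ∧ ∀ x, J' x * deriv b x = J x * deriv b x := by
  by_cases h0 : ∀ x, deriv b x = 0
  · refine ⟨0, by simp [JI], fun x => by simp [h0 x], fun x => by simp [h0 x]⟩
  push Not at h0
  obtain ⟨x1, h1⟩ := h0
  have hc : Continuous (deriv b) := hs.continuous_deriv (by simp)
  have hev := hc.continuousAt.eventually_ne h1
  obtain ⟨x2, h12, h2⟩ : ∃ x2, x2 ≠ x1 ∧ deriv b x2 ≠ 0 := by
    have := (hev.filter_mono (nhdsWithin_le_nhds (s := {x1}ᶜ))).and self_mem_nhdsWithin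
    obtain ⟨x, a, b⟩ := this.exists
    exact ⟨x, b, a⟩
  have key : ∀ x, deriv b x ≠ 0 → ∃ ε > 0, ∀ r, 0 < r → r < ε → IntegrableOn (fun y => J y / (x - y)) {y : ℝ | r < |x - y|} := by
    intro x hx
    have := (hJ x).eventually_ne hx
    obtain ⟨ε, hε, h⟩ := mem_nhdsGT_iff_exists_Ioo_subset.mp this
    refine ⟨ε, hε, fun r h0 hr => ?_⟩
    by_contra hn
    exact h ⟨h0, hr⟩ (by rw [integral_undef hn, mul_zero])
  obtain ⟨e1, p1, k1⟩ := key x1 h1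
  obtain ⟨e2, p2, k2⟩ := key x2 h2
  have hd : 0 < |x1 - x2| := abs_pos.mpr (sub_ne_zero.mpr h12.symm)
  set r := min (min e1 e2) |x1 - x2| / 3 with hr
  have hr0 : 0 < r := by positivity
  have l0 : min (min e1 e2) |x1 - x2| = 3 * r := by rw [hr]; ring
  have l1 : r < e1 := by have := (min_le_left (min e1 e2) |x1 - x2|).trans (min_le_left e1 e2); linarith
  have l2 : r < e2 := by have := (min_le_left (min e1 e2) |x1 - x2|).trans (min_le_right e1 e2); linarith
  have l3 : 3 * r ≤ |x1 - x2| := by have := (min_le_right (min e1 e2) |x1 - x2|); linarith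
  have mul : ∀ x, IntegrableOn (fun y => J y / (x - y)) {y : ℝ | r < |x - y|} → IntegrableOn (fun y => J y / (1 + |y|)) {y : ℝ | r < |x - y|} := by
    intro x hi
    have hi' := Integrable.mul_bdd (c := 1 + |x|) hi (g := fun y => (x - y) / (1 + |y|)) (by
      refine Continuous.aestronglyMeasurable (Continuous.div (by fun_prop) (by fun_prop) fun y => by positivity)) (ae_of_all _ fun y => by
        have hp : 0 < 1 + |y| := by positivity
        rw [norm_div, norm_eq_abs, norm_of_nonneg hp.le, div_le_iff₀ hp]
        have := abs_sub x y
        nlinarith [abs_nonneg x, abs_nonneg y, mul_nonneg (abs_nonneg x) (abs_nonneg y)])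
    refine hi'.congr ((ae_restrict_iff' (meas_far x r)).mpr (ae_of_all _ fun y hy => ?_))
    have hy : r < |x - y| := hy
    have : x - y ≠ 0 := fun h => by rw [h, abs_zero] at hy; linarith
    field_simp
  have hJI : JI J := by
    rw [JI, ← integrableOn_univ]
    refine ((mul x1 (k1 r hr0 l1)).union (mul x2 (k2 r hr0 l2))).mono_set fun y _ => ?_
    by_contra hn
    rw [Set.mem_union, not_or] at hn
    have a1 : |x1 - y| ≤ r := not_lt.mp hn.1
    have a2 : |x2 - y| ≤ r := not_lt.mp hn.2
    have a3 := abs_sub (x1 - y) (x2 - y)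
    rw [sub_sub_sub_cancel_right] at a3
    linarith
  exact ⟨J, hJI, hJ, fun x => rfl⟩

lemma fwd_bd {h : ℝ} (hh : |h| ≤ 1) : ∀ (m : ℕ) (R : ℝ) (f : ℕ → ℝ → ℝ) (C : ℝ), (∀ k x, HasDerivAt (f k) (f (k + 1) x) x) →
    (∀ x, |x| ≤ R + m → |f m x| ≤ C) → ∀ x, |x| ≤ R → |(fwdDiff h)^[m] (f 0) x| ≤ C * |h| ^ m := by
  intro m
  induction m with
  | zero => intro R f C _ hf x hx; simpa using hf x (by simpa using hx)
  | succ m ih =>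
    intro R f C hd hf x hx
    have := ih R (fun k y => f k (y + h) - f k y) (C * |h|) (fun k x => ((hd k (x + h)).comp_add_const x h).fun_sub (hd k x)) (fun y hy => by
      have hy' : |y + h| ≤ R + (m + 1 : ℕ) := by push_cast; linarith [abs_add_le y h]
      have := Convex.norm_image_sub_le_of_norm_hasDerivWithin_le (f := f m) (f' := f (m + 1)) (C := C) (s := closedBall 0 (R + (m + 1 : ℕ))) (fun z _ => (hd m z).hasDerivWithinAt) (fun z hz => hf z (by simpa using hz)) (convex_closedBall _ _) (x := y) (y := y + h) (by simp; linarith) (by simpa using hy')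
      simpa using this) x hx
    rw [Function.iterate_succ_apply, pow_succ', ← mul_assoc]
    exact this

lemma hasD (hs : ContDiff ℝ (⊤ : ℕ∞) b) (k : ℕ) (x : ℝ) : HasDerivAt (iteratedDeriv k b) (iteratedDeriv (k + 1) b x) x := by
  rw [iteratedDeriv_succ]
  exact ((hs.differentiable_iteratedDeriv k (by exact_mod_cast WithTop.coe_lt_top k)) x).hasDerivAt

structure RR (n R : ℝ) (b : ℝ → ℝ) : Prop where
  rg : ∀ x, |x| ≤ R → Rg n 1 b x
  fd : ∀ x h, |x| ≤ R → |h| ≤ 1 → |(fwdDiff h)^[15] b x| ≤ n * |h| ^ 15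

lemma smooth_RR (hs : ContDiff ℝ (⊤ : ℕ∞) b) (R : ℝ) : ∃ n0 : ℝ, ∀ n, n0 ≤ n → RR n R b := by
  have hk : ∀ k : ℕ, ∃ C, ∀ x, |x| ≤ R + 1 + k → |iteratedDeriv k b x| ≤ C := fun k => by
    obtain ⟨C, hC⟩ := (isCompact_closedBall (0 : ℝ) (R + 1 + k)).exists_bound_of_continuousOn (hs.continuous_iteratedDeriv k (by exact_mod_cast le_top)).continuousOn
    exact ⟨C, fun x hx => hC x (by simpa using hx)⟩
  choose C hC using hk
  have key : ∀ (m : ℕ) x h, |x| ≤ R + 1 → |h| ≤ 1 → |(fwdDiff h)^[m] b x| ≤ C m * |h| ^ m := fun m x h hx hh => by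
    have := fwd_bd hh m (R + 1) (fun k => iteratedDeriv k b) (C m) (hasD hs) (hC m) x hx
    simpa using this
  refine ⟨max (C 1) (max (C 2) (C 15)), fun n hn => ?_⟩
  rw [max_le_iff, max_le_iff] at hn
  refine ⟨fun x hx => ⟨fun r hr => ?_, fun r hr => ?_⟩, fun x h hx hh => (key 15 x h (by linarith) hh).trans (mul_le_mul_of_nonneg_right hn.2.2 (by positivity))⟩
  · have := (key 1 x r (by linarith) hr).trans (mul_le_mul_of_nonneg_right hn.1 (by positivity))
    simpa [fwdDiff] using this
  · have := (key 2 (x - r) r (by linarith [abs_sub x r]) hr).trans (mul_le_mul_of_nonneg_right hn.2.1 (by positivity))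
    rw [sq_abs] at this
    refine le_trans (le_of_eq ?_) this
    rw [← abs_neg]; congr 1
    simp only [Function.iterate_succ, Function.iterate_zero, Function.comp, fwdDiff, D2, id]
    rw [show x - r + r + r = x + r by ring, show x - r + r = x by ring]; ring

def TT (α μ : ℝ) (b : ℝ → ℝ) (ψ : TF) : ℝ := (Qf b ψ 0 1).im / 2 - μ * LLf α b ψ.f0

lemma partB (hα : α ∈ Ioo 0 2) (hb : Bd M b) (hs : ContDiff ℝ (⊤ : ℕ∞) b) (hbi : Integrable b)
    (hJ : IsHilbertPV J (deriv b)) (hL : IsFracLapPV α b L) (ψ : TF) (hψ : ∀ x, ψ.f0 x ≠ 0 → |x| ≤ R) :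
    Integrable (fun x => ψ.f0 x * (-(J x * deriv b x + μ * L x))) ∧ ∫ x, ψ.f0 x * (-(J x * deriv b x + μ * L x)) = TT α μ b ψ := by
  obtain ⟨J', hJ', hP, he⟩ := A0 hJ hs
  obtain ⟨n, hn⟩ := smooth_RR hs R
  have hn := hn n le_rfl
  have hd : ∀ x, HasDerivAt b (deriv b x) x := fun x => (hs.differentiable (by simp) x).hasDerivAt
  have hc : Continuous (deriv b) := hs.continuous_deriv (by simp)
  have hA : A2P J' b := fun x ε hε => A2 hJ' hb.c hd (fun x => by
    have := (hP x).const_mul π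
    refine this.congr fun ε => ?_
    have := pi_ne_zero
    rw [hx]; field_simp) x hε
  have hcs : HasCompactSupport fun x => ψ.f0 x * deriv b x := HasCompactSupport.intro (isCompact_closedBall (0:ℝ) R) fun x hx => by
    by_contra h; exact hx (by simpa using hψ x (left_ne_zero_of_mul h))
  have hcc := ψ.c0.mul hc
  obtain ⟨m, hm⟩ := hcs.exists_bound_of_continuous hcc
  have hm : ∀ x, |ψ.f0 x * deriv b x| ≤ m := hm
  have q := quadB hJ' hb (fun z hz => F_eq_g hJ' hb hbi hA hz) hd hc ψ hψ hm (hcc.integrable_of_hasCompactSupport hcs)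
    (fun x hx => (hn.rg x (hψ x hx)).h1 hb one_pos) (fun x hx => (hn.rg x (hψ x hx)).h2 hb one_pos le_rfl)
  obtain ⟨l1, l2⟩ := lapB hα hb one_pos le_rfl ψ (fun x hx => hn.rg x (hψ x hx)) hL
  have i1 : Integrable fun x => ψ.f0 x * deriv b x * J' x := hJ'.int_cs hcc (fun x hx => hψ x (left_ne_zero_of_mul hx)) hm
  have e : (fun x => ψ.f0 x * (-(J x * deriv b x + μ * L x))) = fun x => -(ψ.f0 x * deriv b x * J' x) - μ * (ψ.f0 x * L x) := by
    ext x; rw [← he]; ring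
  rw [e]
  have i2 : Integrable fun x => -(ψ.f0 x * deriv b x * J' x) := i1.neg
  refine ⟨i2.sub (l1.const_mul μ), ?_⟩
  rw [integral_sub i2 (l1.const_mul μ), integral_neg, integral_const_mul, l2, ← q, TT]

def TF.of (f : ℝ → ℝ) (hs : ContDiff ℝ (⊤ : ℕ∞) f) (hc : HasCompactSupport f) : TF :=
  have hcn : ∀ k, Continuous (iteratedDeriv k f) := fun k => hs.continuous_iteratedDeriv k (by exact_mod_cast le_top)
  have hi : ∀ k, Integrable (iteratedDeriv k f) := fun k => (hcn k).integrable_of_hasCompactSupport (by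
      induction k with
      | zero => simpa using hc
      | succ k ih => rw [iteratedDeriv_succ]; exact ih.deriv)
  { f0 := f, f1 := iteratedDeriv 1 f, f2 := iteratedDeriv 2 f, f3 := iteratedDeriv 3 f
    h0 := fun x => by simpa using hasD hs 0 x
    h1 := hasD hs 1, h2 := hasD hs 2, c3 := hcn 3
    i0 := by simpa using hi 0
    i1 := hi 1, i2 := hi 2, i3 := hi 3 }

lemma int_le {D : ℝ → ℝ} {c : ℝ} (hf : Integrable f) (h : ∀ x, f x ≠ 0 → |D x| ≤ c) : |∫ x, f x * D x| ≤ c * n1 f := by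
  rw [n1, ← integral_const_mul]
  refine norm_integral_le_of_norm_le (f := fun x => f x * D x) (hf.abs.const_mul c) (ae_of_all _ fun x => ?_)
  rw [norm_eq_abs, abs_mul, mul_comm]
  rcases eq_or_ne (f x) 0 with h0 | h0
  · simp [h0]
  · exact mul_le_mul_of_nonneg_right (h x h0) (abs_nonneg _)

lemma Rg.nn (h : Rg n 1 b x) : 0 ≤ n := by
  have := (abs_nonneg _).trans (h.a 1 (by simp)); simpa using this

def CK (α μ M n : ℝ) : ℝ := ((2 * n + 2 * M) + (2 * n + 8 * M)) ^ 2 / 2 + |μ| * ((4 * M + n) * cα α)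

lemma g_K (hb : Bd M b) (h : Rg n 1 b x) (hv : 0 < v) :
    ‖gC b (x + v * I)‖ ≤ (2 * n + 2 * M) + (2 * n + 8 * M) := by
  have := g_bd hb (h.h1 hb one_pos) (h.h2 hb one_pos le_rfl) hv
  norm_num at this ⊢; linarith

lemma LL_K (hα : α ∈ Ioo 0 2) (hb : Bd M b) (hn0 : 0 ≤ n) (ψ : TF) (h : ∀ x, ψ.f0 x ≠ 0 → Rg n 1 b x) :
    |LLf α b ψ.f0| ≤ (4 * M + n) * cα α * n1 ψ.f0 := by
  have hM := hb.nonneg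
  have h0 := n1_nonneg ψ.f0
  have := LLf_le hα (b := b) (f := ψ.f0) (A0 := 4 * M * n1 ψ.f0) (A2 := n * n1 ψ.f0) (by positivity) (by positivity)
    (fun r hr => by rw [D2_symm hb ψ.i0]; exact int_le ψ.i0 fun x _ => D2_le4 hb r x)
    (fun r hr hr1 => by
      rw [D2_symm hb ψ.i0]
      refine (int_le ψ.i0 (c := n * r ^ 2) fun x hx => (h x hx).b r (by rwa [abs_of_pos hr])).trans (le_of_eq (by ring)))
  exact this.trans (le_of_eq (by ring))

lemma TT_K (hα : α ∈ Ioo 0 2) (hb : Bd M b) (hn0 : 0 ≤ n) (ψ : TF) (h : ∀ x, ψ.f0 x ≠ 0 → Rg n 1 b x) :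
    |TT α μ b ψ| ≤ CK α μ M n * n1 ψ.f0 := by
  have q : ‖Qf b ψ 0 1‖ ≤ ((2 * n + 2 * M) + (2 * n + 8 * M)) ^ 2 * n1 ψ.f0 := by
    refine le_of_tendsto (Qf_tendsto hb ψ one_pos).norm ?_
    filter_upwards [self_mem_nhdsWithin] with v hv
    refine Th_bound' ψ.i0 fun s hs => ?_
    rw [GC, norm_pow]
    exact pow_le_pow_left₀ (norm_nonneg _) (g_K hb (h s hs) hv) 2
  have q1 := (abs_im_le_norm (Qf b ψ 0 1)).trans q
  have q2 := mul_le_mul_of_nonneg_left (LL_K hα hb hn0 ψ h) (abs_nonneg μ)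
  rw [TT, CK]
  refine (abs_sub _ _).trans ?_
  rw [abs_mul, abs_div, abs_two]
  nlinarith

lemma D_ae {N : ℝ} {D : ℝ → ℝ} (h0 : 0 < R') (hR : R' < R)
    (h : ∀ ψ : TF, (∀ x, ψ.f0 x ≠ 0 → |x| ≤ R) → Integrable (fun x => ψ.f0 x * D x) ∧ |∫ x, ψ.f0 x * D x| ≤ N * n1 ψ.f0) :
    ∀ᵐ x, |x| < R' → |D x| ≤ N := by
  let θ : ContDiffBump (0 : ℝ) := ⟨R', R, h0, hR⟩
  have hg := (h (TF.of θ θ.contDiff θ.hasCompactSupport) fun x hx => by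
    have : x ∈ Function.support θ := hx
    rw [θ.support_eq] at this
    simpa using (mem_ball.mp this).le).1
  have hp : ∀ i : ℕ, (0 : ℝ) < 1 / (2 * (i + 1)) := fun i => by positivity
  let φ : ℕ → ContDiffBump (0 : ℝ) := fun i => ⟨1 / (2 * (i + 1)), 1 / (i + 1), hp i, by
    refine one_div_lt_one_div_of_lt (by positivity) (by linarith [(by positivity : (0:ℝ) ≤ i)])⟩
  have ht : Tendsto (fun i => (φ i).rOut) atTop (𝓝 0) := tendsto_one_div_add_atTop_nhds_zero_nat
  have := ContDiffBump.ae_convolution_tendsto_right_of_locallyIntegrable (K := 2) ht (Eventually.of_forall fun i => by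
    simp only [φ]; rw [← mul_div_mul_left _ _ (two_ne_zero (α := ℝ)), mul_div_assoc]) hg.locallyIntegrable
  filter_upwards [this] with x hx hxR
  have hθ : θ x = 1 := θ.one_of_mem_closedBall (by simpa using hxR.le)
  simp only [TF.of, hθ, one_mul] at hx
  refine le_of_tendsto hx.abs ?_
  filter_upwards [ht.eventually (gt_mem_nhds (sub_pos.mpr hxR))] with i hi
  have sm : ContDiff ℝ (⊤ : ℕ∞) fun s => (φ i).normed volume (x - s) := (φ i).contDiff_normed.comp (contDiff_const.sub contDiff_id)
  have hz : ∀ s, (φ i).normed volume (x - s) ≠ 0 → |x - s| < (φ i).rOut := fun s hs => by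
    have : x - s ∈ Function.support ((φ i).normed volume) := hs
    rw [(φ i).support_normed_eq] at this
    simpa using this
  have hz' : ∀ s, (φ i).normed volume (x - s) ≠ 0 → |s| ≤ R' := fun s hs => by
    have h1 := hz s hs; have h2 := abs_sub x (x - s); rw [sub_sub_cancel] at h2; linarith
  have hc : HasCompactSupport fun s => (φ i).normed volume (x - s) := HasCompactSupport.intro (isCompact_closedBall (0:ℝ) R') fun s hs => by
    by_contra hn; exact hs (by simpa using hz' s hn)
  have b := (h (TF.of _ sm hc) fun s hs => (hz' s hs).trans hR.le).2
  have n1e : n1 (TF.of _ sm hc).f0 = 1 := by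
    have : n1 (TF.of _ sm hc).f0 = ∫ s, (φ i).normed volume (x - s) := integral_congr_ae (ae_of_all _ fun s => abs_of_nonneg ((φ i).nonneg_normed _))
    rw [this, integral_sub_left_eq_self (fun s => (φ i).normed volume s) volume x, (φ i).integral_normed]
  rw [n1e, mul_one] at b
  refine le_trans (le_of_eq ?_) b
  rw [convolution_eq_swap]
  congr 1
  refine integral_congr_ae (ae_of_all _ fun s => ?_)
  simp only [TF.of, ContinuousLinearMap.lsmul_apply, smul_eq_mul]
  rcases eq_or_ne ((φ i).normed volume (x - s)) 0 with h0 | h0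
  · simp [h0]
  · rw [θ.one_of_mem_closedBall (by simpa using hz' s h0), one_mul]

def PS (ρ : ℝ) (ψ : TF) : Prop := ∀ x, ψ.f0 x ≠ 0 → |x| ≤ ρ

structure Mu (Q : ℝ) where
  k0 : ℝ → ℝ
  k1 : ℝ → ℝ
  k2 : ℝ → ℝ
  k3 : ℝ → ℝ
  h0 : ∀ x, HasDerivAt k0 (k1 x) x
  h1 : ∀ x, HasDerivAt k1 (k2 x) x
  h2 : ∀ x, HasDerivAt k2 (k3 x) x
  c3 : Continuous k3
  b0 : ∀ x, |k0 x| ≤ Q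
  b1 : ∀ x, |k1 x| ≤ Q
  b2 : ∀ x, |k2 x| ≤ Q
  b3 : ∀ x, |k3 x| ≤ Q

lemma n1_mul (hf : Integrable f) (hk : ∀ x, |k x| ≤ Q) : n1 (fun x => f x * k x) ≤ Q * n1 f := by
  rw [n1, n1, ← integral_const_mul]
  refine integral_mono_of_nonneg (ae_of_all _ fun x => abs_nonneg _) (hf.abs.const_mul Q) (ae_of_all _ fun x => ?_)
  simp only [abs_mul]; rw [mul_comm]
  exact mul_le_mul_of_nonneg_right (hk x) (abs_nonneg _)

lemma n1_add (hf : Integrable f) (hg : Integrable g) : n1 (fun x => f x + g x) ≤ n1 f + n1 g := by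
  rw [n1, n1, n1, ← integral_add hf.abs hg.abs]
  exact integral_mono_of_nonneg (ae_of_all _ fun x => abs_nonneg _) (hf.abs.add hg.abs) (ae_of_all _ fun x => abs_add_le _ _)

lemma n1_cmul (c : ℝ) (f : ℝ → ℝ) : n1 (fun x => c * f x) = |c| * n1 f := by
  simp only [n1, abs_mul]; exact integral_const_mul _ _

lemma TF.im (hf : Integrable f) (hc : Continuous k) (hk : ∀ x, |k x| ≤ Q) : Integrable (fun x => f x * k x) :=
  hf.mul_bdd hc.aestronglyMeasurable (ae_of_all _ hk)

lemma Mu.c0 (k : Mu Q) : Continuous k.k0 := continuous_iff_continuousAt.mpr fun x => (k.h0 x).continuousAt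

lemma Mu.c1 (k : Mu Q) : Continuous k.k1 := continuous_iff_continuousAt.mpr fun x => (k.h1 x).continuousAt

lemma Mu.c2 (k : Mu Q) : Continuous k.k2 := continuous_iff_continuousAt.mpr fun x => (k.h2 x).continuousAt

def TF.mulc {Q : ℝ} (θ : TF) (k : Mu Q) : TF where
  f0 := fun x => θ.f0 x * k.k0 x
  f1 := fun x => θ.f1 x * k.k0 x + θ.f0 x * k.k1 x
  f2 := fun x => (θ.f2 x * k.k0 x + 2 * (θ.f1 x * k.k1 x)) + θ.f0 x * k.k2 x
  f3 := fun x => (θ.f3 x * k.k0 x + 3 * (θ.f2 x * k.k1 x)) + (3 * (θ.f1 x * k.k2 x) + θ.f0 x * k.k3 x)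
  h0 := fun x => (θ.h0 x).fun_mul (k.h0 x)
  h1 := fun x => (((θ.h1 x).fun_mul (k.h0 x)).fun_add ((θ.h0 x).fun_mul (k.h1 x))).congr_deriv (by ring)
  h2 := fun x => ((((θ.h2 x).fun_mul (k.h0 x)).fun_add (((θ.h1 x).fun_mul (k.h1 x)).const_mul 2)).fun_add ((θ.h0 x).fun_mul (k.h2 x))).congr_deriv (by ring)
  c3 := by
    have := θ.c0; have := θ.c1; have := θ.c2; have := θ.c3; have := k.c0; have := k.c1; have := k.c2; have := k.c3
    fun_prop
  i0 := TF.im θ.i0 k.c0 k.b0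
  i1 := (TF.im θ.i1 k.c0 k.b0).add (TF.im θ.i0 k.c1 k.b1)
  i2 := ((TF.im θ.i2 k.c0 k.b0).add ((TF.im θ.i1 k.c1 k.b1).const_mul 2)).add (TF.im θ.i0 k.c2 k.b2)
  i3 := ((TF.im θ.i3 k.c0 k.b0).add ((TF.im θ.i2 k.c1 k.b1).const_mul 3)).add (((TF.im θ.i1 k.c2 k.b2).const_mul 3).add (TF.im θ.i0 k.c3 k.b3))

lemma TF.mulc_N (θ : TF) (k : Mu Q) : (θ.mulc k).N ≤ 6 * Q * θ.N := by
  have hQ : 0 ≤ Q := (abs_nonneg _).trans (k.b0 0)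
  have a00 := n1_mul θ.i0 k.b0; have a10 := n1_mul θ.i1 k.b0; have a20 := n1_mul θ.i2 k.b0; have a30 := n1_mul θ.i3 k.b0
  have a01 := n1_mul θ.i0 k.b1; have a11 := n1_mul θ.i1 k.b1; have a21 := n1_mul θ.i2 k.b1
  have a02 := n1_mul θ.i0 k.b2; have a12 := n1_mul θ.i1 k.b2; have a03 := n1_mul θ.i0 k.b3
  have j00 := TF.im θ.i0 k.c0 k.b0; have j10 := TF.im θ.i1 k.c0 k.b0; have j20 := TF.im θ.i2 k.c0 k.b0; have j30 := TF.im θ.i3 k.c0 k.b0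
  have j01 := TF.im θ.i0 k.c1 k.b1; have j11 := (TF.im θ.i1 k.c1 k.b1).const_mul 2; have j21 := (TF.im θ.i2 k.c1 k.b1).const_mul 3
  have j02 := TF.im θ.i0 k.c2 k.b2; have j12 := (TF.im θ.i1 k.c2 k.b2).const_mul 3; have j03 := TF.im θ.i0 k.c3 k.b3
  have e1 := n1_add j10 j01
  have e2 := (n1_add (j20.fun_add j11) j02).trans (add_le_add_left (n1_add j20 j11) _)
  have e3 := (n1_add (j30.fun_add j21) (j12.fun_add j03)).trans (add_le_add (n1_add j30 j21) (n1_add j12 j03))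
  rw [n1_cmul, abs_two] at e2
  rw [n1_cmul, n1_cmul, abs_of_pos (by norm_num : (0:ℝ) < 3)] at e3
  have p0 := mul_nonneg hQ (n1_nonneg θ.f0); have p1 := mul_nonneg hQ (n1_nonneg θ.f1); have p2 := mul_nonneg hQ (n1_nonneg θ.f2); have p3 := mul_nonneg hQ (n1_nonneg θ.f3)
  simp only [TF.N, TF.mulc] at *
  linarith

lemma TF.mulc_PS {θ : TF} (h : PS ρ θ) (k : Mu Q) : PS ρ (θ.mulc k) := fun x hx => h x (left_ne_zero_of_mul hx)

lemma zpow_der (z : ℂ) (hz : 0 < z.im) (m : ℕ) (c : ℂ) (s : ℝ) :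
    HasDerivAt (fun s : ℝ => c * ((z - s) ^ m)⁻¹) (m * c * ((z - s) ^ (m + 1))⁻¹) s := by
  have hne : z - s ≠ 0 := sub_ne hz s
  have h1 : HasDerivAt (fun s : ℝ => z - s) (-1) s := by simpa using (ofRealCLM.hasDerivAt (x := s)).const_sub z
  refine (((h1.fun_pow m).fun_inv (pow_ne_zero _ hne)).const_mul c).congr_deriv ?_
  rcases m with _ | m
  · simp
  · simp only [Nat.add_sub_cancel]; field_simp; ring

lemma inv_bd (z : ℂ) (hz : 0 < z.im) (hz1 : z.im ≤ 1) {m : ℕ} (hm : m ≤ 5) {c : ℝ} (hc : 0 ≤ c) (hc' : c ≤ 24) (s : ℝ) :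
    ‖(c : ℂ) * ((z - s) ^ m)⁻¹‖ ≤ 24 * (z.im ^ 5)⁻¹ := by
  rw [norm_mul, norm_inv, norm_pow, norm_real, norm_of_nonneg hc]
  refine mul_le_mul hc' (inv_anti₀ (by positivity) ?_) (by positivity) (by norm_num)
  exact (pow_le_pow_of_le_one hz.le hz1 hm).trans (pow_le_pow_left₀ hz.le (im_le_norm_sub z s) m)

def Mu.inv (z : ℂ) (hz : 0 < z.im) (hz1 : z.im ≤ 1) (l : ℂ →L[ℝ] ℝ) (hl : ∀ w, |l w| ≤ ‖w‖) : Mu (24 * (z.im ^ 5)⁻¹) where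
  k0 := fun s => l (((1 : ℝ) : ℂ) * ((z - s) ^ 2)⁻¹)
  k1 := fun s => l (((2 : ℝ) : ℂ) * ((z - s) ^ 3)⁻¹)
  k2 := fun s => l (((6 : ℝ) : ℂ) * ((z - s) ^ 4)⁻¹)
  k3 := fun s => l (((24 : ℝ) : ℂ) * ((z - s) ^ 5)⁻¹)
  h0 := fun s => l.hasFDerivAt.comp_hasDerivAt s ((zpow_der z hz 2 _ s).congr_deriv (by push_cast; ring))
  h1 := fun s => l.hasFDerivAt.comp_hasDerivAt s ((zpow_der z hz 3 _ s).congr_deriv (by push_cast; ring))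
  h2 := fun s => l.hasFDerivAt.comp_hasDerivAt s ((zpow_der z hz 4 _ s).congr_deriv (by push_cast; ring))
  c3 := l.continuous.comp (continuous_iff_continuousAt.mpr fun s => (zpow_der z hz 5 _ s).continuousAt)
  b0 := fun s => (hl _).trans (inv_bd z hz hz1 (by norm_num) (by norm_num) (by norm_num) s)
  b1 := fun s => (hl _).trans (inv_bd z hz hz1 (by norm_num) (by norm_num) (by norm_num) s)
  b2 := fun s => (hl _).trans (inv_bd z hz hz1 (by norm_num) (by norm_num) (by norm_num) s)
  b3 := fun s => (hl _).trans (inv_bd z hz hz1 (by norm_num) (by norm_num) (by norm_num) s)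

lemma bump_PS (h0 : 0 < r) (hR : r < R) : ∃ θ : TF, PS R θ ∧ (∀ x, |x| ≤ r → θ.f0 x = 1) ∧ ∀ x, 0 ≤ θ.f0 x ∧ θ.f0 x ≤ 1 := by
  let θ : ContDiffBump (0 : ℝ) := ⟨r, R, h0, hR⟩
  refine ⟨TF.of θ θ.contDiff θ.hasCompactSupport, fun x hx => ?_, fun x hx => θ.one_of_mem_closedBall (by simpa using hx), fun x => ⟨θ.nonneg, θ.le_one⟩⟩
  have : x ∈ Function.support θ := hx
  rw [θ.support_eq] at this
  simpa using (mem_ball.mp this).le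

lemma gW {R1 R2 : ℝ} (h0 : 0 < R2) (hR : R2 < R1) : ∃ C, 0 ≤ C ∧ ∀ (W : ℝ → ℝ) (M κ : ℝ), Bd M W → 0 ≤ κ →
    (∀ ψ, PS R1 ψ → |∫ x, ψ.f0 x * W x| ≤ κ * ψ.N) → ∀ x v : ℝ, |x| ≤ R2 → 0 < v → v ≤ 1 →
    ‖gC W (x + v * I)‖ ≤ C * (M + κ * (v ^ 5)⁻¹) := by
  obtain ⟨θ, hθ, h1, h01⟩ := bump_PS (r := (R1 + R2) / 2) (R := R1) (by linarith) (by linarith)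
  have hN : 0 ≤ θ.N := by have := n1_nonneg θ.f0; have := n1_nonneg θ.f1; have := n1_nonneg θ.f2; have := n1_nonneg θ.f3; unfold TF.N; positivity
  set d := (R1 - R2) / 2 with hd
  have hd0 : 0 < d := by linarith
  refine ⟨(1 + 1 / d ^ 2) * π + 288 * θ.N, by positivity, fun W M κ hW hκ hw x v hx hv hv1 => ?_⟩
  have hM := hW.nonneg
  set z : ℂ := x + v * I with hz
  have hzi : z.im = v := line_im x v
  have hzr : z.re = x := line_re x v
  have hz0 : 0 < z.im := by rwa [hzi]
  have hz1 : z.im ≤ 1 := by rwa [hzi]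
  have cI := gC_integrable hW hz0
  have near : ∀ (l : ℂ →L[ℝ] ℝ) (hl : ∀ w, |l w| ≤ ‖w‖), |∫ s, θ.f0 s * l (((z - s) ^ 2)⁻¹) * W s| ≤ κ * (6 * (24 * (v ^ 5)⁻¹) * θ.N) := fun l hl => by
    have a := hw _ (TF.mulc_PS hθ (Mu.inv z hz0 hz1 l hl))
    have b := mul_le_mul_of_nonneg_left (TF.mulc_N θ (Mu.inv z hz0 hz1 l hl)) hκ
    have a := a.trans b
    simpa [TF.mulc, Mu.inv, hzi] using a
  have I1 : Integrable fun s : ℝ => (θ.f0 s : ℂ) * ((W s : ℂ) / (z - s) ^ 2) := cI.bdd_mul (c := 1) (continuous_ofReal.comp θ.c0).aestronglyMeasurable (ae_of_all _ fun s => by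
      rw [norm_real, norm_of_nonneg (h01 s).1]; exact (h01 s).2)
  have I2 : Integrable fun s : ℝ => ((1 - θ.f0 s : ℝ) : ℂ) * ((W s : ℂ) / (z - s) ^ 2) := cI.bdd_mul (c := 1) (continuous_ofReal.comp (continuous_const.sub θ.c0)).aestronglyMeasurable (ae_of_all _ fun s => by
      rw [norm_real, norm_of_nonneg (by linarith [h01 s])]; linarith [h01 s])
  have e : ∫ s : ℝ, (W s : ℂ) / (z - s) ^ 2 = (∫ s : ℝ, (θ.f0 s : ℂ) * ((W s : ℂ) / (z - s) ^ 2)) + ∫ s : ℝ, ((1 - θ.f0 s : ℝ) : ℂ) * ((W s : ℂ) / (z - s) ^ 2) := by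
    rw [← integral_add I1 I2]; congr 1; ext s; push_cast; ring
  have n1' : ‖∫ s : ℝ, (θ.f0 s : ℂ) * ((W s : ℂ) / (z - s) ^ 2)‖ ≤ 288 * θ.N * (κ * (v ^ 5)⁻¹) := by
    have r := near reCLM abs_re_le_norm
    have i := near imCLM abs_im_le_norm
    have er : (∫ s : ℝ, (θ.f0 s : ℂ) * ((W s : ℂ) / (z - s) ^ 2)).re = ∫ s, θ.f0 s * reCLM (((z - s) ^ 2)⁻¹) * W s := by
      rw [← RCLike.re_eq_complex_re, ← integral_re I1]; congr 1; ext s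
      rw [RCLike.re_eq_complex_re, re_ofReal_mul, div_eq_mul_inv, re_ofReal_mul, Complex.reCLM_apply]; ring
    have ei : (∫ s : ℝ, (θ.f0 s : ℂ) * ((W s : ℂ) / (z - s) ^ 2)).im = ∫ s, θ.f0 s * imCLM (((z - s) ^ 2)⁻¹) * W s := by
      rw [← RCLike.im_eq_complex_im, ← integral_im I1]; congr 1; ext s
      rw [RCLike.im_eq_complex_im, im_ofReal_mul, div_eq_mul_inv, im_ofReal_mul, Complex.imCLM_apply]; ring
    refine (Complex.norm_le_abs_re_add_abs_im _).trans ?_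
    rw [er, ei]; linarith
  have n2' : ‖∫ s : ℝ, ((1 - θ.f0 s : ℝ) : ℂ) * ((W s : ℂ) / (z - s) ^ 2)‖ ≤ (1 + 1 / d ^ 2) * π * M := by
    have := norm_integral_le_of_norm_le (f := fun s : ℝ => ((1 - θ.f0 s : ℝ) : ℂ) * ((W s : ℂ) / (z - s) ^ 2)) ((integrable_lor x one_pos).const_mul (M * (1 + 1 / d ^ 2))) (ae_of_all _ fun s => ?_)
    · rw [integral_const_mul, integral_lor x one_pos] at this
      refine this.trans (le_of_eq (by ring))
    · by_cases hs : |s| ≤ (R1 + R2) / 2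
      · rw [h1 s hs]; simp; positivity
      push Not at hs
      have hds : d ≤ |s - x| := by have := abs_sub_abs_le_abs_sub s x; linarith
      have hds2 : d ^ 2 ≤ (s - x) ^ 2 := by rw [← sq_abs (s - x)]; exact pow_le_pow_left₀ hd0.le hds 2
      have hq : 0 < (s - x) ^ 2 := lt_of_lt_of_le (by positivity) hds2
      rw [norm_mul, norm_div, norm_real, norm_real, norm_pow, norm_eq_abs, norm_eq_abs, normSq_sub, hzr, hzi, abs_of_nonneg (by linarith [h01 s])]
      calc (1 - θ.f0 s) * (|W s| / ((s - x) ^ 2 + v ^ 2)) ≤ 1 * (M / (s - x) ^ 2) := by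
            refine mul_le_mul (by linarith [h01 s]) (div_le_div₀ hM (hW.le s) hq (by nlinarith)) (by positivity) one_pos.le
        _ ≤ _ := by
            rw [one_mul, div_eq_mul_inv, mul_assoc]
            refine mul_le_mul_of_nonneg_left ?_ hM
            rw [← div_eq_mul_inv, inv_eq_one_div, div_le_div_iff₀ hq (by positivity), one_mul, add_mul, one_mul, one_div, one_pow]
            have : 1 ≤ (d ^ 2)⁻¹ * (s - x) ^ 2 := by rw [inv_mul_eq_div, one_le_div (by positivity)]; exact hds2
            linarith
  rw [gC, norm_mul, norm_neg, norm_div, norm_I, norm_real, norm_of_nonneg pi_pos.le, e]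
  have hp : 1 / π ≤ 1 := by rw [div_le_one pi_pos]; linarith [pi_gt_three]
  refine (mul_le_of_le_one_left (norm_nonneg _) hp).trans ((norm_add_le _ _).trans ((add_le_add n1' n2').trans ?_))
  have := pi_pos
  have : 0 ≤ (1 + 1 / d ^ 2) * π * (κ * (v ^ 5)⁻¹) := by positivity
  have : 0 ≤ 288 * θ.N * M := by positivity
  nlinarith

lemma int_sc (f : ℝ → ℝ) (x : ℝ) (hY : 0 < Y) : ∫ s, f ((s - x) / Y) = Y * ∫ s, f s := by
  rw [integral_sub_right_eq_self (fun s => f (s / Y)) x, Measure.integral_comp_div, abs_of_pos hY, smul_eq_mul]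

lemma n1_sc (f : ℝ → ℝ) (c x : ℝ) (hY : 0 < Y) : n1 (fun s => c * f ((s - x) / Y)) = |c| * Y * n1 f := by
  rw [n1_cmul, n1, int_sc (fun s => |f s|) x hY, n1, mul_assoc]

def TF.sc (ψ : TF) (c x Y : ℝ) (hY : 0 < Y) : TF :=
  have hd : ∀ s, HasDerivAt (fun s : ℝ => (s - x) / Y) (1 / Y) s := fun s => ((hasDerivAt_id' s).sub_const x).div_const Y
  have hi : ∀ (c : ℝ) (f : ℝ → ℝ), Integrable f → Integrable (fun s => c * f ((s - x) / Y)) := fun c f hf => ((hf.comp_div hY.ne').comp_sub_right x).const_mul c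
  { f0 := fun s => c * ψ.f0 ((s - x) / Y)
    f1 := fun s => c / Y * ψ.f1 ((s - x) / Y)
    f2 := fun s => c / Y ^ 2 * ψ.f2 ((s - x) / Y)
    f3 := fun s => c / Y ^ 3 * ψ.f3 ((s - x) / Y)
    h0 := fun s => (((ψ.h0 _).comp s (hd s)).const_mul c).congr_deriv (by ring)
    h1 := fun s => (((ψ.h1 _).comp s (hd s)).const_mul (c / Y)).congr_deriv (by field_simp)
    h2 := fun s => (((ψ.h2 _).comp s (hd s)).const_mul (c / Y ^ 2)).congr_deriv (by field_simp)
    c3 := by have := ψ.c3; fun_prop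
    i0 := hi _ _ ψ.i0, i1 := hi _ _ ψ.i1, i2 := hi _ _ ψ.i2, i3 := hi _ _ ψ.i3 }

def TF.d2 (ψ : TF) (r : ℝ) : TF :=
  have hd : ∀ (f g : ℝ → ℝ), (∀ x, HasDerivAt f (g x) x) → ∀ s, HasDerivAt (D2 f r) (D2 g r s) s := fun f g h s =>
    (((h s).const_mul 2).fun_sub ((h (s + r)).comp_add_const s r)).fun_sub ((h (s - r)).comp_sub_const s r)
  { f0 := D2 ψ.f0 r, f1 := D2 ψ.f1 r, f2 := D2 ψ.f2 r, f3 := D2 ψ.f3 r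
    h0 := hd _ _ ψ.h0, h1 := hd _ _ ψ.h1, h2 := hd _ _ ψ.h2
    c3 := by have := ψ.c3; unfold D2; fun_prop
    i0 := D2_int ψ.i0 r, i1 := D2_int ψ.i1 r, i2 := D2_int ψ.i2 r, i3 := D2_int ψ.i3 r }

lemma d2_N (ψ ψ2 : TF) (h0 : ψ2.f0 = ψ.f2) (h1 : ψ2.f1 = ψ.f3) (hr : 0 ≤ r) : (ψ.d2 r).N ≤ r ^ 2 * ψ2.N := by
  have a0 := n1_D2_le ψ.h0 ψ.h1 ψ.c2 ψ.i0 ψ.i1 ψ.i2 hr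
  have a1 := n1_D2_le ψ.h1 ψ.h2 ψ.c3 ψ.i1 ψ.i2 ψ.i3 hr
  have a2 := n1_D2_le ψ2.h0 ψ2.h1 ψ2.c2 ψ2.i0 ψ2.i1 ψ2.i2 hr
  have a3 := n1_D2_le ψ2.h1 ψ2.h2 ψ2.c3 ψ2.i1 ψ2.i2 ψ2.i3 hr
  simp only [h0, h1] at a2 a3
  simp only [TF.N, TF.d2, h0, h1]; linarith

lemma moll : ∃ ρ ρ2 : TF, ρ2.f0 = ρ.f2 ∧ ρ2.f1 = ρ.f3 ∧ (∀ x, 0 ≤ ρ.f0 x) ∧ ∫ x, ρ.f0 x = 1 ∧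
    ∀ x, (ρ.f0 x ≠ 0 ∨ ρ.f1 x ≠ 0 ∨ ρ.f2 x ≠ 0 ∨ ρ.f3 x ≠ 0) → |x| ≤ 1 := by
  let φ : ContDiffBump (0 : ℝ) := ⟨1 / 2, 1, by norm_num, by norm_num⟩
  have hs : ContDiff ℝ (⊤ : ℕ∞) (φ.normed volume) := φ.contDiff_normed
  have hc := φ.hasCompactSupport_normed (μ := volume)
  have hc2 : HasCompactSupport (iteratedDeriv 2 (φ.normed volume)) := by
    rw [iteratedDeriv_succ, iteratedDeriv_one]; exact hc.deriv.deriv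
  have hs2 : ContDiff ℝ (⊤ : ℕ∞) (iteratedDeriv 2 (φ.normed volume)) := by
    rw [iteratedDeriv_eq_iterate]; exact hs.iterate_deriv 2
  refine ⟨TF.of _ hs hc, TF.of _ hs2 hc2, rfl, ?_, φ.nonneg_normed, φ.integral_normed, fun x hx => ?_⟩
  · simp only [TF.of]; rw [iteratedDeriv_one, ← iteratedDeriv_succ]
  · by_contra hn
    push Not at hn
    have ev : φ.normed volume =ᶠ[𝓝 x] fun _ => 0 := by
      filter_upwards [(isOpen_lt continuous_const continuous_abs).mem_nhds (show (1:ℝ) < |x| from hn)] with y hy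
      by_contra h
      have : y ∈ Function.support (φ.normed volume) := h
      rw [φ.support_normed_eq] at this
      have h1 : |y| < 1 := by simpa using this
      exact absurd h1 (not_lt.mpr (le_of_lt hy))
    have := ev.eq_of_nhds
    have h1 : deriv (φ.normed volume) x = 0 := by rw [ev.deriv_eq]; simp
    have h2 := ev.iteratedDeriv_eq 2; have h3 := ev.iteratedDeriv_eq 3
    simp [TF.of, this, h1, h2, h3] at hx

lemma TT_N (hα : α ∈ Ioo 0 2) (hb : Bd M b) (ψ : TF) :
    |TT α μ b ψ| ≤ (M ^ 2 + |μ| * (4 * M * cα α)) * ψ.N := by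
  have hM := hb.nonneg
  have q := (abs_im_le_norm _).trans (Qf_bound hb ψ one_pos)
  have l := mul_le_mul_of_nonneg_left (LLf_bound hα hb ψ) (abs_nonneg μ)
  have p0 := n1_nonneg ψ.f0; have p1 := n1_nonneg ψ.f1; have p2 := n1_nonneg ψ.f2; have p3 := n1_nonneg ψ.f3
  have hc := cα_nonneg α
  have hk : 0 ≤ |μ| * (M * cα α) := by positivity
  rw [TT]
  refine (abs_sub _ _).trans ?_
  rw [abs_mul, abs_div, abs_two]
  have e1 : |(Qf b ψ 0 1).im| / 2 ≤ M ^ 2 * ψ.N := by unfold TF.N; rw [div_le_iff₀ two_pos]; refine q.trans (le_of_eq (by ring))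
  have e2 : |μ| * ((M * (4 * n1 ψ.f0) + M * n1 ψ.f2) * cα α) ≤ |μ| * (4 * M * cα α) * ψ.N := by
    unfold TF.N; nlinarith [mul_nonneg hk p1, mul_nonneg hk p2, mul_nonneg hk p3]
  linarith

lemma avg (ρ : TF) (hρ0 : ∀ x, 0 ≤ ρ.f0 x) (hρ1 : ∫ x, ρ.f0 x = 1) (hρ : PS 1 ρ) (hc : Continuous b) (hy : 0 < y) (hn : 0 ≤ n)
    (h : ∀ h, |h| ≤ y → |(fwdDiff h)^[15] b x| ≤ n * |h| ^ 15) (hb : Bd M b) :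
    |b x - ∑ k ∈ Finset.range 15, ((-1 : ℝ) ^ (14 - k) * (Nat.choose 15 (k + 1))) * ∫ s, (ρ.sc ((k + 1) * y)⁻¹ x ((k + 1) * y) (by positivity)).f0 s * b s| ≤ n * y ^ 15 := by
  have e : ∀ k : ℕ, ∫ s, (ρ.sc ((k + 1) * y)⁻¹ x ((k + 1) * y) (by positivity)).f0 s * b s = ∫ σ, ρ.f0 σ * b (x + (k + 1) * y * σ) := fun k => by
    have hY : 0 < (k + 1) * y := by positivity
    have := int_sc (fun σ => ρ.f0 σ * b (x + (k + 1) * y * σ)) x hY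
    rw [← mul_right_inj' hY.ne', ← this, ← integral_const_mul]
    congr 1; ext s
    rw [mul_div_cancel₀ _ hY.ne']; simp only [TF.sc]
    rw [add_sub_cancel]; field_simp
  have I : ∀ c : ℝ, Integrable fun σ => ρ.f0 σ * b (x + c * σ) := fun c =>
    ρ.i0.mul_bdd (c := M) (by fun_prop) (ae_of_all _ fun σ => hb.le _)
  have ident : ∫ σ, ρ.f0 σ * (fwdDiff (y * σ))^[15] b x = (∑ k ∈ Finset.range 15, ((-1 : ℝ) ^ (14 - k) * (Nat.choose 15 (k + 1))) * ∫ σ, ρ.f0 σ * b (x + (k + 1) * y * σ)) - b x := by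
    have : ∀ σ, ρ.f0 σ * (fwdDiff (y * σ))^[15] b x = (∑ k ∈ Finset.range 15, ((-1 : ℝ) ^ (14 - k) * (Nat.choose 15 (k + 1))) * (ρ.f0 σ * b (x + (k + 1) * y * σ))) - ρ.f0 σ * b x := fun σ => by
      rw [fwdDiff_iter_eq_sum_shift, Finset.sum_range_succ', mul_add, Finset.mul_sum, sub_eq_add_neg]
      congr 1
      · refine Finset.sum_congr rfl fun k hk => ?_
        simp only [zsmul_eq_mul, nsmul_eq_mul]
        rw [show 15 - (k + 1) = 14 - k by omega]; push_cast
        rw [show x + ((k : ℝ) + 1) * (y * σ) = x + (k + 1) * y * σ by ring]; ring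
      · simp
    simp_rw [this]
    rw [integral_sub (integrable_finsetSum _ fun k _ => (I _).const_mul _) (ρ.i0.mul_const _), integral_finsetSum _ fun k _ => (I _).const_mul _, integral_mul_const, hρ1, one_mul]
    simp_rw [integral_const_mul]
  simp_rw [e]
  rw [abs_sub_comm, ← ident]
  have := norm_integral_le_of_norm_le (f := fun σ => ρ.f0 σ * (fwdDiff (y * σ))^[15] b x) (ρ.i0.const_mul (n * y ^ 15)) (ae_of_all _ fun σ => ?_)
  · rwa [integral_const_mul, hρ1, mul_one] at this
  · rw [norm_mul, norm_of_nonneg (hρ0 σ), mul_comm]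
    rcases eq_or_ne (ρ.f0 σ) 0 with h0 | h0
    · simp [h0]
    refine mul_le_mul_of_nonneg_right ?_ (hρ0 σ)
    have h1 : |y * σ| ≤ y := by rw [abs_mul, abs_of_pos hy]; exact mul_le_of_le_one_right hy.le (hρ σ h0)
    exact (h _ h1).trans (mul_le_mul_of_nonneg_left (pow_le_pow_left₀ (abs_nonneg _) h1 _) hn)

lemma gC_sub {M' : ℝ} {a : ℝ → ℝ} (ha : Bd M a) (hb : Bd M' b) (hz : 0 < z.im) : gC (fun x => b x - a x) z = gC b z - gC a z := by
  rw [gC, gC, gC, ← mul_sub, ← integral_sub (gC_integrable hb hz) (gC_integrable ha hz)]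
  congr 2; ext s; push_cast; ring

lemma Bd.sub {M' : ℝ} {a : ℝ → ℝ} (ha : Bd M a) (hb : Bd M' b) : Bd (M + M') (fun x => b x - a x) :=
  ⟨hb.c.sub ha.c, fun x => (abs_sub _ _).trans (by linarith [ha.le x, hb.le x])⟩

lemma sc_sup {ρ : TF} (hρ : ∀ x, (ρ.f0 x ≠ 0 ∨ ρ.f1 x ≠ 0 ∨ ρ.f2 x ≠ 0 ∨ ρ.f3 x ≠ 0) → |x| ≤ 1) {c : ℝ} (hY : 0 < Y) (hx : |x| ≤ R) (s : ℝ)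
    (h : (ρ.sc c x Y hY).f0 s ≠ 0 ∨ (ρ.sc c x Y hY).f1 s ≠ 0 ∨ (ρ.sc c x Y hY).f2 s ≠ 0 ∨ (ρ.sc c x Y hY).f3 s ≠ 0) : |s| ≤ R + Y := by
  have := hρ ((s - x) / Y) (by
    rcases h with h | h | h | h <;> simp only [TF.sc] at h
    · exact Or.inl (right_ne_zero_of_mul h)
    · exact Or.inr (Or.inl (right_ne_zero_of_mul h))
    · exact Or.inr (Or.inr (Or.inl (right_ne_zero_of_mul h)))
    · exact Or.inr (Or.inr (Or.inr (right_ne_zero_of_mul h))))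
  rw [abs_div, abs_of_pos hY, div_le_one hY] at this
  have := abs_add_le (s - x) x; rw [sub_add_cancel] at this; linarith

set_option maxHeartbeats 600000 in
lemma TTsc {α μ M n R' d K0 : ℝ} (hα : α ∈ Ioo 0 2) (hR : 0 < R') (hd : 0 < d) (hK : 0 ≤ K0) (hn : 0 ≤ n) (hM : 0 ≤ M)
    (ρ ρ2 : TF) (h20 : ρ2.f0 = ρ.f2) (h21 : ρ2.f1 = ρ.f3) (hρ : ∀ x, (ρ.f0 x ≠ 0 ∨ ρ.f1 x ≠ 0 ∨ ρ.f2 x ≠ 0 ∨ ρ.f3 x ≠ 0) → |x| ≤ 1) :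
    ∃ K', 0 ≤ K' ∧ ∀ a b : ℝ → ℝ, Bd M a → Bd M b → RR n (R' + d) a → ∀ (κ x Y : ℝ) (hY : 0 < Y), 0 ≤ κ → (∀ ψ, PS (R' + 2 * d) ψ → |∫ x, ψ.f0 x * (b x - a x)| ≤ κ * ψ.N) →
      Y < 1 → Y ≤ d → κ ≤ K0 * Y ^ 15 → |x| ≤ R' → |TT α μ b (ρ.sc Y⁻¹ x Y hY)| ≤ K' := by
  obtain ⟨C, hC0, hC⟩ := gW (R1 := R' + 2 * d) (R2 := R' + d) (by linarith) (by linarith)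
  have p0 := n1_nonneg ρ.f0; have p1 := n1_nonneg ρ.f1; have p2 := n1_nonneg ρ.f2; have p3 := n1_nonneg ρ.f3
  have q0 := n1_nonneg ρ2.f0; have q1 := n1_nonneg ρ2.f1; have q2 := n1_nonneg ρ2.f2; have q3 := n1_nonneg ρ2.f3
  have hc := cα_nonneg α
  have hN2 : 0 ≤ ρ2.N := by unfold TF.N; positivity
  have hN : 0 ≤ ρ.N := by unfold TF.N; positivity
  set G := (2 * n + 2 * M) + (2 * n + 8 * M) + C * ((M + M) + K0) with hG
  set A2 := n * n1 ρ.f0 + K0 * ρ2.N + 4 * M * n1 ρ.f0 / d ^ 2 with hA2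
  have hA20 : 0 ≤ A2 := by positivity
  refine ⟨G ^ 2 * ρ.N + M ^ 2 * n1 ρ.f3 + |μ| * ((4 * M * n1 ρ.f0 + A2) * cα α), by positivity, fun a b ha hb hr κ x Y hY hκ0 hκ hY1 hYd hκY hx => ?_⟩
  set ψ := ρ.sc Y⁻¹ x Y hY with hψ
  have hsup : ∀ s, (ψ.f0 s ≠ 0 ∨ ψ.f1 s ≠ 0 ∨ ψ.f2 s ≠ 0 ∨ ψ.f3 s ≠ 0) → |s| ≤ R' + Y := sc_sup hρ hY hx
  have m0 : n1 ψ.f0 = n1 ρ.f0 := by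
    rw [hψ]; simp only [TF.sc]; rw [n1_sc _ _ _ hY, abs_of_pos (by positivity)]; field_simp
  have m1 : Y * n1 ψ.f1 = n1 ρ.f1 := by
    rw [hψ]; simp only [TF.sc]; rw [n1_sc _ _ _ hY, abs_of_pos (by positivity)]; field_simp
  have m2 : Y ^ 2 * n1 ψ.f2 = n1 ρ.f2 := by
    rw [hψ]; simp only [TF.sc]; rw [n1_sc _ _ _ hY, abs_of_pos (by positivity)]; field_simp
  have m3 : Y ^ 3 * n1 ψ.f3 = n1 ρ.f3 := by
    rw [hψ]; simp only [TF.sc]; rw [n1_sc _ _ _ hY, abs_of_pos (by positivity)]; field_simp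
  have hY3 : Y ^ 3 < Y := by nlinarith [pow_lt_one₀ hY.le hY1 two_ne_zero]
  have hQ : ‖Qf b ψ 0 1‖ ≤ G ^ 2 * ρ.N + M ^ 2 * n1 ρ.f3 := by
    rw [Qf_indep hb ψ one_pos hY]
    refine (Qf_boundK hb ψ (Y := Y) (v0 := Y ^ 3) (A := G ^ 2) hY (by positivity) hY3.le (by positivity) (fun s v hv hvY hs => ?_) (Or.inr hY3)).trans
      (le_of_eq (by rw [m0, m1, m2, m3, TF.N, mul_assoc (M ^ 2), m3]))
    have hv0 : 0 < v := lt_trans (by positivity) hv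
    have hz : 0 < ((s : ℂ) + v * I).im := by rw [line_im]; exact hv0
    have e1 := hC _ _ κ (ha.sub hb) hκ0 hκ s v (by linarith [hsup s hs]) hv0 (by linarith)
    rw [gC_sub ha hb hz] at e1
    have e2 := g_K ha (hr.rg s (by linarith [hsup s hs])) hv0
    have e3 : κ * (v ^ 5)⁻¹ ≤ K0 := by
      rw [← div_eq_mul_inv, div_le_iff₀ (by positivity)]
      refine hκY.trans (mul_le_mul_of_nonneg_left ?_ hK)
      calc Y ^ 15 = (Y ^ 3) ^ 5 := by ring
        _ ≤ v ^ 5 := pow_le_pow_left₀ (by positivity) hv.le 5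
    have e4 := mul_le_mul_of_nonneg_left (add_le_add_right e3 (M + M)) hC0
    rw [GC, norm_pow]
    refine pow_le_pow_left₀ (norm_nonneg _) ?_ 2
    have e5 := norm_add_le (gC b (s + v * I) - gC a (s + v * I)) (gC a (s + v * I))
    rw [sub_add_cancel] at e5
    linarith
  have crude : ∀ r, |∫ s, b s * D2 ψ.f0 r s| ≤ 4 * M * n1 ρ.f0 := fun r => by
    rw [D2_symm hb ψ.i0, ← m0]; exact int_le ψ.i0 fun x _ => D2_le4 hb r x
  set ψ2 := ρ2.sc (Y ^ 3)⁻¹ x Y hY with hψ2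
  have hL := LLf_le hα (b := b) (f := ψ.f0) (A0 := 4 * M * n1 ρ.f0) (A2 := A2) (by positivity) hA20 (fun r _ => crude r) (fun r hr0 hr1 => by
    rcases le_or_gt r d with hrd | hrd
    · have e1 : |∫ s, a s * D2 ψ.f0 r s| ≤ n * r ^ 2 * n1 ψ.f0 := by
        rw [D2_symm ha ψ.i0]
        refine int_le ψ.i0 fun s hs => (hr.rg s ?_).b r (by rwa [abs_of_pos hr0])
        linarith [hsup s (Or.inl hs)]
      have e2 := hκ (ψ.d2 r) (fun s hs => by
        simp only [TF.d2, D2] at hs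
        by_contra hn
        push Not at hn
        have k : ∀ u, R' + Y < |u| → ψ.f0 u = 0 := fun u hu => by
          by_contra h; exact absurd (hsup u (Or.inl h)) (not_le.mpr hu)
        refine hs ?_
        have a1 := abs_sub_abs_le_abs_sub s (-r); have a2 := abs_sub_abs_le_abs_sub s r
        rw [abs_neg, abs_of_pos hr0, sub_neg_eq_add] at a1; rw [abs_of_pos hr0] at a2
        rw [k s (by linarith), k (s + r) (by linarith), k (s - r) (by linarith)]; simp)
      have e3 := d2_N ψ ψ2 (by rw [hψ, hψ2]; simp only [TF.sc, h20]; ext s; field_simp) (by rw [hψ, hψ2]; simp only [TF.sc, h21]; ext s; field_simp) hr0.le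
      have e4 : κ * ψ2.N ≤ K0 * ρ2.N := by
        have k : ∀ c : ℝ, 0 ≤ c → c ≤ (Y ^ 5)⁻¹ * Y⁻¹ → ∀ f, κ * n1 (fun s => c * f ((s - x) / Y)) ≤ K0 * n1 f := fun c hc0 hc f => by
          rw [n1_sc _ _ _ hY, abs_of_nonneg hc0, ← mul_assoc]
          refine mul_le_mul_of_nonneg_right ?_ (n1_nonneg f)
          calc κ * (c * Y) ≤ (K0 * Y ^ 15) * (((Y ^ 5)⁻¹ * Y⁻¹) * Y) := by gcongr
            _ = K0 * Y ^ 10 := by field_simp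
            _ ≤ K0 := mul_le_of_le_one_right hK (pow_le_one₀ hY.le hY1.le)
        have kk : ∀ j : ℕ, j ≤ 3 → (Y ^ 3)⁻¹ / Y ^ j ≤ (Y ^ 5)⁻¹ * Y⁻¹ := fun j hj => by
          rw [div_eq_mul_inv, ← mul_inv, ← mul_inv, ← pow_add, ← pow_succ]
          exact inv_anti₀ (by positivity) (pow_le_pow_of_le_one hY.le hY1.le (by omega))
        have k0 := k ((Y ^ 3)⁻¹) (by positivity) (by simpa using kk 0 (by norm_num)) ρ2.f0
        have k1 := k ((Y ^ 3)⁻¹ / Y) (by positivity) (by simpa using kk 1 (by norm_num)) ρ2.f1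
        have k2 := k _ (by positivity) (kk 2 (by norm_num)) ρ2.f2
        have k3 := k _ (by positivity) (kk 3 (by norm_num)) ρ2.f3
        rw [hψ2]; simp only [TF.N, TF.sc]; linarith
      have e5 : ∫ s, b s * D2 ψ.f0 r s = ∫ s, a s * D2 ψ.f0 r s + (ψ.d2 r).f0 s * (b s - a s) := by
        congr 1; ext s; simp only [TF.d2]; ring
      rw [e5, integral_add (bD2_int ha ψ.i0 r) (((bD2_int hb ψ.i0 r).sub (bD2_int ha ψ.i0 r)).congr (ae_of_all _ fun s => by simp only [TF.d2, Pi.sub_apply]; ring))]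
      refine (abs_add_le _ _).trans ?_
      have e6 := mul_le_mul_of_nonneg_left e3 hκ0
      have e7 := mul_le_mul_of_nonneg_left e4 (sq_nonneg r)
      have e8 : 0 ≤ r ^ 2 * (4 * M * n1 ρ.f0 / d ^ 2) := by positivity
      rw [m0] at e1
      have e9 : r ^ 2 * A2 = n * r ^ 2 * n1 ρ.f0 + r ^ 2 * (K0 * ρ2.N) + r ^ 2 * (4 * M * n1 ρ.f0 / d ^ 2) := by rw [hA2]; ring
      rw [mul_left_comm] at e6
      rw [e9]; linarith
    · refine (crude r).trans ?_
      have : 4 * M * n1 ρ.f0 ≤ r ^ 2 * (4 * M * n1 ρ.f0 / d ^ 2) := by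
        rw [mul_div_assoc', le_div_iff₀ (by positivity), mul_comm]
        exact mul_le_mul_of_nonneg_right (pow_le_pow_left₀ hd.le hrd.le 2) (by positivity)
      have e8 : 0 ≤ r ^ 2 * (n * n1 ρ.f0 + K0 * ρ2.N) := by positivity
      have e9 : r ^ 2 * A2 = r ^ 2 * (n * n1 ρ.f0 + K0 * ρ2.N) + r ^ 2 * (4 * M * n1 ρ.f0 / d ^ 2) := by rw [hA2]; ring
      rw [e9]; linarith)
  have q1 := (abs_im_le_norm (Qf b ψ 0 1)).trans hQ
  have q2 := mul_le_mul_of_nonneg_left hL (abs_nonneg μ)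
  rw [TT]
  refine (abs_sub _ _).trans ?_
  rw [abs_mul, abs_div, abs_two]
  linarith [abs_nonneg (Qf b ψ 0 1).im]

lemma gap (hα : α ∈ Ioo 0 2) (hR' : 0 < R') (hR : R' < R) (hM : 0 ≤ M) (hn : 0 ≤ n) :
    ∃ N, 0 ≤ N ∧ ∀ (B : ℝ → ℝ → ℝ) (a e : ℝ), a < e → (∀ τ ∈ Icc a e, Bd M (B τ)) → RR n R (B a) → RR n R (B e) →
      (∀ ψ, (∃ ρ < R, PS ρ ψ) → ∀ τ ∈ Icc a e, ∀ A, (∀ σ ∈ Icc a e, |TT α μ (B σ) ψ| ≤ A) → |∫ x, ψ.f0 x * (B τ x - B a x)| ≤ A * (e - a)) →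
      ∀ x, |x| ≤ R' → |B e x - B a x| ≤ N * (e - a) := by
  obtain ⟨ρ, ρ2, h20, h21, hρ0, hρ1, hρ⟩ := moll
  set d := (R - R') / 3 with hd
  have hd0 : 0 < d := by linarith
  have hc := cα_nonneg α
  set K0 := M ^ 2 + |μ| * (4 * M * cα α) with hK0
  have hK : 0 ≤ K0 := by positivity
  obtain ⟨K', hK', hT⟩ := TTsc (μ := μ) hα hR' hd0 hK hn hM ρ ρ2 h20 h21 hρ
  obtain ⟨y0, hy0, hy1, hyd⟩ : ∃ y0, 0 < y0 ∧ 15 * y0 < 1 ∧ 15 * y0 ≤ d := ⟨min (1 / 30) (d / 15), by positivity, by linarith [min_le_left (1 / 30) (d / 15)], by linarith [min_le_right (1 / 30) (d / 15)]⟩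
  set S := ∑ k ∈ Finset.range 15, |(-1 : ℝ) ^ (14 - k) * (Nat.choose 15 (k + 1))| with hS
  have hS0 : 0 ≤ S := Finset.sum_nonneg fun _ _ => abs_nonneg _
  refine ⟨2 * M / y0 ^ 15 + (2 * n + S * K'), by positivity, fun B a e hae hB hra hre hw x hx => ?_⟩
  have ia : a ∈ Icc a e := ⟨le_rfl, hae.le⟩
  have ie : e ∈ Icc a e := ⟨hae.le, le_rfl⟩
  have hδ : 0 < e - a := by linarith
  rcases lt_or_ge (y0 ^ 15) (e - a) with hbig | hsm
  · have h1 := ((hB a ia).sub (hB e ie)).le x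
    have h2 : 2 * M ≤ 2 * M / y0 ^ 15 * (e - a) := by
      rw [div_mul_eq_mul_div, le_div_iff₀ (by positivity)]; exact mul_le_mul_of_nonneg_left hbig.le (by positivity)
    have h3 : 0 ≤ (2 * n + S * K') * (e - a) := by positivity
    linarith
  obtain ⟨y, hy, hy15⟩ : ∃ y, 0 < y ∧ y ^ 15 = e - a := ⟨(e - a) ^ ((15 : ℕ) : ℝ)⁻¹, by positivity, Real.rpow_inv_natCast_pow hδ.le (by norm_num)⟩
  have hyy : y ≤ y0 := le_of_pow_le_pow_left₀ (n := 15) (by norm_num) hy0.le (by rw [hy15]; exact hsm)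
  have hκ : ∀ τ ∈ Icc a e, ∀ ψ, PS (R' + 2 * d) ψ → |∫ x, ψ.f0 x * (B τ x - B a x)| ≤ K0 * (e - a) * ψ.N := fun τ hτ ψ hψ => by
    have := hw ψ ⟨_, by rw [hd]; linarith, hψ⟩ τ hτ (K0 * ψ.N) fun σ hσ => TT_N hα (hB σ hσ) ψ
    linarith
  have hra' : RR n (R' + d) (B a) := ⟨fun x hx => hra.rg x (by linarith), fun x h hx => hra.fd x h (by linarith)⟩
  have key : ∀ k : ℕ, k < 15 → |(∫ s, (ρ.sc ((k + 1) * y)⁻¹ x ((k + 1) * y) (by positivity)).f0 s * B e s) - ∫ s, (ρ.sc ((k + 1) * y)⁻¹ x ((k + 1) * y) (by positivity)).f0 s * B a s| ≤ K' * (e - a) := fun k hk => by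
    have hk' : (k : ℝ) + 1 ≤ 15 := by exact_mod_cast hk
    have hkY : y ≤ (k + 1) * y := by nlinarith [(Nat.cast_nonneg k : (0 : ℝ) ≤ k)]
    have hkY' : (k + 1) * y ≤ 15 * y0 := by gcongr
    have hY : 0 < (k + 1) * y := by positivity
    set ψ := ρ.sc ((k + 1) * y)⁻¹ x ((k + 1) * y) hY with hψ
    have := hw ψ ⟨R' + (k + 1) * y, by linarith, fun s hs => sc_sup hρ hY hx s (Or.inl hs)⟩ e ie K' fun σ hσ =>
      hT (B a) (B σ) (hB a ia) (hB σ hσ) hra' (K0 * (e - a)) x _ hY (by positivity) (hκ σ hσ) (by linarith) (by linarith)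
        (mul_le_mul_of_nonneg_left (by rw [← hy15]; exact pow_le_pow_left₀ hy.le hkY 15) hK) hx
    rw [← integral_sub (ψ.i0.mul_bdd (hB e ie).c.aestronglyMeasurable (ae_of_all _ (hB e ie).le)) (ψ.i0.mul_bdd (hB a ia).c.aestronglyMeasurable (ae_of_all _ (hB a ia).le))]
    simpa only [mul_sub] using this
  have hρ' : PS 1 ρ := fun x hx => hρ x (Or.inl hx)
  have v1 := avg (x := x) ρ hρ0 hρ1 hρ' (hB e ie).c hy hn (fun h hh => hre.fd x h (by linarith) (by linarith)) (hB e ie)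
  have v2 := avg (x := x) ρ hρ0 hρ1 hρ' (hB a ia).c hy hn (fun h hh => hra.fd x h (by linarith) (by linarith)) (hB a ia)
  rw [hy15] at v1 v2
  have v3 : |(∑ k ∈ Finset.range 15, ((-1 : ℝ) ^ (14 - k) * (Nat.choose 15 (k + 1))) * ∫ s, (ρ.sc ((k + 1) * y)⁻¹ x ((k + 1) * y) (by positivity)).f0 s * B e s) -
      ∑ k ∈ Finset.range 15, ((-1 : ℝ) ^ (14 - k) * (Nat.choose 15 (k + 1))) * ∫ s, (ρ.sc ((k + 1) * y)⁻¹ x ((k + 1) * y) (by positivity)).f0 s * B a s| ≤ S * (K' * (e - a)) := by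
    rw [← Finset.sum_sub_distrib, hS, Finset.sum_mul]
    refine (Finset.abs_sum_le_sum_abs _ _).trans (Finset.sum_le_sum fun k hk => ?_)
    rw [← mul_sub, abs_mul]
    exact mul_le_mul_of_nonneg_left (key k (Finset.mem_range.mp hk)) (abs_nonneg _)
  have h4 : 0 ≤ 2 * M / y0 ^ 15 * (e - a) := by positivity
  have : |B e x - B a x| ≤ (2 * n + S * K') * (e - a) := by
    rw [abs_le] at v1 v2 v3 ⊢
    constructor <;> nlinarith [v1.1, v1.2, v2.1, v2.2, v3.1, v3.2]
  linarith

lemma L1' {K Z : Set ℝ} (hK : IsClosed K) {N : ℝ} (hd : ∀ τ ∈ K, HasDerivWithinAt f (f' τ) K τ) (hZ : volume Z = 0) (hZK : Z ⊆ K)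
    (hN : ∀ τ ∈ K, τ ∉ Z → f' τ ≤ N) (hg : ∀ a ∈ K, ∀ b ∈ K, a < b → (∀ c, a < c → c < b → c ∉ K) → f b - f a ≤ N * (b - a))
    (hs : s ∈ K) (ht : t ∈ K) (hst : s ≤ t) : f t - f s ≤ N * (t - s) := by
  suffices h : ∀ N', N < N' → f t - N' * t ≤ f s - N' * s by
    refine ge_of_tendsto (((continuous_id.mul continuous_const).tendsto N).mono_left (nhdsWithin_le_nhds (s := Ioi N))) ?_
    filter_upwards [self_mem_nhdsWithin] with N' h'; have := h N' h'; show f t - f s ≤ N' * (t - s); linarith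
  intro N' hN'
  by_contra hlt
  push Not at hlt
  set g := fun τ => f τ - N' * τ with hgd
  have hgK : ∀ τ ∈ K, HasDerivWithinAt g (f' τ - N') K τ := fun τ hτ =>
    ((hd τ hτ).fun_sub ((hasDerivAt_id' τ).const_mul N').hasDerivWithinAt).congr_deriv (by ring)
  have hgc : ContinuousOn g K := fun τ hτ => (hgK τ hτ).continuousWithinAt
  have hnull : volume (g '' Z) = 0 := addHaar_image_eq_zero_of_differentiableOn_of_addHaar_eq_zero volume
    (fun τ hτ => ((hgK τ (hZK hτ)).mono hZK).differentiableWithinAt) hZ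
  obtain ⟨c, ⟨hc1, hc2⟩, hcZ⟩ : ∃ c, c ∈ Ioo (g s) (g t) ∧ c ∉ g '' Z := by
    by_contra h
    push Not at h
    have : volume (Ioo (g s) (g t)) = 0 := measure_mono_null h hnull
    rw [Real.volume_Ioo, ENNReal.ofReal_eq_zero] at this
    linarith [show g s < g t from hlt]
  set S := {τ | τ ∈ K ∩ Icc s t ∧ g τ ≤ c} with hS
  have hScl : IsClosed S := (hgc.mono Set.inter_subset_left).preimage_isClosed_of_isClosed (hK.inter isClosed_Icc) isClosed_Iic
  have hSb : BddAbove S := ⟨t, fun τ h => h.1.2.2⟩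
  have hSn : S.Nonempty := ⟨s, ⟨hs, le_rfl, hst⟩, hc1.le⟩
  have hu := hScl.csSup_mem hSn hSb
  set u := sSup S with hud
  have hut : u < t := lt_of_le_of_ne hu.1.2.2 fun h => by have := hu.2; rw [h] at this; linarith
  have hab : ∀ τ ∈ K, u < τ → τ ≤ t → c < g τ := fun τ hτ h1 h2 => by
    by_contra h
    exact absurd (le_csSup hSb ⟨⟨hτ, hu.1.2.1.trans h1.le, h2⟩, not_lt.mp h⟩) (not_le.mpr h1)
  set V := {τ | τ ∈ K ∧ u < τ ∧ τ ≤ t} with hV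
  have hVn : V.Nonempty := ⟨t, ht, hut, le_rfl⟩
  have hVb : BddBelow V := ⟨u, fun τ h => h.2.1.le⟩
  have hw := csInf_mem_closure hVn hVb
  have huw : u ≤ sInf V := le_csInf hVn fun τ h => h.2.1.le
  have hwt : sInf V ≤ t := csInf_le hVb ⟨ht, hut, le_rfl⟩
  have hwK : sInf V ∈ K := hK.closure_subset_iff.mpr (fun _ h => h.1) hw
  rcases huw.lt_or_eq with h | h
  · have h1 := hg u hu.1.1 _ hwK h fun c h1 h2 hcK => absurd (csInf_le hVb ⟨hcK, h1, h2.le.trans hwt⟩) (not_le.mpr h2)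
    have h2 := hab _ hwK h hwt
    have h3 : (N' - N) * (sInf V - u) > 0 := mul_pos (by linarith) (by linarith)
    have h4 := hu.2
    simp only [hgd] at h2 h4; linarith
  · rw [← h] at hw
    have hVK : V ⊆ K := fun _ h => h.1
    have : (𝓝[V] u).NeBot := mem_closure_iff_nhdsWithin_neBot.mp hw
    have hgu : c ≤ g u := ge_of_tendsto ((hgc u hu.1.1).mono hVK) (by filter_upwards [self_mem_nhdsWithin] with τ hτ using (hab τ hτ.1 hτ.2.1 hτ.2.2).le)
    have hd' := (hgK u hu.1.1).mono hVK
    rw [hasDerivWithinAt_iff_tendsto_slope' (fun h => lt_irrefl _ h.2.1)] at hd'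
    have h0 : 0 ≤ f' u - N' := ge_of_tendsto hd' (by
      filter_upwards [self_mem_nhdsWithin] with τ hτ
      rw [slope_def_field]
      exact div_nonneg (by linarith [hab τ hτ.1 hτ.2.1 hτ.2.2, hu.2]) (by linarith [hτ.2.1]))
    have huZ : u ∈ Z := by by_contra hz; linarith [hN u hu.1.1 hz]
    exact hcZ ⟨u, huZ, le_antisymm hu.2 hgu⟩

structure Sol (α μ : ℝ) (B J LB : ℝ → ℝ → ℝ) : Prop where
  a : α ∈ Ioo 0 2
  bs : ∀ t : ℝ, 0 < t → IsHilbertPV (J t) (deriv (B t))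
  lap : ∀ t : ℝ, 0 < t → IsFracLapPV α (B t) (LB t)
  eq : ∀ x : ℝ, ∀ t : ℝ, 0 < t → HasDerivAt (fun τ : ℝ => B τ x) (-(J t x * deriv (B t) x + μ * LB t x)) t
  sm : ∀ t : ℝ, ContDiff ℝ (⊤ : ℕ∞) (B t)
  ct : ∀ x, Continuous fun τ => B τ x
  bd : ∀ T : ℝ, ∃ M : ℝ, ∀ t ≤ T, Bd M (B t)
  it : ∀ t : ℝ, Integrable (B t)

section

variable {α μ : ℝ} {B J LB : ℝ → ℝ → ℝ}

lemma Sol.T_cont (h : Sol α μ B J LB) (ψ : TF) : Continuous fun t => TT α μ (B t) ψ := by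
  refine continuous_iff_continuousAt.mpr fun t => ?_
  obtain ⟨M, hM⟩ := h.bd (t + 1)
  have ev : ∀ᶠ s in 𝓝 t, Bd M (B s) := (eventually_lt_nhds (lt_add_one t)).mono fun s hs => hM s hs.le
  have q := Qf_cont ev (fun x => (h.ct x).tendsto t) ψ
  have l := LLf_cont h.a ev (fun x => (h.ct x).tendsto t) ψ
  exact (((continuous_im.tendsto _).comp q).div_const 2).sub (l.const_mul μ)

lemma Sol.F_cont (h : Sol α μ B J LB) (hf : Integrable f) : Continuous fun t => ∫ x, f x * B t x := by
  refine continuous_iff_continuousAt.mpr fun t => ?_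
  obtain ⟨M, hM⟩ := h.bd (t + 1)
  refine tendsto_integral_filter_of_dominated_convergence (fun x => M * |f x|) (Eventually.of_forall fun s => hf.1.mul (h.sm s).continuous.aestronglyMeasurable) ?_ (hf.abs.const_mul M)
    (ae_of_all _ fun x => ((h.ct x).tendsto t).const_mul _)
  filter_upwards [eventually_lt_nhds (lt_add_one t)] with s hs
  refine ae_of_all _ fun x => ?_
  rw [norm_mul, mul_comm]; exact mul_le_mul_of_nonneg_right ((hM s hs.le).le x) (abs_nonneg _)

def HH (α μ : ℝ) (B : ℝ → ℝ → ℝ) (ψ : TF) (t : ℝ) : ℝ := (∫ x, ψ.f0 x * B t x) - ∫ τ in 0..t, TT α μ (B τ) ψ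

lemma Sol.H_cont (h : Sol α μ B J LB) (ψ : TF) : Continuous (HH α μ B ψ) :=
  (h.F_cont ψ.i0).sub (intervalIntegral.continuous_primitive (fun a b => (h.T_cont ψ).intervalIntegrable a b) 0)

def gd (α μ : ℝ) (B : ℝ → ℝ → ℝ) (R t1 t : ℝ) : Prop := ∃ ε > 0, ∀ ψ, (∃ ρ < R, PS ρ ψ) → ∀ s τ, |s - t| < ε → |τ - t| < ε → t1 ≤ s → t1 ≤ τ → HH α μ B ψ s = HH α μ B ψ τ

lemma gd_open : IsOpen {t | gd α μ B R t1 t} := by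
  rw [Metric.isOpen_iff]
  rintro t ⟨ε, hε, H⟩
  refine ⟨ε / 2, by positivity, fun u hu => ⟨ε / 2, by positivity, fun ψ hψ s τ hs hτ => H ψ hψ s τ ?_ ?_⟩⟩
  all_goals
    rw [mem_ball, dist_eq] at hu
  · have := abs_sub_le s u t; linarith
  · have := abs_sub_le τ u t; linarith

lemma gd_const (h : Sol α μ B J LB) {a : ℝ} (ha : t1 ≤ a) (hg : ∀ t, a < t → t < e → gd α μ B R t1 t) {ψ : TF} (hψ : ∃ ρ < R, PS ρ ψ) {τ : ℝ} (has : a ≤ s) (hsτ : s ≤ τ) (hτ : τ ≤ e) :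
    HH α μ B ψ s = HH α μ B ψ τ := by
  rcases hsτ.eq_or_lt with rfl | hlt
  · rfl
  obtain ⟨c, -, hc⟩ := exists_hasDerivAt_eq_slope (HH α μ B ψ) (fun _ => 0) hlt (h.H_cont ψ).continuousOn fun u hu => by
    obtain ⟨ε, hε, H⟩ := hg u (by linarith [hu.1]) (by linarith [hu.2])
    have h1 := hu.1
    refine (hasDerivAt_const u (HH α μ B ψ u)).congr_of_eventuallyEq ?_
    filter_upwards [ball_mem_nhds u hε, lt_mem_nhds h1] with v hv hv1
    rw [mem_ball, dist_eq] at hv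
    exact H ψ hψ v u hv (by simpa using hε) (by linarith) (by linarith)
  rw [eq_comm, div_eq_zero_iff] at hc
  rcases hc with hc | hc <;> linarith

end

section

variable {α μ : ℝ} {B J LB : ℝ → ℝ → ℝ}

lemma RR_closed (h : Sol α μ B J LB) (n R : ℝ) : IsClosed {t | RR n R (B t)} := by
  have e : {t | RR n R (B t)} = {t | (∀ x, |x| ≤ R → (∀ r, |r| ≤ 1 → |B t (x + r) - B t x| ≤ n * |r|) ∧ (∀ r, |r| ≤ 1 → |D2 (B t) r x| ≤ n * r ^ 2)) ∧
      ∀ x h, |x| ≤ R → |h| ≤ 1 → |(fwdDiff h)^[15] (B t) x| ≤ n * |h| ^ 15} := by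
    ext t; exact ⟨fun H => ⟨fun x hx => ⟨(H.rg x hx).a, (H.rg x hx).b⟩, H.fd⟩, fun H => ⟨fun x hx => ⟨(H.1 x hx).1, (H.1 x hx).2⟩, H.2⟩⟩
  rw [e]
  simp only [Set.ofPred_and, Set.ofPred_forall]
  refine IsClosed.inter ?_ ?_
  · refine isClosed_iInter fun x => isClosed_iInter fun _ => IsClosed.inter ?_ ?_
    · exact isClosed_iInter fun r => isClosed_iInter fun _ => isClosed_le (((h.ct _).sub (h.ct _)).abs) continuous_const
    · exact isClosed_iInter fun r => isClosed_iInter fun _ => isClosed_le (((((h.ct _).const_mul 2).sub (h.ct _)).sub (h.ct _)).abs) continuous_const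
  · refine isClosed_iInter fun x => isClosed_iInter fun r => isClosed_iInter fun _ => isClosed_iInter fun _ => isClosed_le (Continuous.abs ?_) continuous_const
    simp only [fwdDiff_iter_eq_sum_shift]
    exact continuous_finsetSum _ fun k _ => (h.ct _).fun_const_smul _

lemma D_meas (h : Sol α μ B J LB) : Measurable fun p : ℝ × ℝ => if 0 < p.1 then -(J p.1 p.2 * deriv (B p.1) p.2 + μ * LB p.1 p.2) else 0 := by
  have hm : Measurable (Function.uncurry B) := measurable_uncurry_of_continuous_of_measurable h.ct fun t => (h.sm t).continuous.measurable
  refine measurable_of_tendsto_metrizable (f := fun (k : ℕ) (p : ℝ × ℝ) => if 0 < p.1 then ((k : ℝ) + 1) * (B (p.1 + 1 / ((k : ℝ) + 1)) p.2 - B p.1 p.2) else 0) (fun k => ?_) ?_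
  · refine Measurable.ite (measurableSet_lt measurable_const measurable_fst) ?_ measurable_const
    exact ((hm.comp ((measurable_fst.add_const _).prodMk measurable_snd)).sub hm).const_mul _
  · refine tendsto_pi_nhds.mpr fun p => ?_
    by_cases hp : 0 < p.1
    · simp only [hp, if_true]
      have := (h.eq p.2 p.1 hp).tendsto_slope_zero_right.comp ((tendsto_nhdsWithin_iff.mpr ⟨tendsto_one_div_add_atTop_nhds_zero_nat, Eventually.of_forall fun n => by show (0 : ℝ) < _; positivity⟩))
      refine this.congr fun k => ?_
      simp [smul_eq_mul]
    · simp [hp]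

lemma lipK (h : Sol α μ B J LB) {N1 N2 : ℝ} (h0 : 0 < R') (hR : R' < R) {K : Set ℝ} (hK : IsClosed K) (hpos : ∀ τ ∈ K, 0 < τ)
    (hT : ∀ τ ∈ K, ∀ ψ : TF, PS R ψ → |TT α μ (B τ) ψ| ≤ N1 * n1 ψ.f0)
    (hg : ∀ x, |x| ≤ R' → ∀ a ∈ K, ∀ b ∈ K, a < b → (∀ c, a < c → c < b → c ∉ K) → |B b x - B a x| ≤ N2 * (b - a)) :
    ∀ᵐ x, |x| < R' → ∀ s ∈ K, ∀ t ∈ K, |B t x - B s x| ≤ max N1 N2 * |t - s| := by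
  set D : ℝ → ℝ → ℝ := fun τ x => -(J τ x * deriv (B τ) x + μ * LB τ x) with hD
  have hsl : ∀ τ ∈ K, ∀ᵐ x, |x| < R' → |D τ x| ≤ N1 := fun τ hτ => by
    obtain ⟨M, hM⟩ := h.bd τ
    refine D_ae h0 hR fun ψ hψ => ?_
    obtain ⟨i, e⟩ := partB (μ := μ) h.a (hM τ le_rfl) (h.sm τ) (h.it τ) (h.bs τ (hpos τ hτ)) (h.lap τ (hpos τ hτ)) ψ hψ
    exact ⟨i, by rw [e]; exact hT τ hτ ψ hψ⟩
  set E : Set (ℝ × ℝ) := {p | p.2 ∈ K ∧ |p.1| < R' ∧ N1 < |if 0 < p.2 then D p.2 p.1 else 0|} with hE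
  have hEm : MeasurableSet E := (measurable_snd hK.measurableSet).inter ((measurableSet_lt measurable_fst.abs measurable_const).inter
    (measurableSet_lt measurable_const ((D_meas h).comp measurable_swap).abs))
  have hE0 : (volume : Measure (ℝ × ℝ)) E = 0 := by
    rw [Measure.volume_eq_prod, ← Measure.prod_swap, Measure.map_apply measurable_swap hEm, Measure.measure_prod_null (measurable_swap hEm)]
    refine ae_of_all _ fun τ => ?_
    by_cases hτ : τ ∈ K
    · refine measure_mono_null ?_ (hsl τ hτ)
      rintro x ⟨-, hx, hx2⟩
      simp only [Prod.swap, hpos τ hτ, if_true] at hx hx2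
      intro hh
      exact absurd (hh hx) (not_le.mpr hx2)
    · have : Prod.mk τ ⁻¹' (Prod.swap ⁻¹' E) = ∅ := by
        ext x; simp only [Set.mem_preimage, Set.mem_empty_iff_false, iff_false]; exact fun hh => hτ hh.1
      show volume (Prod.mk τ ⁻¹' (Prod.swap ⁻¹' E)) = 0
      rw [this]; simp
  have hae := Measure.measure_ae_null_of_prod_null (μ := volume) (ν := volume) (s := E) (by rw [← Measure.volume_eq_prod]; exact hE0)
  filter_upwards [hae] with x hx hxR
  set Z := Prod.mk x ⁻¹' E with hZ
  have hZK : Z ⊆ K := fun τ hτ => hτ.1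
  have hZn : ∀ τ ∈ K, τ ∉ Z → |D τ x| ≤ max N1 N2 := fun τ hτ hn => by
    refine le_trans ?_ (le_max_left _ _)
    by_contra hh
    exact hn ⟨hτ, hxR, by simp only [hpos τ hτ, if_true]; exact not_le.mp hh⟩
  have hdw : ∀ τ ∈ K, HasDerivWithinAt (fun τ => B τ x) (D τ x) K τ := fun τ hτ => (h.eq x τ (hpos τ hτ)).hasDerivWithinAt
  have hgg : ∀ a ∈ K, ∀ b ∈ K, a < b → (∀ c, a < c → c < b → c ∉ K) → |B b x - B a x| ≤ max N1 N2 * (b - a) := fun a ha b hb hab hc =>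
    (hg x hxR.le a ha b hb hab hc).trans (mul_le_mul_of_nonneg_right (le_max_right _ _) (by linarith))
  have key : ∀ s ∈ K, ∀ t ∈ K, s ≤ t → |B t x - B s x| ≤ max N1 N2 * (t - s) := fun s hs t ht hst => by
    have u1 := L1' (N := max N1 N2) hK hdw hx hZK (fun τ hτ hn => (abs_le.mp (hZn τ hτ hn)).2) (fun a ha b hb hab hc => (abs_le.mp (hgg a ha b hb hab hc)).2) hs ht hst
    have u2 := L1' (N := max N1 N2) hK (fun τ hτ => (hdw τ hτ).fun_neg) hx hZK (fun τ hτ hn => by linarith [(abs_le.mp (hZn τ hτ hn)).1])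
      (fun a ha b hb hab hc => by linarith [(abs_le.mp (hgg a ha b hb hab hc)).1]) hs ht hst
    exact abs_le.mpr ⟨by linarith, u1⟩
  intro s hs t ht
  rcases le_total s t with hst | hst
  · rw [abs_of_nonneg (by linarith : 0 ≤ t - s)]; exact key s hs t ht hst
  · rw [abs_sub_comm, abs_sub_comm t s, abs_of_nonneg (by linarith : 0 ≤ s - t)]; exact key t ht s hs hst

lemma F_deriv (h : Sol α μ B J LB) {N : ℝ} {K : Set ℝ} (hl : ∀ᵐ x, |x| < R' → ∀ s ∈ K, ∀ t ∈ K, |B t x - B s x| ≤ N * |t - s|) {ψ : TF} (hρ : ρ < R') (hψ : PS ρ ψ)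
    {τ : ℝ} (hτ : τ ∈ K) (hτ0 : 0 < τ) : HasDerivWithinAt (HH α μ B ψ) 0 K τ := by
  obtain ⟨M, hM⟩ := h.bd τ
  obtain ⟨-, e⟩ := partB (μ := μ) h.a (hM τ le_rfl) (h.sm τ) (h.it τ) (h.bs τ hτ0) (h.lap τ hτ0) ψ hψ
  have i : ∀ t, Integrable fun x => ψ.f0 x * B t x := fun t => by
    obtain ⟨M, hM⟩ := h.bd t
    exact ψ.i0.mul_bdd (hM t le_rfl).c.aestronglyMeasurable (ae_of_all _ (hM t le_rfl).le)
  have hF : HasDerivWithinAt (fun t => ∫ x, ψ.f0 x * B t x) (TT α μ (B τ) ψ) K τ := by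
    rw [hasDerivWithinAt_iff_tendsto_slope, ← e]
    have he : ∀ t, slope (fun t => ∫ x, ψ.f0 x * B t x) τ t = ∫ x, ψ.f0 x * slope (fun t => B t x) τ t := fun t => by
      rw [slope_def_field, ← integral_sub (i t) (i τ), ← integral_div]
      congr 1; ext x; rw [slope_def_field]; ring
    refine Tendsto.congr (fun t => (he t).symm) ?_
    refine tendsto_integral_filter_of_dominated_convergence (fun x => N * |ψ.f0 x|) (Eventually.of_forall fun t => ?_) ?_ (ψ.i0.abs.const_mul N) (ae_of_all _ fun x => ?_)
    · simp_rw [slope_def_field]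
      exact (ψ.c0.mul (((h.sm t).continuous.sub (h.sm τ).continuous).div_const _)).aestronglyMeasurable
    · filter_upwards [self_mem_nhdsWithin] with t ht
      filter_upwards [hl] with x hx
      rw [norm_mul, mul_comm]
      by_cases h0 : ψ.f0 x = 0
      · simp [h0]
      refine mul_le_mul_of_nonneg_right ?_ (abs_nonneg _)
      have hne : 0 < |t - τ| := abs_pos.mpr (sub_ne_zero.mpr ht.2)
      rw [slope_def_field, norm_div, norm_eq_abs, norm_eq_abs, div_le_iff₀ hne]
      exact hx (lt_of_le_of_lt (hψ x h0) hρ) τ hτ t ht.1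
    · have := (h.eq x τ hτ0).hasDerivWithinAt (s := K)
      rw [hasDerivWithinAt_iff_tendsto_slope] at this
      exact this.const_mul _
  have hI : HasDerivAt (fun t => ∫ τ in 0..t, TT α μ (B τ) ψ) (TT α μ (B τ) ψ) τ := ((h.T_cont ψ).integral_hasStrictDerivAt 0 τ).hasDerivAt
  exact (hF.fun_sub hI.hasDerivWithinAt).congr_deriv (sub_self _)

lemma all_good (h : Sol α μ B J LB) (hR : 0 < R) (ht1 : 0 < t1) (t : ℝ) : gd α μ B R t1 t := by
  by_contra hbad
  set C := {t | gd α μ B R t1 t}ᶜ with hC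
  have hCc : IsClosed C := gd_open.isClosed_compl
  have hC1 : ∀ u ∈ C, t1 ≤ u := fun u hu => by
    by_contra hlt
    push Not at hlt
    refine hu ⟨t1 - u, by linarith, fun ψ _ s τ hs _ h1 _ => ?_⟩
    have := (abs_lt.mp hs).2; linarith
  have : Nonempty C := ⟨⟨t, hbad⟩⟩
  have : CompleteSpace C := hCc.completeSpace_coe
  obtain ⟨n, ⟨⟨p, hpC⟩, hp⟩⟩ := nonempty_interior_of_iUnion_of_closed (f := fun n : ℕ => {t : C | RR n R (B t)})
    (fun n => (RR_closed h n R).preimage continuous_subtype_val) (Set.eq_univ_of_forall fun u => by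
      obtain ⟨n0, hn0⟩ := smooth_RR (h.sm u) R
      obtain ⟨n, hn⟩ := exists_nat_ge n0
      exact Set.mem_iUnion.mpr ⟨n, hn0 n hn⟩)
  rw [mem_interior_iff_mem_nhds, Metric.mem_nhds_iff] at hp
  obtain ⟨ε, hε, hpε⟩ := hp
  have hRR : ∀ u ∈ C, |u - p| < ε → RR n R (B u) := fun u hu hlt => hpε (show (⟨u, hu⟩ : C) ∈ ball ⟨p, hpC⟩ ε from hlt)
  set K := C ∩ Icc (p - ε / 2) (p + ε / 2) with hK
  have hKc : IsClosed K := hCc.inter isClosed_Icc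
  have hKR : ∀ u ∈ K, RR n R (B u) := fun u hu => hRR u hu.1 (by rw [abs_lt]; constructor <;> linarith [hu.2.1, hu.2.2])
  have hpos : ∀ u ∈ K, 0 < u := fun u hu => ht1.trans_le (hC1 u hu.1)
  have hgapK : ∀ a ∈ K, ∀ e ∈ K, a < e → (∀ c, a < c → c < e → c ∉ K) → ∀ c, a < c → c < e → gd α μ B R t1 c := fun a ha e he hae hc c h1 h2 => by
    by_contra hcc
    exact hc c h1 h2 ⟨hcc, by linarith [ha.2.1], by linarith [he.2.2]⟩
  obtain ⟨M, hM⟩ := h.bd (p + ε)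
  have hKM : ∀ u ≤ p + ε / 2, Bd M (B u) := fun u hu => hM u (by linarith)
  have hM0 : 0 ≤ M := (hKM p (by linarith)).nonneg
  have hH0 : ∀ ψ, (∃ ρ < R, PS ρ ψ) → ∀ s ∈ K, ∀ u ∈ K, s ≤ u → HH α μ B ψ s = HH α μ B ψ u := by
    rintro ψ ⟨ρ, hρR, hψ⟩
    obtain ⟨R', hR'0, hR'R⟩ := exists_between (max_lt hρR hR)
    have hR0 : 0 < R' := (le_max_right _ _).trans_lt hR'0
    obtain ⟨N2, hN2, hgap⟩ := gap (μ := μ) h.a hR0 hR'R hM0 (Nat.cast_nonneg n)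
    have hl := lipK (N1 := CK α μ M n) (N2 := N2) h hR0 hR'R hKc hpos
      (fun τ hτ ψ hψ => TT_K h.a (hKM τ hτ.2.2) (Nat.cast_nonneg n) ψ fun x hx => (hKR τ hτ).rg x (hψ x hx))
      (fun x hx a ha b hb hab hc => hgap B a b hab (fun τ hτ => hKM τ (hτ.2.trans hb.2.2)) (hKR a ha) (hKR b hb) (fun ψ hψ τ hτ A hA => by
        have e1 := gd_const h (hC1 a ha.1) (hgapK a ha b hb hab hc) hψ le_rfl hτ.1 hτ.2
        rw [HH, HH] at e1
        have e2 := intervalIntegral.integral_interval_sub_left (μ := volume) ((h.T_cont ψ).intervalIntegrable 0 τ) ((h.T_cont ψ).intervalIntegrable 0 a)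
        have e3 : ∫ x, ψ.f0 x * (B τ x - B a x) = ∫ σ in a..τ, TT α μ (B σ) ψ := by
          have i : ∀ t ≤ p + ε / 2, Integrable fun x => ψ.f0 x * B t x := fun t ht => ψ.i0.mul_bdd (hKM t ht).c.aestronglyMeasurable (ae_of_all _ (hKM t ht).le)
          simp_rw [mul_sub]
          rw [integral_sub (i τ (hτ.2.trans hb.2.2)) (i a ha.2.2)]; linarith
        have e4 := intervalIntegral.norm_integral_le_of_norm_le_const (a := a) (b := τ) (C := A) (f := fun σ => TT α μ (B σ) ψ) fun σ hσ => by
          rw [uIoc_of_le hτ.1] at hσ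
          exact hA σ ⟨hσ.1.le, hσ.2.trans hτ.2⟩
        rw [e3]
        refine e4.trans ?_
        rw [abs_of_nonneg (by linarith [hτ.1])]
        exact mul_le_mul_of_nonneg_left (by linarith [hτ.2]) ((abs_nonneg _).trans (hA a ⟨le_rfl, hab.le⟩))) x hx)
    intro s hs u hu hsu
    have hd : ∀ τ ∈ K, HasDerivWithinAt (HH α μ B ψ) ((fun _ => 0) τ) K τ := fun τ hτ => F_deriv h hl ((le_max_left _ _).trans_lt hR'0) hψ hτ (hpos τ hτ)
    have hc : ∀ a ∈ K, ∀ b ∈ K, a < b → (∀ c, a < c → c < b → c ∉ K) → HH α μ B ψ a = HH α μ B ψ b := fun a ha b hb hab hc =>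
      gd_const h (hC1 a ha.1) (hgapK a ha b hb hab hc) ⟨ρ, hρR, hψ⟩ le_rfl hab.le le_rfl
    have u1 := L1' (N := 0) (Z := ∅) hKc hd (by simp) (by simp) (fun _ _ _ => le_rfl) (fun a ha b hb hab hc' => by rw [hc a ha b hb hab hc']; simp) hs hu hsu
    have u2 := L1' (N := 0) (Z := ∅) hKc (fun τ hτ => (hd τ hτ).fun_neg) (by simp) (by simp) (fun _ _ _ => by simp) (fun a ha b hb hab hc' => by rw [hc a ha b hb hab hc']; simp) hs hu hsu
    linarith
  have hpK : p ∈ K := ⟨hpC, by linarith, by linarith⟩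
  refine hpC ⟨ε / 2, by positivity, fun ψ hψ => ?_⟩
  suffices hp : ∀ s, |s - p| < ε / 2 → t1 ≤ s → HH α μ B ψ s = HH α μ B ψ p from fun s τ hs hτ h1 h2 => (hp s hs h1).trans (hp τ hτ h2).symm
  intro s hs h1
  rw [abs_lt] at hs
  rcases le_total s p with hsp | hsp
  · have hcl : IsClosed (K ∩ Icc s p) := hKc.inter isClosed_Icc
    have hb : BddBelow (K ∩ Icc s p) := ⟨s, fun u hu => hu.2.1⟩
    have hk := hcl.csInf_mem ⟨p, hpK, hsp, le_rfl⟩ hb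
    refine (gd_const h (R := R) (e := sInf (K ∩ Icc s p)) h1 (fun c hc1 hc2 => ?_) hψ le_rfl hk.2.1 le_rfl).trans (hH0 ψ hψ _ hk.1 p hpK hk.2.2)
    by_contra hcc
    exact absurd (csInf_le hb ⟨⟨hcc, by linarith, by linarith [hk.2.2]⟩, hc1.le, by linarith [hk.2.2]⟩) (not_le.mpr hc2)
  · have hcl : IsClosed (K ∩ Icc p s) := hKc.inter isClosed_Icc
    have hb : BddAbove (K ∩ Icc p s) := ⟨s, fun u hu => hu.2.2⟩
    have hk := hcl.csSup_mem ⟨p, hpK, le_rfl, hsp⟩ hb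
    refine ((hH0 ψ hψ p hpK _ hk.1 hk.2.1).trans (gd_const h (R := R) (e := s) (hC1 _ hk.1.1) (fun c hc1 hc2 => ?_) hψ le_rfl hk.2.2 le_rfl)).symm
    by_contra hcc
    exact absurd (le_csSup hb ⟨⟨hcc, by linarith [hk.2.1], by linarith⟩, by linarith [hk.2.1], hc2.le⟩) (not_le.mpr hc1)

lemma weakC (h : Sol α μ B J LB) {ψ : TF} (hψ : PS ρ ψ) (ht : 0 ≤ t) : HH α μ B ψ t = HH α μ B ψ 0 := by
  have hψ' : ∃ r < max ρ 0 + 1, PS r ψ := ⟨ρ, by linarith [le_max_left ρ 0], hψ⟩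
  have h1 : ∀ s, 0 < s → HH α μ B ψ (s + t) = HH α μ B ψ s := fun s hs =>
    (gd_const h (R := max ρ 0 + 1) (t1 := s) (e := s + t) le_rfl (fun u _ _ => all_good h (by positivity) hs u) hψ' le_rfl (by linarith) le_rfl).symm
  have c1 : Tendsto (fun s => HH α μ B ψ (s + t)) (𝓝[>] 0) (𝓝 (HH α μ B ψ (0 + t))) := (((h.H_cont ψ).comp (continuous_id.add continuous_const)).tendsto 0).mono_left nhdsWithin_le_nhds
  have c2 : Tendsto (HH α μ B ψ) (𝓝[>] 0) (𝓝 (HH α μ B ψ 0)) := ((h.H_cont ψ).tendsto 0).mono_left nhdsWithin_le_nhds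
  rw [zero_add] at c1
  exact tendsto_nhds_unique c1 (c2.congr' (by filter_upwards [self_mem_nhdsWithin] with s hs using (h1 s hs).symm))

end

lemma Th_add (h : Bd M b) (hf : Integrable f) (hg : Integrable g) (hv : 0 < v) : Th b (fun s => f s + g s) v = Th b f v + Th b g v := by
  rw [Th, Th, Th, ← integral_add (Th_integrable h hf hv) (Th_integrable h hg hv)]
  congr 1; ext s; push_cast; ring

lemma TT_add (hα : α ∈ Ioo 0 2) (hb : Bd M b) {ψ ψ1 ψ2 : TF} (h : ∀ x, ψ.f0 x = ψ1.f0 x + ψ2.f0 x) :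
    TT α μ b ψ = TT α μ b ψ1 + TT α μ b ψ2 := by
  have h' : ψ.f0 = fun x => ψ1.f0 x + ψ2.f0 x := funext h
  have q : Qf b ψ 0 1 = Qf b ψ1 0 1 + Qf b ψ2 0 1 := by
    refine tendsto_nhds_unique (Qf_tendsto hb ψ one_pos) (((Qf_tendsto hb ψ1 one_pos).add (Qf_tendsto hb ψ2 one_pos)).congr' ?_)
    filter_upwards [self_mem_nhdsWithin] with v hv
    rw [h', Th_add hb ψ1.i0 ψ2.i0 hv]
  have l : LLf α b ψ.f0 = LLf α b ψ1.f0 + LLf α b ψ2.f0 := by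
    rw [LLf, LLf, LLf, ← mul_add, ← integral_add (LLf_integrand hα hb ψ1) (LLf_integrand hα hb ψ2)]
    congr 2; ext r
    rw [← mul_add, ← integral_add (bD2_int hb ψ1.i0 r) (bD2_int hb ψ2.i0 r)]
    congr 2; ext s; simp only [D2, h]; ring
  rw [TT, TT, TT, q, l, Complex.add_im]; ring

lemma sup_der (h : ∀ x, R < |x| → f x = 0) (hd : ∀ x, HasDerivAt f (g x) x) (x : ℝ) (hx : R < |x|) : g x = 0 := by
  refine (hd x).unique ((hasDerivAt_const x (0 : ℝ)).congr_of_eventuallyEq ?_)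
  filter_upwards [(isOpen_lt continuous_const continuous_abs).mem_nhds hx] with y hy using h y hy

lemma bd_of (h : ∀ x, R < |x| → f x = 0) (hc : Continuous f) : ∃ Q, ∀ x, |f x| ≤ Q := by
  obtain ⟨C, hC⟩ := (isCompact_closedBall (0 : ℝ) R).exists_bound_of_continuousOn hc.continuousOn
  refine ⟨max C 0, fun x => ?_⟩
  rcases le_or_gt |x| R with hx | hx
  · exact (hC x (by simpa using hx)).trans (le_max_left _ _)
  · rw [h x hx, abs_zero]; exact le_max_right _ _

lemma cutoff : ∃ (Q : ℝ) (m : ℕ → Mu Q), (∀ k x, (m k).k0 x ≠ 1 → |x| ≤ 2 * (k + 1)) ∧ ∀ x, Tendsto (fun k => (m k).k0 x) atTop (𝓝 0) ∧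
    Tendsto (fun k => (m k).k1 x) atTop (𝓝 0) ∧ Tendsto (fun k => (m k).k2 x) atTop (𝓝 0) ∧ Tendsto (fun k => (m k).k3 x) atTop (𝓝 0) := by
  obtain ⟨θ, hθ, h1, h01⟩ := bump_PS (r := 1) (R := 2) one_pos one_lt_two
  have z0 : ∀ x, 2 < |x| → θ.f0 x = 0 := fun x hx => by by_contra h; exact absurd (hθ x h) (not_le.mpr hx)
  have z1 := sup_der z0 θ.h0
  have z2 := sup_der z1 θ.h1
  obtain ⟨Q1, q1⟩ := bd_of z1 θ.c1
  obtain ⟨Q2, q2⟩ := bd_of z2 θ.c2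
  obtain ⟨Q3, q3⟩ := bd_of (sup_der z2 θ.h2) θ.c3
  have n1 := (abs_nonneg _).trans (q1 0); have n2 := (abs_nonneg _).trans (q2 0); have n3 := (abs_nonneg _).trans (q3 0)
  have inv1 : ∀ k : ℕ, |((k : ℝ) + 1)⁻¹| ≤ 1 := fun k => by
    rw [abs_of_pos (by positivity)]; exact inv_le_one_of_one_le₀ (by linarith [(Nat.cast_nonneg k : (0 : ℝ) ≤ k)])
  have bb : ∀ (k j : ℕ) (y Q' : ℝ), |y| ≤ Q' → Q' ≤ 1 + Q1 + Q2 + Q3 → |-(((k : ℝ) + 1)⁻¹ ^ j * y)| ≤ 1 + Q1 + Q2 + Q3 := fun k j y Q' hy hQ => by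
    rw [abs_neg, abs_mul, abs_pow]
    exact (mul_le_of_le_one_left (abs_nonneg _) (pow_le_one₀ (abs_nonneg _) (inv1 k))).trans (hy.trans hQ)
  have hd : ∀ (k : ℕ) (x : ℝ), HasDerivAt (fun s : ℝ => ((k : ℝ) + 1)⁻¹ * s) (((k : ℝ) + 1)⁻¹) x := fun k x => by simpa using (hasDerivAt_id' x).const_mul (((k : ℝ) + 1)⁻¹)
  refine ⟨1 + Q1 + Q2 + Q3, fun k =>
    { k0 := fun x => 1 - θ.f0 (((k : ℝ) + 1)⁻¹ * x)
      k1 := fun x => -(((k : ℝ) + 1)⁻¹ ^ 1 * θ.f1 (((k : ℝ) + 1)⁻¹ * x))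
      k2 := fun x => -(((k : ℝ) + 1)⁻¹ ^ 2 * θ.f2 (((k : ℝ) + 1)⁻¹ * x))
      k3 := fun x => -(((k : ℝ) + 1)⁻¹ ^ 3 * θ.f3 (((k : ℝ) + 1)⁻¹ * x))
      h0 := fun x => (((θ.h0 _).comp x (hd k x)).const_sub 1).congr_deriv (by ring)
      h1 := fun x => ((((θ.h1 _).comp x (hd k x)).const_mul _).fun_neg).congr_deriv (by ring)
      h2 := fun x => ((((θ.h2 _).comp x (hd k x)).const_mul _).fun_neg).congr_deriv (by ring)
      c3 := by have := θ.c3; fun_prop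
      b0 := fun x => by have := h01 (((k : ℝ) + 1)⁻¹ * x); rw [abs_le]; constructor <;> linarith [this.1, this.2]
      b1 := fun x => bb k 1 _ Q1 (q1 _) (by linarith)
      b2 := fun x => bb k 2 _ Q2 (q2 _) (by linarith)
      b3 := fun x => bb k 3 _ Q3 (q3 _) (by linarith) }, fun k x hx => ?_, fun x => ?_⟩
  · have := hθ _ (show θ.f0 (((k : ℝ) + 1)⁻¹ * x) ≠ 0 from fun h => hx (by simp [h]))
    rw [abs_mul, abs_of_pos (by positivity), inv_mul_le_iff₀ (by positivity)] at this
    linarith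
  · have t0 : Tendsto (fun k : ℕ => ((k : ℝ) + 1)⁻¹) atTop (𝓝 0) := by simpa [one_div] using tendsto_one_div_add_atTop_nhds_zero_nat (𝕜 := ℝ)
    have t1 : Tendsto (fun k : ℕ => ((k : ℝ) + 1)⁻¹ * x) atTop (𝓝 0) := by simpa using t0.mul_const x
    have tj : ∀ (j : ℕ) (f : ℝ → ℝ), Continuous f → Tendsto (fun k : ℕ => -(((k : ℝ) + 1)⁻¹ ^ (j + 1) * f (((k : ℝ) + 1)⁻¹ * x))) atTop (𝓝 0) := fun j f hf => by
      simpa using (((t0.pow (j + 1)).mul ((hf.tendsto 0).comp t1))).neg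
    refine ⟨?_, tj 0 _ θ.c1, tj 1 _ θ.c2, tj 2 _ θ.c3⟩
    have := ((θ.c0.tendsto 0).comp t1).const_sub 1
    rw [h1 0 (by simp), sub_self] at this
    exact this

lemma n1_dct (hf : Integrable f) {k : ℕ → ℝ → ℝ} (hc : ∀ n, Continuous (k n)) (hk : ∀ n x, |k n x| ≤ Q) (ht : ∀ x, Tendsto (fun n => k n x) atTop (𝓝 0)) :
    Tendsto (fun n => n1 (fun x => f x * k n x)) atTop (𝓝 0) := by
  have := tendsto_integral_of_dominated_convergence (F := fun n x => |f x * k n x|) (f := fun _ => 0) (μ := volume) (fun x => |f x| * Q) (fun n => (TF.im hf (hc n) (hk n)).abs.1) (hf.abs.mul_const Q)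
    (fun n => ae_of_all _ fun x => by
      rw [norm_eq_abs, abs_abs, abs_mul]; exact mul_le_mul_of_nonneg_left (hk n x) (abs_nonneg _)) (ae_of_all _ fun x => by simpa using ((ht x).const_mul (f x)).abs)
  simpa [n1] using this

lemma cutoff_N (ψ : TF) : ∃ (Q : ℝ) (m : ℕ → Mu Q), (∀ k x, (m k).k0 x ≠ 1 → |x| ≤ 2 * (k + 1)) ∧ Tendsto (fun k => (ψ.mulc (m k)).N) atTop (𝓝 0) := by
  obtain ⟨Q, m, hm, ht⟩ := cutoff
  refine ⟨Q, m, hm, ?_⟩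
  have a0 : ∀ f, Integrable f → Tendsto (fun n => n1 (fun x => f x * (m n).k0 x)) atTop (𝓝 0) := fun f hf => n1_dct hf (fun n => (m n).c0) (fun n => (m n).b0) fun x => (ht x).1
  have a1 : ∀ f, Integrable f → Tendsto (fun n => n1 (fun x => f x * (m n).k1 x)) atTop (𝓝 0) := fun f hf => n1_dct hf (fun n => (m n).c1) (fun n => (m n).b1) fun x => (ht x).2.1
  have a2 : ∀ f, Integrable f → Tendsto (fun n => n1 (fun x => f x * (m n).k2 x)) atTop (𝓝 0) := fun f hf => n1_dct hf (fun n => (m n).c2) (fun n => (m n).b2) fun x => (ht x).2.2.1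
  have a3 : ∀ f, Integrable f → Tendsto (fun n => n1 (fun x => f x * (m n).k3 x)) atTop (𝓝 0) := fun f hf => n1_dct hf (fun n => (m n).c3) (fun n => (m n).b3) fun x => (ht x).2.2.2
  have lim := ((((a0 _ ψ.i0).add ((a0 _ ψ.i1).add (a1 _ ψ.i0))).add (((a0 _ ψ.i2).add ((a1 _ ψ.i1).const_mul 2)).add (a2 _ ψ.i0)))).add
    (((a0 _ ψ.i3).add ((a1 _ ψ.i2).const_mul 3)).add (((a2 _ ψ.i1).const_mul 3).add (a3 _ ψ.i0)))
  norm_num at lim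
  refine squeeze_zero (fun k => ?_) (fun k => ?_) lim
  · have p0 := n1_nonneg (ψ.mulc (m k)).f0; have p1 := n1_nonneg (ψ.mulc (m k)).f1; have p2 := n1_nonneg (ψ.mulc (m k)).f2; have p3 := n1_nonneg (ψ.mulc (m k)).f3
    unfold TF.N; positivity
  · set k := m k
    have j10 := TF.im ψ.i1 k.c0 k.b0; have j20 := TF.im ψ.i2 k.c0 k.b0; have j30 := TF.im ψ.i3 k.c0 k.b0
    have j01 := TF.im ψ.i0 k.c1 k.b1; have j11 := (TF.im ψ.i1 k.c1 k.b1).const_mul 2; have j21 := (TF.im ψ.i2 k.c1 k.b1).const_mul 3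
    have j02 := TF.im ψ.i0 k.c2 k.b2; have j12 := (TF.im ψ.i1 k.c2 k.b2).const_mul 3; have j03 := TF.im ψ.i0 k.c3 k.b3
    have e1 := n1_add j10 j01
    have e2 := (n1_add (j20.fun_add j11) j02).trans (add_le_add_left (n1_add j20 j11) _)
    have e3 := (n1_add (j30.fun_add j21) (j12.fun_add j03)).trans (add_le_add (n1_add j30 j21) (n1_add j12 j03))
    rw [n1_cmul, abs_two] at e2
    rw [n1_cmul, n1_cmul, abs_of_pos (by norm_num : (0:ℝ) < 3)] at e3
    simp only [TF.N, TF.mulc] at *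
    linarith

def Mu.compl {Q : ℝ} (k : Mu Q) : Mu (1 + Q) where
  k0 := fun x => 1 - k.k0 x
  k1 := fun x => -k.k1 x
  k2 := fun x => -k.k2 x
  k3 := fun x => -k.k3 x
  h0 := fun x => (k.h0 x).const_sub 1
  h1 := fun x => (k.h1 x).fun_neg
  h2 := fun x => (k.h2 x).fun_neg
  c3 := k.c3.neg
  b0 := fun x => (abs_sub _ _).trans (by rw [abs_one]; linarith [k.b0 x])
  b1 := fun x => by rw [abs_neg]; linarith [k.b1 x]
  b2 := fun x => by rw [abs_neg]; linarith [k.b2 x]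
  b3 := fun x => by rw [abs_neg]; linarith [k.b3 x]

section

variable {α μ : ℝ} {B J LB : ℝ → ℝ → ℝ}

lemma weak (h : Sol α μ B J LB) (ψ : TF) (ht : 0 ≤ t) : HH α μ B ψ t = HH α μ B ψ 0 := by
  obtain ⟨Q, m, hm, hN⟩ := cutoff_N ψ
  obtain ⟨M, hM⟩ := h.bd t
  have i : ∀ (φ : TF) s, s ≤ t → Integrable fun x => φ.f0 x * B s x := fun φ s hs => φ.i0.mul_bdd (hM s hs).c.aestronglyMeasurable (ae_of_all _ (hM s hs).le)
  have hadd : ∀ k s, s ≤ t → 0 ≤ s → HH α μ B ψ s = HH α μ B (ψ.mulc (m k).compl) s + HH α μ B (ψ.mulc (m k)) s := fun k s hs hs0 => by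
    have e0 : ∀ x, ψ.f0 x = (ψ.mulc (m k).compl).f0 x + (ψ.mulc (m k)).f0 x := fun x => by simp only [TF.mulc, Mu.compl]; ring
    have e1 : ∫ τ in 0..s, TT α μ (B τ) ψ = (∫ τ in 0..s, TT α μ (B τ) (ψ.mulc (m k).compl)) + ∫ τ in 0..s, TT α μ (B τ) (ψ.mulc (m k)) := by
      rw [← intervalIntegral.integral_add ((h.T_cont _).intervalIntegrable _ _) ((h.T_cont _).intervalIntegrable _ _)]
      refine integral_congr fun τ hτ => ?_
      rw [uIcc_of_le hs0] at hτ
      exact TT_add h.a (hM τ (hτ.2.trans hs)) e0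
    have e2 : ∫ x, ψ.f0 x * B s x = (∫ x, (ψ.mulc (m k).compl).f0 x * B s x) + ∫ x, (ψ.mulc (m k)).f0 x * B s x := by
      rw [← integral_add (i _ s hs) (i _ s hs)]
      congr 1; ext x; rw [e0]; ring
    rw [HH, HH, HH, e1, e2]; ring
  have hb : ∀ (φ : TF), |HH α μ B φ t - HH α μ B φ 0| ≤ (2 * M + (M ^ 2 + |μ| * (4 * M * cα α)) * t) * φ.N := fun φ => by
    have e1 := intervalIntegral.norm_integral_le_of_norm_le_const (a := 0) (b := t) (C := (M ^ 2 + |μ| * (4 * M * cα α)) * φ.N) (f := fun σ => TT α μ (B σ) φ) fun σ hσ => by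
      rw [uIoc_of_le ht] at hσ
      exact TT_N h.a (hM σ hσ.2) φ
    rw [sub_zero, abs_of_nonneg ht, norm_eq_abs] at e1
    have e2 : ∀ s ≤ t, |∫ x, φ.f0 x * B s x| ≤ M * n1 φ.f0 := fun s hs => int_le φ.i0 fun x _ => (hM s hs).le x
    have e3 : n1 φ.f0 ≤ φ.N := by have := n1_nonneg φ.f1; have := n1_nonneg φ.f2; have := n1_nonneg φ.f3; unfold TF.N; linarith
    have e4 := mul_le_mul_of_nonneg_left e3 (hM t le_rfl).nonneg
    have e5 := abs_le.mp (e2 t le_rfl); have e6 := abs_le.mp (e2 0 ht); have e7 := abs_le.mp e1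
    rw [HH, HH, intervalIntegral.integral_same, abs_le]
    constructor <;> linarith [e5.1, e5.2, e6.1, e6.2, e7.1, e7.2]
  have hfin : ∀ k, |HH α μ B ψ t - HH α μ B ψ 0| ≤ (2 * M + (M ^ 2 + |μ| * (4 * M * cα α)) * t) * (ψ.mulc (m k)).N := fun k => by
    have hc : PS (2 * (k + 1)) (ψ.mulc (m k).compl) := fun x hx => hm k x fun h1 => hx (by simp [TF.mulc, Mu.compl, h1])
    rw [hadd k t le_rfl ht, hadd k 0 ht le_rfl, weakC h hc ht, add_sub_add_left_eq_sub]
    exact hb _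
  have := le_of_tendsto_of_tendsto' tendsto_const_nhds (hN.const_mul _) hfin
  rw [mul_zero] at this
  exact sub_eq_zero.mp (abs_nonpos_iff.mp this)

lemma weakD (h : Sol α μ B J LB) (ψ : TF) (ht : 0 ≤ t) : ∫ x, ψ.f0 x * B t x = (∫ x, ψ.f0 x * B 0 x) + ∫ τ in 0..t, TT α μ (B τ) ψ := by
  have := weak h ψ ht
  rw [HH, HH, intervalIntegral.integral_same] at this; linarith

end

lemma minp {u T : ℝ → ℝ → ℝ} {t0 K l : ℝ} (hl : 0 ≤ l)
    (hd : ∀ t, 0 < t → ∀ x, HasDerivAt (fun τ => u τ x) (T t x) t)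
    (hL : ∀ x, ∀ s ∈ Icc 0 t0, ∀ t ∈ Icc 0 t0, |u t x - u s x| ≤ K * |t - s|)
    (hc : ∀ t, Continuous (u t)) (hi : ∀ t, Tendsto (u t) (cocompact ℝ) (𝓝 l)) (h0 : ∀ x, 0 ≤ u 0 x)
    (hm : ∀ t, 0 < t → ∀ x, (∀ y, u t x ≤ u t y) → 0 ≤ T t x) : ∀ t ∈ Icc 0 t0, ∀ x, 0 ≤ u t x := by
  have att : ∀ t x, u t x < 0 → ∃ x0, ∀ y, u t x0 ≤ u t y := fun t x hx =>
    (hc t).exists_forall_le' x (((hi t).eventually (lt_mem_nhds (hx.trans_le hl))).mono fun _ h => le_of_lt h)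
  have main : ∀ c : ℝ, 0 < c → ∀ t ∈ Icc 0 t0, ∀ x, -c * (t + 1) < u t x := by
    intro c hcp
    by_contra! hn
    let S := {t | t ∈ Icc 0 t0 ∧ ∃ x, u t x ≤ -c * (t + 1)}
    obtain ⟨t, ht, x, hx⟩ := hn
    have hS : S.Nonempty := ⟨t, ht, x, hx⟩
    have hB : BddBelow S := ⟨0, fun s hs => hs.1.1⟩
    have hcl := csInf_mem_closure hS hB
    set w := sInf S
    have hw : w ∈ Icc 0 t0 := ⟨le_csInf hS fun s hs => hs.1.1, (csInf_le hB ⟨ht, x, hx⟩).trans ht.2⟩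
    have hwS : ∃ x, u w x ≤ -c * (w + 1) := by
      by_contra! hno
      have : ∃ d, -c * (w + 1) < d ∧ ∀ y, d ≤ u w y := by
        by_cases hneg : ∃ x, u w x < 0
        · obtain ⟨x, hx⟩ := hneg
          obtain ⟨x0, h⟩ := att w x hx
          exact ⟨_, hno x0, h⟩
        · push Not at hneg
          exact ⟨0, by nlinarith [hw.1], hneg⟩
      obtain ⟨d, hd1, hd2⟩ := this
      have ev : ∀ᶠ s in 𝓝 w, -c * (s + 1) + K * |s - w| < d := by
        have hcn : Continuous fun s => -c * (s + 1) + K * |s - w| := by fun_prop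
        refine (hcn.tendsto w).eventually (gt_mem_nhds ?_)
        simpa using hd1
      obtain ⟨s, hs, hs2⟩ := mem_closure_iff_nhds.mp hcl _ ev
      obtain ⟨hs3, y, hy⟩ := hs2
      have a := (abs_le.mp (hL y w hw s hs3)).1
      have b := hd2 y
      have c' : -c * (s + 1) + K * |s - w| < d := hs
      linarith
    obtain ⟨x, hx⟩ := hwS
    have hneg : u w x < 0 := hx.trans_lt (by nlinarith [hw.1])
    have hwp : 0 < w := by
      rcases hw.1.eq_or_lt with h | h
      · rw [← h] at hneg; exact absurd (h0 x) (not_le.mpr hneg)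
      · exact h
    obtain ⟨x0, hx0⟩ := att w x hneg
    have hT := hm w hwp x0 hx0
    have hg := (hd w hwp x0).fun_add (((hasDerivAt_id' w).add_const 1).const_mul c)
    rw [hasDerivAt_iff_tendsto_slope] at hg
    have e1 := hg.eventually (lt_mem_nhds (show (0:ℝ) < T w x0 + c * 1 by linarith))
    have e2 : ∀ᶠ s in 𝓝[<] w, 0 < slope (fun τ => u τ x0 + c * (τ + 1)) w s :=
      e1.filter_mono (nhdsWithin_mono _ fun s hs => ne_of_lt hs)
    have e3 : ∀ᶠ s in 𝓝[<] w, 0 < s := (lt_mem_nhds hwp).filter_mono nhdsWithin_le_nhds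
    obtain ⟨s, ⟨h1, h2⟩, h3⟩ := ((e2.and e3).and self_mem_nhdsWithin).exists
    have h3 : s < w := h3
    rw [slope_def_field] at h1
    have h4 := mul_neg_of_pos_of_neg h1 (sub_neg.mpr h3)
    rw [div_mul_cancel₀ _ (sub_neg.mpr h3).ne] at h4
    have : s ∈ S := ⟨⟨h2.le, h3.le.trans hw.2⟩, x0, by linarith [hx0 x]⟩
    exact absurd (csInf_le hB this) (not_le.mpr h3)
  intro t ht x
  by_contra! hn
  have h1 : 0 < t + 1 := by linarith [ht.1]
  have := main (-u t x / (t + 1)) (div_pos (by linarith) h1) t ht x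
  have e : -(-u t x / (t + 1)) * (t + 1) = u t x := by field_simp
  linarith

lemma lorI : ∀ s : ℝ, ‖I - s‖ ^ 2 = s ^ 2 + 1 := fun s => by simpa using normSq_sub I s

def PP : TF :=
  have hI : 0 < I.im := by simp
  have hd : ∀ (m : ℕ) (c : ℂ) (s : ℝ), HasDerivAt (fun s : ℝ => (c * ((I - s) ^ m)⁻¹).im) ((m * c * ((I - s) ^ (m + 1))⁻¹).im) s :=
    fun m c s => imCLM.hasFDerivAt.comp_hasDerivAt s (zpow_der I hI m c s)
  have hc : ∀ (m : ℕ) (c : ℂ), Continuous (fun s : ℝ => (c * ((I - s) ^ m)⁻¹).im) := fun m c => continuous_iff_continuousAt.mpr fun s => (hd m c s).continuousAt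
  have hi : ∀ (m : ℕ) (c : ℂ), Integrable (fun s : ℝ => (c * ((I - s) ^ (m + 2))⁻¹).im) := fun m c => by
    refine ((integrable_inv_one_add_sq).const_mul ‖c‖).mono' (hc _ c).aestronglyMeasurable (ae_of_all _ fun s => (abs_im_le_norm _).trans ?_)
    rw [norm_mul, norm_inv, norm_pow, pow_add, lorI, add_comm (s ^ 2)]
    have h1 : 1 ≤ ‖I - s‖ := by
      have := lorI s; nlinarith [norm_nonneg (I - s), sq_nonneg s]
    refine mul_le_mul_of_nonneg_left (inv_anti₀ (by positivity) ?_) (norm_nonneg _)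
    nlinarith [one_le_pow₀ h1 (n := m), sq_nonneg s]
  { f0 := fun s => (-(1 / π : ℂ) * ((I - s) ^ 1)⁻¹).im
    f1 := fun s => ((1 : ℕ) * -(1 / π : ℂ) * ((I - s) ^ (1 + 1))⁻¹).im
    f2 := fun s => ((2 : ℕ) * ((1 : ℕ) * -(1 / π : ℂ)) * ((I - s) ^ (2 + 1))⁻¹).im
    f3 := fun s => ((3 : ℕ) * ((2 : ℕ) * ((1 : ℕ) * -(1 / π : ℂ))) * ((I - s) ^ (3 + 1))⁻¹).im
    h0 := hd 1 _, h1 := hd 2 _, h2 := hd 3 _, c3 := hc 4 _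
    i0 := by
      refine (integrable_inv_one_add_sq.const_mul (1 / π)).congr (ae_of_all _ fun s => ?_)
      have e : -(1 / π : ℂ) = ((-(1 / π) : ℝ) : ℂ) := by push_cast; rfl
      dsimp only
      rw [e, im_ofReal_mul, pow_one, inv_im, normSq_eq_norm_sq, lorI]
      simp; field_simp; ring
    i1 := hi 0 _, i2 := hi 1 _, i3 := hi 2 _ }

lemma PP0 (s : ℝ) : PP.f0 s = 1 / π * (1 + s ^ 2)⁻¹ := by
  have e : -(1 / π : ℂ) = ((-(1 / π) : ℝ) : ℂ) := by push_cast; rfl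
  simp only [PP]
  rw [e, im_ofReal_mul, pow_one, inv_im, normSq_eq_norm_sq, lorI]
  simp; field_simp; ring

def PZ (x y : ℝ) (hy : 0 < y) : TF := PP.sc y⁻¹ x y hy

lemma PZ0 (x : ℝ) (hy : 0 < y) (s : ℝ) : (PZ x y hy).f0 s = y / π * ((s - x) ^ 2 + y ^ 2)⁻¹ := by
  have : (PZ x y hy).f0 s = y⁻¹ * PP.f0 ((s - x) / y) := rfl
  rw [this, PP0]
  have h1 : 0 < y ^ 2 + (s - x) ^ 2 := by positivity
  have h2 : 0 < (s - x) ^ 2 + y ^ 2 := by positivity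
  have := pi_pos
  have h3 : 0 < 1 + ((s - x) / y) ^ 2 := by positivity
  field_simp
  ring

lemma PZN (x : ℝ) (hy : 0 < y) : (PZ x y hy).N = (PZ 0 y hy).N := by
  simp only [TF.N, PZ, TF.sc]; simp only [n1_sc _ _ _ hy]

lemma PZQ (h : Bd M b) (x : ℝ) (hy : 0 < y) : Qf b (PZ x y hy) 0 1 = GC b (x + y * I) := by
  have him : ((x : ℂ) + y * I).im = y := line_im x y
  have hre : ((x : ℂ) + y * I).re = x := line_re x y
  refine tendsto_nhds_unique (Qf_tendsto h (PZ x y hy) one_pos) ?_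
  have e : ∀ᶠ ε : ℝ in 𝓝[>] 0, GC b (x + y * I + ε * I) = Th b (PZ x y hy).f0 ε := by
    filter_upwards [self_mem_nhdsWithin] with ε hε
    rw [← GC_poisson h (him.symm ▸ hy) hε, him, hre, Th]
    simp only [PZ0]
  refine Tendsto.congr' e ?_
  have hz : (0 : ℝ) < ((x : ℂ) + y * I).im := him.symm ▸ hy
  have hcA : ContinuousAt (GC b) (x + y * I) := (GC_diff h hz).continuousAt
  have : Tendsto (fun ε : ℝ => (x : ℂ) + y * I + ε * I) (𝓝[>] 0) (𝓝 (x + y * I)) := by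
    have hcn : Continuous fun ε : ℝ => (x : ℂ) + y * I + ε * I := by fun_prop
    have := hcn.tendsto 0
    simp only [Complex.ofReal_zero, zero_mul, add_zero] at this
    exact this.mono_left nhdsWithin_le_nhds
  exact hcA.tendsto.comp this

section

variable {α μ M : ℝ} {b : ℝ → ℝ}

lemma fb_int (h : Bd M b) (hf : Integrable f) : Integrable (fun s => f s * b s) :=
  hf.mul_bdd h.c.aestronglyMeasurable (ae_of_all _ h.le)

lemma PZ_der (h : Bd M b) (x : ℝ) (hy : 0 < y) :
    HasDerivAt (fun x => ∫ s, (PZ x y hy).f0 s * b s) (gC b (x + y * I)).re x := by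
  have hM := h.nonneg
  have hpi := pi_pos
  have hp : ∀ s x : ℝ, 0 < (s - x) ^ 2 + y ^ 2 := fun s x => by positivity
  have e : (gC b (x + y * I)).re = ∫ s, y / π * (2 * (s - x) / ((s - x) ^ 2 + y ^ 2) ^ 2) * b s := by
    have hz : 0 < ((x : ℂ) + y * I).im := (line_im x y).symm ▸ hy
    have : gC b (x + y * I) = ∫ s : ℝ, -(I / π) * ((b s : ℂ) / (x + y * I - s) ^ 2) := by
      rw [integral_const_mul]; rfl
    have h2 := reCLM.integral_comp_comm ((gC_integrable h hz).const_mul (-(I / π)))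
    rw [this]
    refine h2.symm.trans (integral_congr_ae (ae_of_all _ fun s => ?_))
    have hn := sub_ne hz s
    have e1 : -(I / π) * ((b s : ℂ) / (x + y * I - s) ^ 2) = ((b s / (π * ((s - x) ^ 2 + y ^ 2) ^ 2) : ℝ) : ℂ) * (-I * ((x - s) - y * I) ^ 2) := by
      have q : (((s - x) ^ 2 + y ^ 2 : ℝ) : ℂ) = (x + y * I - s) * ((x - s) - y * I) := by
        push_cast; ring_nf; rw [I_sq]; ring
      have q2 : (((s - x) ^ 2 + y ^ 2 : ℝ) : ℂ) ≠ 0 := by exact_mod_cast (hp s x).ne'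
      have hpc : (π : ℂ) ≠ 0 := by exact_mod_cast hpi.ne'
      rw [Complex.ofReal_div, Complex.ofReal_mul, Complex.ofReal_pow, q]
      rw [q] at q2
      have q3 := right_ne_zero_of_mul q2
      generalize (x : ℂ) + y * I - s = v at *
      generalize (x : ℂ) - s - y * I = w at *
      field_simp
    simp only [Complex.reCLM_apply]
    rw [e1, re_ofReal_mul]
    have : (-I * (((x : ℂ) - s) - y * I) ^ 2).re = 2 * (s - x) * y := by
      rw [sq]; simp; ring
    rw [this]
    have := (hp s x).ne'
    field_simp
  rw [e]
  refine (hasDerivAt_integral_of_dominated_loc_of_deriv_le (s := ball x y) (bound := fun s => 3 * M / π * ((s - x) ^ 2 + y ^ 2)⁻¹)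
    (F := fun x s => (PZ x y hy).f0 s * b s) (F' := fun x s => y / π * (2 * (s - x) / ((s - x) ^ 2 + y ^ 2) ^ 2) * b s)
    (ball_mem_nhds x hy) (Eventually.of_forall fun x => (fb_int h (PZ x y hy).i0).aestronglyMeasurable) (fb_int h (PZ x y hy).i0)
    ?_ (ae_of_all _ fun s x' hx' => ?_) ((integrable_lor x hy).const_mul _) (ae_of_all _ fun s x' hx' => ?_)).2
  · refine Continuous.aestronglyMeasurable (((continuous_const.mul (Continuous.div (by fun_prop) (by fun_prop) fun s => ?_))).mul h.c)
    exact (pow_pos (hp s x) 2).ne'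
  · rw [mem_ball, dist_eq] at hx'
    have h3 : (s - x) ^ 2 + y ^ 2 ≤ 3 * ((s - x') ^ 2 + y ^ 2) := by
      have := sq_lt_sq' (abs_lt.mp hx').1 (abs_lt.mp hx').2
      nlinarith [sq_nonneg ((s - x') - (x' - x))]
    set d := (s - x') ^ 2 + y ^ 2 with hd
    have hdp := hp s x'
    have h4 : |2 * (s - x')| * y ≤ d := by
      rw [abs_mul, abs_two, hd, ← sq_abs (s - x')]; nlinarith [sq_nonneg (|s - x'| - y)]
    rw [norm_mul, norm_mul, norm_div, norm_div, norm_of_nonneg hy.le, norm_of_nonneg hpi.le, norm_of_nonneg (pow_pos hdp 2).le]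
    have h5 : y / π * (‖2 * (s - x')‖ / d ^ 2) ≤ 3 / π * ((s - x) ^ 2 + y ^ 2)⁻¹ := by
      have : y / π * (‖2 * (s - x')‖ / d ^ 2) = (|2 * (s - x')| * y) * (d ^ 2)⁻¹ / π := by rw [norm_eq_abs]; ring
      rw [this]
      have h6 : (|2 * (s - x')| * y) * (d ^ 2)⁻¹ ≤ d⁻¹ := by
        refine (mul_le_mul_of_nonneg_right h4 (by positivity)).trans (le_of_eq ?_); field_simp
      have h7 : d⁻¹ ≤ 3 * ((s - x) ^ 2 + y ^ 2)⁻¹ := by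
        rw [inv_le_comm₀ hdp (by have := hp s x; positivity), mul_inv, inv_inv]; linarith
      have := div_le_div_of_nonneg_right (h6.trans h7) hpi.le
      refine this.trans (le_of_eq (by ring))
    refine (mul_le_mul h5 (h.le s) (abs_nonneg _) (by have := hp s x; positivity)).trans (le_of_eq (by ring))
  · simp only [PZ0]
    refine (((((((hasDerivAt_id' x').const_sub s).fun_pow 2).add_const (y ^ 2)).fun_inv (hp s x').ne').const_mul (y / π)).mul_const (b s)).congr_deriv ?_
    congr 2; norm_num

lemma TT_ext (hμ : 0 ≤ μ) (h : Bd M b) (he : e ≠ 0) (x : ℝ) (hy : 0 < y)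
    (hm : ∀ x', e * ∫ s, (PZ x y hy).f0 s * b s ≤ e * ∫ s, (PZ x' y hy).f0 s * b s) : 0 ≤ e * TT α μ b (PZ x y hy) := by
  have hd := (PZ_der h x hy).const_mul e
  have h0 := IsLocalMin.hasDerivAt_eq_zero (Eventually.of_forall hm) hd
  have h1 : (gC b (x + y * I)).re = 0 := (mul_eq_zero.mp h0).resolve_left he
  have h2 : (GC b (x + y * I)).im = 0 := by rw [GC, sq, mul_im, h1]; ring
  rw [TT, PZQ h, h2]
  have h3 : e * LLf α b (PZ x y hy).f0 ≤ 0 := by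
    have : e * LLf α b (PZ x y hy).f0 = 1 / π * (e * ∫ r in Ioi (0 : ℝ), r ^ (-1 - α) * ∫ s, b s * D2 (PZ x y hy).f0 r s) := by rw [LLf]; ring
    rw [this, ← integral_const_mul]
    refine mul_nonpos_of_nonneg_of_nonpos (by have := pi_pos; positivity) (setIntegral_nonpos measurableSet_Ioi fun r hr => ?_)
    have hr : 0 < r := hr
    have e2 : ∫ s, b s * D2 (PZ x y hy).f0 r s = 2 * (∫ s, (PZ x y hy).f0 s * b s) - (∫ s, (PZ (x - r) y hy).f0 s * b s) - ∫ s, (PZ (x + r) y hy).f0 s * b s := by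
      have i1 : Integrable (fun s => 2 * ((PZ x y hy).f0 s * b s) - (PZ (x - r) y hy).f0 s * b s) := ((fb_int h (PZ x y hy).i0).const_mul 2).sub (fb_int h (PZ (x - r) y hy).i0)
      rw [← integral_const_mul, ← integral_sub ((fb_int h (PZ x y hy).i0).const_mul 2) (fb_int h (PZ (x - r) y hy).i0), ← integral_sub i1 (fb_int h (PZ (x + r) y hy).i0)]
      congr 1; ext s
      simp only [D2, PZ0]
      rw [show s + r - x = s - (x - r) by ring, show s - r - x = s - (x + r) by ring]; ring
    rw [e2, mul_left_comm]
    exact mul_nonpos_of_nonneg_of_nonpos (by positivity) (by linarith [hm (x - r), hm (x + r)])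
  have : e * ((0:ℝ) / 2 - μ * LLf α b (PZ x y hy).f0) = -(μ * (e * LLf α b (PZ x y hy).f0)) := by ring
  rw [this]; linarith [mul_nonpos_of_nonneg_of_nonpos hμ h3]

lemma PZ_inf (hb : Integrable b) (hy : 0 < y) : Tendsto (fun x => ∫ s, (PZ x y hy).f0 s * b s) (cocompact ℝ) (𝓝 0) := by
  have hpi := pi_pos
  have : (0 : ℝ) = ∫ s : ℝ, (0 : ℝ) := by simp
  rw [this]
  have : (cocompact ℝ).IsCountablyGenerated := by rw [cocompact_eq_atBot_atTop]; infer_instance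
  refine tendsto_integral_filter_of_dominated_convergence (fun s => y / π * (y ^ 2)⁻¹ * |b s|)
    (Eventually.of_forall fun x => (PZ x y hy).c0.aestronglyMeasurable.mul hb.aestronglyMeasurable) (Eventually.of_forall fun x => ae_of_all _ fun s => ?_) (hb.abs.const_mul _) (ae_of_all _ fun s => ?_)
  · rw [PZ0, norm_mul, norm_of_nonneg (by positivity)]
    refine mul_le_mul_of_nonneg_right (mul_le_mul_of_nonneg_left (inv_anti₀ (by positivity) (by nlinarith [sq_nonneg (s - x)])) (by positivity)) (abs_nonneg _)
  · simp only [PZ0]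
    have h1 : Tendsto (fun x : ℝ => s - x) (cocompact ℝ) (cocompact ℝ) := (Homeomorph.subLeft s).isClosedEmbedding.tendsto_cocompact
    have h2 : Tendsto (fun x : ℝ => ‖s - x‖ ^ 2 + y ^ 2) (cocompact ℝ) atTop :=
      tendsto_atTop_add_const_right _ _ ((tendsto_pow_atTop two_ne_zero).comp ((tendsto_norm_cocompact_atTop (E := ℝ)).comp h1))
    have h3 := (h2.inv_tendsto_atTop.const_mul (y / π)).mul_const (b s)
    simpa [sq_abs] using h3

lemma PZ_lim (h : Bd M b) (x : ℝ) : Tendsto (fun y : ℝ => if hy : 0 < y then ∫ s, (PZ x y hy).f0 s * b s else 0) (𝓝[>] 0) (𝓝 (b x)) := by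
  have hpi := pi_pos
  have hI : ∫ s, PP.f0 s = 1 := by
    simp only [PP0]; rw [integral_const_mul, integral_univ_inv_one_add_sq]; field_simp
  have e : ∀ᶠ y : ℝ in 𝓝[>] 0, ∫ s, PP.f0 s * b (x + y * s) = if hy : 0 < y then ∫ s, (PZ x y hy).f0 s * b s else 0 := by
    filter_upwards [self_mem_nhdsWithin] with y hy
    have hy : 0 < y := hy
    rw [dif_pos hy]
    have := int_sc (fun s => PP.f0 s * b (x + y * s)) x hy
    rw [eq_comm, ← eq_inv_mul_iff_mul_eq₀ hy.ne'] at this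
    rw [this, ← integral_const_mul]
    congr 1; ext s
    have e1 : x + y * ((s - x) / y) = s := by field_simp; ring
    rw [e1, ← mul_assoc]; rfl
  refine Tendsto.congr' e ?_
  have : b x = ∫ s, PP.f0 s * b (x + 0 * s) := by simp [integral_mul_const, hI]
  rw [this]
  refine tendsto_integral_filter_of_dominated_convergence (fun s => PP.f0 s * M)
    (Eventually.of_forall fun y => (PP.c0.mul (h.c.comp (by fun_prop))).aestronglyMeasurable) (Eventually.of_forall fun y => ae_of_all _ fun s => ?_) (PP.i0.mul_const _) (ae_of_all _ fun s => ?_)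
  · rw [PP0, norm_mul, norm_of_nonneg (by positivity)]
    exact mul_le_mul_of_nonneg_left (h.le _) (by positivity)
  · have hc : Continuous fun y => PP.f0 s * b (x + y * s) := continuous_const.mul (h.c.comp (by fun_prop))
    exact (hc.tendsto 0).mono_left nhdsWithin_le_nhds

end

section

variable {α μ : ℝ} {B J LB : ℝ → ℝ → ℝ}

lemma weakL (h : Sol α μ B J LB) (ψ : TF) (hs : 0 ≤ s) (ht : 0 ≤ t) :
    (∫ x, ψ.f0 x * B t x) - (∫ x, ψ.f0 x * B s x) = ∫ τ in s..t, TT α μ (B τ) ψ := by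
  have i : ∀ a b, IntervalIntegrable (fun τ => TT α μ (B τ) ψ) volume a b := fun a b => (h.T_cont ψ).intervalIntegrable a b
  rw [weakD h ψ ht, weakD h ψ hs, ← intervalIntegral.integral_interval_sub_left (i 0 t) (i 0 s)]; ring

lemma prin (h : Sol α μ B J LB) (hμ : 0 ≤ μ) {l : ℝ} (he : e ≠ 0) (hl : 0 ≤ l) (h0 : ∀ x, 0 ≤ l + e * B 0 x) (ht : 0 ≤ t) (x : ℝ) :
    0 ≤ l + e * B t x := by
  have key : ∀ y (hy : 0 < y), 0 ≤ l + e * ∫ s, (PZ x y hy).f0 s * B t s := by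
    intro y hy
    obtain ⟨M, hM⟩ := h.bd t
    refine minp (u := fun t x => l + e * ∫ s, (PZ x y hy).f0 s * B t s) (T := fun t x => e * TT α μ (B t) (PZ x y hy)) (l := l) (t0 := t)
      (K := |e| * ((M ^ 2 + |μ| * (4 * M * cα α)) * (PZ 0 y hy).N)) hl (fun τ hτ x => ?_) (fun x s hs τ hτ => ?_) (fun τ => ?_) (fun τ => ?_) (fun x => ?_) (fun τ hτ x hx => ?_) t ⟨ht, le_rfl⟩ x
    · refine HasDerivAt.const_add l (HasDerivAt.const_mul e ?_)
      have hc := h.T_cont (PZ x y hy)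
      refine ((intervalIntegral.integral_hasDerivAt_right (hc.intervalIntegrable 0 τ) (hc.stronglyMeasurableAtFilter _ _) hc.continuousAt).const_add (∫ s, (PZ x y hy).f0 s * B 0 s)).congr_of_eventuallyEq ?_
      filter_upwards [lt_mem_nhds hτ] with σ hσ using weakD h _ hσ.le
    · have e1 : (l + e * ∫ s, (PZ x y hy).f0 s * B τ s) - (l + e * ∫ a, (PZ x y hy).f0 a * B s a) = e * ((∫ s, (PZ x y hy).f0 s * B τ s) - ∫ a, (PZ x y hy).f0 a * B s a) := by ring
      rw [e1, weakL h _ hs.1 hτ.1, abs_mul, mul_assoc]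
      refine mul_le_mul_of_nonneg_left (intervalIntegral.norm_integral_le_of_norm_le_const (f := fun τ => TT α μ (B τ) (PZ x y hy)) fun σ hσ => ?_) (abs_nonneg _)
      rw [← PZN x hy]
      exact TT_N h.a (hM σ (hσ.2.trans (max_le hs.2 hτ.2))) _
    · obtain ⟨M', hM'⟩ := h.bd τ
      exact continuous_const.add (continuous_const.mul (continuous_iff_continuousAt.mpr fun x => (PZ_der (hM' τ le_rfl) x hy).continuousAt))
    · simpa using ((PZ_inf (h.it τ) hy).const_mul e).const_add l
    · have hB := hM 0 ht
      have hI : ∫ s, (PZ x y hy).f0 s = 1 := by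
        simp only [PZ0]; rw [integral_const_mul, integral_lor x hy]; have := pi_pos; field_simp
      have e1 : l + e * ∫ s, (PZ x y hy).f0 s * B 0 s = ∫ s, (PZ x y hy).f0 s * (l + e * B 0 s) := by
        simp only [mul_add]
        rw [integral_add ((PZ x y hy).i0.mul_const l) (by simpa only [mul_left_comm] using (fb_int hB (PZ x y hy).i0).const_mul e), integral_mul_const, hI, ← integral_const_mul]
        simp only [one_mul, mul_left_comm]
      rw [e1]
      refine integral_nonneg fun s => mul_nonneg ?_ (h0 s)
      rw [PZ0]; have := pi_pos; positivity
    · obtain ⟨M', hM'⟩ := h.bd τ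
      exact TT_ext hμ (hM' τ le_rfl) he x hy fun x' => by have := hx x'; linarith
  obtain ⟨M, hM⟩ := h.bd t
  refine ge_of_tendsto (((PZ_lim (hM t le_rfl) x).const_mul e).const_add l) ?_
  filter_upwards [self_mem_nhdsWithin] with y hy
  have hy : 0 < y := hy
  rw [dif_pos hy]; exact key y hy

end

def qq (p s : ℝ) : ℝ := (1 + s ^ 2) ^ (-p)

lemma qw (s : ℝ) : 0 < 1 + s ^ 2 := by positivity

lemma qq_pos (p s : ℝ) : 0 < qq p s := rpow_pos_of_pos (qw s) _

lemma qq_add (p s : ℝ) (k : ℕ) : qq (p + k) s = qq p s * ((1 + s ^ 2) ^ k)⁻¹ := by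
  rw [qq, qq, neg_add, Real.rpow_add (qw s), rpow_neg (qw s).le (k : ℝ), rpow_natCast]

lemma qq_der (j : ℕ) (c p s : ℝ) : HasDerivAt (fun s => c * (s ^ j * qq p s)) (c * (j * s ^ (j - 1) * qq p s - 2 * p * s ^ (j + 1) * qq (p + 1) s)) s := by
  have h := (((hasDerivAt_id' s).fun_pow 2).const_add 1).rpow_const (p := -p) (Or.inl (qw s).ne')
  refine ((((hasDerivAt_id' s).fun_pow j).fun_mul h).const_mul c).congr_deriv ?_
  unfold qq
  rw [show -(p + 1) = -p - 1 by ring]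
  push_cast; ring

lemma qq_bd (p s : ℝ) {j k : ℕ} (hjk : j ≤ k) : |s ^ j * qq (p + k) s| ≤ qq p s := by
  have h1 : |s| ≤ 1 + s ^ 2 := by rw [← sq_abs s]; nlinarith [sq_nonneg (|s| - 1)]
  have h2 : 1 ≤ 1 + s ^ 2 := by nlinarith [sq_nonneg s]
  rw [qq_add, abs_mul, abs_mul, abs_of_pos (qq_pos p s), abs_of_pos (inv_pos.mpr (pow_pos (qw s) k)), abs_pow]
  have : |s| ^ j ≤ (1 + s ^ 2) ^ k := (pow_le_pow_left₀ (abs_nonneg s) h1 j).trans (pow_le_pow_right₀ h2 hjk)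
  have h3 : |s| ^ j * ((1 + s ^ 2) ^ k)⁻¹ ≤ 1 := by rw [← div_eq_mul_inv]; exact div_le_one_of_le₀ this (pow_pos (qw s) k).le
  nlinarith [qq_pos p s]

lemma qq_int (hp : 1 / 2 < p) : Integrable (qq p) := by
  have := integrable_rpow_neg_one_add_norm_sq (E := ℝ) (μ := volume) (r := 2 * p) (by simp; linarith)
  refine this.congr (ae_of_all _ fun s => ?_)
  simp only [qq, norm_eq_abs, sq_abs]; congr 1; ring

def PH (p : ℝ) (hp : 1 / 2 < p) : TF :=
  have cq : ∀ r, Continuous (qq r) := fun r => continuous_iff_continuousAt.mpr fun s => by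
    have := (qq_der 0 1 r s).continuousAt; simpa using this
  have hi : ∀ (j k : ℕ) (c : ℝ), j ≤ k → Integrable (fun s => c * (s ^ j * qq (p + k) s)) := fun j k c h =>
    ((qq_int hp).mono' ((continuous_pow j).mul (cq _)).aestronglyMeasurable (ae_of_all _ fun s => qq_bd p s h)).const_mul c
  { f0 := qq p
    f1 := fun s => -2 * p * (s ^ 1 * qq (p + (1 : ℕ)) s)
    f2 := fun s => -2 * p * (s ^ 0 * qq (p + (1 : ℕ)) s) + 4 * p * (p + 1) * (s ^ 2 * qq (p + (2 : ℕ)) s)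
    f3 := fun s => 12 * p * (p + 1) * (s ^ 1 * qq (p + (2 : ℕ)) s) + -8 * p * (p + 1) * (p + 2) * (s ^ 3 * qq (p + (3 : ℕ)) s)
    h0 := fun s => by
      have := qq_der 0 1 p s
      simp only [pow_zero, one_mul] at this
      exact this.congr_deriv (by push_cast; ring)
    h1 := fun s => (qq_der 1 (-2 * p) (p + (1 : ℕ)) s).congr_deriv (by
      rw [show p + (2 : ℕ) = p + (1 : ℕ) + 1 by push_cast; ring]; push_cast; ring)
    h2 := fun s => ((qq_der 0 (-2 * p) (p + (1 : ℕ)) s).fun_add (qq_der 2 (4 * p * (p + 1)) (p + (2 : ℕ)) s)).congr_deriv (by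
      rw [show p + (3 : ℕ) = p + (2 : ℕ) + 1 by push_cast; ring, show p + (1 : ℕ) + 1 = p + (2 : ℕ) by push_cast; ring]; push_cast; ring)
    c3 := by have h2 := cq (p + (2 : ℕ)); have h3 := cq (p + (3 : ℕ)); fun_prop
    i0 := qq_int hp
    i1 := hi 1 1 _ le_rfl
    i2 := (hi 0 1 _ zero_le_one).fun_add (hi 2 2 _ le_rfl)
    i3 := (hi 1 2 _ one_le_two).fun_add (hi 3 3 _ le_rfl) }

lemma qq_le {c : ℝ} (hp : 0 ≤ p) (hc : 0 < c) (h : 1 + s ^ 2 ≤ c * (1 + t ^ 2)) : qq p t ≤ c ^ p * qq p s := by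
  unfold qq
  rw [rpow_neg (qw s).le, rpow_neg (qw t).le, ← div_eq_mul_inv, le_div_iff₀ (rpow_pos_of_pos (qw s) p), mul_comm, ← div_eq_mul_inv, div_le_iff₀ (rpow_pos_of_pos (qw t) p),
    ← mul_rpow hc.le (qw t).le]
  exact Real.rpow_le_rpow (qw s).le h hp

lemma D2_pt (ψ : TF) {K : ℝ} (hr : 0 ≤ r) (hK : ∀ a, |a| ≤ r → |ψ.f2 (s + a)| ≤ K) : |D2 ψ.f0 r s| ≤ 2 * r ^ 2 * K := by
  have h1 : ∀ a ∈ Icc 0 r, ‖ψ.f1 (s + a) - ψ.f1 (s - a)‖ ≤ K * (2 * r) := by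
    intro a ha
    have hK0 : 0 ≤ K := (abs_nonneg _).trans (hK 0 (by simpa using hr))
    refine (Convex.norm_image_sub_le_of_norm_hasDerivWithin_le (s := Icc (s - r) (s + r)) (C := K) (fun x _ => (ψ.h1 x).hasDerivWithinAt) (fun x hx => ?_) (convex_Icc _ _)
      ⟨by linarith [ha.2], by linarith [ha.1]⟩ ⟨by linarith [ha.1], by linarith [ha.2]⟩).trans ?_
    · have := hK (x - s) (abs_le.mpr ⟨by linarith [hx.1], by linarith [hx.2]⟩)
      rwa [add_sub_cancel] at this
    · rw [show s + a - (s - a) = 2 * a by ring, norm_of_nonneg (by linarith [ha.1])]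
      exact mul_le_mul_of_nonneg_left (by linarith [ha.2]) hK0
  have h2 := Convex.norm_image_sub_le_of_norm_hasDerivWithin_le (f := fun a => ψ.f0 (s + a) + ψ.f0 (s - a)) (f' := fun a => ψ.f1 (s + a) - ψ.f1 (s - a)) (s := Icc 0 r)
    (fun a _ => ((((ψ.h0 (s + a)).comp_const_add s a).fun_add ((ψ.h0 (s - a)).comp_const_sub s a)).congr_deriv (by ring)).hasDerivWithinAt) h1 (convex_Icc _ _)
    (Set.left_mem_Icc.mpr hr) (Set.right_mem_Icc.mpr hr)
  have e : D2 ψ.f0 r s = -((ψ.f0 (s + r) + ψ.f0 (s - r)) - (ψ.f0 (s + 0) + ψ.f0 (s - 0))) := by simp only [D2, add_zero, sub_zero]; ring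
  rw [e, abs_neg]
  refine h2.trans (le_of_eq ?_)
  rw [sub_zero, norm_of_nonneg hr]; ring

def AH (p : ℝ) : ℝ := 2 * ((2 * p + 4 * p * (p + 1)) * 3 ^ p) + 2

lemma PH_pt (hp : 1 / 2 < p) (hpa : p = (1 + α) / 2) (hr : 0 < r) (s : ℝ) :
    r ^ (-1 - α) * |D2 (PH p hp).f0 r s| ≤ qq p s * (AH p * kα α r + 2 ^ p * 4 ^ p * (2 * qq p r + qq p (s + r) + qq p (s - r))) := by
  have hp0 : 0 < p := by linarith
  have hq := qq_pos p
  have hk := kα_nonneg α hr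
  have h3 : (0:ℝ) < 3 ^ p := by positivity
  have h24 : (0:ℝ) < 2 ^ p * 4 ^ p := by positivity
  have hrr : 0 < r ^ (-1 - α) := by positivity
  by_cases h1 : r ≤ 1
  · have hD := D2_pt (PH p hp) (s := s) (K := (2 * p + 4 * p * (p + 1)) * (3 ^ p * qq p s)) hr.le (fun a ha => by
      have a1 := qq_bd p (s + a) zero_le_one
      have a2 := qq_bd p (s + a) (le_refl 2)
      have a3 : qq p (s + a) ≤ 3 ^ p * qq p s := qq_le hp0.le (by norm_num) (by
        have : a ^ 2 ≤ 1 := by rw [← sq_abs]; nlinarith [abs_nonneg a]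
        nlinarith [sq_nonneg (s + 2 * a)])
      refine (abs_add_le _ _).trans ?_
      rw [abs_mul, abs_mul (4 * p * (p + 1)), abs_of_pos (show 0 < 4 * p * (p + 1) by positivity), show |-2 * p| = 2 * p by rw [abs_mul, abs_of_pos hp0]; norm_num, add_mul]
      exact add_le_add (mul_le_mul_of_nonneg_left (a1.trans a3) (by positivity)) (mul_le_mul_of_nonneg_left (a2.trans a3) (by positivity)))
    have e := rpow_kα (α := α) hr h1
    calc _ ≤ r ^ (-1 - α) * (2 * r ^ 2 * ((2 * p + 4 * p * (p + 1)) * (3 ^ p * qq p s))) := mul_le_mul_of_nonneg_left hD hrr.le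
      _ = qq p s * ((AH p - 2) * kα α r) := by rw [← e, AH]; ring
      _ ≤ _ := mul_le_mul_of_nonneg_left (by
        have := mul_pos h24 (show 0 < 2 * qq p r + qq p (s + r) + qq p (s - r) by linarith [hq r, hq (s + r), hq (s - r)])
        nlinarith) (hq s).le
  · push Not at h1
    have ek : kα α r = r ^ (-1 - α) := by rw [kα, if_neg (not_le.mpr h1)]
    have kr : r ^ (-1 - α) ≤ 2 ^ p * qq p r := by
      rw [qq, rpow_neg (qw r).le, ← div_eq_mul_inv, le_div_iff₀ (rpow_pos_of_pos (qw r) p)]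
      have : r ^ (-1 - α) = ((r ^ 2) ^ p)⁻¹ := by
        rw [← rpow_natCast r 2, ← Real.rpow_mul hr.le, ← rpow_neg hr.le]; congr 1; push_cast; rw [hpa]; ring
      rw [this, inv_mul_le_iff₀ (by positivity), ← mul_rpow (by positivity) (by norm_num)]
      exact Real.rpow_le_rpow (qw r).le (by nlinarith) hp0.le
    have sub : ∀ c, (c - s) ^ 2 = r ^ 2 → qq p r * qq p c ≤ 4 ^ p * qq p s * (qq p r + qq p c) := by
      intro c hc
      have h4 : (0:ℝ) < 4 ^ p := by positivity
      have w : 1 + s ^ 2 ≤ 2 * (1 + c ^ 2) + 2 * (1 + r ^ 2) := by nlinarith [sq_nonneg (2 * c - s)]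
      rcases le_total (1 + c ^ 2) (1 + r ^ 2) with hh | hh
      · have := qq_le (p := p) (c := 4) (s := s) (t := r) hp0.le (by norm_num) (by linarith)
        have := mul_le_mul_of_nonneg_right this (hq c).le
        nlinarith [mul_pos (mul_pos h4 (hq s)) (hq r)]
      · have := qq_le (p := p) (c := 4) (s := s) (t := c) hp0.le (by norm_num) (by linarith)
        have := mul_le_mul_of_nonneg_right this (hq r).le
        nlinarith [mul_pos (mul_pos h4 (hq s)) (hq c)]
    have s1 := sub (s + r) (by ring)
    have s2 := sub (s - r) (by ring)
    have hD : |D2 (PH p hp).f0 r s| ≤ 2 * qq p s + (qq p (s + r) + qq p (s - r)) := by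
      have e : D2 (PH p hp).f0 r s = 2 * qq p s - qq p (s + r) - qq p (s - r) := rfl
      have := hq s; have := hq (s + r); have := hq (s - r)
      rw [e, abs_le]; constructor <;> linarith
    have hA : 2 ≤ AH p := by unfold AH; have : 0 < 2 * ((2 * p + 4 * p * (p + 1)) * 3 ^ p) := by positivity
                             linarith
    calc _ ≤ r ^ (-1 - α) * (2 * qq p s + (qq p (s + r) + qq p (s - r))) := mul_le_mul_of_nonneg_left hD hrr.le
      _ = qq p s * (2 * kα α r) + r ^ (-1 - α) * (qq p (s + r) + qq p (s - r)) := by rw [ek]; ring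
      _ ≤ qq p s * (AH p * kα α r) + 2 ^ p * (qq p r * qq p (s + r) + qq p r * qq p (s - r)) := by
        refine add_le_add (mul_le_mul_of_nonneg_left (mul_le_mul_of_nonneg_right hA hk) (hq s).le) ?_
        refine (mul_le_mul_of_nonneg_right kr (add_pos (hq _) (hq _)).le).trans (le_of_eq (by ring))
      _ ≤ qq p s * (AH p * kα α r) + 2 ^ p * (4 ^ p * qq p s * (qq p r + qq p (s + r)) + 4 ^ p * qq p s * (qq p r + qq p (s - r))) :=
        add_le_add le_rfl (mul_le_mul_of_nonneg_left (add_le_add s1 s2) (by positivity))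
      _ = _ := by ring

def HC (α p : ℝ) : ℝ := AH p * cα α + 2 ^ p * 4 ^ p * (4 * ∫ s, qq p s)

lemma LL_R (hα : α ∈ Ioo 0 2) (hp : 1 / 2 < p) (hpa : p = (1 + α) / 2) (h : Bd M b) (hb : ∀ s, 0 ≤ b s) (hR : 0 < R) :
    |LLf α b ((PH p hp).sc 1 0 R hR).f0| ≤ 1 / π * (HC α p * R ^ (-α) * ∫ s, ((PH p hp).sc 1 0 R hR).f0 s * b s) := by
  set ψ := (PH p hp).sc 1 0 R hR with hψ
  have hpi := pi_pos
  have hf : ∀ s, ψ.f0 s = qq p (R⁻¹ * s) := fun s => by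
    have : ψ.f0 s = 1 * qq p ((s - 0) / R) := rfl
    rw [this, one_mul, sub_zero, div_eq_inv_mul]
  have hq := qq_pos p
  have iq := qq_int hp
  have ia : ∀ s, Integrable fun r => qq p (s + r) := fun s => iq.comp_add_left s
  have is : ∀ s, Integrable fun r => qq p (s - r) := fun s => iq.comp_sub_left s
  have hle : ∀ {f : ℝ → ℝ}, Integrable f → (∀ r, 0 ≤ f r) → ∫ r in Ioi 0, f r ≤ ∫ r, f r := fun hi h0 => setIntegral_le_integral hi (ae_of_all _ h0)
  let g : ℝ → ℝ → ℝ := fun s r => AH p * kα α r + 2 ^ p * 4 ^ p * (2 * qq p r + qq p (s + r) + qq p (s - r))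
  have i2 : ∀ s, Integrable fun r => 2 * qq p r + qq p (s + r) + qq p (s - r) := fun s => ((iq.const_mul 2).fun_add (ia s)).fun_add (is s)
  have gi : ∀ s, IntegrableOn (g s) (Ioi 0) := fun s => ((kα_int hα).const_mul _).fun_add ((i2 s).integrableOn.const_mul _)
  have gI : ∀ s, ∫ r in Ioi 0, g s r ≤ HC α p := by
    intro s
    have e1 : ∫ r in Ioi 0, g s r = AH p * cα α + 2 ^ p * 4 ^ p * ∫ r in Ioi 0, (2 * qq p r + qq p (s + r) + qq p (s - r)) := by
      rw [integral_add ((kα_int hα).const_mul _) ((i2 s).integrableOn.const_mul _), integral_const_mul, integral_const_mul]; rfl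
    rw [e1, HC]
    refine add_le_add le_rfl (mul_le_mul_of_nonneg_left ?_ (by positivity))
    refine (hle (i2 s) fun r => by have := hq r; have := hq (s + r); have := hq (s - r); positivity).trans (le_of_eq ?_)
    rw [integral_add ((iq.const_mul 2).fun_add (ia s)) (is s), integral_add (iq.const_mul 2) (ia s), integral_const_mul, integral_add_left_eq_self (qq p) s, integral_sub_left_eq_self (qq p) volume s]; ring
  have pt : ∀ s, ‖∫ r in Ioi (0 : ℝ), r ^ (-1 - α) * (b s * D2 ψ.f0 r s)‖ ≤ HC α p * R ^ (-α) * (ψ.f0 s * b s) := by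
    intro s
    have hRi : 0 < R⁻¹ := inv_pos.mpr hR
    have gsi : IntegrableOn (fun r => g (R⁻¹ * s) (R⁻¹ * r)) (Ioi 0) := by
      rw [integrableOn_Ioi_comp_mul_left_iff _ _ hRi, mul_zero]; exact gi _
    have gsI : ∫ r in Ioi 0, g (R⁻¹ * s) (R⁻¹ * r) ≤ R * HC α p := by
      rw [integral_comp_mul_left_Ioi _ _ hRi, mul_zero, inv_inv, smul_eq_mul]
      exact mul_le_mul_of_nonneg_left (gI _) hR.le
    have hc0 : 0 ≤ b s * (R ^ (-1 - α) * ψ.f0 s) := mul_nonneg (hb s) (mul_nonneg (by positivity) (by rw [hf]; exact (hq _).le))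
    refine (norm_integral_le_of_norm_le (gsi.const_mul (b s * (R ^ (-1 - α) * ψ.f0 s))) ((ae_restrict_iff' measurableSet_Ioi).mpr (ae_of_all _ fun r hr => ?_))).trans ?_
    · have hr : 0 < r := hr
      have := PH_pt hp hpa (mul_pos hRi hr) (R⁻¹ * s)
      have eD : D2 ψ.f0 r s = D2 (PH p hp).f0 (R⁻¹ * r) (R⁻¹ * s) := by
        simp only [D2, hf, mul_add, mul_sub]; rfl
      rw [norm_mul, norm_mul, norm_of_nonneg (by positivity : (0:ℝ) ≤ r ^ (-1 - α)), norm_of_nonneg (hb s), eD, hf, norm_eq_abs]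
      have er : r ^ (-1 - α) = R ^ (-1 - α) * (R⁻¹ * r) ^ (-1 - α) := by
        rw [← mul_rpow hR.le (mul_pos hRi hr).le]; congr 1; field_simp
      rw [er]
      have := mul_le_mul_of_nonneg_left this (mul_nonneg (hb s) (by positivity : 0 ≤ R ^ (-1 - α)))
      calc _ = b s * R ^ (-1 - α) * ((R⁻¹ * r) ^ (-1 - α) * |D2 (PH p hp).f0 (R⁻¹ * r) (R⁻¹ * s)|) := by ring
        _ ≤ _ := this
        _ = _ := by ring
    · rw [integral_const_mul]
      refine (mul_le_mul_of_nonneg_left gsI hc0).trans (le_of_eq ?_)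
      have : R ^ (-α) = R ^ (-1 - α) * R := by
        rw [← Real.rpow_add_one hR.ne']; congr 1; ring
      rw [this]; ring
  have sw : LLf α b ψ.f0 = 1 / π * ∫ s, ∫ r in Ioi (0 : ℝ), r ^ (-1 - α) * (b s * D2 ψ.f0 r s) := by
    rw [LLf, ← integral_integral_swap (D2_prod hα h ψ)]
    simp only [integral_const_mul]
  rw [sw, abs_mul, abs_of_pos (by positivity : 0 < 1 / π), ← integral_const_mul (HC α p * R ^ (-α))]
  refine mul_le_mul_of_nonneg_left (norm_integral_le_of_norm_le ((fb_int h ψ.i0).const_mul _) (ae_of_all _ pt)) (by positivity)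

lemma TT_R (hα : α ∈ Ioo 0 2) (hp : 1 / 2 < p) (hpa : p = (1 + α) / 2) (hμ : 0 ≤ μ) (h : Bd M b) (hb : ∀ s, 0 ≤ b s) (hR : 0 < R) :
    |TT α μ b ((PH p hp).sc 1 0 R hR)| ≤ M ^ 2 * (PH p hp).N * R⁻¹ + μ / π * HC α p * R ^ (-α) * ∫ s, ((PH p hp).sc 1 0 R hR).f0 s * b s := by
  have q := (abs_im_le_norm _).trans (Qf_bound h ((PH p hp).sc 1 0 R hR) hR)
  have l := mul_le_mul_of_nonneg_left (LL_R hα hp hpa h hb hR) hμ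
  have e : 2 * M ^ 2 * (n1 ((PH p hp).sc 1 0 R hR).f0 / R ^ 2 + n1 ((PH p hp).sc 1 0 R hR).f1 / R + n1 ((PH p hp).sc 1 0 R hR).f2 + R * n1 ((PH p hp).sc 1 0 R hR).f3) = 2 * (M ^ 2 * (PH p hp).N * R⁻¹) := by
    simp only [TF.sc, n1_sc _ _ _ hR, TF.N]
    rw [abs_one, abs_of_pos (by positivity : 0 < 1 / R), abs_of_pos (by positivity : 0 < 1 / R ^ 2), abs_of_pos (by positivity : 0 < 1 / R ^ 3)]
    field_simp
  rw [e] at q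
  rw [TT]
  refine (abs_sub _ _).trans ?_
  rw [abs_mul, abs_div, abs_two, abs_of_nonneg hμ]
  refine add_le_add (by linarith) (l.trans (le_of_eq (by ring)))

section

variable {α μ : ℝ} {B J LB : ℝ → ℝ → ℝ}

lemma mass (h : Sol α μ B J LB) (hμ : 0 ≤ μ) (hM : ∀ t, 0 ≤ t → Bd M (B t)) (hn : ∀ t, 0 ≤ t → ∀ x, 0 ≤ B t x) (ht : 0 ≤ t) :
    ∫ x, B t x = ∫ x, B 0 x := by
  obtain ⟨p, hpa⟩ : ∃ p, p = (1 + α) / 2 := ⟨_, rfl⟩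
  have hp : 1 / 2 < p := by have := h.a.1; linarith
  let m : ℝ → ℝ → ℝ := fun R t => ∫ s, 1 * qq p ((s - 0) / R) * B t s
  have hle1 : ∀ s, qq p s ≤ 1 := fun s => by
    rw [qq, rpow_neg (qw s).le]; exact inv_le_one_of_one_le₀ (Real.one_le_rpow (by nlinarith [sq_nonneg s]) (by linarith))
  have lim : ∀ t, Tendsto (fun R => m R t) atTop (𝓝 (∫ s, B t s)) := by
    intro t
    refine tendsto_integral_filter_of_dominated_convergence (fun s => |B t s|) ?_ (Eventually.of_forall fun R => ae_of_all _ fun s => ?_) (h.it t).abs (ae_of_all _ fun s => ?_)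
    · filter_upwards [eventually_gt_atTop 0] with R hR
      exact (((PH p hp).sc 1 0 R hR).c0.aestronglyMeasurable.mul (h.it t).aestronglyMeasurable)
    · rw [norm_mul, one_mul, norm_of_nonneg (qq_pos p _).le]
      exact mul_le_of_le_one_left (abs_nonneg _) (hle1 _)
    · have hc : Continuous (qq p) := (PH p hp).c0
      have h1 : Tendsto (fun R : ℝ => (s - 0) / R) atTop (𝓝 0) := tendsto_const_nhds.div_atTop tendsto_id
      have h2 := (((hc.tendsto 0).comp h1).const_mul 1).mul_const (B t s)
      have e0 : qq p 0 = 1 := by simp [qq]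
      simpa [e0] using h2
  set A := M ^ 2 * (PH p hp).N
  set E := μ / π * HC α p
  have hA : Tendsto (fun R : ℝ => t * (A * R⁻¹)) atTop (𝓝 0) := by simpa using (tendsto_inv_atTop_zero.const_mul A).const_mul t
  have hE : Tendsto (fun R : ℝ => t * (E * R ^ (-α))) atTop (𝓝 0) := by simpa using ((tendsto_rpow_neg_atTop h.a.1).const_mul E).const_mul t
  have key : ∀ᶠ R in atTop, ‖m R t - m R 0‖ ≤ t * (A * R⁻¹) + t * (E * R ^ (-α)) * (2 * ((∫ x, B 0 x) + t * (A * R⁻¹))) := by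
    filter_upwards [eventually_gt_atTop 0, hE.eventually (gt_mem_nhds (show (0:ℝ) < 1 / 2 by norm_num))] with R hR hR2
    set ψ := (PH p hp).sc 1 0 R hR
    have hm : ∀ τ, m R τ = ∫ s, ψ.f0 s * B τ s := fun τ => rfl
    have mc : Continuous (m R) := h.F_cont ψ.i0
    have m0 : ∀ τ, 0 ≤ τ → 0 ≤ m R τ := fun τ hτ => integral_nonneg fun s => mul_nonneg (by rw [one_mul]; exact (qq_pos p _).le) (hn τ hτ s)
    have hHC : 0 ≤ E := by
      have := pi_pos
      have h1 := cα_nonneg α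
      have h2 : 0 ≤ ∫ s, qq p s := integral_nonneg fun s => (qq_pos p s).le
      have hp0 : 0 < p := by linarith
      have : 0 ≤ AH p := by unfold AH; positivity
      have : 0 ≤ HC α p := by unfold HC; positivity
      positivity
    have hAn : 0 ≤ A := by
      have := n1_nonneg (PH p hp).f0; have := n1_nonneg (PH p hp).f1; have := n1_nonneg (PH p hp).f2; have := n1_nonneg (PH p hp).f3
      have : 0 ≤ (PH p hp).N := by unfold TF.N; positivity
      positivity
    have hEn : 0 ≤ E * R ^ (-α) := by positivity
    have hARn : 0 ≤ A * R⁻¹ := by positivity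
    obtain ⟨w, hw, hS⟩ := isCompact_Icc.exists_isMaxOn (Set.nonempty_Icc.mpr ht) mc.continuousOn
    have st : ∀ τ ∈ Icc 0 t, ‖m R τ - m R 0‖ ≤ t * (A * R⁻¹) + t * (E * R ^ (-α)) * m R w := by
      intro τ hτ
      rw [hm, hm, weakL h ψ le_rfl hτ.1]
      refine (intervalIntegral.norm_integral_le_of_norm_le_const (f := fun τ => TT α μ (B τ) ψ) (C := A * R⁻¹ + E * R ^ (-α) * m R w) fun σ hσ => ?_).trans ?_
      · rw [uIoc_of_le hτ.1] at hσ
        refine (TT_R h.a hp hpa hμ (hM σ hσ.1.le) (hn σ hσ.1.le) hR).trans ?_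
        exact add_le_add le_rfl (mul_le_mul_of_nonneg_left (hS ⟨hσ.1.le, hσ.2.trans hτ.2⟩) hEn)
      · rw [sub_zero, abs_of_nonneg hτ.1]
        refine (mul_le_mul_of_nonneg_left hτ.2 (add_nonneg hARn (mul_nonneg hEn (m0 w hw.1)))).trans (le_of_eq (by ring))
    have hm0 : m R 0 ≤ ∫ x, B 0 x := integral_mono (fb_int (hM 0 le_rfl) ψ.i0) (h.it 0) fun s => by
      have : 1 * qq p ((s - 0) / R) * B 0 s ≤ 1 * B 0 s := mul_le_mul_of_nonneg_right (by rw [one_mul]; exact hle1 _) (hn 0 le_rfl s)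
      simpa using this
    have hw1 := (abs_le.mp (st w hw)).2
    have hw2 : m R w ≤ 2 * ((∫ x, B 0 x) + t * (A * R⁻¹)) := by
      have := mul_le_mul_of_nonneg_right hR2.le (m0 w hw.1)
      linarith
    exact (st t ⟨ht, le_rfl⟩).trans (add_le_add le_rfl (mul_le_mul_of_nonneg_left hw2 (mul_nonneg ht hEn)))
  have z : Tendsto (fun R => m R t - m R 0) atTop (𝓝 0) := by
    refine squeeze_zero_norm' key ?_
    have := hA.add (hE.mul ((hA.const_add (∫ x, B 0 x)).const_mul 2))
    simpa using this
  have := tendsto_nhds_unique z ((lim t).sub (lim 0))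
  linarith

end

end


/-- **Remark 6.2.** Let `0 < α < 2`, `μ ≥ 0`, and let `B` be a smooth, locally
bounded, integrable solution of `B_t + J B_x + μ Λ^α B = 0`, `B_x = ℋ J` with
nonnegative initial data `B₀ = B(·,0) ≥ 0`.  (By skew-symmetry of the Hilbert
transform, `∫ B_x J dx = ∫ J ℋJ dx = 0`, and `∫ Λ^α B dx = 0`.)  Then `B(·,t) ≥ 0`
for all `t ≥ 0`, the `L¹` norm is conserved, `‖B(t)‖_{L¹} = ‖B₀‖_{L¹}`, and the
`L²` norm of `B(t)` is bounded uniformly in time. -/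
theorem nonneg_L1_conservation_L2_bound (α μ : ℝ) (hα : α ∈ Set.Ioo (0 : ℝ) 2) (hμ : 0 ≤ μ)
    (B J LB : ℝ → ℝ → ℝ)
    (hBiotSavart : ∀ t : ℝ, 0 < t → IsHilbertPV (J t) (deriv (B t)))
    (hLap : ∀ t : ℝ, 0 < t → IsFracLapPV α (B t) (LB t))
    (heq : ∀ x : ℝ, ∀ t : ℝ, 0 < t →
      HasDerivAt (fun τ : ℝ => B τ x) (-(J t x * deriv (B t) x + μ * LB t x)) t)
    (hsmooth : ∀ t : ℝ, 0 ≤ t → ContDiff ℝ (⊤ : ℕ∞) (B t))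
    (hcont : ∀ x : ℝ, ContinuousWithinAt (fun τ : ℝ => B τ x) (Set.Ici 0) 0)
    (hbdd : ∀ T : ℝ, 0 < T → ∃ M : ℝ, ∀ t ∈ Set.Icc (0 : ℝ) T, ∀ x : ℝ, |B t x| ≤ M)
    (hint : ∀ t : ℝ, 0 ≤ t → Integrable (B t))
    (hskew : ∀ t : ℝ, 0 < t → ∫ x : ℝ, J t x * deriv (B t) x = 0)
    (hlapmean : ∀ t : ℝ, 0 < t → ∫ x : ℝ, LB t x = 0)
    (hB₀ : ∀ x : ℝ, 0 ≤ B 0 x) :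
    (∀ t : ℝ, 0 ≤ t → ∀ x : ℝ, 0 ≤ B t x) ∧
    (∀ t : ℝ, 0 ≤ t → ∫ x : ℝ, |B t x| = ∫ x : ℝ, |B 0 x|) ∧
    (∃ C : ℝ, ∀ t : ℝ, 0 ≤ t → eLpNorm (B t) 2 volume ≤ ENNReal.ofReal C) := by
  have em : ∀ {t : ℝ}, 0 ≤ t → max t 0 = t := fun h => max_eq_left h
  have hS : Sol α μ (fun t => B (max t 0)) J LB :=
    { a := hα
      bs := fun t ht => by simpa only [em ht.le] using hBiotSavart t ht
      lap := fun t ht => by simpa only [em ht.le] using hLap t ht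
      eq := fun x t ht => by
        simp only [em ht.le]
        refine (heq x t ht).congr_of_eventuallyEq ?_
        filter_upwards [lt_mem_nhds ht] with s hs
        rw [em (le_of_lt hs)]
      sm := fun t => hsmooth _ (le_max_right _ _)
      ct := fun x => by
        have h1 : ContinuousOn (fun τ => B τ x) (Set.Ici 0) := fun t ht => by
          rcases (show (0:ℝ) ≤ t from ht).eq_or_lt with h | h
          · rw [← h]; exact hcont x
          · exact (heq x t h).continuousAt.continuousWithinAt
        exact h1.comp_continuous (continuous_id.max continuous_const) fun t => Set.mem_Ici.mpr (le_max_right _ _)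
      bd := fun T => by
        obtain ⟨M, hM⟩ := hbdd (max T 1) (by positivity)
        exact ⟨M, fun t ht => ⟨(hsmooth _ (le_max_right _ _)).continuous, hM _ ⟨le_max_right _ _, max_le (ht.trans (le_max_left _ _)) (by positivity)⟩⟩⟩
      it := fun t => hint _ (le_max_right _ _) }
  have e0 : max (0:ℝ) 0 = 0 := max_self 0
  have nn : ∀ t : ℝ, 0 ≤ t → ∀ x : ℝ, 0 ≤ B t x := fun t ht x => by
    have := prin hS hμ (e := 1) (l := 0) one_ne_zero le_rfl (fun x => by simpa using hB₀ x) ht x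
    simpa [em ht] using this
  obtain ⟨M, hM⟩ := hbdd 1 one_pos
  have hM0 := hM 0 ⟨le_rfl, zero_le_one⟩
  have hMp : 0 ≤ M := (abs_nonneg _).trans (hM0 0)
  have ub : ∀ t : ℝ, 0 ≤ t → ∀ x : ℝ, B t x ≤ M := fun t ht x => by
    have := prin hS hμ (e := -1) (l := M) (by norm_num) hMp (fun x => by
      have := (abs_le.mp (hM0 x)).2
      simp only [e0]; linarith) ht x
    simp only [em ht] at this; linarith
  have ms : ∀ t : ℝ, 0 ≤ t → ∫ x : ℝ, B t x = ∫ x : ℝ, B 0 x := fun t ht => by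
    have := mass hS hμ (M := M) (fun t ht => by
      simp only [em ht]
      exact ⟨(hsmooth t ht).continuous, fun x => by rw [abs_of_nonneg (nn t ht x)]; exact ub t ht x⟩) (fun t ht x => by simpa only [em ht] using nn t ht x) ht
    simpa only [em ht, e0] using this
  refine ⟨nn, fun t ht => ?_, ((M * ∫ x, B 0 x) ^ (1 / 2 : ℝ)), fun t ht => ?_⟩
  · simp only [abs_of_nonneg (nn t ht _), abs_of_nonneg (hB₀ _)]; exact ms t ht
  · have hI : 0 ≤ M * ∫ x, B 0 x := mul_nonneg hMp (integral_nonneg hB₀)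
    rw [eLpNorm_eq_lintegral_rpow_enorm_toReal two_ne_zero ENNReal.ofNat_ne_top, ← ENNReal.ofReal_rpow_of_nonneg hI (by norm_num)]
    refine ENNReal.rpow_le_rpow ?_ (by norm_num)
    rw [← ms t ht, ← integral_const_mul, ofReal_integral_eq_lintegral_ofReal ((hint t ht).const_mul M) (ae_of_all _ fun x => mul_nonneg hMp (nn t ht x))]
    refine lintegral_mono fun x => ?_
    rw [Real.enorm_of_nonneg (nn t ht x), ENNReal.ofReal_rpow_of_nonneg (nn t ht x) (by norm_num)]
    refine ENNReal.ofReal_le_ofReal ?_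
    simp only [ENNReal.toReal_ofNat, Real.rpow_ofNat]
    nlinarith [nn t ht x, ub t ht x]
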